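/- Let H_0 be the free Dirac operator on ℝ³ with spectral projections P_± onto its positive/negative spectrum, and let V be a measurable Hermitian 4×4-matrix-valued function with ‖V(x)‖_{L(ℂ⁴)} ≤ a + b/|x| almost everywhere, where a, b ≥ 0 satisfy a + (b/2)(π/2 + 2/π) < 1/2 and a + 2b < 1 (so that ‖V H_0^{-1}‖ < 1 by Hardy's inequality). For γ ∈ 𝔻 let H(γ) be the operator associated with h_0 + γv, where v is the form of V, let Q_±(γ) be its spectral projections corresponding to ℂ_±, X_±(γ) := P_∓ (P_±|_{Q_±(γ)H})^{-1}, Ω_±(γ) := (1 − X_∓(γ)X_±(γ))^{-1/2}, U(γ) := [[Ω_+(γ), X_−(γ)Ω_−(γ)], [X_+(γ)Ω_+(γ), Ω_−(γ)]], and Ĥ_diag(γ) := U(γ)^{-1} H(γ) U(γ). Then the Douglas–Kroll–Heß approximants Ĥ_diag^N(γ) — the unique self-adjoint operators associated with the N-th order Taylor forms ĥ_diag^N(γ)[u,w] := Σ_{n=0}^{N} (γ^n/n!) (d^n/dγ^n)(T(γ)|H_0|^{1/2}u, |H_0|^{1/2}w)|_{γ=0}, where T(γ) is the bounded closure of |H_0|^{-1/2}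 Ĥ_diag(γ) |H_0|^{-1/2} — exist for all sufficiently large N and converge to Ĥ_diag(γ) in the norm-resolvent topology as N → ∞, uniformly on compact subsets of (−1, 1). In particular this holds for the Coulomb potential V = 1/|x| scaled by γ with γ (π/4 + 1/π) < 1/2, i.e. γ = Zα for all nuclear charges Z ≤ 62. -/

import Mathlib

noncomputable section

open Complex Filter Topology MeasureTheory

namespace Paper

variable {X : Type*} [NormedAddCommGroup X] [NormedSpace ℂ X]

/-- `R` is a (two-sided) bounded resolvent of the unbounded operator `T` at the point `z`. -/
def IsResolventAt (T : X →ₗ.[ℂ] X) (z : ℂ) (R : X →L[ℂ] X) : Prop :=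
  (∀ u : T.domain, R (T u - z • (u : X)) = u) ∧
  (∀ y : X, ∃ hy : R y ∈ T.domain, T ⟨R y, hy⟩ - z • R y = y)

/-- The resolvent set of an unbounded operator. -/
def resolventSet (T : X →ₗ.[ℂ] X) : Set ℂ := {z | ∃ R, IsResolventAt T z R}

/-- The spectrum of an unbounded operator. -/
def spec (T : X →ₗ.[ℂ] X) : Set ℂ := (resolventSet T)ᶜ

open Classical in
/-- The resolvent operator of `T` at `z` (junk value `0` if `z` is not in the resolvent set). -/
def res (T : X →ₗ.[ℂ] X) (z : ℂ) : X →L[ℂ] X :=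
  if h : z ∈ resolventSet T then Classical.choose h else 0

open Classical in
/-- Application of an unbounded operator, with junk value `0` outside of the domain. -/
def pApply (T : X →ₗ.[ℂ] X) (u : X) : X :=
  if h : u ∈ T.domain then T ⟨u, h⟩ else 0

/-- `R` is a bounded resolvent at `z` of the part of `T` in the range of the
(not necessarily orthogonal) projection `Q`. -/
def IsPartResolventAt (T : X →ₗ.[ℂ] X) (Q : X →L[ℂ] X) (z : ℂ) (R : X →L[ℂ] X) : Prop :=
  (∀ y, R (Q y) = R y) ∧ (∀ y, Q (R y) = R y) ∧
  (∀ y, ∃ hy : R y ∈ T.domain, T ⟨R y, hy⟩ - z • R y = Q y) ∧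
  (∀ u : T.domain, Q (u : X) = (u : X) → R (T u - z • (u : X)) = (u : X))

/-- The spectrum of the part `T|_{ran Q}` of `T` in the range of the projection `Q`. -/
def partSpec (T : X →ₗ.[ℂ] X) (Q : X →L[ℂ] X) : Set ℂ :=
  {z | ¬∃ R, IsPartResolventAt T Q z R}

/-- `T` is decomposed according to `X = Q₊X ∔ Q₋X`: the `Q₊, Q₋` are complementary (bounded)
projections whose ranges are invariant under `T`. -/
def DecomposedBy (T : X →ₗ.[ℂ] X) (Qp Qm : X →L[ℂ] X) : Prop :=
  Qp + Qm = 1 ∧ IsIdempotentElem Qp ∧ IsIdempotentElem Qm ∧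
  (∀ u : T.domain, ∃ hp : Qp (u : X) ∈ T.domain, T ⟨Qp (u : X), hp⟩ = Qp (T u)) ∧
  (∀ u : T.domain, ∃ hm : Qm (u : X) ∈ T.domain, T ⟨Qm (u : X), hm⟩ = Qm (T u))

/-- `D` is a core for the closed operator `T`: the closure of the restriction of `T` to `D`
is again `T`. -/
def IsCore (T : X →ₗ.[ℂ] X) (D : Submodule ℂ X) : Prop :=
  D ≤ T.domain ∧ (T.domRestrict D).closure = T

/-- The operator `W⁻¹ T W` (with `W' = W⁻¹`). -/
def conjPMap (W W' : X →L[ℂ] X) (T : X →ₗ.[ℂ] X) : X →ₗ.[ℂ] X where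
  domain := T.domain.comap (W : X →ₗ[ℂ] X)
  toFun := (W' : X →ₗ[ℂ] X) ∘ₗ (T.toFun ∘ₗ ((W : X →ₗ[ℂ] X).restrict fun _ hx => hx))

/-- The linear span of the graph of `f` restricted to `D`; if `f` is linear on `D` this is
the graph of the corresponding operator with domain `D`. -/
def graphSpan (D : Submodule ℂ X) (f : X → X) : Submodule ℂ (X × X) :=
  Submodule.span ℂ {p : X × X | p.1 ∈ D ∧ p.2 = f p.1}

/-- The unbounded operator with domain `D` acting as `f` (obtained from the span of the
graph of `f|_D`). -/
def pmapOf (D : Submodule ℂ X) (f : X → X) : X →ₗ.[ℂ] X := (graphSpan D f).toLinearPMap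
section Hilbert

variable {H : Type*} [NormedAddCommGroup H] [InnerProductSpace ℂ H] [CompleteSpace H]

local notation "⟪" x ", " y "⟫" => @inner ℂ _ _ x y

/-- The inverse of a bounded operator `J`, as an unbounded operator (defined via the
flipped graph of `J`; if `J` is injective this is the genuine inverse with domain `ran J`). -/
def pinv (J : H →L[ℂ] H) : H →ₗ.[ℂ] H :=
  ((LinearMap.graph (J : H →ₗ[ℂ] H)).map
    ((LinearEquiv.prodComm ℂ H H) : H × H →ₗ[ℂ] H × H)).toLinearPMap

/-- For `R` self-adjoint, `|R| = √(R²)`. -/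
def absCLM (R : H →L[ℂ] H) : H →L[ℂ] H := CFC.sqrt (R * R)

/-- For `R = H₀⁻¹` with `H₀` self-adjoint, this is `|H₀|^{-1/2} = √(|R|)`. -/
def invSqrtAbs (R : H →L[ℂ] H) : H →L[ℂ] H := CFC.sqrt (absCLM R)

/-- For `R = H₀⁻¹` with `H₀` self-adjoint, this is the unbounded operator `|H₀|^{1/2}`,
realized as the inverse of `|H₀|^{-1/2}`; its domain is `dom |H₀|^{1/2}`. -/
def sqrtAbsPMap (R : H →L[ℂ] H) : H →ₗ.[ℂ] H := pinv (invSqrtAbs R)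

/-- `U` is the sign `sign(H₀) = sign(H₀⁻¹) = sign(R)` of the boundedly invertible self-adjoint
operator `H₀ = R⁻¹`: a self-adjoint involution with `R U = U R = |R|`. -/
def IsSignOf (U R : H →L[ℂ] H) : Prop :=
  IsSelfAdjoint U ∧ U * U = 1 ∧ R * U = absCLM R ∧ U * R = absCLM R

/-- The quadratic form `h₀` represented by `H₀ = R⁻¹`:
`h₀[u,w] = (|H₀|^{1/2}u, sign(H₀)|H₀|^{1/2}w)`, linear in `u` and conjugate-linear in `w`
(values outside `dom |H₀|^{1/2}` are junk). -/
def h0form (R U : H →L[ℂ] H) (u w : H) : ℂ :=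
  ⟪U (pApply (sqrtAbsPMap R) w), pApply (sqrtAbsPMap R) u⟫

/-- `v` is a sesquilinear form on `Q` (linear in the first, conjugate-linear in the second
argument, as in the paper). -/
def SesqOn (Q : Submodule ℂ H) (v : H → H → ℂ) : Prop :=
  (∀ u₁ u₂ w, u₁ ∈ Q → u₂ ∈ Q → w ∈ Q → v (u₁ + u₂) w = v u₁ w + v u₂ w) ∧
  (∀ (c : ℂ) u w, u ∈ Q → w ∈ Q → v (c • u) w = c * v u w) ∧
  (∀ u w₁ w₂, u ∈ Q → w₁ ∈ Q → w₂ ∈ Q → v u (w₁ + w₂) = v u w₁ + v u w₂) ∧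
  (∀ (c : ℂ) u w, u ∈ Q → w ∈ Q → v u (c • w) = (starRingEnd ℂ) c * v u w)

/-- `T` is the operator associated with the densely defined sesquilinear form `h`
with form domain `Q` (in the sense of the paper):
`T` is closed and densely defined, `dom T, dom T* ⊆ Q`, `(Tu, w) = h[u, w]` for
`u ∈ dom T`, `w ∈ Q`, and `(u, T*w) = h[u, w]` for `u ∈ Q`, `w ∈ dom T*`.
(The paper's inner product `(·,·)` is linear in the first argument, so
`(x, y) = ⟪y, x⟫` in Mathlib conventions.) -/
def IsAssocForm (Q : Submodule ℂ H) (h : H → H → ℂ) (T : H →ₗ.[ℂ] H) : Prop :=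
  T.IsClosed ∧ Dense (T.domain : Set H) ∧ T.domain ≤ Q ∧ T.adjoint.domain ≤ Q ∧
  (∀ u : T.domain, ∀ w ∈ Q, ⟪w, T u⟫ = h u w) ∧
  (∀ u ∈ Q, ∀ w : T.adjoint.domain, ⟪T.adjoint w, u⟫ = h u w)

/-- `‖H_{a,b}^{1/2} u‖ = (a‖u‖² + b‖|H₀|^{1/2}u‖²)^{1/2}` for `u ∈ dom |H₀|^{1/2}`,
where `H_{a,b} = a + b|H₀|` and `R = H₀⁻¹`. -/
def habNorm (R : H →L[ℂ] H) (a b : ℝ) (u : H) : ℝ :=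
  Real.sqrt (a * ‖u‖ ^ 2 + b * ‖pApply (sqrtAbsPMap R) u‖ ^ 2)

/-- `Pp, Pm` are the spectral projections of the bounded self-adjoint operator `R` onto its
positive and negative spectral subspaces (`R` is assumed injective, e.g. the inverse of a
self-adjoint operator, so that the pair is uniquely determined). -/
def IsPosNegPair (R Pp Pm : H →L[ℂ] H) : Prop :=
  Pp + Pm = 1 ∧ IsSelfAdjoint Pp ∧ IsSelfAdjoint Pm ∧
  IsIdempotentElem Pp ∧ IsIdempotentElem Pm ∧
  Pp * R = R * Pp ∧
  (∀ x : H, 0 ≤ (⟪Pp x, R (Pp x)⟫).re) ∧ (∀ x : H, (⟪Pm x, R (Pm x)⟫).re ≤ 0)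

/-- Membership in the Schatten-von Neumann class of order `p`, via the Schmidt
representation `A = ∑ sₙ ⟪eₙ, ·⟫ fₙ` with `(sₙ) ∈ ℓᵖ`. -/
def MemSchatten (p : ℝ) (A : H →L[ℂ] H) : Prop :=
  ∃ (s : ℕ → ℝ) (e f : ℕ → H), Orthonormal ℂ e ∧ Orthonormal ℂ f ∧ (∀ n, 0 ≤ s n) ∧
    Summable (fun n => s n ^ p) ∧
    ∀ x : H, HasSum (fun n => s n • (⟪e n, x⟫ • f n)) (A x)

end Hilbert


section Dirac

open ComplexConjugate

/-- Euclidean 3-space. -/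
abbrev V3 := EuclideanSpace ℝ (Fin 3)

/-- The spinor space `ℂ⁴`. -/
abbrev C4 := EuclideanSpace ℂ (Fin 4)

/-- Two-component spinors `ℂ²`. -/
abbrev C2 := EuclideanSpace ℂ (Fin 2)

/-- The Hilbert space `L²(ℝ³, ℂ⁴)`. -/
abbrev DSp := MeasureTheory.Lp (α := V3) C4 2 (volume : Measure V3)

/-- The Hilbert space `L²(ℝ³, ℂ²)` (for the Pauli operator). -/
abbrev DSp2 := MeasureTheory.Lp (α := V3) C2 2 (volume : Measure V3)

/-- Application of a `4 × 4` matrix to a spinor. -/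
def mapp (M : Matrix (Fin 4) (Fin 4) ℂ) (ξ : C4) : C4 :=
  (WithLp.equiv 2 (Fin 4 → ℂ)).symm (M.mulVec (WithLp.equiv 2 (Fin 4 → ℂ) ξ))

/-- Application of a `2 × 2` matrix to a two-component spinor. -/
def mapp2 (M : Matrix (Fin 2) (Fin 2) ℂ) (ξ : C2) : C2 :=
  (WithLp.equiv 2 (Fin 2 → ℂ)).symm (M.mulVec (WithLp.equiv 2 (Fin 2 → ℂ) ξ))

/-- The Pauli matrices `σ₁, σ₂, σ₃`. -/
def pauli : Fin 3 → Matrix (Fin 2) (Fin 2) ℂ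
  | 0 => !![0, 1; 1, 0]
  | 1 => !![0, -Complex.I; Complex.I, 0]
  | 2 => !![1, 0; 0, -1]

/-- The Dirac matrices `α_j = [[0, σ_j], [σ_j, 0]]`. -/
def diracα : Fin 3 → Matrix (Fin 4) (Fin 4) ℂ
  | 0 => !![0, 0, 0, 1;
            0, 0, 1, 0;
            0, 1, 0, 0;
            1, 0, 0, 0]
  | 1 => !![0, 0, 0, -Complex.I;
            0, 0, Complex.I, 0;
            0, -Complex.I, 0, 0;
            Complex.I, 0, 0, 0]
  | 2 => !![0, 0, 1, 0;
            0, 0, 0, -1;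
            1, 0, 0, 0;
            0, -1, 0, 0]

/-- The Dirac matrix `β = diag(1, 1, -1, -1)`. -/
def diracβ : Matrix (Fin 4) (Fin 4) ℂ :=
  !![1, 0, 0, 0;
     0, 1, 0, 0;
     0, 0, -1, 0;
     0, 0, 0, -1]

/-- The projection onto the upper two spinor components. -/
def upperMat : Matrix (Fin 4) (Fin 4) ℂ :=
  !![1, 0, 0, 0;
     0, 1, 0, 0;
     0, 0, 0, 0;
     0, 0, 0, 0]

/-- The projection onto the lower two spinor components. -/
def lowerMat : Matrix (Fin 4) (Fin 4) ℂ :=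
  !![0, 0, 0, 0;
     0, 0, 0, 0;
     0, 0, 1, 0;
     0, 0, 0, 1]

/-- The classical action of the free Dirac operator
`H₀ = β - i Σ_j α_j ∂_j` on a differentiable function. -/
def diracAct (f : V3 → C4) (x : V3) : C4 :=
  mapp diracβ (f x) -
    Complex.I • ∑ j : Fin 3, mapp (diracα j) (fderiv ℝ f x (EuclideanSpace.single j (1 : ℝ)))

/-- The classical action of the magnetic Dirac operator
`H_A = β - i Σ_j α_j ∂_j - Σ_j A_j α_j` (i.e. with `-iσ·∇` replaced by
`-iσ·∇_A = -iσ·∇ - σ·A`). -/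
def diracActA (A : V3 → V3) (f : V3 → C4) (x : V3) : C4 :=
  mapp diracβ (f x) -
    Complex.I • ∑ j : Fin 3, mapp (diracα j) (fderiv ℝ f x (EuclideanSpace.single j (1 : ℝ))) -
    ∑ j : Fin 3, (A x j : ℂ) • mapp (diracα j) (f x)

/-- The classical action of the operator `-iσ·∇_A = -iσ·∇ - σ·A` on two-component spinors. -/
def pauliDiracAct (A : V3 → V3) (f : V3 → C2) (x : V3) : C2 :=
  (-Complex.I) • ∑ j : Fin 3, mapp2 (pauli j) (fderiv ℝ f x (EuclideanSpace.single j (1 : ℝ))) -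
    ∑ j : Fin 3, (A x j : ℂ) • mapp2 (pauli j) (f x)

/-- A smooth compactly supported (test) function. -/
def IsTestFn (f : V3 → C4) : Prop := ContDiff ℝ (⊤ : ℕ∞) f ∧ HasCompactSupport f

/-- A smooth compactly supported function supported away from the origin. -/
def IsTestFnAway (f : V3 → C4) : Prop :=
  ContDiff ℝ (⊤ : ℕ∞) f ∧ HasCompactSupport f ∧ (0 : V3) ∉ tsupport f

/-- The subspace of `L²(ℝ³, ℂ⁴)` of (classes of) test functions. -/
def testSub : Submodule ℂ DSp :=
  Submodule.span ℂ {u : DSp | ∃ f : V3 → C4, IsTestFn f ∧ ⇑u =ᵐ[volume] f}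

/-- The subspace of (classes of) test functions supported away from the origin,
`C₀^∞(ℝ³ \ {0})⁴`. -/
def testSubAway : Submodule ℂ DSp :=
  Submodule.span ℂ {u : DSp | ∃ f : V3 → C4, IsTestFnAway f ∧ ⇑u =ᵐ[volume] f}

/-- `H₀` is the free Dirac operator on `ℝ³` (units `m = c = ħ = 1`): it is self-adjoint,
acts as `diracAct` on test functions, and the test functions form a core (which, together
with self-adjointness, determines it uniquely; its domain is `H¹(ℝ³, ℂ⁴)`). -/
def IsFreeDirac (H0 : DSp →ₗ.[ℂ] DSp) : Prop :=
  H0.adjoint = H0 ∧ IsCore H0 testSub ∧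
  ∀ (u : DSp) (f : V3 → C4), IsTestFn f → ⇑u =ᵐ[volume] f →
    ∃ hu : u ∈ H0.domain, ⇑(H0 ⟨u, hu⟩) =ᵐ[volume] fun x => diracAct f x

/-- `HA` is the magnetic Dirac operator with vector potential `A`: the self-adjoint
closure of the classical magnetic Dirac operator on `C₀^∞(ℝ³ \ {0})⁴` (on which it is
essentially self-adjoint). -/
def IsMagneticDirac (A : V3 → V3) (HA : DSp →ₗ.[ℂ] DSp) : Prop :=
  HA.adjoint = HA ∧ IsCore HA testSubAway ∧
  ∀ (u : DSp) (f : V3 → C4), IsTestFnAway f → ⇑u =ᵐ[volume] f →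
    ∃ hu : u ∈ HA.domain, ⇑(HA ⟨u, hu⟩) =ᵐ[volume] fun x => diracActA A f x

/-- `Bfun` is the distributional curl of the vector potential `A`:
`(curl A)_i = ∂_{i+1} A_{i+2} - ∂_{i+2} A_{i+1}` (cyclically), tested against smooth
compactly supported functions. -/
def IsCurlOf (A : V3 → V3) (Bfun : V3 → V3) : Prop :=
  ∀ (i : Fin 3) (φ : V3 → ℝ), ContDiff ℝ (⊤ : ℕ∞) φ → HasCompactSupport φ →
    ∫ x : V3, Bfun x i * φ x =
      ∫ x : V3, (A x (i + 1) * fderiv ℝ φ x (EuclideanSpace.single (i + 2) (1 : ℝ)) -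
        A x (i + 2) * fderiv ℝ φ x (EuclideanSpace.single (i + 1) (1 : ℝ)))

end Dirac

section Statement19

local notation "⟪" x ", " y "⟫" => @inner ℂ _ _ x y

/-- The sesquilinear form `v[u, w] = (Vu, w) = ∫ (V(x)u(x), w(x))_{ℂ⁴} dx` of a
matrix-valued potential (linear in `u`, conjugate-linear in `w`). -/
def matPotForm (V : V3 → Matrix (Fin 4) (Fin 4) ℂ) (u w : DSp) : ℂ :=
  ∫ x : V3, ⟪(w : V3 → C4) x, mapp (V x) ((u : V3 → C4) x)⟫

/-- The binomial coefficient `binom(-1/2, n)`. -/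
def binomHalf (n : ℕ) : ℝ :=
  (∏ i ∈ Finset.range n, (-(1 : ℝ) / 2 - (i : ℝ))) / (n.factorial : ℝ)

/-- `Ω = (1 - A)^{-1/2}`, defined by the binomial power series
`Σ_n binom(-1/2, n) (-A)^n`. -/
def omegaSeries (A : DSp →L[ℂ] DSp) : DSp →L[ℂ] DSp :=
  ∑' n : ℕ, binomHalf n • (-A) ^ n

section Proofs
open ComplexConjugate
open scoped ENNReal

/-- A zero-free holomorphic function bounded above on a disc and bounded below at the centre
is bounded below on the half disc. -/
lemma norm_ge_of_zeroFree {d : ℂ → ℂ} {r M δ : ℝ} (hr : 0 < r) (hδ : 0 < δ)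
    (hd : DifferentiableOn ℂ d (Metric.ball 0 r)) (hne : ∀ z ∈ Metric.ball (0 : ℂ) r, d z ≠ 0)
    (hM : ∀ z ∈ Metric.ball (0 : ℂ) r, ‖d z‖ ≤ M) (h0 : δ ≤ ‖d 0‖) {z : ℂ} (hz : ‖z‖ ≤ r / 2) :
    δ * Real.exp (-(2 * Real.log ((M + δ) / δ))) ≤ ‖d z‖ := by
  have hz0 : (0 : ℂ) ∈ Metric.ball (0 : ℂ) r := Metric.mem_ball_self hr
  have hzr : z ∈ Metric.ball (0 : ℂ) r := by
    rw [mem_ball_zero_iff]; linarith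
  have hMδ : δ ≤ M := h0.trans (hM 0 hz0)
  have hd0 : d 0 ≠ 0 := hne 0 hz0
  have hA : 0 < Real.log ((M + δ) / δ) := Real.log_pos (by rw [lt_div_iff₀ hδ]; linarith)
  have hd' : DifferentiableOn ℂ (fun z => deriv d z / d z) (Metric.ball 0 r) :=
    (hd.deriv Metric.isOpen_ball).div hd hne
  obtain ⟨g, hg0, hg⟩ := hd'.isExactOn_ball.with_val_at 0 0
  have hgd : DifferentiableOn ℂ g (Metric.ball 0 r) :=
    fun z hz => (hg z hz).differentiableAt.differentiableWithinAt
  have key : ∀ w ∈ Metric.ball (0 : ℂ) r, d w = d 0 * exp (g w) := by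
    have hc : ∀ w ∈ Metric.ball (0 : ℂ) r, d w * exp (-g w) = d 0 * exp (-g 0) := by
      intro w hw
      refine (convex_ball (0 : ℂ) r).is_const_of_fderivWithin_eq_zero (𝕜 := ℂ)
        (f := fun w => d w * exp (-g w)) (hd.mul (hgd.neg.cexp)) ?_ hw hz0
      intro x hx
      have h1 : HasDerivAt d (deriv d x) x :=
        (hd.differentiableAt (Metric.isOpen_ball.mem_nhds hx)).hasDerivAt
      have h2 := h1.mul ((hg x hx).neg.cexp)
      have h3 : deriv d x * exp (-g x) + d x * (exp (-g x) * -(deriv d x / d x)) = 0 := by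
        field_simp [hne x hx]; ring
      rw [fderivWithin_of_isOpen Metric.isOpen_ball hx]
      have h4 : HasDerivAt (fun w => d w * exp (-g w)) 0 x := by
        refine h2.congr_deriv ?_
        simpa using h3
      simpa using h4.hasFDerivAt.fderiv
    intro w hw
    have := hc w hw
    rw [hg0, neg_zero, exp_zero, mul_one] at this
    rw [← this, mul_assoc, ← exp_add]; simp
  have hre : Set.MapsTo g (Metric.ball 0 r) {z | z.re ≤ Real.log ((M + δ) / δ)} := by
    intro w hw
    have h1 := hM w hw
    rw [key w hw, norm_mul, norm_exp] at h1
    have hm : δ * Real.exp (g w).re ≤ M :=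
      (mul_le_mul_of_nonneg_right h0 (Real.exp_pos _).le).trans h1
    show (g w).re ≤ _
    rw [Real.le_log_iff_exp_le (div_pos (by linarith) hδ), le_div_iff₀ hδ]
    linarith
  have hb := borelCaratheodory_zero hA hgd hre hr hzr hg0
  have hb2 : ‖g z‖ ≤ 2 * Real.log ((M + δ) / δ) := by
    refine hb.trans ?_
    rw [div_le_iff₀ (by linarith)]
    nlinarith
  rw [key z hzr, norm_mul, norm_exp]
  have : -(2 * Real.log ((M + δ) / δ)) ≤ (g z).re := by
    have := abs_re_le_norm (g z)
    have := abs_le.1 this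
    linarith
  gcongr

section WeakAnalytic
variable {H : Type*} [NormedAddCommGroup H] [InnerProductSpace ℂ H]

lemma opNorm_le_of_inner {f : H →L[ℂ] H} {C : ℝ} (hC : 0 ≤ C)
    (h : ∀ x y, ‖⟪y, f x⟫‖ ≤ C * ‖x‖ * ‖y‖) : ‖f‖ ≤ C := by
  refine f.opNorm_le_bound hC fun x => ?_
  by_cases h0 : f x = 0
  · rw [h0, norm_zero]; positivity
  · have := h x (f x)
    rw [inner_self_eq_norm_sq_to_K] at this
    have h2 : ‖f x‖ * ‖f x‖ ≤ (C * ‖x‖) * ‖f x‖ := by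
      simpa [pow_two] using this
    exact le_of_mul_le_mul_right h2 (norm_pos_iff.2 h0)

variable [CompleteSpace H]

/-- Weakly holomorphic and bounded operator functions are norm-holomorphic. -/
lemma differentiableAt_of_weak {f : ℂ → (H →L[ℂ] H)} {c : ℂ} {r M : ℝ} (hr : 0 < r)
    (hM : ∀ z ∈ Metric.ball c r, ‖f z‖ ≤ M)
    (hw : ∀ x y : H, DifferentiableOn ℂ (fun z => ⟪y, f z x⟫) (Metric.ball c r)) :
    DifferentiableAt ℂ f c := by
  have hM0 : 0 ≤ M := (norm_nonneg _).trans (hM c (Metric.mem_ball_self hr))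
  have hMw : ∀ x y : H, ∀ z ∈ Metric.ball c r, ‖⟪y, f z x⟫‖ ≤ M * ‖x‖ * ‖y‖ := by
    intro x y z hz
    refine (norm_inner_le_norm _ _).trans ?_
    have := (f z).le_of_opNorm_le (hM z hz) x
    nlinarith [norm_nonneg y]
  -- Lipschitz on the half ball
  have hlip : ∀ z ∈ Metric.closedBall c (r / 4), ∀ w ∈ Metric.closedBall c (r / 4),
      ‖f z - f w‖ ≤ (M / (r / 2)) * ‖z - w‖ := by
    intro z hz w hw'
    refine opNorm_le_of_inner (by positivity) fun x y => ?_
    have hder : ∀ t ∈ Metric.closedBall c (r / 4),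
        ‖deriv (fun z => ⟪y, f z x⟫) t‖ ≤ M * ‖x‖ * ‖y‖ / (r / 2) := by
      intro t ht
      have hsub : Metric.closedBall t (r / 2) ⊆ Metric.ball c r := by
        intro s hs
        rw [Metric.mem_closedBall] at hs ht
        rw [Metric.mem_ball]
        linarith [dist_triangle s t c]
      refine norm_deriv_le_of_forall_mem_sphere_norm_le (by positivity)
        (((hw x y).mono hsub).diffContOnCl_ball subset_rfl) ?_
      intro s hs
      exact hMw x y s (hsub (Metric.sphere_subset_closedBall hs))
    have hsub : Metric.closedBall c (r / 4) ⊆ Metric.ball c r :=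
      Metric.closedBall_subset_ball (by linarith)
    have := (convex_closedBall c (r / 4)).norm_image_sub_le_of_norm_deriv_le
      (f := fun z => ⟪y, f z x⟫) (fun t ht => (hw x y).differentiableAt
        (Metric.isOpen_ball.mem_nhds (hsub ht))) hder hw' hz
    rw [sub_apply, inner_sub_right]
    refine this.trans (le_of_eq ?_)
    ring
  have hcont : ContinuousOn f (Metric.closedBall c (r / 4)) := by
    have : LipschitzOnWith (Real.toNNReal (M / (r / 2))) f (Metric.closedBall c (r / 4)) := by
      refine LipschitzOnWith.of_dist_le_mul fun z hz w hw' => ?_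
      rw [dist_eq_norm, dist_eq_norm, Real.coe_toNNReal _ (by positivity)]
      exact hlip z hz w hw'
    exact this.continuousOn
  have hr4 : 0 < r / 4 := by positivity
  lift r / 4 to NNReal using hr4.le with ρ hρ
  have hρ' : (0 : ℝ) < ρ := hr4
  have hci : CircleIntegrable f c ρ :=
    (hcont.mono Metric.sphere_subset_closedBall).circleIntegrable hρ'.le
  have hps := hasFPowerSeriesOn_cauchy_integral hci (by exact_mod_cast hρ')
  refine hps.differentiableOn.differentiableAt (x := c) ?_ |>.congr_of_eventuallyEq ?_
  · exact Metric.eball_mem_nhds _ (by simpa using hρ')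
  · filter_upwards [Metric.ball_mem_nhds c hρ'] with w hw'
    refine ContinuousLinearMap.ext fun x => ext_inner_left ℂ fun y => ?_
    have hcc : CircleIntegrable (fun z => (z - w)⁻¹ • f z) c ρ := by
      refine ContinuousOn.circleIntegrable hρ'.le ?_
      refine ContinuousOn.smul (ContinuousOn.inv₀ (f := fun z => z - w)
        (Continuous.continuousOn (by fun_prop)) ?_)
        (hcont.mono Metric.sphere_subset_closedBall)
      intro z hz h0
      rw [sub_eq_zero.1 h0] at hz
      rw [Metric.mem_sphere] at hz
      rw [Metric.mem_ball] at hw'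
      linarith
    let L : (H →L[ℂ] H) →L[ℂ] ℂ := (innerSL ℂ y).comp (ContinuousLinearMap.apply ℂ H x)
    have h1 : ⟪y, ((2 * Real.pi * I : ℂ)⁻¹ • ∮ z in C(c, ρ), (z - w)⁻¹ • f z) x⟫ =
        (2 * Real.pi * I : ℂ)⁻¹ • ∮ z in C(c, ρ), (z - w)⁻¹ • ⟪y, f z x⟫ := by
      have : L (∮ z in C(c, ρ), (z - w)⁻¹ • f z) = ∮ z in C(c, ρ), (z - w)⁻¹ • ⟪y, f z x⟫ := by
        unfold circleIntegral
        rw [← L.intervalIntegral_comp_comm]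
        · congr 1; ext θ; simp [L]
        · exact hcc.out
      rw [← this]
      simp [L, inner_smul_right]
    rw [h1]
    have h2 := DifferentiableOn.circleIntegral_sub_inv_smul (c := c) (R := ρ) (w := w)
      (f := fun z => ⟪y, f z x⟫) ((hw x y).mono ?_) hw'
    · rw [h2]
      rw [smul_smul, inv_mul_cancel₀ (by simp [Real.pi_ne_zero]), one_smul]
    · rw [hρ]; exact Metric.closedBall_subset_ball (by linarith)

end WeakAnalytic

lemma exists_matrix_inv_bound (n : ℕ) (a M : ℝ) (ha : 1 ≤ a) (hM : 1 ≤ M) :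
    ∃ K : ℝ, 0 ≤ K ∧ ∀ (r : ℝ) (A : ℂ → Matrix (Fin n) (Fin n) ℂ) (B : Matrix (Fin n) (Fin n) ℂ),
      0 < r → (∀ i j, DifferentiableOn ℂ (fun s => A s i j) (Metric.ball 0 r)) →
      (∀ s ∈ Metric.ball (0 : ℂ) r, ∀ i j, ‖A s i j‖ ≤ a) →
      (∀ s ∈ Metric.ball (0 : ℂ) r, IsUnit (A s).det) →
      A 0 * B = 1 → (∀ i j, ‖B i j‖ ≤ M) →
      ∀ s : ℂ, ‖s‖ ≤ r / 2 → ∀ i j, ‖(A s)⁻¹ i j‖ ≤ K := by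
  have hdet : ∀ (N : Matrix (Fin n) (Fin n) ℂ) (x : ℝ), (∀ i j, ‖N i j‖ ≤ x) →
      ‖N.det‖ ≤ n.factorial * x ^ n := by
    intro N x hx
    have := Matrix.det_le (A := N) (abv := NormedField.toAbsoluteValue ℂ) (x := x) hx
    rw [nsmul_eq_mul, Fintype.card_fin] at this
    exact this
  set δ : ℝ := (n.factorial * M ^ n)⁻¹ with hδ
  set D : ℝ := n.factorial * a ^ n with hD
  have hfac : (0 : ℝ) < n.factorial := by exact_mod_cast n.factorial_pos
  have hδ0 : 0 < δ := by positivity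
  refine ⟨(δ * Real.exp (-(2 * Real.log ((D + δ) / δ))))⁻¹ * D, by positivity, ?_⟩
  intro r A B hr hA hAa hu hB hBM s hs i j
  have hsr : s ∈ Metric.ball (0 : ℂ) r := by rw [mem_ball_zero_iff]; linarith
  have h0 : δ ≤ ‖(A 0).det‖ := by
    have h1 : (A 0).det * B.det = 1 := by rw [← Matrix.det_mul, hB, Matrix.det_one]
    have h2 : ‖(A 0).det‖ * ‖B.det‖ = 1 := by rw [← norm_mul, h1, norm_one]
    have h3 := hdet B M hBM
    rw [hδ, inv_le_iff_one_le_mul₀ (by positivity), ← h2]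
    gcongr
  have hdd : DifferentiableOn ℂ (fun s => (A s).det) (Metric.ball 0 r) := by
    simp only [Matrix.det_apply]
    refine DifferentiableOn.fun_sum fun σ _ => ?_
    refine DifferentiableOn.const_smul ?_ _
    exact DifferentiableOn.fun_finsetProd fun i _ => hA _ _
  have hb := norm_ge_of_zeroFree hr hδ0 hdd (fun z hz => (hu z hz).ne_zero)
    (fun z hz => hdet _ _ (hAa z hz)) h0 hs
  rw [Matrix.inv_def, Matrix.smul_apply, norm_smul, Ring.inverse_eq_inv', norm_inv,
    Matrix.adjugate_apply]
  refine mul_le_mul (inv_anti₀ (by positivity) hb) ?_ (norm_nonneg _) (by positivity)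
  refine hdet _ _ fun k l => ?_
  rw [Matrix.updateRow_apply]
  split_ifs
  · rw [Pi.single_apply]; split_ifs <;> simp <;> linarith
  · exact hAa s hsr k l

section Step
variable {H : Type*} [NormedAddCommGroup H] [InnerProductSpace ℂ H]

/-- Off a finite-dimensional subspace of controlled dimension, a Hilbert-Schmidt seminorm `g`
is small. -/
lemma exists_orthonormal_compl {g : H → ℝ} {κ c : ℝ} (hc : 0 < c)
    (hg : ∀ (n : ℕ) (e : Fin n → H), Orthonormal ℂ e → ∑ i, g (e i) ^ 2 ≤ κ) :
    ∃ (n : ℕ) (e : Fin n → H), Orthonormal ℂ e ∧ (n : ℝ) * c ^ 2 ≤ κ ∧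
      ∀ y : H, ‖y‖ = 1 → (∀ i, ⟪e i, y⟫ = 0) → g y ≤ c := by
  let P : ℕ → Prop := fun n => ∃ e : Fin n → H, Orthonormal ℂ e ∧ ∀ i, c < g (e i)
  have hP : ∀ n, P n → (n : ℝ) * c ^ 2 ≤ κ := by
    rintro n ⟨e, he, hge⟩
    refine le_trans ?_ (hg n e he)
    have : ∑ i : Fin n, c ^ 2 ≤ ∑ i, g (e i) ^ 2 :=
      Finset.sum_le_sum fun i _ => by have := hge i; gcongr
    simpa using this
  have h0 : P 0 := ⟨fun i => i.elim0, ⟨fun i => i.elim0, fun i => i.elim0⟩, fun i => i.elim0⟩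
  obtain ⟨n, hn, hn1⟩ : ∃ n, P n ∧ ¬ P (n + 1) := by
    by_contra! hcon
    have hall : ∀ n, P n := fun n => Nat.rec h0 (fun n ih => hcon n ih) n
    obtain ⟨N, hN⟩ := exists_nat_gt (κ / c ^ 2)
    have := hP N (hall N)
    rw [div_lt_iff₀ (by positivity)] at hN
    linarith
  obtain ⟨e, he, hge⟩ := hn
  refine ⟨n, e, he, hP n ⟨e, he, hge⟩, fun y hy hye => ?_⟩
  by_contra! hcy
  refine hn1 ⟨Fin.cons y e, ⟨?_, ?_⟩, ?_⟩
  · intro i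
    refine Fin.cases ?_ (fun i => ?_) i
    · simpa using hy
    · simpa using he.1 i
  · intro i
    refine Fin.cases ?_ (fun i => ?_) i
    · intro j
      refine Fin.cases (fun h => absurd rfl h) (fun j _ => ?_) j
      show ⟪(Fin.cons y e : Fin (n+1) → H) 0, (Fin.cons y e : Fin (n+1) → H) j.succ⟫ = 0
      simpa [inner_eq_zero_symm] using hye j
    · intro j
      refine Fin.cases (fun _ => ?_) (fun j h => ?_) j
      · show ⟪(Fin.cons y e : Fin (n+1) → H) i.succ, (Fin.cons y e : Fin (n+1) → H) 0⟫ = 0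
        simpa using hye i
      · show ⟪(Fin.cons y e : Fin (n+1) → H) i.succ, (Fin.cons y e : Fin (n+1) → H) j.succ⟫ = 0
        simpa using he.2 (fun h' => h (by rw [h']))
  · intro i
    refine Fin.cases ?_ (fun i => ?_) i
    · simpa using hcy
    · simpa using hge i


/-- The finite-rank operator `y ↦ ∑ ⟪eᵢ, y⟫ fᵢ`. -/
def finRankOp {n : ℕ} (e f : Fin n → H) : H →L[ℂ] H :=
  ∑ i, (innerSL ℂ (e i)).smulRight (f i)

lemma finRankOp_apply {n : ℕ} (e f : Fin n → H) (y : H) :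
    finRankOp e f y = ∑ i, ⟪e i, y⟫ • f i := by
  simp [finRankOp]

lemma inner_finRankOp {n : ℕ} {e f : Fin n → H} (hf : Orthonormal ℂ f) (y : H) (i : Fin n) :
    ⟪f i, finRankOp e f y⟫ = ⟪e i, y⟫ := by
  rw [finRankOp_apply, hf.inner_right_fintype]

lemma finRankOp_self {n : ℕ} {e f : Fin n → H} (he : Orthonormal ℂ e) (i : Fin n) :
    finRankOp e f (e i) = f i := by
  rw [finRankOp_apply, Finset.sum_eq_single i]
  · rw [inner_self_eq_norm_sq_to_K, he.1 i]; simp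
  · intro j _ hj; rw [he.2 hj, zero_smul]
  · simp

lemma norm_finRankOp_le {n : ℕ} {e f : Fin n → H} (he : Orthonormal ℂ e)
    (hf : Orthonormal ℂ f) (y : H) : ‖finRankOp e f y‖ ≤ ‖y‖ := by
  have h1 : ‖finRankOp e f y‖ ^ 2 = ∑ i, ‖⟪e i, y⟫‖ ^ 2 := by
    have h := hf.inner_sum (fun i => ⟪e i, y⟫) (fun i => ⟪e i, y⟫) Finset.univ
    rw [← finRankOp_apply, inner_self_eq_norm_sq_to_K] at h
    have h2 : ((‖finRankOp e f y‖ ^ 2 : ℝ) : ℂ) = ((∑ i, ‖⟪e i, y⟫‖ ^ 2 : ℝ) : ℂ) := by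
      push_cast
      rw [show ((‖finRankOp e f y‖ : ℂ)) = ((‖finRankOp e f y‖ : ℝ) : ℂ) from rfl] at *
      refine h.trans (Finset.sum_congr rfl fun i _ => ?_)
      rw [RCLike.conj_mul]; rfl
    exact_mod_cast h2
  have h2 := he.sum_inner_products_le (s := Finset.univ) y
  rw [← h1] at h2
  exact le_of_sq_le_sq h2 (norm_nonneg _)

end Step

section Step
variable {H : Type*} [NormedAddCommGroup H] [InnerProductSpace ℂ H] [CompleteSpace H]

lemma norm_inverse_one_sub_le {X : H →L[ℂ] H} (hX : ‖X‖ ≤ 1 / 2) :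
    IsUnit (1 - X) ∧ ∀ y, ‖Ring.inverse (1 - X) y‖ ≤ 2 * ‖y‖ := by
  have hu : IsUnit (1 - X) := isUnit_one_sub_of_norm_lt_one (by linarith)
  refine ⟨hu, fun y => ?_⟩
  set z := Ring.inverse (1 - X) y with hz
  have h1 : (1 - X) z = y := by
    have := DFunLike.congr_fun (Ring.mul_inverse_cancel _ hu) y
    simpa using this
  have h2 : z = y + X z := by
    rw [← h1]; simp
  have h3 : ‖z‖ ≤ ‖y‖ + ‖X z‖ := by
    conv_lhs => rw [h2]
    exact norm_add_le _ _
  have h4 := X.le_of_opNorm_le hX z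
  linarith

/-- A basis of the orthogonal complement of `L (e^⊥)`, with `N = L⁻¹`. -/
lemma exists_dual_family {n : ℕ} {e : Fin n → H} (he : Orthonormal ℂ e) {L N : H →L[ℂ] H}
    (hNL : N * L = 1) :
    ∃ f : Fin n → H, Orthonormal ℂ f ∧
      (∀ y, (∀ i, ⟪e i, y⟫ = 0) → ∀ i, ⟪f i, L y⟫ = 0) ∧
      (∀ x, (∀ i, ⟪f i, x⟫ = 0) → ∀ i, ⟪e i, N x⟫ = 0) := by
  let g : Fin n → H := fun i => N.adjoint (e i)
  have hg : LinearIndependent ℂ g := by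
    refine LinearIndependent.map' he.linearIndependent (N.adjoint : H →ₗ[ℂ] H) ?_
    rw [LinearMap.ker_eq_bot']
    intro m hm
    have h1 : (ContinuousLinearMap.adjoint L) (N.adjoint m) = m := by
      have : ContinuousLinearMap.adjoint (N * L) = 1 := by
        rw [hNL]; exact ContinuousLinearMap.adjoint_id
      have h2 := DFunLike.congr_fun this m
      rw [ContinuousLinearMap.mul_def, ContinuousLinearMap.adjoint_comp] at h2
      simpa using h2
    have hm' : N.adjoint m = 0 := hm
    rw [← h1, hm', map_zero]
  have hspan := InnerProductSpace.span_gramSchmidtNormed_range (𝕜 := ℂ) g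
  rw [InnerProductSpace.span_gramSchmidt] at hspan
  refine ⟨InnerProductSpace.gramSchmidtNormed ℂ g,
    InnerProductSpace.gramSchmidtNormed_orthonormal hg, ?_, ?_⟩
  · intro y hy i
    have hmem : InnerProductSpace.gramSchmidtNormed ℂ g i ∈ Submodule.span ℂ (Set.range g) := by
      rw [← hspan]; exact Submodule.subset_span ⟨i, rfl⟩
    generalize InnerProductSpace.gramSchmidtNormed ℂ g i = z at hmem ⊢
    induction hmem using Submodule.span_induction with
    | mem x hx =>
      obtain ⟨j, rfl⟩ := hx
      show ⟪N.adjoint (e j), L y⟫ = 0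
      rw [ContinuousLinearMap.adjoint_inner_left]
      have := DFunLike.congr_fun hNL y
      rw [show N (L y) = y from this, hy]
    | zero => simp
    | add x y _ _ hx hy => rw [inner_add_left, hx, hy, add_zero]
    | smul c x _ hx => rw [inner_smul_left, hx, mul_zero]
  · intro x hx i
    have hmem : g i ∈ Submodule.span ℂ (Set.range (InnerProductSpace.gramSchmidtNormed ℂ g)) := by
      rw [hspan]; exact Submodule.subset_span ⟨i, rfl⟩
    rw [← ContinuousLinearMap.adjoint_inner_left]
    show ⟪g i, x⟫ = 0
    generalize g i = z at hmem ⊢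
    induction hmem using Submodule.span_induction with
    | mem z hz => obtain ⟨j, rfl⟩ := hz; exact hx j
    | zero => simp
    | add x y _ _ hx hy => rw [inner_add_left, hx, hy, add_zero]
    | smul c x _ hx => rw [inner_smul_left, hx, mul_zero]

lemma step_fixed (n : ℕ) {c l β M : ℝ} (hc : 0 ≤ c) (hl : 0 ≤ l) (hβ : 0 < β) (hM : 1 ≤ M) :
    ∃ M' : ℝ, 0 ≤ M' ∧ ∀ (e : Fin n → H) (L0 k : H →L[ℂ] H) (N : ℂ → (H →L[ℂ] H)) (r : ℝ),
      r = 1 / (4 * β * (2 * c + 1)) → Orthonormal ℂ e → ‖L0‖ ≤ l → ‖k‖ ≤ β →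
      (∀ s : ℂ, ‖s‖ < r → (L0 - s • k) * N s = 1 ∧ N s * (L0 - s • k) = 1) →
      (∀ y, (∀ i, ⟪e i, y⟫ = 0) → ‖y‖ ≤ c * ‖L0 y‖) →
      ‖N 0‖ ≤ M → ∀ s : ℂ, ‖s‖ ≤ r / 2 → ‖N s‖ ≤ M' := by
  set a : ℝ := 2 * (2 * c + 1) * (l + 1) + 1 with ha
  obtain ⟨K, hK0, hK⟩ := exists_matrix_inv_bound n a M
    (by rw [ha]; have : 0 ≤ 2 * (2 * c + 1) * (l + 1) := by positivity
        linarith) hM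
  refine ⟨(1 + (a + 1) * (n * (n * K))) * (2 * (2 * c + 1)), by positivity, ?_⟩
  intro e L0 k N r hr he hL0 hk hN hbb hN0 s hs
  have hr0 : 0 < r := by rw [hr]; positivity
  have h0 := hN 0 (by simpa using hr0)
  rw [zero_smul, sub_zero] at h0
  obtain ⟨hLN, hNL⟩ := h0
  obtain ⟨f, hf, hf1, hf2⟩ := exists_dual_family he hNL
  have hpr : ∀ y i, ⟪e i, y - finRankOp e e y⟫ = 0 := fun y i => by
    rw [inner_sub_right, inner_finRankOp he, sub_self]
  -- the finite-rank modification `D` and its inverse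
  let D0 : H →L[ℂ] H := L0 * (1 - finRankOp e e) + finRankOp e f
  let E0 : H →L[ℂ] H := N 0 * (1 - finRankOp f f) + finRankOp f e
  have hD0 : ∀ y, D0 y = L0 (y - finRankOp e e y) + finRankOp e f y := fun y => rfl
  have hE0 : ∀ y, E0 y = N 0 (y - finRankOp f f y) + finRankOp f e y := fun y => rfl
  have hLNx : ∀ x, L0 (N 0 x) = x := fun x => DFunLike.congr_fun hLN x
  have hNLx : ∀ x, N 0 (L0 x) = x := fun x => DFunLike.congr_fun hNL x
  have hfD : ∀ y i, ⟪f i, D0 y⟫ = ⟪e i, y⟫ := fun y i => by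
    rw [hD0, inner_add_right, hf1 _ (hpr y), inner_finRankOp hf, zero_add]
  have hED : ∀ y, E0 (D0 y) = y := fun y => by
    have h1 : finRankOp f f (D0 y) = finRankOp e f y := by
      simp only [finRankOp_apply, hfD]
    have h2 : finRankOp f e (D0 y) = finRankOp e e y := by
      simp only [finRankOp_apply, hfD]
    rw [hE0, h1, h2, hD0, add_sub_cancel_right, hNLx, sub_add_cancel]
  have hE0b : ∀ x, ‖E0 x‖ ≤ (2 * c + 1) * ‖x‖ := fun x => by
    rw [hE0]
    have h1 : ∀ i, ⟪f i, x - finRankOp f f x⟫ = 0 := fun i => by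
      rw [inner_sub_right, inner_finRankOp hf, sub_self]
    have h2 := hbb _ (hf2 _ h1)
    rw [hLNx] at h2
    have h3 := norm_sub_le x (finRankOp f f x)
    have h4 := norm_finRankOp_le hf hf x
    have h5 := norm_finRankOp_le hf he x
    refine (norm_add_le _ _).trans ?_
    nlinarith
  let X : H →L[ℂ] H := E0 * (k * (1 - finRankOp e e))
  have hXb : ∀ x, ‖X x‖ ≤ (2 * c + 1) * (β * (2 * ‖x‖)) := fun x => by
    refine (hE0b _).trans ?_
    have h1 : ‖k (x - finRankOp e e x)‖ ≤ β * ‖x - finRankOp e e x‖ := k.le_of_opNorm_le hk _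
    have h3 := norm_sub_le x (finRankOp e e x)
    have h4 := norm_finRankOp_le he he x
    have : ‖x - finRankOp e e x‖ ≤ 2 * ‖x‖ := by linarith
    refine mul_le_mul_of_nonneg_left (h1.trans ?_) (by positivity)
    gcongr
  have hXs : ∀ s : ℂ, ‖s‖ < r → ‖s • X‖ ≤ 1 / 2 := fun s hs => by
    refine ContinuousLinearMap.opNorm_le_bound _ (by norm_num) fun x => ?_
    have h1 : (s • X) x = s • X x := rfl
    rw [h1, norm_smul]
    calc ‖s‖ * ‖X x‖ ≤ r * ((2 * c + 1) * (β * (2 * ‖x‖))) :=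
          mul_le_mul hs.le (hXb x) (norm_nonneg _) hr0.le
      _ = 1 / 2 * ‖x‖ := by rw [hr]; field_simp; ring
  let Z : ℂ → (H →L[ℂ] H) := fun s => Ring.inverse (1 - s • X) * (E0 * (L0 - s • k))
  let D : ℂ → (H →L[ℂ] H) := fun s => Ring.inverse (1 - s • X) * E0
  have hDb : ∀ s : ℂ, ‖s‖ < r → ∀ x, ‖D s x‖ ≤ 2 * (2 * c + 1) * ‖x‖ := fun s hs x => by
    refine ((norm_inverse_one_sub_le (hXs s hs)).2 (E0 x)).trans ?_
    have := hE0b x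
    linarith
  have hZD : ∀ s x, Z s x = D s ((L0 - s • k) x) := fun s x => rfl
  have hinv : ∀ s : ℂ, ‖s‖ < r → ∀ x, Ring.inverse (1 - s • X) (x - s • X x) = x :=
    fun s hs x => DFunLike.congr_fun
      (Ring.inverse_mul_cancel _ (norm_inverse_one_sub_le (hXs s hs)).1) x
  have hZpr : ∀ s : ℂ, ‖s‖ < r → ∀ y, (∀ i, ⟪e i, y⟫ = 0) → Z s y = y := fun s hs y hy => by
    have h1 : finRankOp e e y = 0 := by simp [finRankOp_apply, hy]
    have h2 : finRankOp e f y = 0 := by simp [finRankOp_apply, hy]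
    have h3 : D0 y = L0 y := by rw [hD0, h1, h2, sub_zero, add_zero]
    have h4 : X y = E0 (k y) := by
      show E0 (k (y - finRankOp e e y)) = _
      rw [h1, sub_zero]
    have h5 : E0 ((L0 - s • k) y) = y - s • X y := by
      rw [h4, sub_apply, map_sub, ← h3, hED]
      simp
    show Ring.inverse (1 - s • X) (E0 ((L0 - s • k) y)) = y
    rw [h5, hinv s hs]
  have hDf : ∀ s : ℂ, ‖s‖ < r → ∀ i, D s (f i) = e i := fun s hs i => by
    have h1 : finRankOp e e (e i) = e i := finRankOp_self he i
    have h2 : D0 (e i) = f i := by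
      rw [hD0, h1, sub_self, map_zero, zero_add, finRankOp_self he]
    have h4 : X (e i) = 0 := by
      show E0 (k (e i - finRankOp e e (e i))) = _
      rw [h1, sub_self, map_zero, map_zero]
    have h5 : E0 (f i) = e i - s • X (e i) := by
      rw [h4, smul_zero, sub_zero, ← h2, hED]
    show Ring.inverse (1 - s • X) (E0 (f i)) = e i
    rw [h5, hinv s hs]
  have hZb : ∀ s : ℂ, ‖s‖ < r → ∀ x, ‖Z s x‖ ≤ a * ‖x‖ := fun s hs x => by
    rw [hZD]
    refine (hDb s hs _).trans ?_
    have h1 : ‖(L0 - s • k) x‖ ≤ (l + 1) * ‖x‖ := by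
      have h2 : ‖s‖ * β ≤ 1 := by
        have : r * β ≤ 1 := by
          rw [hr, div_mul_eq_mul_div, div_le_one (by positivity)]
          nlinarith
        nlinarith
      have h3 : ‖(L0 - s • k) x‖ ≤ ‖L0 x‖ + ‖s • k x‖ := norm_sub_le _ _
      have h4 := L0.le_of_opNorm_le hL0 x
      have h5 := k.le_of_opNorm_le hk x
      rw [norm_smul] at h3
      have h6 : ‖s‖ * ‖k x‖ ≤ 1 * ‖x‖ :=
        (mul_le_mul_of_nonneg_left h5 (norm_nonneg _)).trans (by
          rw [← mul_assoc]; gcongr)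
      linarith
    calc 2 * (2 * c + 1) * ‖(L0 - s • k) x‖ ≤ 2 * (2 * c + 1) * ((l + 1) * ‖x‖) := by gcongr
      _ ≤ a * ‖x‖ := by rw [ha]; nlinarith [norm_nonneg x]
  let A : ℂ → Matrix (Fin n) (Fin n) ℂ := fun s => Matrix.of fun i j => ⟪e i, Z s (e j)⟫
  have hAapp : ∀ s : ℂ, ‖s‖ < r → ∀ u i,
      ⟪e i, Z s u⟫ = ∑ j, A s i j * ⟪e j, u⟫ := fun s hs u i => by
    have h1 : u = (u - finRankOp e e u) + finRankOp e e u := by simp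
    conv_lhs => rw [h1, map_add, hZpr s hs _ (hpr u), inner_add_right, hpr, zero_add,
      finRankOp_apply, map_sum, inner_sum]
    refine Finset.sum_congr rfl fun j _ => ?_
    rw [map_smul, inner_smul_right, mul_comm]; rfl
  let B : ℂ → Matrix (Fin n) (Fin n) ℂ := fun s => Matrix.of fun i j => ⟪e i, N s (f j)⟫
  have hAB : ∀ s : ℂ, ‖s‖ < r → A s * B s = 1 := fun s hs => by
    ext i m
    rw [Matrix.mul_apply]
    have h1 := hAapp s hs (N s (f m)) i
    have h2 : (L0 - s • k) (N s (f m)) = f m := DFunLike.congr_fun (hN s hs).1 (f m)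
    rw [hZD, h2, hDf s hs] at h1
    rw [← show ⟪e i, e m⟫ = ∑ j, A s i j * B s j m from h1, orthonormal_iff_ite.1 he,
      Matrix.one_apply]
  have hsr : ‖s‖ < r := by linarith
  have hKs := hK r A (B 0) hr0 ?_ ?_ ?_ (hAB 0 (by simpa using hr0)) ?_ s hs
  · refine ContinuousLinearMap.opNorm_le_bound _ (by positivity) fun x => ?_
    set u := N s x with hu
    have hLu : (L0 - s • k) u = x := DFunLike.congr_fun (hN s hsr).1 x
    set y := Z s u with hy
    have hyb : ‖y‖ ≤ 2 * (2 * c + 1) * ‖x‖ := by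
      rw [hy, hZD, hLu]; exact hDb s hsr x
    have hc' : ∀ i, ⟪e i, u⟫ = ∑ j, (A s)⁻¹ i j * ⟪e j, y⟫ := by
      have h1 : (fun i => ⟪e i, y⟫) = (A s).mulVec fun j => ⟪e j, u⟫ := by
        ext i; rw [hy, hAapp s hsr]; rfl
      have hdet : IsUnit (A s).det := by
        have := congrArg Matrix.det (hAB s hsr)
        rw [Matrix.det_mul, Matrix.det_one] at this
        exact IsUnit.of_mul_eq_one _ this
      have h2 : (A s)⁻¹.mulVec (fun i => ⟪e i, y⟫) = fun j => ⟪e j, u⟫ := by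
        rw [h1, Matrix.mulVec_mulVec, Matrix.nonsing_inv_mul _ hdet, Matrix.one_mulVec]
      intro i
      exact (congrFun h2 i).symm
    have hcb : ∀ i, ‖⟪e i, u⟫‖ ≤ n * K * ‖y‖ := fun i => by
      rw [hc']
      refine (norm_sum_le _ _).trans ?_
      calc ∑ j, ‖(A s)⁻¹ i j * ⟪e j, y⟫‖ ≤ ∑ j : Fin n, K * ‖y‖ := by
            refine Finset.sum_le_sum fun j _ => ?_
            rw [norm_mul]
            have h3 := norm_inner_le_norm (𝕜 := ℂ) (e j) y
            rw [he.1 j, one_mul] at h3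
            exact mul_le_mul (hKs i j) h3 (norm_nonneg _) hK0
        _ = n * K * ‖y‖ := by simp [mul_assoc]
    have hpru : ‖finRankOp e e u‖ ≤ n * (n * K) * ‖y‖ := by
      rw [finRankOp_apply]
      refine (norm_sum_le _ _).trans ?_
      calc ∑ j, ‖⟪e j, u⟫ • e j‖ ≤ ∑ j : Fin n, n * K * ‖y‖ := by
            refine Finset.sum_le_sum fun j _ => ?_
            rw [norm_smul, he.1 j, mul_one]; exact hcb j
        _ = n * (n * K) * ‖y‖ := by simp [mul_assoc]
    have hdecu : u = (y - Z s (finRankOp e e u)) + finRankOp e e u := by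
      have h1 : Z s (u - finRankOp e e u) = u - finRankOp e e u := hZpr s hsr _ (hpr u)
      rw [map_sub] at h1
      rw [hy, h1]; simp
    have h5 : ‖u‖ ≤ ‖y‖ + ‖Z s (finRankOp e e u)‖ + ‖finRankOp e e u‖ := by
      conv_lhs => rw [hdecu]
      exact (norm_add_le _ _).trans (by gcongr; exact norm_sub_le _ _)
    have h6 := hZb s hsr (finRankOp e e u)
    have ha0 : 0 ≤ a := by positivity
    calc ‖u‖ ≤ (1 + (a + 1) * (n * (n * K))) * ‖y‖ := by nlinarith
      _ ≤ (1 + (a + 1) * (n * (n * K))) * (2 * (2 * c + 1) * ‖x‖) := by gcongr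
      _ = _ := by ring
  · intro i j s hs
    rw [mem_ball_zero_iff] at hs
    refine DifferentiableAt.differentiableWithinAt ?_
    have h1 : DifferentiableAt ℂ (fun s : ℂ => Ring.inverse (1 - s • X)) s :=
      DifferentiableAt.comp (f := fun s : ℂ => (1 : H →L[ℂ] H) - s • X) s
        (differentiableAt_inverse (norm_inverse_one_sub_le (hXs s hs)).1) (by fun_prop)
    have h2 : DifferentiableAt ℂ (fun s : ℂ => E0 ((L0 - s • k) (e j))) s := by
      simp only [sub_apply, smul_apply, map_sub, map_smul]
      fun_prop
    exact ((innerSL ℂ (e i)).differentiableAt).comp s (h1.clm_apply h2)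
  · intro s hs i j
    rw [mem_ball_zero_iff] at hs
    have h3 := norm_inner_le_norm (𝕜 := ℂ) (e i) (Z s (e j))
    have h4 := hZb s hs (e j)
    rw [he.1, mul_one] at h4
    rw [he.1, one_mul] at h3
    exact h3.trans h4
  · intro s hs
    rw [mem_ball_zero_iff] at hs
    have := congrArg Matrix.det (hAB s hs)
    rw [Matrix.det_mul, Matrix.det_one] at this
    exact IsUnit.of_mul_eq_one _ this
  · intro i j
    have h3 := norm_inner_le_norm (𝕜 := ℂ) (e i) (N 0 (f j))
    have h4 := (N 0).le_of_opNorm_le hN0 (f j)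
    rw [hf.1, mul_one] at h4
    rw [he.1, one_mul] at h3
    exact h3.trans h4

variable (H) in
/-- One step of the continuation argument, with constants independent of the operators. -/
lemma exists_step_bound {C κ l β M : ℝ} (hC : 0 < C) (hl : 0 ≤ l) (hβ : 0 < β) (hM : 1 ≤ M) :
    ∃ M' : ℝ, 1 ≤ M' ∧ ∀ (g : H → ℝ) (L0 k : H →L[ℂ] H) (r : ℝ),
      r = 1 / (4 * β * (4 * C + 1)) →
      (∀ (n : ℕ) (e : Fin n → H), Orthonormal ℂ e → ∑ i, g (e i) ^ 2 ≤ κ) →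
      (∀ (t : ℂ) y, g (t • y) = ‖t‖ * g y) → ‖L0‖ ≤ l → ‖k‖ ≤ β →
      (∀ s : ℂ, ‖s‖ < r → IsUnit (L0 - s • k)) →
      (∀ y, ‖y‖ ≤ C * (‖L0 y‖ + g y)) →
      ‖Ring.inverse L0‖ ≤ M → ∀ s : ℂ, ‖s‖ ≤ r / 2 → ‖Ring.inverse (L0 - s • k)‖ ≤ M' := by
  choose F hF0 hF using fun n : ℕ =>
    step_fixed (H := H) n (c := 2 * C) (l := l) (β := β) (M := M) (by positivity) hl hβ hM
  obtain ⟨m, hm⟩ := exists_nat_gt (κ * (2 * C) ^ 2)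
  refine ⟨1 + ∑ n ∈ Finset.range (m + 1), F n, ?_, ?_⟩
  · have := Finset.sum_nonneg fun n (_ : n ∈ Finset.range (m + 1)) => hF0 n
    linarith
  intro g L0 k r hr hg hgs hL0 hk hu hap hN s hs
  obtain ⟨n, e, he, hn, hy⟩ := exists_orthonormal_compl (c := 1 / (2 * C)) (by positivity) hg
  have hnm : n ∈ Finset.range (m + 1) := by
    rw [Finset.mem_range]
    have h1 : (n : ℝ) ≤ κ * (2 * C) ^ 2 := by
      rw [div_pow, one_pow, mul_one_div, div_le_iff₀ (by positivity)] at hn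
      exact hn
    have : (n : ℝ) < m := h1.trans_lt hm
    have : n < m := by exact_mod_cast this
    omega
  have h1 : F n ≤ ∑ n ∈ Finset.range (m + 1), F n :=
    Finset.single_le_sum (f := F) (fun n _ => hF0 n) hnm
  refine (hF n e L0 k (fun s => Ring.inverse (L0 - s • k)) r ?_ he hL0 hk ?_ ?_ ?_ s hs).trans
    (by linarith)
  · rw [hr]; ring
  · intro s hs
    exact ⟨Ring.mul_inverse_cancel _ (hu s hs), Ring.inverse_mul_cancel _ (hu s hs)⟩
  · intro y hye
    by_cases hy0 : y = 0
    · simp [hy0]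
    have hyn : 0 < ‖y‖ := norm_pos_iff.2 hy0
    have h2 : g y ≤ 1 / (2 * C) * ‖y‖ := by
      have h3 := hy (((‖y‖⁻¹ : ℝ) : ℂ) • y) ?_ ?_
      · rw [hgs, Complex.norm_real, norm_inv, norm_norm, inv_mul_le_iff₀ hyn] at h3
        linarith
      · rw [norm_smul, Complex.norm_real, norm_inv, norm_norm, inv_mul_cancel₀ hyn.ne']
      · intro i; rw [inner_smul_right, hye, mul_zero]
    have h3 := hap y
    have h4 : C * g y ≤ ‖y‖ / 2 := by
      calc C * g y ≤ C * (1 / (2 * C) * ‖y‖) := by gcongr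
        _ = ‖y‖ / 2 := by field_simp
    linarith
  · simpa using hN

variable (H) in
/-- Continuation of inverse bounds along a chain of overlapping discs. -/
lemma exists_chain_bound {C κ β S : ℝ} (hC : 0 < C) (hβ : 0 < β) (hS : 0 ≤ S) (m : ℕ) :
    ∃ M : ℝ, 1 ≤ M ∧ ∀ (g : H → ℝ) (k : H →L[ℂ] H) (r : ℝ) (σ : ℕ → ℂ),
      r = 1 / (4 * β * (4 * C + 1)) →
      (∀ (n : ℕ) (e : Fin n → H), Orthonormal ℂ e → ∑ i, g (e i) ^ 2 ≤ κ) →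
      (∀ (t : ℂ) y, g (t • y) = ‖t‖ * g y) → ‖k‖ ≤ β → σ 0 = 0 →
      (∀ j ≤ m, ‖σ j‖ ≤ S) → (∀ j < m, ‖σ (j + 1) - σ j‖ ≤ r / 2) →
      (∀ j ≤ m, ∀ s : ℂ, ‖s - σ j‖ < r → IsUnit (1 - s • k)) →
      (∀ j ≤ m, ∀ y, ‖y‖ ≤ C * (‖(1 - σ j • k) y‖ + g y)) →
      ‖Ring.inverse (1 - σ m • k)‖ ≤ M := by
  induction m with
  | zero =>
    refine ⟨1, le_rfl, fun g k r σ _ _ _ _ h0 _ _ _ _ => ?_⟩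
    rw [h0, zero_smul, sub_zero, Ring.inverse_one]
    exact ContinuousLinearMap.norm_id_le
  | succ m ih =>
    obtain ⟨M, hM, hih⟩ := ih
    obtain ⟨M', hM', h⟩ := exists_step_bound H (C := C) (κ := κ) (l := 1 + S * β) (β := β) (M := M)
      hC (by positivity) hβ hM
    refine ⟨M', hM', fun g k r σ hr hg hgs hk h0 hσ hd hu hap => ?_⟩
    have h1 := h g (1 - σ m • k) k r hr hg hgs ?_ hk ?_ (hap m (by omega))
      (hih g k r σ hr hg hgs hk h0 (fun j hj => hσ j (by omega)) (fun j hj => hd j (by omega))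
        (fun j hj => hu j (by omega)) (fun j hj => hap j (by omega)))
      (σ (m + 1) - σ m) (hd m (by omega))
    · rwa [sub_sub, ← add_smul, add_sub_cancel] at h1
    · refine (norm_sub_le _ _).trans ?_
      rw [norm_smul]
      have h2 : ‖(1 : H →L[ℂ] H)‖ ≤ 1 := ContinuousLinearMap.norm_id_le
      have h3 := hσ m (by omega)
      gcongr
    · intro s hs
      have := hu m (by omega) (σ m + s) (by simpa using hs)
      rwa [add_smul, ← sub_sub] at this

end Step

section Half
variable {H : Type*} [NormedAddCommGroup H] [InnerProductSpace ℂ H]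

/-- `A` is a bounded symmetric injective operator commuting with the unitary involution `J`. -/
structure SqrtSetup (A J : H →L[ℂ] H) : Prop where
  symmA : ∀ x y, ⟪A x, y⟫ = ⟪x, A y⟫
  symmJ : ∀ x y, ⟪J x, y⟫ = ⟪x, J y⟫
  invol : ∀ x, J (J x) = x
  comm : ∀ x, J (A x) = A (J x)
  inj : ∀ x, A x = 0 → x = 0

namespace SqrtSetup
variable {A J : H →L[ℂ] H}

lemma neg (hs : SqrtSetup A J) : SqrtSetup A (-J) where
  symmA := hs.symmA
  symmJ x y := by simp [hs.symmJ]
  invol x := by simp [hs.invol]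
  comm x := by simp [hs.comm]
  inj := hs.inj

lemma norm_J (hs : SqrtSetup A J) (x : H) : ‖J x‖ = ‖x‖ := by
  have h : ⟪J x, J x⟫ = ⟪x, x⟫ := by rw [hs.symmJ, hs.invol]
  rw [inner_self_eq_norm_sq_to_K, inner_self_eq_norm_sq_to_K] at h
  have h2 : ‖J x‖ ^ 2 = ‖x‖ ^ 2 := by exact_mod_cast h
  exact (sq_eq_sq₀ (norm_nonneg _) (norm_nonneg _)).1 h2

/-- `⟪x, A² x⟫ = ‖A x‖²`. -/
lemma inner_B (hs : SqrtSetup A J) (x : H) : ⟪x, A (A x)⟫ = ((‖A x‖ ^ 2 : ℝ) : ℂ) := by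
  rw [← hs.symmA, inner_self_eq_norm_sq_to_K]; push_cast; rfl

/-- `⟪J x, A² x⟫` is real. -/
lemma inner_JB_im (hs : SqrtSetup A J) (x : H) : (⟪J x, A (A x)⟫).im = 0 := by
  have h : ⟪J x, A (A x)⟫ = ⟪A (A x), J x⟫ := by
    rw [hs.symmA, hs.symmA, hs.symmJ, hs.comm, hs.comm]
  have h2 := inner_conj_symm (𝕜 := ℂ) (J x) (A (A x))
  rw [← h] at h2
  exact Complex.conj_eq_iff_im.1 h2

lemma norm_sq_J_sub (hs : SqrtSetup A J) (t : ℝ) (x : H) :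
    ‖J x - (I * t) • A (A x)‖ ^ 2 = ‖x‖ ^ 2 + t ^ 2 * ‖A (A x)‖ ^ 2 := by
  rw [@norm_sub_sq ℂ, inner_smul_right]
  have h1 : RCLike.re (I * t * ⟪J x, A (A x)⟫) = 0 := by
    have := hs.inner_JB_im x
    simp [this]
  rw [h1, norm_smul, hs.norm_J, mul_pow]
  simp

lemma norm_le_J_sub (hs : SqrtSetup A J) (t : ℝ) (x : H) :
    ‖x‖ ≤ ‖J x - (I * t) • A (A x)‖ := by
  have := hs.norm_sq_J_sub t x
  refine le_of_sq_le_sq ?_ (norm_nonneg _)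
  rw [this]
  nlinarith [mul_nonneg (sq_nonneg t) (sq_nonneg ‖A (A x)‖)]

lemma norm_B_le (hs : SqrtSetup A J) (t : ℝ) (x : H) :
    |t| * ‖A (A x)‖ ≤ ‖J x - (I * t) • A (A x)‖ := by
  have := hs.norm_sq_J_sub t x
  refine le_of_sq_le_sq ?_ (norm_nonneg _)
  rw [this, mul_pow, sq_abs]
  nlinarith [sq_nonneg ‖x‖]

lemma norm_A_sq_le (hs : SqrtSetup A J) (t : ℝ) (x : H) :
    2 * |t| * ‖A x‖ ^ 2 ≤ ‖J x - (I * t) • A (A x)‖ ^ 2 := by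
  rw [hs.norm_sq_J_sub]
  have h1 : ‖A x‖ ^ 2 ≤ ‖x‖ * ‖A (A x)‖ := by
    have := norm_inner_le_norm (𝕜 := ℂ) x (A (A x))
    rw [hs.inner_B, Complex.norm_real, Real.norm_of_nonneg (by positivity)] at this
    exact this
  have h2 : 2 * |t| * ‖A x‖ ^ 2 ≤ 2 * |t| * (‖x‖ * ‖A (A x)‖) := by gcongr
  have h3 := sq_nonneg (‖x‖ - |t| * ‖A (A x)‖)
  have h4 := sq_abs t
  nlinarith

lemma le_norm_J_add_sub (hs : SqrtSetup A J) (t : ℝ) (w : H →L[ℂ] H) (x : H) :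
    (1 - ‖w‖) * ‖x‖ ≤ ‖(J + w - (I * t) • (A * A)) x‖ := by
  have h1 := hs.norm_le_J_sub t x
  have h2 : J x - (I * t) • A (A x) = (J + w - (I * t) • (A * A)) x - w x := by
    simp only [sub_apply, add_apply, smul_apply]
    abel
  rw [h2] at h1
  have h3 := norm_sub_le ((J + w - (I * t) • (A * A)) x) (w x)
  have h4 := w.le_opNorm x
  linarith

variable [CompleteSpace H]

lemma isUnit_J_sub (hs : SqrtSetup A J) (t : ℝ) : IsUnit (J - (I * t) • (A * A)) := by
  have h1 : IsUnit (1 - (I * t) • (J * (A * A))) := by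
    refine ContinuousLinearMap.isUnit_of_forall_le_norm_inner_map _ (c := 1) one_pos fun x => ?_
    have h2 : ⟪(1 - (I * t) • (J * (A * A))) x, x⟫ = ⟪x, x⟫ - ⟪(I * t) • J (A (A x)), x⟫ := by
      rw [← inner_sub_left]; rfl
    have h3 : RCLike.re (⟪(1 - (I * t) • (J * (A * A))) x, x⟫) = ‖x‖ ^ 2 := by
      have h4 := hs.inner_JB_im x
      have h5 : ⟪J (A (A x)), x⟫ = ⟪J x, A (A x)⟫ := by
        rw [hs.comm, hs.comm, hs.symmA, hs.symmA]
      rw [h2, inner_smul_left, h5, inner_self_eq_norm_sq_to_K]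
      simp [Complex.mul_re, h4, ← Complex.ofReal_pow]
    have h6 := RCLike.abs_re_le_norm (⟪(1 - (I * t) • (J * (A * A))) x, x⟫)
    rw [h3, abs_of_nonneg (by positivity)] at h6
    rwa [NNReal.coe_one, mul_one]
  have hJ : IsUnit J := ⟨⟨J, J, ContinuousLinearMap.ext hs.invol, ContinuousLinearMap.ext hs.invol⟩, rfl⟩
  have h2 : J - (I * t) • (A * A) = J * (1 - (I * t) • (J * (A * A))) := by
    ext x; simp [hs.invol]
  rw [h2]
  exact hJ.mul h1

lemma norm_inverse_J_sub_le (hs : SqrtSetup A J) (t : ℝ) (x : H) :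
    ‖Ring.inverse (J - (I * t) • (A * A)) x‖ ≤ ‖x‖ := by
  have h1 := DFunLike.congr_fun (Ring.mul_inverse_cancel _ (hs.isUnit_J_sub t)) x
  refine (hs.norm_le_J_sub t _).trans (le_of_eq ?_)
  exact congrArg norm h1

lemma isUnit_J_add_sub (hs : SqrtSetup A J) (t : ℝ) {w : H →L[ℂ] H} (hw : ‖w‖ < 1) :
    IsUnit (J + w - (I * t) • (A * A)) := by
  set N := Ring.inverse (J - (I * t) • (A * A)) with hN
  have hNn : ‖N‖ ≤ 1 := ContinuousLinearMap.opNorm_le_bound _ zero_le_one fun x => by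
    rw [one_mul]; exact hs.norm_inverse_J_sub_le t x
  have h1 : J + w - (I * t) • (A * A) = (J - (I * t) • (A * A)) * (1 - -(N * w)) := by
    have := Ring.mul_inverse_cancel _ (hs.isUnit_J_sub t)
    rw [sub_neg_eq_add, mul_add, mul_one, ← mul_assoc, hN, this, one_mul]
    abel
  rw [h1]
  refine (hs.isUnit_J_sub t).mul (isUnit_one_sub_of_norm_lt_one ?_)
  rw [norm_neg]
  refine (norm_mul_le _ _).trans_lt ?_
  nlinarith [norm_nonneg w]

end SqrtSetup
end Half

section Half
variable {H : Type*} [NormedAddCommGroup H] [InnerProductSpace ℂ H]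

/-- `r` is the family of inverses `k (1 - z k)⁻¹` on the range of `Q`, for `z` in the closed
right half plane. -/
structure HalfRes (k Q : H →L[ℂ] H) (r : ℂ → H →L[ℂ] H) : Prop where
  left : ∀ z : ℂ, 0 ≤ z.re → ∀ x, r z (x - z • k x) = k (Q x)
  right : ∀ z : ℂ, 0 ≤ z.re → ∀ x, r z x - z • k (r z x) = k (Q x)
  comp : ∀ z : ℂ, 0 ≤ z.re → ∀ x, r z (Q x) = r z x
  range : ∀ z : ℂ, 0 ≤ z.re → ∀ x, Q (r z x) = r z x

namespace HalfRes
variable {k Q : H →L[ℂ] H} {r : ℂ → H →L[ℂ] H}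

lemma commute (hr : HalfRes k Q r) {z : ℂ} (hz : 0 ≤ z.re) (hz0 : z ≠ 0) (x : H) :
    r z (k x) = k (r z x) := by
  have h := (hr.left z hz x).trans (hr.right z hz x).symm
  rw [map_sub, map_smul, sub_right_inj] at h
  exact smul_right_injective H hz0 h

/-- The resolvent identity. -/
lemma identity (hr : HalfRes k Q r) (hk : ∀ x, k x = 0 → x = 0) {z u : ℂ} (hz : 0 ≤ z.re)
    (hz0 : z ≠ 0) (hu : 0 ≤ u.re) (y : H) : r z y - r u y = (z - u) • r z (r u y) := by
  have h1 := hr.right u hu y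
  have h2 := hr.left z hz (r u y)
  have h3 : r u y - z • k (r u y) = k (Q y) - (z - u) • k (r u y) := by
    rw [← h1, sub_smul]; abel
  rw [h3, map_sub, map_smul, hr.commute hz hz0, hr.commute hz hz0, hr.comp z hz, hr.range u hu]
    at h2
  refine sub_eq_zero.1 (hk _ ?_)
  rw [map_sub, map_sub, map_smul, ← h2]
  abel

lemma isUnit (hr : HalfRes k Q r) (hk : ∀ x, k x = 0 → x = 0) {z u : ℂ} (hz : 0 ≤ z.re)
    (hz0 : z ≠ 0) (hu : 0 ≤ u.re) (hu0 : u ≠ 0) :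
    (1 - (z - u) • r u) * (1 + (z - u) • r z) = 1 ∧
      (1 + (z - u) • r z) * (1 - (z - u) • r u) = 1 := by
  have e1 : r z - r u = (z - u) • (r z * r u) :=
    ContinuousLinearMap.ext fun y => hr.identity hk hz hz0 hu y
  have e2 : r u - r z = (u - z) • (r u * r z) :=
    ContinuousLinearMap.ext fun y => hr.identity hk hu hu0 hz y
  have e3 : r z - r u = (z - u) • (r u * r z) := by
    rw [← neg_sub, e2, ← neg_smul, neg_sub]
  constructor
  · rw [mul_add, mul_one, sub_mul, one_mul, smul_mul_assoc, mul_smul_comm, ← e3, smul_sub]; abel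
  · rw [mul_sub, mul_one, add_mul, one_mul, smul_mul_assoc, mul_smul_comm, ← e1, smul_sub]; abel

end HalfRes

lemma SqrtSetup.isUnit_one_add [CompleteSpace H] {A J : H →L[ℂ] H} (hs : SqrtSetup A J)
    {z : ℂ} (hz : 0 ≤ z.re) : IsUnit (1 + z • (A * A)) := by
  refine ContinuousLinearMap.isUnit_of_forall_le_norm_inner_map _ (c := 1) one_pos fun x => ?_
  have e : ⟪(1 + z • (A * A)) x, x⟫ = ⟪x, x⟫ + ⟪z • A (A x), x⟫ := by
    rw [← inner_add_left]; rfl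
  have e2 : ‖x‖ ^ 2 ≤ RCLike.re (⟪(1 + z • (A * A)) x, x⟫) := by
    have h5 : ⟪A (A x), x⟫ = ((‖A x‖ ^ 2 : ℝ) : ℂ) := by
      rw [hs.symmA, hs.symmA, hs.inner_B]
    rw [e, inner_smul_left, h5, map_add, inner_self_eq_norm_sq, RCLike.re_eq_complex_re,
      Complex.re_mul_ofReal, Complex.conj_re]
    have := mul_nonneg hz (sq_nonneg ‖A x‖)
    linarith
  have h6 := RCLike.abs_re_le_norm (⟪(1 + z • (A * A)) x, x⟫)
  rw [NNReal.coe_one, mul_one]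
  exact e2.trans ((le_abs_self _).trans h6)

/-- Solving `(1 + z B) p = h₁ + B h₂` in the right half plane. -/
lemma SqrtSetup.norm_le_of_one_add [CompleteSpace H] {A J : H →L[ℂ] H} (hs : SqrtSetup A J)
    {z : ℂ} (hz : 0 ≤ z.re) (hz0 : z ≠ 0) {p h₁ h₂ : H}
    (h : p + z • A (A p) = h₁ + A (A h₂)) : ‖p‖ ≤ ‖h₁‖ + ‖h₂‖ / ‖z‖ := by
  have key : ∀ x, ‖x‖ ^ 2 + ‖z‖ ^ 2 * ‖A (A x)‖ ^ 2 ≤ ‖x + z • A (A x)‖ ^ 2 := fun x => by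
    rw [@norm_add_sq ℂ, norm_smul, mul_pow, inner_smul_right, hs.inner_B]
    have : 0 ≤ RCLike.re (z * ((‖A x‖ ^ 2 : ℝ) : ℂ)) := by
      rw [RCLike.re_eq_complex_re, Complex.re_mul_ofReal]; positivity
    linarith
  have key1 : ∀ x, ‖x‖ ≤ ‖x + z • A (A x)‖ := fun x =>
    le_of_sq_le_sq (by nlinarith [key x, mul_nonneg (sq_nonneg ‖z‖) (sq_nonneg ‖A (A x)‖)])
      (norm_nonneg _)
  have key2 : ∀ x, ‖z‖ * ‖A (A x)‖ ≤ ‖x + z • A (A x)‖ := fun x =>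
    le_of_sq_le_sq (by rw [mul_pow]; nlinarith [key x, sq_nonneg ‖x‖]) (norm_nonneg _)
  have solve : ∀ y, ∃ x, x + z • A (A x) = y := fun y =>
    ⟨Ring.inverse (1 + z • (A * A)) y,
      DFunLike.congr_fun (Ring.mul_inverse_cancel _ (hs.isUnit_one_add hz)) y⟩
  obtain ⟨p1, hp1⟩ := solve h₁
  obtain ⟨p2, hp2⟩ := solve h₂
  have hp : p = p1 + A (A p2) := by
    rw [← sub_eq_zero, ← norm_le_zero_iff]
    refine (key1 _).trans (le_of_eq ?_)
    rw [norm_eq_zero, ← sub_eq_zero.2 h, ← hp1, ← hp2]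
    simp only [map_sub, map_add, map_smul, smul_sub, smul_add]
    abel
  have hzp : 0 < ‖z‖ := norm_pos_iff.2 hz0
  rw [hp]
  refine (norm_add_le _ _).trans (add_le_add ((key1 p1).trans_eq (by rw [hp1])) ?_)
  rw [le_div_iff₀ hzp, mul_comm]
  exact (key2 p2).trans_eq (by rw [hp2])

end Half

section Half
variable {H : Type*} [NormedAddCommGroup H] [InnerProductSpace ℂ H]

/-- The abstract properties of a relatively bounded perturbation `w` of the sign `J` with
`k = A (J + w)⁻¹ A`, together with a local smoothing property of `B = A²`. -/
structure PotSetup (A J w wt k G : H →L[ℂ] H) (q a b κ : ℝ) : Prop extends SqrtSetup A J where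
  hq0 : 0 ≤ q
  hq1 : q < 1
  ha : 0 ≤ a
  hb : 0 ≤ b
  hκ : 0 ≤ κ
  norm_w : ‖w‖ ≤ q
  norm_wt : ‖wt‖ ≤ q
  solve : ∀ x, ∃ z, k x = A z ∧ J z + w z = A x
  intertw : ∀ x, wt (A x) = A (w x)
  fact : ∀ x, k x = A (A (G x))
  loc : ∀ ρ ε : ℝ, 0 < ρ → 0 < ε → ∃ (E V : H →L[ℂ] H) (g : H → ℝ),
    (∀ x, wt x = wt (E x) + A (A (V x))) ∧ ‖V‖ ≤ a + b / ρ ∧ (∀ x, 0 ≤ g x) ∧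
    (∀ (t : ℂ) x, g (t • x) = ‖t‖ * g x) ∧
    (∀ (K : H →L[ℂ] H) (n : ℕ) (e : Fin n → H), Orthonormal ℂ e →
      ∑ i, g (K (e i)) ^ 2 ≤ κ * (ρ / ε) ^ 3 * ‖K‖ ^ 2) ∧
    ∀ u, ‖E (A (A u))‖ ≤ 2 * ε * ‖u‖ + 2 * g (A (A u))

namespace PotSetup
variable {A J w wt k G Q : H →L[ℂ] H} {q a b κ : ℝ} {r : ℂ → H →L[ℂ] H}

lemma neg (h : PotSetup A J w wt k G q a b κ) : PotSetup A (-J) (-w) (-wt) (-k) (-G) q a b κ where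
  toSqrtSetup := h.toSqrtSetup.neg
  hq0 := h.hq0
  hq1 := h.hq1
  ha := h.ha
  hb := h.hb
  hκ := h.hκ
  norm_w := by rw [norm_neg]; exact h.norm_w
  norm_wt := by rw [norm_neg]; exact h.norm_wt
  solve x := by
    obtain ⟨z, h1, h2⟩ := h.solve x
    exact ⟨-z, by simp [h1], by simpa using h2⟩
  intertw x := by simp [h.intertw]
  fact x := by simp [h.fact]
  loc ρ ε hρ hε := by
    obtain ⟨E, V, g, h1, h2, h3⟩ := h.loc ρ ε hρ hε
    refine ⟨E, -V, g, fun x => ?_, by rwa [norm_neg], h3⟩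
    simp only [neg_apply, map_neg]
    rw [h1 x, neg_add]

lemma inj_k (h : PotSetup A J w wt k G q a b κ) (x : H) (hx : k x = 0) : x = 0 := by
  obtain ⟨z, h1, h2⟩ := h.solve x
  have hz : z = 0 := h.inj _ (h1 ▸ hx)
  rw [hz, map_zero, map_zero, add_zero] at h2
  exact h.inj _ h2.symm

lemma J_add_wt (h : PotSetup A J w wt k G q a b κ) (x : H) :
    J (k x) + wt (k x) = A (A x) := by
  obtain ⟨z, h1, h2⟩ := h.solve x
  rw [h1, h.comm, h.intertw, ← map_add, h2]

variable [CompleteSpace H]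

/-- Decay of the half resolvent along the imaginary axis. -/
lemma axis (h : PotSetup A J w wt k G q a b κ) (hr : HalfRes k Q r) {t : ℝ} (ht : t ≠ 0) :
    ‖r (I * t)‖ ≤ ‖Q‖ / (1 - q) / |t| := by
  have hq := sub_pos.2 h.hq1
  have htp : 0 < |t| := abs_pos.2 ht
  refine ContinuousLinearMap.opNorm_le_bound _ (by positivity) fun y => ?_
  have hre : 0 ≤ (I * (t : ℂ)).re := by simp
  have h1 : r (I * t) y = k ((I * t) • r (I * t) y + Q y) := by
    rw [map_add, ← hr.right _ hre y, map_smul]; abel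
  obtain ⟨z, hz1, hz2⟩ := h.solve ((I * t) • r (I * t) y + Q y)
  rw [← h1] at hz1
  have hN : ∀ u, ∃ x, J x - (I * t) • A (A x) = u := fun u =>
    ⟨Ring.inverse (J - (I * t) • (A * A)) u,
      DFunLike.congr_fun (Ring.mul_inverse_cancel _ (h.isUnit_J_sub t)) u⟩
  have hinj : ∀ x, J x - (I * t) • A (A x) = 0 → x = 0 := fun x hx => by
    have := h.norm_le_J_sub t x
    rwa [hx, norm_zero, norm_le_zero_iff] at this
  obtain ⟨x1, hx1⟩ := hN (Q y)
  obtain ⟨x2, hx2⟩ := hN (w z)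
  have hzeq : z = A x1 - x2 := by
    rw [← sub_eq_zero]
    refine hinj _ ?_
    have e1 : J z - (I * t) • A (A z) = A (Q y) - w z := by
      rw [hz1, map_add, map_smul] at hz2
      rw [sub_eq_sub_iff_add_eq_add, hz2, add_comm]
    have e2 : J (A x1) - (I * t) • A (A (A x1)) = A (Q y) := by
      rw [← hx1, map_sub, map_smul, h.comm]
    calc J (z - (A x1 - x2)) - (I * t) • A (A (z - (A x1 - x2)))
        = (J z - (I * t) • A (A z)) - (J (A x1) - (I * t) • A (A (A x1)))
          + (J x2 - (I * t) • A (A x2)) := by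
          simp only [map_sub, smul_sub]; abel
      _ = 0 := by rw [e1, e2, hx2]; abel
  set Y := ‖Q y‖
  have n1 : |t| * ‖A (A x1)‖ ≤ Y := by simpa only [hx1] using h.norm_B_le t x1
  have n2 : 2 * |t| * ‖A x1‖ ^ 2 ≤ Y ^ 2 := by simpa only [hx1] using h.norm_A_sq_le t x1
  have n3 : ‖x2‖ ≤ q * ‖z‖ := by
    refine (h.norm_le_J_sub t x2).trans ?_
    rw [hx2]
    exact (w.le_opNorm z).trans (mul_le_mul_of_nonneg_right h.norm_w (norm_nonneg _))
  have n4 : 2 * |t| * ‖A x2‖ ^ 2 ≤ (q * ‖z‖) ^ 2 := by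
    refine (h.norm_A_sq_le t x2).trans ?_
    rw [hx2]
    gcongr
    exact (w.le_opNorm z).trans (mul_le_mul_of_nonneg_right h.norm_w (norm_nonneg _))
  have n5 : (1 - q) * ‖z‖ ≤ ‖A x1‖ := by
    have := norm_sub_le (A x1) x2
    rw [← hzeq] at this
    linarith
  have n6 : ‖r (I * t) y‖ ≤ ‖A (A x1)‖ + ‖A x2‖ := by
    rw [hz1, hzeq, map_sub]; exact norm_sub_le _ _
  have n7 : (1 - q) * (|t| * ‖A x2‖) ≤ q * Y := by
    have hq0 := h.hq0
    refine le_of_sq_le_sq ?_ (by positivity)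
    have e1 : 2 * |t| * ((1 - q) * ‖A x2‖) ^ 2 ≤ (q * ‖A x1‖) ^ 2 := by
      have : (1 - q) ^ 2 * (q * ‖z‖) ^ 2 ≤ (q * ‖A x1‖) ^ 2 := by
        rw [← mul_pow]
        exact pow_le_pow_left₀ (by positivity) (by nlinarith) 2
      nlinarith [mul_le_mul_of_nonneg_left n4 (sq_nonneg (1 - q))]
    have e3 : 2 * |t| * (2 * |t| * ((1 - q) * ‖A x2‖) ^ 2) ≤ q ^ 2 * Y ^ 2 := by
      calc _ ≤ 2 * |t| * (q * ‖A x1‖) ^ 2 := by gcongr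
        _ = q ^ 2 * (2 * |t| * ‖A x1‖ ^ 2) := by ring
        _ ≤ _ := by gcongr
    have e4 : 0 ≤ (|t| * ((1 - q) * ‖A x2‖)) ^ 2 := sq_nonneg _
    nlinarith
  have hY : Y ≤ ‖Q‖ * ‖y‖ := Q.le_opNorm y
  calc ‖r (I * t) y‖ ≤ ‖A (A x1)‖ + ‖A x2‖ := n6
    _ ≤ Y / (1 - q) / |t| := by
        rw [le_div_iff₀ htp, le_div_iff₀ hq]
        nlinarith
    _ ≤ ‖Q‖ * ‖y‖ / (1 - q) / |t| := by gcongr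
    _ = _ := by ring

set_option maxHeartbeats 800000 in
/-- A priori estimate for the half resolvent up to a local Hilbert-Schmidt term. -/
lemma apriori (h : PotSetup A J w wt k G q a b κ) {cx : ℝ} (hcx : 0 ≤ cx)
    (hgraph : ∀ v, Q v = v → ‖v‖ ≤ cx * ‖v - J v‖) :
    ∃ C κ' Λ : ℝ, 0 < C ∧ 0 ≤ κ' ∧ 0 < Λ ∧ ∀ L, Λ ≤ L → ∃ g : H → ℝ, (∀ x, 0 ≤ g x) ∧
      (∀ (t : ℂ) x, g (t • x) = ‖t‖ * g x) ∧
      (∀ (K : H →L[ℂ] H) (n : ℕ) (e : Fin n → H), Orthonormal ℂ e →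
        ∑ i, g (K (e i)) ^ 2 ≤ κ' * ‖K‖ ^ 2) ∧
      ∀ (r : ℂ → H →L[ℂ] H), HalfRes k Q r → ∀ z : ℂ, 0 ≤ z.re → ‖z‖ = L → ∀ y,
        ‖r z y‖ ≤ C * (‖y‖ / L + g (r z y)) := by
  have hq0 := h.hq0
  have ha := h.ha
  have hb := h.hb
  -- coefficient of `‖v‖` : `c (2 q η ‖G‖ + a / L + b / M)` with `c = 2 cx + 1`
  set c : ℝ := 2 * cx + 1 with hc
  have hcp : 1 ≤ c := by linarith
  set η : ℝ := 1 / (12 * c * (‖G‖ + 1)) with hη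
  set M : ℝ := 6 * c * (b + 1) with hM
  set Λ : ℝ := 6 * c * (a + 1) with hΛ
  have hηp : 0 < η := by positivity
  have hMp : 0 < M := by positivity
  have hΛp : 0 < Λ := by positivity
  set C : ℝ := 4 * c * (‖Q‖ + 1) + 4 * c with hC
  refine ⟨C, κ * (M / η) ^ 3, Λ, by positivity, mul_nonneg h.hκ (by positivity), hΛp,
    fun L hL => ?_⟩
  have hLp : 0 < L := hΛp.trans_le hL
  obtain ⟨E, V, g, hV, hVn, hg0, hghom, hgHS, hE⟩ :=
    h.loc (M / L) (η / L) (by positivity) (by positivity)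
  refine ⟨g, hg0, hghom, fun K n e he => ?_, fun r hr z hz hzL y => ?_⟩
  · have := hgHS K n e he
    rwa [div_div_div_cancel_right₀ hLp.ne'] at this
  · have hz0 : z ≠ 0 := norm_pos_iff.1 (hzL ▸ hLp)
    set v := r z y with hv
    have h1 : v = k (z • v + Q y) := by
      rw [map_add, ← hr.right _ hz y, map_smul]; abel
    have h2 : v = A (A (G (z • v + Q y))) := by rw [← h.fact]; exact h1
    have h3 : J v + wt v = A (A (z • v + Q y)) := by
      have := h.J_add_wt (z • v + Q y)
      rwa [← h1] at this
    set P : H →L[ℂ] H := 1 - J with hP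
    have hPn : ∀ x, ‖P x‖ ≤ 2 * ‖x‖ := fun x => by
      have := norm_sub_le x (J x)
      rw [h.norm_J] at this
      linarith! [show P x = x - J x from rfl]
    have hPA : ∀ x, P (A x) = A (P x) := fun x => by
      change A x - J (A x) = A (x - J x)
      rw [map_sub, h.comm]
    have hPJ : ∀ x, P (J x) = - P x := fun x => by
      change J x - J (J x) = -(x - J x)
      rw [h.invol]; abel
    have h4 : P v + z • A (A (P v)) = P (wt (E v)) + A (A (P (V v) - P (Q y))) := by
      have h5 := congrArg P h3
      rw [map_add, hPJ, hPA, hPA, map_add, map_smul, hV v, map_add, hPA, hPA] at h5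
      simp only [map_add, map_sub, map_smul] at h5 ⊢
      rw [← sub_eq_zero] at h5 ⊢
      rw [← neg_eq_zero, ← h5]
      abel
    have h6 := h.norm_le_of_one_add hz hz0 h4
    rw [hzL] at h6
    have h7 : ‖v‖ ≤ cx * ‖P v‖ := hgraph v (hr.range z hz y)
    have h8 : ‖P (wt (E v))‖ ≤ 2 * (1 * ‖E v‖) := by
      refine (hPn _).trans ?_
      gcongr
      exact (wt.le_opNorm _).trans
        (mul_le_mul_of_nonneg_right (h.norm_wt.trans h.hq1.le) (norm_nonneg _))
    have hQy := Q.le_opNorm y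
    have h9 : ‖P (V v) - P (Q y)‖ ≤ 2 * ((a + b / (M / L)) * ‖v‖ + ‖Q‖ * ‖y‖) := by
      rw [← map_sub]
      refine (hPn _).trans ?_
      gcongr
      exact (norm_sub_le _ _).trans (add_le_add ((V.le_opNorm v).trans (by gcongr)) hQy)
    have h10 : ‖E v‖ ≤ 2 * (η / L) * (‖G‖ * (L * ‖v‖ + ‖Q‖ * ‖y‖)) + 2 * g v := by
      have h11 := hE (G (z • v + Q y))
      rw [← h2] at h11
      refine h11.trans ?_
      gcongr
      refine (G.le_opNorm _).trans ?_
      gcongr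
      refine (norm_add_le _ _).trans (add_le_add ?_ hQy)
      rw [norm_smul, hzL]
    set n := ‖v‖
    set D := ‖Q‖ * ‖y‖ with hD
    have hD0 : 0 ≤ D := by positivity
    have hn0 : 0 ≤ n := norm_nonneg _
    have s1 : c * (2 * η * ‖G‖) ≤ 1 / 6 := by
      have : c * (2 * η * ‖G‖) = ‖G‖ / (6 * (‖G‖ + 1)) := by
        rw [hη]; field_simp; ring
      rw [this, div_le_iff₀ (by positivity)]
      linarith
    have s2 : c * (a / L) ≤ 1 / 6 := by
      rw [← mul_div_assoc, div_le_iff₀ hLp]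
      nlinarith
    have s3 : c * (b / M) ≤ 1 / 6 := by
      rw [← mul_div_assoc, div_le_iff₀ hMp, hM]
      nlinarith
    have h12 : n ≤ c * (2 * (η / L) * (‖G‖ * (L * n + D)) + 2 * g v +
        ((a + b / (M / L)) * n + D) / L) := by
      have hg := hg0 v
      have hX : 0 ≤ 2 * (η / L) * (‖G‖ * (L * n + D)) + 2 * g v := by positivity
      calc n ≤ cx * ‖P v‖ := h7
        _ ≤ cx * (2 * (2 * (η / L) * (‖G‖ * (L * n + D)) + 2 * g v) +
              2 * ((a + b / (M / L)) * n + D) / L) := by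
            refine mul_le_mul_of_nonneg_left (h6.trans (add_le_add ?_ ?_)) hcx
            · linarith
            · gcongr
        _ = (2 * cx) * (2 * (η / L) * (‖G‖ * (L * n + D)) + 2 * g v +
              ((a + b / (M / L)) * n + D) / L) := by ring
        _ ≤ _ := by
            refine mul_le_mul_of_nonneg_right (by linarith) ?_
            positivity
    have h13 : c * (2 * (η / L) * (‖G‖ * (L * n + D)) + 2 * g v +
        ((a + b / (M / L)) * n + D) / L) =
        (c * (2 * η * ‖G‖) + c * (a / L) + c * (b / M)) * n +
          (c * (2 * η * ‖G‖) + c) * (D / L) + 2 * c * g v := by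
      field_simp
      ring
    have hDL : 0 ≤ D / L := by positivity
    have h14 : n ≤ 1 / 2 * n + (2 * c) * (D / L) + 2 * c * g v := by
      refine (h12.trans_eq h13).trans ?_
      gcongr <;> linarith
    have h15 : n ≤ 4 * c * (D / L) + 4 * c * g v := by linarith
    refine h15.trans ?_
    have hg := hg0 v
    have e1 : D / L = ‖Q‖ * (‖y‖ / L) := by rw [hD, mul_div_assoc]
    have hyL : 0 ≤ ‖y‖ / L := by positivity
    rw [e1, mul_add C]
    refine add_le_add ?_ ?_
    · rw [← mul_assoc]
      refine mul_le_mul_of_nonneg_right ?_ hyL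
      rw [hC, mul_add (4 * c)]; linarith
    · refine mul_le_mul_of_nonneg_right ?_ hg
      have : 0 ≤ 4 * c * (‖Q‖ + 1) := by positivity
      linarith

end PotSetup
end Half

section Half
variable {H : Type*} [NormedAddCommGroup H] [InnerProductSpace ℂ H]

lemma norm_exp_sub_exp_le (s t : ℝ) : ‖exp (s * I) - exp (t * I)‖ ≤ |s - t| := by
  have h : exp (s * I) - exp (t * I) = exp (t * I) * (exp (I * (s - t : ℝ)) - 1) := by
    rw [mul_sub, ← Complex.exp_add, mul_one]
    congr 2
    push_cast; ring
  rw [h, norm_mul, Complex.norm_exp_ofReal_mul_I, one_mul]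
  exact Real.norm_exp_I_mul_ofReal_sub_one_le

namespace PotSetup
variable {A J w wt k G Q : H →L[ℂ] H} {q a b κ : ℝ} {r : ℂ → H →L[ℂ] H} [CompleteSpace H]

/-- Decay of the half resolvent in the closed right half plane. -/
theorem half_bound (h : PotSetup A J w wt k G q a b κ) (hr : HalfRes k Q r) {cx : ℝ}
    (hcx : 0 ≤ cx) (hgraph : ∀ v, Q v = v → ‖v‖ ≤ cx * ‖v - J v‖) :
    ∃ C Λ : ℝ, 0 < Λ ∧ ∀ z : ℂ, 0 ≤ z.re → Λ ≤ ‖z‖ → ‖r z‖ ≤ C / ‖z‖ := by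
  obtain ⟨C₁, κ', Λ, hC₁, hκ', hΛ, hap⟩ := h.apriori hcx hgraph
  set c₀ : ℝ := ‖Q‖ / (1 - q) with hc₀
  have hc₀0 : 0 ≤ c₀ := div_nonneg (norm_nonneg _) (sub_nonneg.2 h.hq1.le)
  set β : ℝ := max 1 c₀ with hβ
  have hβ1 : 1 ≤ β := le_max_left _ _
  have hβc : c₀ ≤ β := le_max_right _ _
  set C : ℝ := 1 + 2 * C₁ with hC
  have hCp : 0 < C := by positivity
  set d : ℝ := 1 / (4 * β * (4 * C + 1)) with hd
  have hdp : 0 < d := by positivity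
  have hdβ : d * β ≤ 1 / 4 := by
    rw [hd, one_div, inv_mul_le_iff₀ (by positivity)]
    nlinarith
  have hd4 : d ≤ 1 / 4 := by nlinarith
  obtain ⟨m, hm⟩ := exists_nat_ge (2 * Real.pi / d)
  have hmp : (0 : ℝ) < m := lt_of_lt_of_le (by positivity) hm
  obtain ⟨M, hM1, hM⟩ := exists_chain_bound H hCp (zero_lt_one.trans_le hβ1) (κ := κ' * β ^ 2)
    (S := 2) zero_le_two m
  refine ⟨M * c₀, Λ, hΛ, fun z hz hzΛ => ?_⟩
  set L : ℝ := ‖z‖ with hL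
  have hLp : 0 < L := hΛ.trans_le hzΛ
  obtain ⟨g, hg0, hghom, hgHS, hgv⟩ := hap L hzΛ
  have hLc : (L : ℂ) ≠ 0 := by exact_mod_cast hLp.ne'
  have hIL : (0 : ℝ) ≤ (I * (L : ℂ)).re := by simp
  have hIL0 : I * (L : ℂ) ≠ 0 := mul_ne_zero I_ne_zero hLc
  set k₁ : H →L[ℂ] H := (L : ℂ) • r (I * L) with hk₁
  have hk₁n : ‖k₁‖ ≤ β := by
    have := h.axis hr hLp.ne'
    rw [abs_of_pos hLp] at this
    rw [hk₁, norm_smul, Complex.norm_real, Real.norm_of_nonneg hLp.le]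
    calc L * ‖r (I * L)‖ ≤ L * (c₀ / L) := by gcongr
      _ = c₀ := by field_simp
      _ ≤ β := hβc
  -- points of the right half plane
  have hpt : ∀ s : ℂ, 0 ≤ (I * L + s * L).re → I * L + s * L ≠ 0 →
      (1 - s • k₁) * (1 + (s * L) • r (I * L + s * L)) = 1 ∧
      (1 + (s * L) • r (I * L + s * L)) * (1 - s • k₁) = 1 := fun s h1 h2 => by
    have h3 := hr.isUnit h.inj_k h1 h2 hIL hIL0
    have e : s • k₁ = (I * L + s * L - I * L) • r (I * L) := by
      rw [hk₁, smul_smul, add_sub_cancel_left]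
    have e2 : s * L = I * L + s * L - I * L := by ring
    rw [e]
    conv => enter [1, 1, 2, 2, 1]; rw [e2]
    conv => enter [2, 1, 1, 2, 1]; rw [e2]
    exact h3
  set θ : ℝ := arg z
  set σ : ℕ → ℂ := fun j => exp ((Real.pi / 2 + j / m * (θ - Real.pi / 2) : ℝ) * I) - I with hσ
  have hθ : |θ| ≤ Real.pi / 2 := abs_arg_le_pi_div_two_iff.2 hz
  have hθ' := abs_le.1 hθ
  have hσz : ∀ j, I * L + σ j * L =
      L * exp ((Real.pi / 2 + j / m * (θ - Real.pi / 2) : ℝ) * I) := fun j => by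
    simp only [hσ]; ring
  have hσre : ∀ j ≤ m, 0 ≤ (I * L + σ j * L).re := fun j hj => by
    rw [hσz, Complex.re_ofReal_mul, Complex.exp_ofReal_mul_I_re]
    refine mul_nonneg hLp.le (Real.cos_nonneg_of_neg_pi_div_two_le_of_le ?_ ?_)
    · have h1 : (j : ℝ) / m ≤ 1 := by
        rw [div_le_one hmp]; exact_mod_cast hj
      have h2 : (0 : ℝ) ≤ (j : ℝ) / m := by positivity
      nlinarith
    · have h2 : (0 : ℝ) ≤ (j : ℝ) / m := by positivity
      nlinarith
  have hσn : ∀ j, ‖I * L + σ j * L‖ = L := fun j => by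
    rw [hσz, norm_mul, Complex.norm_exp_ofReal_mul_I, mul_one, Complex.norm_real,
      Real.norm_of_nonneg hLp.le]
  have hσm : I * L + σ m * L = z := by
    rw [hσz, div_self hmp.ne', one_mul, add_sub_cancel]
    exact Complex.norm_mul_exp_arg_mul_I z
  have hσ0 : σ 0 = 0 := by
    simp only [hσ, Nat.cast_zero, zero_div, zero_mul, add_zero]
    push_cast
    rw [Complex.exp_pi_div_two_mul_I, sub_self]
  have key := hM (fun y => g (k₁ y)) k₁ d σ hd ?_ ?_ hk₁n hσ0 ?_ ?_ ?_ ?_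
  · have h1 := hpt (σ m) (hσre m le_rfl) (norm_pos_iff.1 (by rw [hσn]; exact hLp))
    rw [hσm] at h1
    have h2 : r z = Ring.inverse (1 - σ m • k₁) * r (I * L) := by
      have h3 : Ring.inverse (1 - σ m • k₁) = 1 + (σ m * L) • r z :=
        Ring.inverse_unit ⟨_, _, h1.1, h1.2⟩
      have e2 : σ m * L = z - I * L := by rw [← hσm]; ring
      rw [h3, e2]
      ext y
      have := hr.identity h.inj_k hz (hσm ▸ norm_pos_iff.1 (by rw [hσn]; exact hLp)) hIL y
      change r z y = r (I * L) y + (z - I * L) • r z (r (I * L) y)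
      rw [← this]; abel
    rw [h2]
    have := h.axis hr hLp.ne'
    rw [abs_of_pos hLp] at this
    calc _ ≤ M * (c₀ / L) := (norm_mul_le _ _).trans (by gcongr)
      _ = _ := by ring
  · intro n e he
    have h1 := hgHS k₁ n e he
    refine h1.trans ?_
    gcongr
  · intro t y
    rw [map_smul, hghom]
  · intro j _
    refine (norm_sub_le _ _).trans ?_
    rw [Complex.norm_exp_ofReal_mul_I, Complex.norm_I]; norm_num
  · intro j _
    have h1 : σ (j + 1) - σ j =
        exp ((Real.pi / 2 + (j + 1 : ℕ) / m * (θ - Real.pi / 2) : ℝ) * I) -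
        exp ((Real.pi / 2 + j / m * (θ - Real.pi / 2) : ℝ) * I) := by simp only [hσ]; ring
    rw [h1]
    refine (norm_exp_sub_exp_le _ _).trans ?_
    have h2 : (Real.pi / 2 + ((j + 1 : ℕ) : ℝ) / m * (θ - Real.pi / 2)) -
        (Real.pi / 2 + (j : ℝ) / m * (θ - Real.pi / 2)) = (θ - Real.pi / 2) / m := by
      push_cast; field_simp; ring
    rw [h2, abs_div, abs_of_pos hmp, div_le_iff₀ hmp]
    have h3 : |θ - Real.pi / 2| ≤ Real.pi := by rw [abs_le]; constructor <;> linarith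
    have h4 : 2 * Real.pi ≤ m * d := (div_le_iff₀ hdp).1 hm
    linarith
  · intro j hj s hs
    by_cases hsre : 0 ≤ (I * L + s * L).re ∧ I * L + s * L ≠ 0
    · have := hpt s hsre.1 hsre.2
      exact ⟨⟨_, _, this.1, this.2⟩, rfl⟩
    · have e0 : I * L + s * L = (I * L + σ j * L) + (s - σ j) * L := by ring
      set u := I * L + s * L with hu
      have n1 : ‖(s - σ j) * (L : ℂ)‖ ≤ d * L := by
        rw [norm_mul, Complex.norm_real, Real.norm_of_nonneg hLp.le]; gcongr
      have n2 : L - d * L ≤ ‖u‖ := by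
        have := norm_sub_norm_le (I * L + σ j * L) (-((s - σ j) * L))
        rw [sub_neg_eq_add, ← e0, norm_neg, hσn] at this
        linarith
      have n3 : -(d * L) ≤ u.re := by
        have h1 := hσre j hj
        have h2 := (abs_le.1 ((Complex.abs_re_le_norm _).trans n1)).1
        rw [e0, Complex.add_re]; linarith
      have hdL : d * L ≤ L / 4 := by nlinarith
      have n4 : u.re < 0 := by
        by_contra hcon
        refine hsre ⟨not_lt.1 hcon, norm_pos_iff.1 ?_⟩
        linarith
      have n5 : L / 2 ≤ |u.im| := by
        have h1 := Complex.norm_le_abs_re_add_abs_im u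
        rw [abs_of_neg n4] at h1
        linarith
      have hu0 : u.im ≠ 0 := fun h0 => by rw [h0, abs_zero] at n5; linarith
      set s' : ℂ := I * (u.im / L) - I with hs'
      have e1 : I * L + s' * L = I * (u.im : ℂ) := by
        rw [hs']; field_simp; ring
      have hIu0 : I * (u.im : ℂ) ≠ 0 := mul_ne_zero I_ne_zero (by exact_mod_cast hu0)
      have hIu : (0 : ℝ) ≤ (I * (u.im : ℂ)).re := by simp
      have h1 := hpt s' (by rw [e1]; exact hIu) (by rw [e1]; exact hIu0)
      rw [e1] at h1
      have e2 : s - s' = (u.re : ℂ) / L := by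
        have : u = u.re + u.im * I := (Complex.re_add_im u).symm
        have h3 : s = u / L - I := by rw [hu]; field_simp; ring
        rw [h3, hs']
        nth_rewrite 1 [this]
        ring
      have e3 : (1 + (s' * L) • r (I * u.im)) * k₁ = (L : ℂ) • r (I * u.im) := by
        ext y
        have h4 := hr.identity h.inj_k hIu hIu0 hIL y
        have e4 : s' * L = I * u.im - I * L := by rw [← e1]; ring
        rw [e4, hk₁, mul_smul_comm]
        change (L : ℂ) • (r (I * L) y + (I * u.im - I * L) • r (I * u.im) (r (I * L) y)) = _
        rw [← h4]
        simp
      have e5 : 1 - s • k₁ = (1 - s' • k₁) *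
          (1 - (s - s') • ((L : ℂ) • r (I * u.im))) := by
        rw [← e3, mul_sub, mul_one, mul_smul_comm, ← mul_assoc, h1.1, one_mul, sub_smul s s']
        abel
      rw [e5]
      refine IsUnit.mul ⟨⟨_, _, h1.1, h1.2⟩, rfl⟩ (isUnit_one_sub_of_norm_lt_one ?_)
      have hax := h.axis hr hu0
      have n6 : L * ‖r (I * u.im)‖ ≤ 2 * c₀ := by
        calc L * ‖r (I * u.im)‖ ≤ L * (c₀ / (L / 2)) := by
              gcongr
              exact hax.trans (by gcongr)
          _ = 2 * c₀ := by field_simp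
      rw [e2, norm_smul, norm_smul, norm_div, Complex.norm_real, Complex.norm_real,
        Real.norm_of_nonneg hLp.le, Real.norm_of_nonpos n4.le]
      have n7 : -u.re / L ≤ d := by rw [div_le_iff₀ hLp]; linarith
      calc -u.re / L * (L * ‖r (I * u.im)‖) ≤ d * (2 * c₀) := by gcongr
        _ ≤ 2 * (d * β) := by nlinarith
        _ < 1 := by linarith
  · intro j hj y
    set u := I * L + σ j * L with hu
    have hu0 : u ≠ 0 := norm_pos_iff.1 (by rw [hσn]; exact hLp)
    have h1 := (hpt (σ j) (hσre j hj) hu0).2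
    set f := (1 - σ j • k₁) y with hf
    have h2 : y = f + (σ j * L) • r u f := by
      have := DFunLike.congr_fun h1 y
      exact this.symm
    have h3 : r u f = r (I * L) y := by
      have := hr.identity h.inj_k (hσre j hj) hu0 hIL y
      rw [← hu] at this
      have e2 : u - I * L = σ j * L := by rw [hu]; ring
      have e3 : f = y - (σ j * L) • r (I * L) y := by
        rw [hf, hk₁, smul_smul]; rfl
      rw [e3, map_sub, map_smul, ← e2, ← this, sub_sub_cancel]
    have h4 : L * g (r u f) = g (k₁ y) := by
      rw [h3, hk₁]
      change _ = g ((L : ℂ) • r (I * L) y)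
      rw [hghom, Complex.norm_real, Real.norm_of_nonneg hLp.le]
    have h5 := hgv r hr u (hσre j hj) (hσn j) f
    have hσ2 : ‖σ j‖ ≤ 2 := by
      refine (norm_sub_le _ _).trans ?_
      rw [Complex.norm_exp_ofReal_mul_I, Complex.norm_I]; norm_num
    have hg := hg0 (k₁ y)
    calc ‖y‖ ≤ ‖f‖ + ‖σ j‖ * L * ‖r u f‖ := by
          conv_lhs => rw [h2]
          refine (norm_add_le _ _).trans (le_of_eq ?_)
          rw [norm_smul, norm_mul, Complex.norm_real, Real.norm_of_nonneg hLp.le]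
      _ ≤ ‖f‖ + 2 * L * (C₁ * (‖f‖ / L + g (r u f))) := by gcongr
      _ = ‖f‖ + 2 * C₁ * (‖f‖ + L * g (r u f)) := by field_simp
      _ ≤ C * (‖f‖ + g (k₁ y)) := by
          rw [h4, hC]; linarith

end PotSetup
end Half

section Formula
variable {H : Type*} [NormedAddCommGroup H] [InnerProductSpace ℂ H]

/-- Cauchy's theorem in the right half plane. -/
lemma tendsto_axis_integral_zero {h : ℂ → ℂ} (hd : DifferentiableOn ℂ h {z | 0 ≤ z.re})
    {C Λ : ℝ} (hb : ∀ z : ℂ, 0 ≤ z.re → Λ ≤ ‖z‖ → ‖h z‖ ≤ C / ‖z‖ ^ 2) :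
    Tendsto (fun τ : ℝ => ∫ t in (-τ)..τ, h (I * t)) atTop (𝓝 0) := by
  have hlim : Tendsto (fun τ : ℝ => 4 * |C| * τ⁻¹) atTop (𝓝 0) := by
    simpa using tendsto_inv_atTop_zero.const_mul (4 * |C|)
  refine squeeze_zero_norm' ?_ hlim
  filter_upwards [eventually_gt_atTop 0, eventually_ge_atTop Λ] with τ hτ hΛ
  have hrect := Complex.integral_boundary_rect_eq_zero_of_differentiableOn h (-τ * I) (τ + τ * I)
    (hd.mono fun z hz => by
      have := hz.1
      simp only [Set.mem_preimage, mul_re, neg_re, ofReal_re, I_re, mul_zero, neg_im, ofReal_im,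
        I_im, mul_one, sub_self, add_re, add_zero, neg_zero, Set.uIcc_of_le hτ.le] at this
      exact this.1)
  simp only [mul_re, neg_re, ofReal_re, I_re, mul_zero, neg_im, ofReal_im, I_im, mul_one,
    sub_self, add_re, add_zero, neg_zero, mul_im, add_im, zero_add, ofReal_zero, ofReal_neg] at hrect
  have hbd : ∀ z : ℂ, 0 ≤ z.re → τ ≤ ‖z‖ → ‖h z‖ ≤ |C| / τ ^ 2 := fun z hz hzτ => by
    refine (hb z hz (hΛ.trans hzτ)).trans ?_
    calc C / ‖z‖ ^ 2 ≤ |C| / ‖z‖ ^ 2 := by gcongr; exact le_abs_self C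
      _ ≤ |C| / τ ^ 2 := by gcongr
  have b1 : ‖∫ x in (0 : ℝ)..τ, h (x + -τ * I)‖ ≤ |C| / τ ^ 2 * |τ - 0| := by
    refine intervalIntegral.norm_integral_le_of_norm_le_const fun x hx => ?_
    rw [Set.uIoc_of_le hτ.le] at hx
    refine hbd _ (by simpa using hx.1.le) ?_
    simpa [abs_of_pos hτ] using Complex.abs_im_le_norm (x + -τ * I)
  have b2 : ‖∫ x in (0 : ℝ)..τ, h (x + τ * I)‖ ≤ |C| / τ ^ 2 * |τ - 0| := by
    refine intervalIntegral.norm_integral_le_of_norm_le_const fun x hx => ?_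
    rw [Set.uIoc_of_le hτ.le] at hx
    refine hbd _ (by simpa using hx.1.le) ?_
    simpa [abs_of_pos hτ] using Complex.abs_im_le_norm (x + τ * I)
  have b3 : ‖∫ y in (-τ)..τ, h (τ + y * I)‖ ≤ |C| / τ ^ 2 * |τ - -τ| := by
    refine intervalIntegral.norm_integral_le_of_norm_le_const fun y hy => ?_
    refine hbd _ (by simpa using hτ.le) ?_
    simpa [abs_of_pos hτ] using Complex.abs_re_le_norm (τ + y * I)
  have e : I * (∫ t in (-τ)..τ, h (I * t)) =
      (∫ x in (0 : ℝ)..τ, h (x + -τ * I)) - (∫ x in (0 : ℝ)..τ, h (x + τ * I)) +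
        I * ∫ y in (-τ)..τ, h (τ + y * I) := by
    simp only [smul_eq_mul] at hrect
    rw [← sub_eq_zero, ← neg_eq_zero, ← hrect]
    simp only [mul_comm I]
    ring
  have hn : ‖∫ t in (-τ)..τ, h (I * t)‖ = ‖I * (∫ t in (-τ)..τ, h (I * t))‖ := by
    rw [norm_mul, Complex.norm_I, one_mul]
  rw [hn, e]
  refine (norm_add_le _ _).trans ((add_le_add (norm_sub_le _ _) le_rfl).trans ?_)
  rw [norm_mul, Complex.norm_I, one_mul]
  refine (add_le_add (add_le_add b1 b2) b3).trans (le_of_eq ?_)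
  rw [sub_zero, sub_neg_eq_add, abs_of_pos hτ, abs_of_pos (by linarith : 0 < τ + τ)]
  field_simp
  ring

lemma tendsto_integral_inv_one_add :
    Tendsto (fun τ : ℝ => ∫ t in (-τ)..τ, (1 + I * t : ℂ)⁻¹) atTop (𝓝 (Real.pi : ℂ)) := by
  have hne : ∀ t : ℝ, (1 + I * t : ℂ) ≠ 0 := fun t h => by
    have := congrArg Complex.re h
    simp at this
  have hc : Continuous fun t : ℝ => (1 + I * t : ℂ)⁻¹ := by fun_prop (disch := exact hne _)
  have e : ∀ τ : ℝ, ∫ t in (-τ)..τ, (1 + I * t : ℂ)⁻¹ = ((2 * Real.arctan τ : ℝ) : ℂ) := by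
    intro τ
    have h1 : ∫ t in (-τ)..τ, (1 + I * t : ℂ)⁻¹ = ∫ t in (-τ)..τ, (1 + I * (-t : ℝ) : ℂ)⁻¹ := by
      rw [intervalIntegral.integral_comp_neg (fun t : ℝ => (1 + I * t : ℂ)⁻¹), neg_neg]
    have hc' : Continuous fun t : ℝ => (1 + I * (-t : ℝ) : ℂ)⁻¹ := hc.comp continuous_neg
    have h2 : 2 * ∫ t in (-τ)..τ, (1 + I * t : ℂ)⁻¹ =
        ∫ t in (-τ)..τ, ((2 * (1 + t ^ 2)⁻¹ : ℝ) : ℂ) := by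
      rw [two_mul]
      nth_rewrite 2 [h1]
      rw [← intervalIntegral.integral_add (hc.intervalIntegrable _ _)
        (hc'.intervalIntegrable _ _)]
      refine intervalIntegral.integral_congr fun t _ => ?_
      have h3 := hne t
      have h4 := hne (-t)
      have h5 : (1 + (t : ℂ) ^ 2) ≠ 0 := by
        have : (0 : ℝ) < 1 + t ^ 2 := by positivity
        exact_mod_cast this.ne'
      push_cast at h4 ⊢
      have h6 : (1 + I * t) * (1 + I * -t) = (1 + (t : ℂ) ^ 2) := by
        linear_combination (-(t : ℂ) ^ 2) * I_sq
      rw [inv_add_inv h3 h4, h6]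
      field_simp
      ring
    rw [intervalIntegral.integral_ofReal, intervalIntegral.integral_const_mul,
      integral_inv_one_add_sq, Real.arctan_neg] at h2
    have : (2 : ℂ) ≠ 0 := two_ne_zero
    apply mul_left_cancel₀ this
    rw [h2]; push_cast; ring
  simp_rw [e]
  refine (Complex.continuous_ofReal.tendsto _).comp ?_
  have h := (Real.tendsto_arctan_atTop.mono_right nhdsWithin_le_nhds).const_mul 2
  rwa [mul_div_cancel₀ _ two_ne_zero] at h

namespace HalfRes
variable {k Q : H →L[ℂ] H} {r : ℂ → H →L[ℂ] H} [CompleteSpace H]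

lemma differentiableOn (hr : HalfRes k Q r) (hk : ∀ x, k x = 0 → x = 0) :
    DifferentiableOn ℂ r {z | 0 ≤ z.re} := by
  intro u hu
  have h1 : Tendsto (fun z : ℂ => 1 - (z - u) • r u) (𝓝 u) (𝓝 1) := by
    have : Continuous fun z : ℂ => 1 - (z - u) • r u := by fun_prop
    simpa using this.tendsto u
  have hunit : ∀ᶠ z in 𝓝 u, IsUnit (1 - (z - u) • r u) :=
    h1.eventually (Units.isOpen.mem_nhds isUnit_one)
  have hdiff : DifferentiableAt ℂ (fun z : ℂ => r u * Ring.inverse (1 - (z - u) • r u)) u := by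
    refine DifferentiableAt.const_mul ?_ _
    have hu1 : IsUnit (1 - (u - u) • r u) := by simp
    have h2 : DifferentiableAt ℂ (fun z : ℂ => 1 - (z - u) • r u) u := by fun_prop
    obtain ⟨v, hv⟩ := hu1
    have h3 : DifferentiableAt ℂ Ring.inverse (1 - (u - u) • r u) := by
      rw [← hv]; exact differentiableAt_inverse v.isUnit
    exact h3.comp u h2
  refine hdiff.differentiableWithinAt.congr_of_eventuallyEq ?_ ?_
  · have hev : ∀ᶠ z in 𝓝[{z | 0 ≤ z.re}] u, z ≠ 0 ∨ z = u := by
      by_cases h0 : u = 0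
      · subst h0
        exact Eventually.of_forall fun z => (em (z = 0)).symm
      · filter_upwards [mem_nhdsWithin_of_mem_nhds (isOpen_ne.mem_nhds h0)] with z hz
        exact Or.inl hz
    filter_upwards [hev, self_mem_nhdsWithin, mem_nhdsWithin_of_mem_nhds hunit] with z h0 hz hzu
    rcases h0 with h0 | rfl
    · have h4 : r z * (1 - (z - u) • r u) = r u := by
        ext x
        have := hr.identity hk hz h0 hu x
        change r z (x - (z - u) • r u x) = r u x
        rw [map_sub, map_smul, ← this, sub_sub_cancel]
      change r z = r u * Ring.inverse (1 - (z - u) • r u)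
      nth_rewrite 1 [← h4]
      rw [mul_assoc, Ring.mul_inverse_cancel _ hzu, mul_one]
    · simp
  · simp

/-- The integral of the half resolvent along the imaginary axis. -/
lemma tendsto_axis (hr : HalfRes k Q r) (hk : ∀ x, k x = 0 → x = 0) {C Λ : ℝ}
    (hΛ : 0 < Λ) (hb : ∀ z : ℂ, 0 ≤ z.re → Λ ≤ ‖z‖ → ‖r z‖ ≤ C / ‖z‖)
    (hcomm : ∀ x, k (Q x) = Q (k x)) (y z₀ : H) :
    Tendsto (fun τ : ℝ => ∫ t in (-τ)..τ, ⟪y, r (I * t) (k z₀)⟫) atTop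
      (𝓝 (-(Real.pi * ⟪y, Q (k z₀)⟫))) := by
  have hne : ∀ z : ℂ, 0 ≤ z.re → 1 + z ≠ 0 := fun z hz h => by
    have := congrArg Complex.re h
    simp at this
    linarith
  set h : ℂ → ℂ := fun z => (1 + z)⁻¹ * ⟪y, r z (z₀ + k z₀)⟫ with hh
  have hid : ∀ z : ℂ, 0 ≤ z.re → ⟪y, r z (k z₀)⟫ = h z - (1 + z)⁻¹ * ⟪y, Q (k z₀)⟫ := by
    intro z hz
    have h1 := hr.left z hz z₀
    rw [map_sub, map_smul, hcomm] at h1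
    have h2 : (1 + z) • r z (k z₀) = r z (z₀ + k z₀) - Q (k z₀) := by
      rw [← h1, map_add, add_smul, one_smul]; abel
    rw [hh]
    simp only
    rw [← mul_sub, ← inner_sub_right, ← h2, inner_smul_right, inv_mul_cancel_left₀ (hne z hz)]
  have hd : DifferentiableOn ℂ h {z | 0 ≤ z.re} := by
    refine DifferentiableOn.mul ?_ ?_
    · refine DifferentiableOn.inv (by fun_prop) hne
    · have := hr.differentiableOn hk
      exact (((innerSL ℂ y).comp (ContinuousLinearMap.apply ℂ H (z₀ + k z₀))).differentiable
        |>.comp_differentiableOn this)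
  have hb' : ∀ z : ℂ, 0 ≤ z.re → Λ ≤ ‖z‖ → ‖h z‖ ≤ (C * ‖y‖ * ‖z₀ + k z₀‖) / ‖z‖ ^ 2 := by
    intro z hz hzΛ
    have hzp : 0 < ‖z‖ := hΛ.trans_le hzΛ
    have h1 : ‖z‖ ≤ ‖1 + z‖ := by
      refine le_of_sq_le_sq ?_ (norm_nonneg _)
      rw [← Complex.normSq_eq_norm_sq, ← Complex.normSq_eq_norm_sq, Complex.normSq_apply,
        Complex.normSq_apply]
      simp
      nlinarith
    have h2 : ‖⟪y, r z (z₀ + k z₀)⟫‖ ≤ ‖y‖ * (C / ‖z‖ * ‖z₀ + k z₀‖) :=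
      (norm_inner_le_norm _ _).trans (by
        gcongr
        exact ((r z).le_opNorm _).trans (by gcongr; exact hb z hz hzΛ))
    rw [hh]
    simp only
    rw [norm_mul, norm_inv]
    calc ‖1 + z‖⁻¹ * ‖⟪y, r z (z₀ + k z₀)⟫‖ ≤ ‖z‖⁻¹ * (‖y‖ * (C / ‖z‖ * ‖z₀ + k z₀‖)) := by
          gcongr
      _ = _ := by field_simp
  have hlim := (tendsto_axis_integral_zero hd hb').sub
    (tendsto_integral_inv_one_add.mul_const ⟪y, Q (k z₀)⟫)
  rw [zero_sub] at hlim
  refine hlim.congr fun τ => ?_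
  have hre : ∀ t : ℝ, 0 ≤ (I * (t : ℂ)).re := fun t => by simp
  have hcont : ∀ f : ℂ → ℂ, DifferentiableOn ℂ f {z | 0 ≤ z.re} →
      Continuous fun t : ℝ => f (I * t) := fun f hf =>
    hf.continuousOn.comp_continuous (by fun_prop) hre
  rw [← intervalIntegral.integral_mul_const, ← intervalIntegral.integral_sub
    ((hcont h hd).intervalIntegrable _ _)
    ((hcont (fun z => (1 + z)⁻¹ * ⟪y, Q (k z₀)⟫)
      (DifferentiableOn.mul_const (DifferentiableOn.inv (by fun_prop) hne) _)).intervalIntegrable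
        _ _)]
  exact intervalIntegral.integral_congr fun t _ => (hid _ (hre t)).symm

end HalfRes
end Formula

section SquareFunction
variable {H : Type*} [NormedAddCommGroup H] [InnerProductSpace ℂ H] [CompleteSpace H]

lemma denseRange_of_symm_inj {T : H →L[ℂ] H} (hT : ∀ x y, ⟪T x, y⟫ = ⟪x, T y⟫)
    (hinj : ∀ x, T x = 0 → x = 0) : DenseRange T := by
  have h : (LinearMap.range (T : H →ₗ[ℂ] H)).topologicalClosure = ⊤ := by
    rw [Submodule.topologicalClosure_eq_top_iff, Submodule.eq_bot_iff]
    intro x hx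
    refine hinj x (inner_self_eq_zero (𝕜 := ℂ).1 ?_)
    rw [hT]
    exact (Submodule.mem_orthogonal' _ _).1 hx _ ⟨T x, rfl⟩
  have h2 := congrArg (fun s : Submodule ℂ H => (s : Set H)) h
  simp only [Submodule.topologicalClosure_coe, Submodule.top_coe] at h2
  exact dense_iff_closure_eq.2 h2

/-- A bounded sesquilinear function is represented by a bounded operator. -/
lemma exists_op_of_sesq (B : H → H → ℂ) (C : ℝ)
    (h1 : ∀ y x x', B y (x + x') = B y x + B y x') (h2 : ∀ (c : ℂ) y x, B y (c • x) = c * B y x)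
    (h3 : ∀ y y' x, B (y + y') x = B y x + B y' x)
    (h4 : ∀ (c : ℂ) y x, B (c • y) x = (starRingEnd ℂ) c * B y x)
    (hb : ∀ y x, ‖B y x‖ ≤ C * (‖y‖ ^ 2 + ‖x‖ ^ 2)) :
    ∃ S : H →L[ℂ] H, ‖S‖ ≤ 2 * |C| ∧ ∀ y x, ⟪y, S x⟫ = B y x := by
  have hb' : ∀ y x, ‖B y x‖ ≤ 2 * |C| * ‖y‖ * ‖x‖ := by
    intro y x
    rcases eq_or_ne y 0 with rfl | hy
    · have : B 0 x = 0 := by simpa using h4 0 0 x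
      simp [this]
    rcases eq_or_ne x 0 with rfl | hx
    · have : B y 0 = 0 := by simpa using h2 0 y 0
      simp [this]
    have hyp := norm_pos_iff.2 hy
    have hxp := norm_pos_iff.2 hx
    have h5 := hb (((‖y‖⁻¹ : ℝ) : ℂ) • y) (((‖x‖⁻¹ : ℝ) : ℂ) • x)
    rw [h4, h2, norm_smul, norm_smul, norm_mul, norm_mul] at h5
    simp only [RCLike.norm_conj, Complex.norm_real, norm_inv, norm_norm] at h5
    rw [inv_mul_cancel₀ hyp.ne', inv_mul_cancel₀ hxp.ne'] at h5
    have h6 : ‖y‖⁻¹ * (‖x‖⁻¹ * ‖B y x‖) = ‖B y x‖ / (‖y‖ * ‖x‖) := by field_simp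
    rw [h6, div_le_iff₀ (by positivity)] at h5
    refine h5.trans ?_
    nlinarith [le_abs_self C, mul_pos hyp hxp]
  let B' : H →ₗ⋆[ℂ] H →ₗ[ℂ] ℂ := LinearMap.mk₂'ₛₗ (starRingEnd ℂ) (RingHom.id ℂ) B h3 h4 h1 h2
  let B'' : H →L⋆[ℂ] H →L[ℂ] ℂ := LinearMap.mkContinuous₂ B' (2 * |C|) hb'
  let S := ContinuousLinearMap.adjoint (InnerProductSpace.continuousLinearMapOfBilin (𝕜 := ℂ) B'')
  have hS : ∀ y x, ⟪y, S x⟫ = B y x := fun y x => by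
    rw [ContinuousLinearMap.adjoint_inner_right,
      InnerProductSpace.continuousLinearMapOfBilin_apply]
    rfl
  refine ⟨S, opNorm_le_of_inner (by positivity) fun x y => ?_, hS⟩
  rw [hS]
  refine (hb' y x).trans (le_of_eq (by ring))

/-- `(J + w - i t A²)⁻¹`. -/
def sgnRes (A J w : H →L[ℂ] H) (t : ℝ) : H →L[ℂ] H := Ring.inverse (J + w - (I * t) • (A * A))

lemma norm_zero_clm_lt {E : Type*} [NormedAddCommGroup E] [InnerProductSpace ℂ E] :
    ‖(0 : E →L[ℂ] E)‖ < 1 := by rw [norm_zero]; exact one_pos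

namespace SqrtSetup
variable {A J w k Qp Qm : H →L[ℂ] H} {rm rp : ℂ → H →L[ℂ] H}

lemma sgnRes_right (hs : SqrtSetup A J) (hw : ‖w‖ < 1) (t : ℝ) (x : H) :
    J (sgnRes A J w t x) + w (sgnRes A J w t x) - (I * t) • A (A (sgnRes A J w t x)) = x :=
  DFunLike.congr_fun (Ring.mul_inverse_cancel _ (hs.isUnit_J_add_sub t hw)) x

lemma sgnRes_left (hs : SqrtSetup A J) (hw : ‖w‖ < 1) (t : ℝ) (x : H) :
    sgnRes A J w t (J x + w x - (I * t) • A (A x)) = x :=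
  DFunLike.congr_fun (Ring.inverse_mul_cancel _ (hs.isUnit_J_add_sub t hw)) x

lemma eq_sgnRes (hs : SqrtSetup A J) (hw : ‖w‖ < 1) {t : ℝ} {x z : H}
    (h : J z + w z - (I * t) • A (A z) = x) : z = sgnRes A J w t x := by
  rw [← h, hs.sgnRes_left hw]

lemma continuous_sgnRes (hs : SqrtSetup A J) (hw : ‖w‖ < 1) : Continuous (sgnRes A J w) := by
  rw [continuous_iff_continuousAt]
  intro t
  have h1 : Continuous fun t : ℝ => J + w - (I * t) • (A * A) := by fun_prop
  obtain ⟨u, hu⟩ := hs.isUnit_J_add_sub t hw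
  have h2 := NormedRing.inverse_continuousAt u
  rw [hu] at h2
  exact ContinuousAt.comp (f := fun t : ℝ => J + w - (I * t) • (A * A)) h2 h1.continuousAt

lemma norm_sgnRes_le (hs : SqrtSetup A J) (hw : ‖w‖ < 1) (t : ℝ) (x : H) :
    (1 - ‖w‖) * ‖sgnRes A J w t x‖ ≤ ‖x‖ := by
  refine (hs.le_norm_J_add_sub t w _).trans (le_of_eq (congrArg norm ?_))
  exact hs.sgnRes_right hw t x

lemma sgnRes_eq (hs : SqrtSetup A J) (hw : ‖w‖ < 1) (t : ℝ) (x : H) :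
    sgnRes A J w t x = sgnRes A J 0 t x - sgnRes A J 0 t (w (sgnRes A J w t x)) := by
  rw [← map_sub]
  refine hs.eq_sgnRes norm_zero_clm_lt ?_
  rw [zero_apply, add_zero, eq_sub_iff_add_eq]
  exact (by abel : _ = _).trans (hs.sgnRes_right hw t x)

lemma norm_sgnRes_zero_le (hs : SqrtSetup A J) (t : ℝ) (x : H) : ‖sgnRes A J 0 t x‖ ≤ ‖x‖ := by
  have := hs.norm_sgnRes_le norm_zero_clm_lt t x
  rwa [norm_zero, sub_zero, one_mul] at this

lemma sgnRes_le_zero (hs : SqrtSetup A J) (hw : ‖w‖ < 1) (t : ℝ) (x : H) :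
    (1 - ‖w‖) * ‖sgnRes A J w t x‖ ≤ ‖sgnRes A J 0 t x‖ := by
  have h1 : ‖sgnRes A J 0 t (w (sgnRes A J w t x))‖ ≤ ‖w‖ * ‖sgnRes A J w t x‖ :=
    (hs.norm_sgnRes_zero_le t _).trans (w.le_opNorm _)
  have h2 := norm_sub_le (sgnRes A J 0 t x) (sgnRes A J 0 t (w (sgnRes A J w t x)))
  rw [← hs.sgnRes_eq hw] at h2
  linarith

lemma zero_le_sgnRes (hs : SqrtSetup A J) (hw : ‖w‖ < 1) (t : ℝ) (x : H) :
    ‖sgnRes A J 0 t x‖ ≤ (1 + ‖w‖) * ‖sgnRes A J w t x‖ := by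
  have h1 : ‖sgnRes A J 0 t (w (sgnRes A J w t x))‖ ≤ ‖w‖ * ‖sgnRes A J w t x‖ :=
    (hs.norm_sgnRes_zero_le t _).trans (w.le_opNorm _)
  have h2 : sgnRes A J 0 t x = sgnRes A J w t x + sgnRes A J 0 t (w (sgnRes A J w t x)) := by
    have := hs.sgnRes_eq hw t x
    rw [eq_sub_iff_add_eq] at this
    exact this.symm
  rw [h2]
  refine (norm_add_le _ _).trans ?_
  linarith

lemma sgnRes_inner (hs : SqrtSetup A J) {w' : H →L[ℂ] H} (hw : ‖w‖ < 1) (hw' : ‖w'‖ < 1)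
    (h : ∀ x y, ⟪w' y, x⟫ = ⟪y, w x⟫) (t : ℝ) (x y : H) :
    ⟪sgnRes A J w' (-t) y, x⟫ = ⟪y, sgnRes A J w t x⟫ := by
  have h1 := hs.sgnRes_right hw t x
  have h2 := hs.sgnRes_right hw' (-t) y
  conv_lhs => rw [← h1]
  conv_rhs => rw [← h2]
  rw [inner_sub_left, inner_add_left, inner_sub_right, inner_add_right, h, hs.symmJ,
    inner_smul_left, inner_smul_right, hs.symmA, hs.symmA]
  simp

lemma sgnRes_intertw (hs : SqrtSetup A J) {w' : H →L[ℂ] H} (hw : ‖w‖ < 1) (hw' : ‖w'‖ < 1)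
    (h : ∀ x, w (A x) = A (w' x)) (t : ℝ) (x : H) :
    sgnRes A J w t (A x) = A (sgnRes A J w' t x) := by
  refine (hs.eq_sgnRes hw ?_).symm
  conv_rhs => rw [← hs.sgnRes_right hw' t x]
  rw [hs.comm, h, map_sub, map_add, map_smul]

lemma sgnRes_comm_J (hs : SqrtSetup A J) (t : ℝ) (x : H) :
    sgnRes A J 0 t (J x) = J (sgnRes A J 0 t x) := by
  refine (hs.eq_sgnRes norm_zero_clm_lt ?_).symm
  conv_rhs => rw [← hs.sgnRes_right norm_zero_clm_lt t x]
  rw [zero_apply, zero_apply, map_sub, map_add, map_smul, hs.comm, hs.comm, map_zero]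

lemma sgnRes_symm_sum (hs : SqrtSetup A J) (t : ℝ) (x y : H) :
    ⟪y, sgnRes A J 0 t x⟫ + ⟪y, sgnRes A J 0 (-t) x⟫ =
      2 * ⟪sgnRes A J 0 t (J y), sgnRes A J 0 t x⟫ := by
  have hadj : ∀ (t : ℝ) x y, ⟪sgnRes A J 0 (-t) y, x⟫ = ⟪y, sgnRes A J 0 t x⟫ := fun t x y =>
    hs.sgnRes_inner norm_zero_clm_lt norm_zero_clm_lt (fun x y => by simp) t x y
  set u := sgnRes A J 0 t x with hu
  set v := sgnRes A J 0 t y with hv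
  have h1 : J u - (I * t) • A (A u) = x := by
    have := hs.sgnRes_right norm_zero_clm_lt t x
    rwa [zero_apply, add_zero] at this
  have h2 : J v - (I * t) • A (A v) = y := by
    have := hs.sgnRes_right norm_zero_clm_lt t y
    rwa [zero_apply, add_zero] at this
  have h3 : ⟪y, sgnRes A J 0 (-t) x⟫ = ⟪v, x⟫ := by
    have := hadj (-t) x y
    rw [neg_neg] at this
    rw [← this]
  have h4 : ⟪y, u⟫ = ⟪J v - (I * t) • A (A v), u⟫ := by rw [h2]
  have h5 : ⟪v, x⟫ = ⟪v, J u - (I * t) • A (A u)⟫ := by rw [h1]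
  rw [h3, hs.sgnRes_comm_J, h4, h5, inner_sub_left, inner_sub_right, inner_smul_left,
    inner_smul_right, hs.symmA, hs.symmA, hs.symmJ]
  simp
  ring

/-- On the imaginary axis the half resolvents add up to `A (J + w - i t A²)⁻¹ A`. -/
lemma axis_eq (hs : SqrtSetup A J) (hw : ‖w‖ < 1)
    (hk : ∀ x, ∃ z, k x = A z ∧ J z + w z = A x) (hrm : HalfRes k Qm rm)
    (hrp : HalfRes (-k) Qp rp) (hQ : ∀ x, Qp x + Qm x = x) (t : ℝ) (x : H) :
    A (sgnRes A J w t (A x)) = rm (I * t) x - rp (I * (-t : ℝ)) x := by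
  have h1 := hrm.right (I * t) (by simp) x
  have h2 := hrp.right (I * (-t : ℝ)) (by simp) x
  set v := rm (I * t) x - rp (I * (-t : ℝ)) x with hv
  have h3 : v = k ((I * t) • v + x) := by
    have e : k x = k (Qp x) + k (Qm x) := by rw [← map_add, hQ]
    rw [map_add, map_smul, e, ← h1]
    have e2 : k (Qp x) = -(rp (I * (-t : ℝ)) x - (I * (-t : ℝ)) • (-k) (rp (I * (-t : ℝ)) x)) := by
      rw [h2, neg_apply, neg_neg]
    rw [e2, hv, map_sub, neg_apply]
    push_cast
    simp only [smul_sub, smul_neg, mul_neg, neg_smul]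
    abel
  obtain ⟨z, hz1, hz2⟩ := hk ((I * t) • v + x)
  rw [← h3] at hz1
  have h4 : z = sgnRes A J w t (A x) := by
    refine hs.eq_sgnRes hw ?_
    rw [hz2, map_add, map_smul, hz1]; abel
  rw [← h4, hz1]

/-- The Cauchy principal value formula for the difference of the projections. -/
lemma tendsto_sgn (hs : SqrtSetup A J) (hw : ‖w‖ < 1)
    (hk : ∀ x, ∃ z, k x = A z ∧ J z + w z = A x) (hkinj : ∀ x, k x = 0 → x = 0)
    (hrm : HalfRes k Qm rm)
    (hrp : HalfRes (-k) Qp rp) (hQ : ∀ x, Qp x + Qm x = x)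
    (hcm : ∀ x, k (Qm x) = Qm (k x)) {C Λ : ℝ}
    (hΛ : 0 < Λ) (hbm : ∀ z : ℂ, 0 ≤ z.re → Λ ≤ ‖z‖ → ‖rm z‖ ≤ C / ‖z‖)
    (hbp : ∀ z : ℂ, 0 ≤ z.re → Λ ≤ ‖z‖ → ‖rp z‖ ≤ C / ‖z‖) (y z₀ : H) :
    Tendsto (fun τ : ℝ => ∫ t in (-τ)..τ, ⟪y, A (sgnRes A J w t (A (k z₀)))⟫) atTop
      (𝓝 (Real.pi * ⟪y, Qp (k z₀) - Qm (k z₀)⟫)) := by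
  have hcp : ∀ x, (-k) (Qp x) = Qp ((-k) x) := fun x => by
    have h1 : Qp x = x - Qm x := eq_sub_of_add_eq (hQ x)
    have h2 : Qp (k x) = k x - Qm (k x) := eq_sub_of_add_eq (hQ (k x))
    rw [neg_apply, neg_apply, map_neg, h1, h2, map_sub, hcm]
  have hkinj' : ∀ x, (-k) x = 0 → x = 0 := fun x hx => hkinj x (neg_eq_zero.1 hx)
  have l1 := hrm.tendsto_axis hkinj hΛ hbm hcm y z₀
  have l2 := hrp.tendsto_axis hkinj' hΛ hbp hcp y (-z₀)
  have e : (-k) (-z₀) = k z₀ := by simp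
  rw [e] at l2
  have l3 := l1.sub l2
  have e2 : -((Real.pi : ℂ) * ⟪y, Qm (k z₀)⟫) - -(Real.pi * ⟪y, Qp (k z₀)⟫) =
      Real.pi * ⟪y, Qp (k z₀) - Qm (k z₀)⟫ := by rw [inner_sub_right]; ring
  rw [e2] at l3
  refine l3.congr fun τ => ?_
  have hc : ∀ {k' Q : H →L[ℂ] H} {r : ℂ → H →L[ℂ] H}, HalfRes k' Q r →
      (∀ x, k' x = 0 → x = 0) → Continuous fun t : ℝ => ⟪y, r (I * t) (k z₀)⟫ := by
    intro k' Q r hr hk'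
    have h1 : Continuous fun t : ℝ => r (I * t) :=
      (hr.differentiableOn hk').continuousOn.comp_continuous (by fun_prop) (by simp)
    exact continuous_const.inner (h1.clm_apply continuous_const)
  have hcp' : Continuous fun t : ℝ => ⟪y, rp (I * (-t : ℝ)) (k z₀)⟫ :=
    (hc hrp hkinj').comp continuous_neg
  have e3 : ∫ t in (-τ)..τ, ⟪y, rp (I * t) (k z₀)⟫ =
      ∫ t in (-τ)..τ, ⟪y, rp (I * (-t : ℝ)) (k z₀)⟫ := by
    have := intervalIntegral.integral_comp_neg (a := -τ) (b := τ)
      (fun t : ℝ => ⟪y, rp (I * t) (k z₀)⟫)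
    rw [neg_neg] at this
    exact this.symm
  rw [e3, ← intervalIntegral.integral_sub ((hc hrm hkinj).intervalIntegrable _ _)
    (hcp'.intervalIntegrable _ _)]
  refine intervalIntegral.integral_congr fun t _ => ?_
  rw [hs.axis_eq hw hk hrm hrp hQ, inner_sub_right]

end SqrtSetup
end SquareFunction

section SquareFunction
variable {H : Type*} [NormedAddCommGroup H] [InnerProductSpace ℂ H] [CompleteSpace H]

namespace SqrtSetup
variable {A J w : H →L[ℂ] H}

lemma exists_halfRes (hs : SqrtSetup A J) : ∃ r : ℂ → H →L[ℂ] H,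
    HalfRes (A * J * A) ((1 / 2 : ℂ) • (1 - J)) r ∧
      ∀ z : ℂ, 0 ≤ z.re → 0 < ‖z‖ → ‖r z‖ ≤ 1 / ‖z‖ := by
  obtain ⟨N, hr, hl⟩ : ∃ N : ℂ → H →L[ℂ] H,
      (∀ z : ℂ, 0 ≤ z.re → ∀ u, N z u + z • A (A (N z u)) = u) ∧
      ∀ z : ℂ, 0 ≤ z.re → ∀ u, N z (u + z • A (A u)) = u :=
    ⟨fun z => Ring.inverse (1 + z • (A * A)),
      fun z hz u => DFunLike.congr_fun (Ring.mul_inverse_cancel _ (hs.isUnit_one_add hz)) u,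
      fun z hz u => DFunLike.congr_fun (Ring.inverse_mul_cancel _ (hs.isUnit_one_add hz)) u⟩
  have hcA : ∀ z : ℂ, 0 ≤ z.re → ∀ u, N z (A u) = A (N z u) := fun z hz u => by
    conv_lhs => rw [← hr z hz u]
    rw [map_add, map_smul, hl z hz]
  have hcJ : ∀ z : ℂ, 0 ≤ z.re → ∀ u, N z (J u) = J (N z u) := fun z hz u => by
    conv_lhs => rw [← hr z hz u]
    rw [map_add, map_smul, hs.comm, hs.comm, hl z hz]
  obtain ⟨P, hP⟩ : ∃ P : H →L[ℂ] H, P = (1 / 2 : ℂ) • (1 - J) := ⟨_, rfl⟩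
  have hPx : ∀ x, P x = (1 / 2 : ℂ) • (x - J x) := fun x => by rw [hP]; rfl
  have hPA : ∀ x, P (A x) = A (P x) := fun x => by
    rw [hPx, hPx, hs.comm, map_smul, map_sub]
  have hJP : ∀ x, J (P x) = -P x := fun x => by
    rw [hPx, map_smul, map_sub, hs.invol, ← smul_neg, neg_sub]
  have hPJ : ∀ x, P (J x) = -P x := fun x => by
    rw [hPx, hPx, hs.invol, ← smul_neg, neg_sub]
  have hPP : ∀ x, P (P x) = P x := fun x => by
    rw [hPx (P x), hJP]; module
  have hPN : ∀ z : ℂ, 0 ≤ z.re → ∀ u, P (N z u) = N z (P u) := fun z hz u => by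
    rw [hPx, hPx, map_smul, map_sub, hcJ z hz]
  rw [← hP]
  refine ⟨fun z => -(N z * (A * A) * P), ⟨fun z hz x => ?_, fun z hz x => ?_,
    fun z hz x => ?_, fun z hz x => ?_⟩, fun z hz hz0 => ?_⟩
  · change -N z (A (A (P (x - z • A (J (A x)))))) = A (J (A (P x)))
    rw [map_sub, map_smul, hPA, hPJ, hPA, hs.comm, hJP, hcA z hz, hcA z hz, map_neg, smul_neg,
      sub_neg_eq_add, hl z hz, map_neg, map_neg]
  · change -N z (A (A (P x))) - z • A (J (A (-N z (A (A (P x)))))) = A (J (A (P x)))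
    rw [hcA z hz, hcA z hz, ← hPN z hz]
    have h1 := hr z hz x
    set v := N z x
    rw [← h1]
    simp only [map_add, map_neg, map_smul, smul_neg, hs.comm, hJP, hPA, neg_neg]
    abel
  · change -N z (A (A (P (P x)))) = -N z (A (A (P x)))
    rw [hPP]
  · change P (-N z (A (A (P x)))) = -N z (A (A (P x)))
    rw [map_neg, hPN z hz, hPA, hPA, hPP]
  · refine ContinuousLinearMap.opNorm_le_bound _ (by positivity) fun x => ?_
    change ‖-N z (A (A (P x)))‖ ≤ _
    have h1 : ‖P x‖ ≤ ‖x‖ := by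
      rw [hPx, norm_smul]
      have := norm_sub_le x (J x)
      rw [hs.norm_J] at this
      norm_num
      linarith
    have h2 := hs.norm_le_of_one_add hz (norm_pos_iff.1 hz0) (h₁ := 0) (h₂ := P x)
      (p := N z (A (A (P x)))) (by rw [hr z hz, zero_add])
    rw [norm_zero, zero_add] at h2
    rw [norm_neg, one_div_mul_eq_div]
    exact h2.trans (by gcongr)

/-- The principal value formula for the unperturbed sign. -/
lemma tendsto_sgn_zero (hs : SqrtSetup A J) (y z₀ : H) :
    Tendsto (fun τ : ℝ => ∫ t in (-τ)..τ, ⟪y, A (sgnRes A J 0 t (A (A (J (A z₀)))))⟫) atTop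
      (𝓝 (Real.pi * ⟪y, J (A (J (A z₀)))⟫)) := by
  obtain ⟨rm, hrm, hbm⟩ := hs.exists_halfRes
  obtain ⟨rp, hrp, hbp⟩ := hs.neg.exists_halfRes
  have e1 : A * -J * A = -(A * J * A) := by rw [mul_neg, neg_mul]
  rw [e1] at hrp
  have h := hs.tendsto_sgn (w := 0) norm_zero_clm_lt (k := A * J * A)
    (fun x => ⟨J (A x), rfl, by rw [hs.invol]; simp⟩)
    (fun x hx => by
      have h1 : J (J (A x)) = J 0 := congrArg J (hs.inj _ hx)
      rw [hs.invol, map_zero] at h1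
      exact hs.inj _ h1) hrm hrp
    (fun x => by simp only [smul_apply, sub_apply, neg_apply, one_apply_eq_self]; module)
    (fun x => by
      change A (J (A ((1 / 2 : ℂ) • (x - J x)))) = (1 / 2 : ℂ) • (A (J (A x)) - J (A (J (A x))))
      simp only [map_smul, map_sub, hs.comm, hs.invol])
    one_pos (fun z hz h1 => hbm z hz (by linarith)) (fun z hz h1 => hbp z hz (by linarith)) y z₀
  have e2 : ∀ x, ((1 / 2 : ℂ) • (1 - -J)) x - ((1 / 2 : ℂ) • (1 - J)) x = J x := fun x => by
    simp only [smul_apply, sub_apply, neg_apply, one_apply_eq_self]; module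
  rw [e2] at h
  exact h

lemma integral_sgn_zero (hs : SqrtSetup A J) (y x : H) (τ : ℝ) :
    ∫ t in (-τ)..τ, ⟪y, A (sgnRes A J 0 t (A x))⟫ =
      ∫ t in (-τ)..τ, ⟪sgnRes A J 0 t (A (J y)), sgnRes A J 0 t (A x)⟫ := by
  have hc : Continuous fun t => ⟪y, A (sgnRes A J 0 t (A x))⟫ :=
    continuous_const.inner (A.continuous.comp
      ((hs.continuous_sgnRes norm_zero_clm_lt).clm_apply continuous_const))
  have h1 := intervalIntegral.integral_comp_neg (a := -τ) (b := τ)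
    (fun t => ⟪y, A (sgnRes A J 0 t (A x))⟫)
  rw [neg_neg] at h1
  have h2 := intervalIntegral.integral_add (hc.intervalIntegrable (μ := volume) (-τ) τ)
    ((hc.comp continuous_neg).intervalIntegrable (-τ) τ)
  have h3 : ∀ t, ⟪y, A (sgnRes A J 0 t (A x))⟫ + ⟪y, A (sgnRes A J 0 (-t) (A x))⟫ =
      2 * ⟪sgnRes A J 0 t (A (J y)), sgnRes A J 0 t (A x)⟫ := fun t => by
    rw [← hs.symmA, ← hs.symmA, hs.sgnRes_symm_sum, hs.comm]
  simp only [Function.comp_apply, h3] at h2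
  rw [intervalIntegral.integral_const_mul, h1, ← two_mul] at h2
  exact (mul_left_cancel₀ two_ne_zero h2).symm

lemma continuous_sgnRes_apply (hs : SqrtSetup A J) (hw : ‖w‖ < 1) (x : H) :
    Continuous fun t => sgnRes A J w t (A x) :=
  (hs.continuous_sgnRes hw).clm_apply continuous_const

lemma dense_range_AJAJ (hs : SqrtSetup A J) : DenseRange (A * J * A) := by
  refine denseRange_of_symm_inj (fun x y => ?_) fun x hx => ?_
  · change ⟪A (J (A x)), y⟫ = ⟪x, A (J (A y))⟫
    rw [hs.symmA, hs.symmJ, hs.symmA]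
  · have h1 : J (J (A x)) = J 0 := congrArg J (hs.inj _ hx)
    rw [hs.invol, map_zero] at h1
    exact hs.inj _ h1

lemma tendsto_square_of_range (hs : SqrtSetup A J) (y z₀ : H) :
    Tendsto (fun τ : ℝ => ∫ t in (-τ)..τ,
      ⟪sgnRes A J 0 t (A y), sgnRes A J 0 t (A (A (J (A z₀))))⟫) atTop
      (𝓝 (Real.pi * ⟪y, A (J (A z₀))⟫)) := by
  have h := hs.tendsto_sgn_zero (J y) z₀
  simp only [hs.integral_sgn_zero, hs.invol] at h
  rwa [hs.symmJ, hs.invol] at h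

lemma integral_square_le (hs : SqrtSetup A J) (x : H) {τ : ℝ} (hτ : 0 ≤ τ) :
    ∫ t in (-τ)..τ, ‖sgnRes A J 0 t (A x)‖ ^ 2 ≤ Real.pi * ‖x‖ ^ 2 := by
  refine hs.dense_range_AJAJ.induction_on (p := fun x => ∫ t in (-τ)..τ,
    ‖sgnRes A J 0 t (A x)‖ ^ 2 ≤ Real.pi * ‖x‖ ^ 2) x ?_ fun z₀ => ?_
  · refine isClosed_le ?_ (by fun_prop)
    refine intervalIntegral.continuous_parametric_intervalIntegral_of_continuous' ?_ _ _
    have := hs.continuous_sgnRes norm_zero_clm_lt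
    have h2 : Continuous fun p : H × ℝ => sgnRes A J 0 p.2 (A p.1) :=
      (this.comp continuous_snd).clm_apply (A.continuous.comp continuous_fst)
    exact h2.norm.pow 2
  · change ∫ t in (-τ)..τ, ‖sgnRes A J 0 t (A (A (J (A z₀))))‖ ^ 2 ≤
      Real.pi * ‖A (J (A z₀))‖ ^ 2
    set x := A (J (A z₀)) with hx
    have hc : Continuous fun t => ‖sgnRes A J 0 t (A x)‖ ^ 2 :=
      (hs.continuous_sgnRes_apply norm_zero_clm_lt x).norm.pow 2
    have h1 := hs.tendsto_square_of_range x z₀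
    rw [← hx] at h1
    have h2 := (Complex.continuous_re.tendsto _).comp h1
    have e : (Complex.re ∘ fun τ : ℝ => ∫ t in (-τ)..τ, ⟪sgnRes A J 0 t (A x), sgnRes A J 0 t (A x)⟫)
        = fun τ : ℝ => ∫ t in (-τ)..τ, ‖sgnRes A J 0 t (A x)‖ ^ 2 := by
      funext τ
      have : ∀ t, ⟪sgnRes A J 0 t (A x), sgnRes A J 0 t (A x)⟫ =
          ((‖sgnRes A J 0 t (A x)‖ ^ 2 : ℝ) : ℂ) := fun t => by
        rw [inner_self_eq_norm_sq_to_K]; push_cast; rfl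
      simp only [Function.comp_apply, this]
      rw [intervalIntegral.integral_ofReal, Complex.ofReal_re]
    rw [e] at h2
    have e2 : ((Real.pi : ℂ) * ⟪x, x⟫).re = Real.pi * ‖x‖ ^ 2 := by
      rw [Complex.re_ofReal_mul, ← RCLike.re_eq_complex_re, inner_self_eq_norm_sq]
    rw [e2] at h2
    refine ge_of_tendsto h2 ?_
    filter_upwards [eventually_ge_atTop τ] with s hτs
    refine intervalIntegral.integral_mono_interval (by linarith) (by linarith) hτs ?_
      (hc.intervalIntegrable _ _)
    exact Eventually.of_forall fun t => by positivity

lemma integrable_square (hs : SqrtSetup A J) (x : H) :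
    Integrable fun t => ‖sgnRes A J 0 t (A x)‖ ^ 2 := by
  have hc : Continuous fun t => ‖sgnRes A J 0 t (A x)‖ ^ 2 :=
    (hs.continuous_sgnRes_apply norm_zero_clm_lt x).norm.pow 2
  refine integrable_of_intervalIntegral_norm_bounded (l := atTop) (a := fun τ => -τ)
    (b := fun τ => τ) (Real.pi * ‖x‖ ^ 2) (fun τ => ?_) tendsto_neg_atTop_atBot tendsto_id ?_
  · exact hc.locallyIntegrable.integrableOn_isCompact isCompact_Icc |>.mono_set
      Set.Ioc_subset_Icc_self
  · filter_upwards [eventually_ge_atTop 0] with τ hτ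
    simp only [norm_pow, norm_norm]
    exact hs.integral_square_le x hτ

lemma integral_square_real_le (hs : SqrtSetup A J) (x : H) :
    ∫ t, ‖sgnRes A J 0 t (A x)‖ ^ 2 ≤ Real.pi * ‖x‖ ^ 2 := by
  refine le_of_tendsto (intervalIntegral_tendsto_integral (hs.integrable_square x)
    tendsto_neg_atTop_atBot tendsto_id) ?_
  filter_upwards [eventually_ge_atTop 0] with τ hτ
  exact hs.integral_square_le x hτ

lemma integrable_square_inner (hs : SqrtSetup A J) (y x : H) :
    Integrable fun t => ⟪sgnRes A J 0 t (A y), sgnRes A J 0 t (A x)⟫ := by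
  have hc : ∀ x, Continuous fun t => sgnRes A J 0 t (A x) :=
    hs.continuous_sgnRes_apply norm_zero_clm_lt
  refine ((hs.integrable_square y).add (hs.integrable_square x)).mono'
    ((hc y).inner (hc x)).aestronglyMeasurable (Eventually.of_forall fun t => ?_)
  refine (norm_inner_le_norm _ _).trans ?_
  simp only [Pi.add_apply]
  nlinarith [sq_nonneg (‖sgnRes A J 0 t (A y)‖ - ‖sgnRes A J 0 t (A x)‖),
    sq_nonneg ‖sgnRes A J 0 t (A y)‖, sq_nonneg ‖sgnRes A J 0 t (A x)‖]

/-- Square function identity. -/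
lemma integral_square_inner (hs : SqrtSetup A J) (y x : H) :
    ∫ t, ⟪sgnRes A J 0 t (A y), sgnRes A J 0 t (A x)⟫ = Real.pi * ⟪y, x⟫ := by
  have hi := hs.integrable_square_inner
  obtain ⟨S, -, hS⟩ := exists_op_of_sesq
    (fun y x => ∫ t, ⟪sgnRes A J 0 t (A y), sgnRes A J 0 t (A x)⟫) (Real.pi)
    (fun y x x' => by
      rw [← integral_add (hi _ _) (hi _ _)]; simp only [map_add, inner_add_right])
    (fun c y x => by
      rw [← integral_const_mul]; simp only [map_smul, inner_smul_right])
    (fun y y' x => by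
      rw [← integral_add (hi _ _) (hi _ _)]; simp only [map_add, inner_add_left])
    (fun c y x => by
      rw [← integral_const_mul]; simp only [map_smul, inner_smul_left])
    (fun y x => by
      rw [mul_add]
      refine le_trans ?_ (add_le_add (hs.integral_square_real_le y)
        (hs.integral_square_real_le x))
      rw [← integral_add (hs.integrable_square y) (hs.integrable_square x)]
      refine norm_integral_le_of_norm_le ((hs.integrable_square y).add (hs.integrable_square x))
        (Eventually.of_forall fun t => ?_)
      refine (norm_inner_le_norm _ _).trans ?_
      nlinarith [sq_nonneg (‖sgnRes A J 0 t (A y)‖ - ‖sgnRes A J 0 t (A x)‖),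
        sq_nonneg ‖sgnRes A J 0 t (A y)‖, sq_nonneg ‖sgnRes A J 0 t (A x)‖])
  have hSx : ∀ x, S x = (Real.pi : ℂ) • x := fun x => by
    refine hs.dense_range_AJAJ.induction_on (p := fun x => S x = (Real.pi : ℂ) • x) x
      (isClosed_eq S.continuous (by fun_prop)) fun z₀ => ?_
    refine ext_inner_left ℂ fun y => ?_
    rw [hS, inner_smul_right]
    exact tendsto_nhds_unique (intervalIntegral_tendsto_integral (hi _ _)
      tendsto_neg_atTop_atBot tendsto_id) (hs.tendsto_square_of_range y z₀)
  rw [← hS, hSx, inner_smul_right]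

/-- The principal value formula for the unperturbed sign. -/
lemma tendsto_sgn_zero' (hs : SqrtSetup A J) (y x : H) :
    Tendsto (fun τ : ℝ => ∫ t in (-τ)..τ, ⟪y, A (sgnRes A J 0 t (A x))⟫) atTop
      (𝓝 (Real.pi * ⟪y, J x⟫)) := by
  simp only [hs.integral_sgn_zero]
  rw [← hs.symmJ, ← hs.integral_square_inner]
  exact intervalIntegral_tendsto_integral (hs.integrable_square_inner _ _)
      tendsto_neg_atTop_atBot tendsto_id

end SqrtSetup
end SquareFunction

section SquareFunction
variable {H : Type*} [NormedAddCommGroup H] [InnerProductSpace ℂ H]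

/-- `S` is the weak principal value of `π⁻¹ ∫ A (J + w - i t A²)⁻¹ A dt`. -/
def IsSgn (A J w S : H →L[ℂ] H) : Prop :=
  ∀ y x, Tendsto (fun τ : ℝ => ∫ t in (-τ)..τ, ⟪y, A (sgnRes A J w t (A x))⟫) atTop
    (𝓝 (Real.pi * ⟪y, S x⟫))

lemma IsSgn.unique {A J w S S' : H →L[ℂ] H} (h : IsSgn A J w S) (h' : IsSgn A J w S') : S = S' := by
  ext x
  refine ext_inner_left ℂ fun y => ?_
  have hpi : (Real.pi : ℂ) ≠ 0 := by exact_mod_cast Real.pi_ne_zero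
  exact mul_left_cancel₀ hpi (tendsto_nhds_unique (h y x) (h' y x))

variable [CompleteSpace H]

namespace SqrtSetup
variable {A J w : H →L[ℂ] H}

lemma continuous_correction (hs : SqrtSetup A J) (hw : ‖w‖ < 1) (v : H →L[ℂ] H) (y x : H) :
    Continuous fun t => ⟪sgnRes A J 0 (-t) (A y), v (sgnRes A J w t (A x))⟫ :=
  ((hs.continuous_sgnRes_apply norm_zero_clm_lt y).comp continuous_neg).inner
    (v.continuous.comp (hs.continuous_sgnRes_apply hw x))

lemma norm_correction_le (hs : SqrtSetup A J) (hw : ‖w‖ < 1) (v : H →L[ℂ] H) (t : ℝ) (y x : H) :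
    ‖⟪sgnRes A J 0 (-t) (A y), v (sgnRes A J w t (A x))⟫‖ ≤ ‖v‖ / (1 - ‖w‖) *
      ((‖sgnRes A J 0 (-t) (A y)‖ ^ 2 + ‖sgnRes A J 0 t (A x)‖ ^ 2) / 2) := by
  have hw' : 0 < 1 - ‖w‖ := by linarith
  have h1 : ‖sgnRes A J w t (A x)‖ ≤ ‖sgnRes A J 0 t (A x)‖ / (1 - ‖w‖) := by
    rw [le_div_iff₀ hw', mul_comm]; exact hs.sgnRes_le_zero hw t _
  refine (norm_inner_le_norm _ _).trans ?_
  have h2 : ‖v (sgnRes A J w t (A x))‖ ≤ ‖v‖ * (‖sgnRes A J 0 t (A x)‖ / (1 - ‖w‖)) :=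
    (v.le_opNorm _).trans (by gcongr)
  calc _ ≤ ‖sgnRes A J 0 (-t) (A y)‖ * (‖v‖ * (‖sgnRes A J 0 t (A x)‖ / (1 - ‖w‖))) := by gcongr
    _ = ‖v‖ / (1 - ‖w‖) * (‖sgnRes A J 0 (-t) (A y)‖ * ‖sgnRes A J 0 t (A x)‖) := by ring
    _ ≤ _ := by
      gcongr
      nlinarith [sq_nonneg (‖sgnRes A J 0 (-t) (A y)‖ - ‖sgnRes A J 0 t (A x)‖)]

lemma integrable_square_bound (hs : SqrtSetup A J) (c : ℝ) (y x : H) :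
    Integrable fun t => c * ((‖sgnRes A J 0 (-t) (A y)‖ ^ 2 + ‖sgnRes A J 0 t (A x)‖ ^ 2) / 2) :=
  (((hs.integrable_square y).comp_neg.add (hs.integrable_square x)).div_const 2).const_mul c

lemma integrable_correction (hs : SqrtSetup A J) (hw : ‖w‖ < 1) (v : H →L[ℂ] H) (y x : H) :
    Integrable fun t => ⟪sgnRes A J 0 (-t) (A y), v (sgnRes A J w t (A x))⟫ :=
  (hs.integrable_square_bound _ y x).mono' (hs.continuous_correction hw v y x).aestronglyMeasurable
    (Eventually.of_forall fun t => hs.norm_correction_le hw v t y x)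

lemma exists_isSgn (hs : SqrtSetup A J) (hw : ‖w‖ < 1) : ∃ S : H →L[ℂ] H, IsSgn A J w S ∧
    ‖S‖ ≤ 1 / (1 - ‖w‖) ∧ ∀ y x, ⟪y, S x⟫ = ⟪y, J x⟫ -
      (Real.pi : ℂ)⁻¹ * ∫ t, ⟪sgnRes A J 0 (-t) (A y), w (sgnRes A J w t (A x))⟫ := by
  have hw' : 0 < 1 - ‖w‖ := by linarith
  have hi := hs.integrable_correction hw w
  obtain ⟨D, hD1, hD⟩ := exists_op_of_sesq
    (fun y x => (Real.pi : ℂ)⁻¹ * ∫ t, ⟪sgnRes A J 0 (-t) (A y), w (sgnRes A J w t (A x))⟫)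
    (‖w‖ / (1 - ‖w‖) / 2)
    (fun y x x' => by
      rw [← mul_add, ← integral_add (hi _ _) (hi _ _)]; simp only [map_add, inner_add_right])
    (fun c y x => by
      simp only [map_smul, inner_smul_right, integral_const_mul]; ring)
    (fun y y' x => by
      rw [← mul_add, ← integral_add (hi _ _) (hi _ _)]; simp only [map_add, inner_add_left])
    (fun c y x => by
      simp only [map_smul, inner_smul_left, integral_const_mul]; ring)
    (fun y x => by
      have h1 : ‖∫ t, ⟪sgnRes A J 0 (-t) (A y), w (sgnRes A J w t (A x))⟫‖ ≤
          ∫ t, ‖w‖ / (1 - ‖w‖) *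
            ((‖sgnRes A J 0 (-t) (A y)‖ ^ 2 + ‖sgnRes A J 0 t (A x)‖ ^ 2) / 2) :=
        norm_integral_le_of_norm_le (hs.integrable_square_bound _ y x)
          (Eventually.of_forall fun t => hs.norm_correction_le hw w t y x)
      rw [integral_const_mul, integral_div, integral_add (hs.integrable_square y).comp_neg
        (hs.integrable_square x), integral_neg_eq_self
          (fun t => ‖sgnRes A J 0 t (A y)‖ ^ 2)] at h1
      have h2 := hs.integral_square_real_le x
      have h3 := hs.integral_square_real_le y
      rw [norm_mul, norm_inv, Complex.norm_real, Real.norm_of_nonneg Real.pi_pos.le,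
        inv_mul_le_iff₀ Real.pi_pos]
      refine h1.trans ?_
      calc _ ≤ ‖w‖ / (1 - ‖w‖) * ((Real.pi * ‖y‖ ^ 2 + Real.pi * ‖x‖ ^ 2) / 2) := by gcongr
        _ = _ := by ring)
  refine ⟨J - D, fun y x => ?_, ?_, fun y x => ?_⟩
  · have e : ∀ t, ⟪y, A (sgnRes A J w t (A x))⟫ = ⟪y, A (sgnRes A J 0 t (A x))⟫ -
        ⟪sgnRes A J 0 (-t) (A y), w (sgnRes A J w t (A x))⟫ := fun t => by
      rw [hs.sgnRes_inner norm_zero_clm_lt norm_zero_clm_lt (fun x y => by simp), hs.symmA,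
        ← inner_sub_right, ← map_sub, ← hs.sgnRes_eq hw]
    have e2 : (Real.pi : ℂ) * ⟪y, (J - D) x⟫ = Real.pi * ⟪y, J x⟫ -
        ∫ t, ⟪sgnRes A J 0 (-t) (A y), w (sgnRes A J w t (A x))⟫ := by
      have hpi : (Real.pi : ℂ) ≠ 0 := by exact_mod_cast Real.pi_ne_zero
      rw [sub_apply, inner_sub_right, hD, mul_sub, mul_inv_cancel_left₀ hpi]
    rw [e2]
    refine ((hs.tendsto_sgn_zero' y x).sub (intervalIntegral_tendsto_integral (hi y x)
      tendsto_neg_atTop_atBot tendsto_id)).congr fun τ => ?_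
    have hc : Continuous fun t => ⟪y, A (sgnRes A J 0 t (A x))⟫ :=
      continuous_const.inner (A.continuous.comp (hs.continuous_sgnRes_apply norm_zero_clm_lt x))
    rw [id, ← intervalIntegral.integral_sub (hc.intervalIntegrable _ _)
      ((hs.continuous_correction hw w y x).intervalIntegrable _ _)]
    simp only [e]
  · have hJ : ‖J‖ ≤ 1 := J.opNorm_le_bound zero_le_one fun x => by rw [hs.norm_J, one_mul]
    rw [abs_of_nonneg (by positivity)] at hD1
    have e : 1 / (1 - ‖w‖) = 1 + ‖w‖ / (1 - ‖w‖) := by field_simp; ring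
    rw [e]
    refine (norm_sub_le _ _).trans (add_le_add hJ (hD1.trans_eq (by ring)))
  · rw [sub_apply, inner_sub_right, hD]

end SqrtSetup

namespace IsSgn
variable {A J w S S' : H →L[ℂ] H}

lemma norm_le (h : IsSgn A J w S) (hs : SqrtSetup A J) (hw : ‖w‖ < 1) :
    ‖S‖ ≤ 1 / (1 - ‖w‖) := by
  obtain ⟨S', h1, h2, -⟩ := hs.exists_isSgn hw
  rwa [h.unique h1]

lemma inner_eq (h : IsSgn A J w S) (hs : SqrtSetup A J) (hw : ‖w‖ < 1) (y x : H) :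
    ⟪y, S x⟫ = ⟪y, J x⟫ -
      (Real.pi : ℂ)⁻¹ * ∫ t, ⟪sgnRes A J 0 (-t) (A y), w (sgnRes A J w t (A x))⟫ := by
  obtain ⟨S', h1, -, h2⟩ := hs.exists_isSgn hw
  rw [h.unique h1, h2]

lemma intertw {w' : H →L[ℂ] H} (h : IsSgn A J w S) (h' : IsSgn A J w' S') (hs : SqrtSetup A J)
    (hw : ‖w‖ < 1) (hw' : ‖w'‖ < 1) (hi : ∀ x, w (A x) = A (w' x)) (x : H) :
    S (A x) = A (S' x) := by
  refine ext_inner_left ℂ fun y => ?_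
  have hpi : (Real.pi : ℂ) ≠ 0 := by exact_mod_cast Real.pi_ne_zero
  refine mul_left_cancel₀ hpi (tendsto_nhds_unique (h y (A x)) ?_)
  rw [← hs.symmA]
  refine (h' (A y) x).congr fun τ => ?_
  simp only [hs.sgnRes_intertw hw hw' hi, hs.symmA]

lemma inner_symm {w' : H →L[ℂ] H} (h : IsSgn A J w S) (h' : IsSgn A J w' S')
    (hs : SqrtSetup A J) (hw : ‖w‖ < 1) (hw' : ‖w'‖ < 1) (hi : ∀ x y, ⟪w' y, x⟫ = ⟪y, w x⟫)
    (x y : H) : ⟪S' y, x⟫ = ⟪y, S x⟫ := by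
  have hpi : (Real.pi : ℂ) ≠ 0 := by exact_mod_cast Real.pi_ne_zero
  refine mul_left_cancel₀ hpi (tendsto_nhds_unique ?_ (h y x))
  have h1 := (Complex.continuous_conj.tendsto _).comp (h' x y)
  rw [map_mul, inner_conj_symm, Complex.conj_ofReal] at h1
  refine h1.congr fun τ => ?_
  have e : ∀ t, ⟪y, A (sgnRes A J w t (A x))⟫ =
      (starRingEnd ℂ) ⟪x, A (sgnRes A J w' (-t) (A y))⟫ := fun t => by
    rw [inner_conj_symm, hs.symmA, hs.sgnRes_inner hw hw' hi, hs.symmA]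
  have h2 := intervalIntegral.integral_comp_neg (a := -τ) (b := τ)
      (fun t => (starRingEnd ℂ) ⟪x, A (sgnRes A J w' t (A y))⟫)
  rw [neg_neg] at h2
  simp only [e]
  rw [h2, Function.comp_apply]
  simp only [intervalIntegral, map_sub, integral_conj]

lemma accretive (h : IsSgn A J w S) (hs : SqrtSetup A J) (hw : ‖w‖ < 1) (x : H) :
    (1 - ‖w‖) / (1 + ‖w‖) ^ 2 * ‖x‖ ^ 2 ≤ (⟪J x, S x⟫).re := by
  have hw' : 0 < 1 - ‖w‖ := by linarith
  have hpt : ∀ t, (1 - ‖w‖) / (1 + ‖w‖) ^ 2 * ‖sgnRes A J 0 t (A x)‖ ^ 2 ≤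
      (⟪J x, A (sgnRes A J w t (A x))⟫).re := fun t => by
    have h1 := hs.sgnRes_right hw t (A x)
    have h2 := hs.zero_le_sgnRes hw t (A x)
    set g := sgnRes A J w t (A x)
    have h3 : ⟪J x, A g⟫ = ⟪J (J g + w g - (I * t) • A (A g)), g⟫ := by
      rw [h1, hs.comm, hs.symmA]
    have h4 : (⟪J (A (A g)), g⟫).im = 0 := by
      have := hs.inner_JB_im g
      rwa [hs.symmJ, ← inner_conj_symm, Complex.conj_im, neg_eq_zero]
    have h5 : ⟪J x, A g⟫.re = ‖g‖ ^ 2 + (⟪J (w g), g⟫).re := by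
      rw [h3, map_sub, map_add, hs.invol, map_smul, inner_sub_left, inner_add_left,
        inner_smul_left, Complex.sub_re, Complex.add_re, ← RCLike.re_eq_complex_re,
        inner_self_eq_norm_sq, RCLike.re_eq_complex_re]
      simp [h4]
    have h6 : ‖⟪J (w g), g⟫‖ ≤ ‖w‖ * ‖g‖ ^ 2 := by
      refine (norm_inner_le_norm _ _).trans ?_
      rw [hs.norm_J, pow_two, ← mul_assoc]
      gcongr
      exact w.le_opNorm g
    have h7 := (abs_le.1 ((Complex.abs_re_le_norm _).trans h6)).1
    have h8 : ‖sgnRes A J 0 t (A x)‖ ^ 2 ≤ (1 + ‖w‖) ^ 2 * ‖g‖ ^ 2 := by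
      rw [← mul_pow]; gcongr
    rw [h5, div_mul_eq_mul_div, div_le_iff₀ (by positivity)]
    calc _ ≤ (1 - ‖w‖) * ((1 + ‖w‖) ^ 2 * ‖g‖ ^ 2) := by gcongr
      _ = ((1 - ‖w‖) * ‖g‖ ^ 2) * (1 + ‖w‖) ^ 2 := by ring
      _ ≤ _ := by gcongr; linarith
  have h1 := (Complex.continuous_re.tendsto _).comp (h (J x) x)
  have h2 := (Complex.continuous_re.tendsto _).comp
    (intervalIntegral_tendsto_integral (hs.integrable_square_inner x x)
      tendsto_neg_atTop_atBot tendsto_id)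
  rw [hs.integral_square_inner] at h2
  rw [Complex.re_ofReal_mul] at h1 h2
  have e0 : ⟪x, x⟫.re = ‖x‖ ^ 2 := inner_self_eq_norm_sq (𝕜 := ℂ) x
  rw [e0] at h2
  have h3 := le_of_tendsto_of_tendsto (h2.const_mul ((1 - ‖w‖) / (1 + ‖w‖) ^ 2)) h1 ?_
  · rw [mul_left_comm] at h3
    exact le_of_mul_le_mul_left h3 Real.pi_pos
  filter_upwards [eventually_ge_atTop 0] with τ hτ
  have hc1 : Continuous fun t => ⟪J x, A (sgnRes A J w t (A x))⟫ :=
    continuous_const.inner (A.continuous.comp (hs.continuous_sgnRes_apply hw x))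
  have hc2 : Continuous fun t => sgnRes A J 0 t (A x) :=
    hs.continuous_sgnRes_apply norm_zero_clm_lt x
  simp only [Function.comp_apply, id]
  have e1 : (∫ t in (-τ)..τ, ⟪J x, A (sgnRes A J w t (A x))⟫).re =
      ∫ t in (-τ)..τ, (⟪J x, A (sgnRes A J w t (A x))⟫).re :=
    (Complex.reCLM.intervalIntegral_comp_comm (hc1.intervalIntegrable _ _)).symm
  have e2 : (∫ t in (-τ)..τ, ⟪sgnRes A J 0 t (A x), sgnRes A J 0 t (A x)⟫).re =
      ∫ t in (-τ)..τ, ‖sgnRes A J 0 t (A x)‖ ^ 2 := by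
    refine (Complex.reCLM.intervalIntegral_comp_comm
      ((hc2.inner hc2).intervalIntegrable _ _)).symm.trans ?_
    refine intervalIntegral.integral_congr fun t _ => ?_
    exact inner_self_eq_norm_sq (𝕜 := ℂ) _
  rw [e1, e2, ← intervalIntegral.integral_const_mul]
  refine intervalIntegral.integral_mono_on (by linarith)
    (((hc2.norm.pow 2).const_mul _).intervalIntegrable _ _)
    ((Complex.continuous_re.comp hc1).intervalIntegrable _ _) fun t _ => hpt t

end IsSgn

lemma PotSetup.isSgn_sub {A J w wt k G Qp Qm : H →L[ℂ] H} {q a b κ : ℝ}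
    {rm rp : ℂ → H →L[ℂ] H}
    (h : PotSetup A J w wt k G q a b κ) (hkd : DenseRange k)
    (hrm : HalfRes k Qm rm) (hrp : HalfRes (-k) Qp rp) (hQ : ∀ x, Qp x + Qm x = x)
    (hcm : ∀ x, k (Qm x) = Qm (k x)) {cx : ℝ} (hcx : 0 ≤ cx)
    (hgm : ∀ v, Qm v = v → ‖v‖ ≤ cx * ‖v - J v‖) (hgp : ∀ v, Qp v = v → ‖v‖ ≤ cx * ‖v + J v‖) :
    IsSgn A J w (Qp - Qm) := by
  have hw : ‖w‖ < 1 := h.norm_w.trans_lt h.hq1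
  obtain ⟨C1, L1, hL1, hb1⟩ := h.half_bound hrm hcx hgm
  obtain ⟨C2, L2, hL2, hb2⟩ := h.neg.half_bound hrp hcx (fun v hv => by
    rw [neg_apply, sub_neg_eq_add]; exact hgp v hv)
  obtain ⟨S, hS, -, -⟩ := h.toSqrtSetup.exists_isSgn hw
  have key : S = Qp - Qm := by
    ext x
    refine hkd.induction_on (p := fun x => S x = (Qp - Qm) x) x
      (isClosed_eq S.continuous (Qp - Qm).continuous) fun z₀ => ?_
    refine ext_inner_left ℂ fun y => ?_
    have hpi : (Real.pi : ℂ) ≠ 0 := by exact_mod_cast Real.pi_ne_zero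
    refine mul_left_cancel₀ hpi (tendsto_nhds_unique (hS y (k z₀)) ?_)
    exact h.toSqrtSetup.tendsto_sgn hw h.solve h.inj_k hrm hrp hQ hcm (C := max C1 C2)
      (Λ := max L1 L2) (lt_max_of_lt_left hL1)
      (fun z hz hl => (hb1 z hz ((le_max_left _ _).trans hl)).trans (by gcongr; exact le_max_left _ _))
      (fun z hz hl => (hb2 z hz ((le_max_right _ _).trans hl)).trans (by gcongr; exact le_max_right _ _))
      y z₀
  rw [← key]
  exact hS

end SquareFunction

section SquareFunction
variable {H : Type*} [NormedAddCommGroup H] [InnerProductSpace ℂ H] [CompleteSpace H]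

namespace SqrtSetup
variable {A J W : H →L[ℂ] H}

lemma norm_smul_clm_le {E : Type*} [NormedAddCommGroup E] [InnerProductSpace ℂ E]
    {W : E →L[ℂ] E} {z : ℂ} (hz : z ∈ Metric.ball (0 : ℂ) 1) :
    ‖z • W‖ ≤ ‖W‖ := by
  rw [norm_smul]
  exact mul_le_of_le_one_left (norm_nonneg _) (mem_ball_zero_iff.1 hz).le

lemma hasDerivAt_sgnRes (hs : SqrtSetup A J) {z : ℂ} (hw : ‖z • W‖ < 1) (t : ℝ) :
    HasDerivAt (fun z : ℂ => sgnRes A J (z • W) t)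
      (-(sgnRes A J (z • W) t * W * sgnRes A J (z • W) t)) z := by
  obtain ⟨u, hu⟩ := hs.isUnit_J_add_sub t hw
  have h1 : HasDerivAt (fun z : ℂ => J + z • W - (I * t) • (A * A)) W z := by
    have := (((hasDerivAt_id z).smul_const W).const_add J).sub_const ((I * t) • (A * A))
    simpa using this
  have h2 := hasFDerivAt_ringInverse (𝕜 := ℂ) u
  rw [hu] at h2
  have h3 := h2.comp_hasDerivAt z h1
  have e : (↑u⁻¹ : H →L[ℂ] H) = sgnRes A J (z • W) t := by
    rw [sgnRes, ← hu, Ring.inverse_unit]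
  rw [e] at h3
  exact h3

lemma differentiableAt_correction (hs : SqrtSetup A J) (hW : ‖W‖ < 1) {z₀ : ℂ}
    (hz₀ : z₀ ∈ Metric.ball (0 : ℂ) 1) (y x : H) :
    DifferentiableAt ℂ (fun z : ℂ => ∫ t, ⟪sgnRes A J 0 (-t) (A y),
      (z • W) (sgnRes A J (z • W) t (A x))⟫) z₀ := by
  have hlt : ∀ z ∈ Metric.ball (0 : ℂ) 1, ‖z • W‖ < 1 := fun z hz =>
    (norm_smul_clm_le hz).trans_lt hW
  have hnhds : Metric.ball (0 : ℂ) 1 ∈ 𝓝 z₀ := Metric.isOpen_ball.mem_nhds hz₀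
  have hW' : 0 < 1 - ‖W‖ := by linarith
  let F' : ℂ → ℝ → ℂ := fun z t => ⟪sgnRes A J 0 (-t) (A y),
    W (sgnRes A J (z • W) t (A x))⟫ + z * ⟪sgnRes A J 0 (-t) (A y),
    W (-(sgnRes A J (z • W) t (W (sgnRes A J (z • W) t (A x)))))⟫
  have hcM : ∀ z ∈ Metric.ball (0 : ℂ) 1, Continuous fun t => sgnRes A J (z • W) t (A x) :=
    fun z hz => hs.continuous_sgnRes_apply (hlt z hz) x
  have hc0 : Continuous fun t => sgnRes A J 0 (-t) (A y) :=
    (hs.continuous_sgnRes_apply norm_zero_clm_lt y).comp continuous_neg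
  refine (hasDerivAt_integral_of_dominated_loc_of_deriv_le (F' := F') (s := Metric.ball 0 1)
    (bound := fun t => ‖W‖ / (1 - ‖W‖) / (1 - ‖W‖) * ((‖sgnRes A J 0 (-t) (A y)‖ ^ 2 +
      ‖sgnRes A J 0 t (A x)‖ ^ 2) / 2)) hnhds ?_ ?_ ?_ ?_ ?_ ?_).2.differentiableAt
  · filter_upwards [hnhds] with z hz
    exact (hs.continuous_correction (hlt z hz) _ y x).aestronglyMeasurable
  · exact hs.integrable_correction (hlt z₀ hz₀) _ y x
  · have h1 := hcM z₀ hz₀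
    have h2 := hs.continuous_sgnRes (hlt z₀ hz₀)
    refine Continuous.aestronglyMeasurable ?_
    refine (hc0.inner (W.continuous.comp h1)).add (continuous_const.mul (hc0.inner
      (W.continuous.comp (h2.clm_apply (W.continuous.comp h1)).neg)))
  · refine Eventually.of_forall fun t z hz => ?_
    have hzW := norm_smul_clm_le (W := W) hz
    have hz1 : ‖z‖ ≤ 1 := (mem_ball_zero_iff.1 hz).le
    set g := sgnRes A J (z • W) t (A x)
    set p := sgnRes A J 0 (-t) (A y)
    have h1 : ‖g‖ * (1 - ‖W‖) ≤ ‖sgnRes A J 0 t (A x)‖ := by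
      refine le_trans ?_ (hs.sgnRes_le_zero (hlt z hz) t (A x))
      rw [mul_comm]
      gcongr
    have h2 : ‖sgnRes A J (z • W) t (W g)‖ * (1 - ‖W‖) ≤ ‖W‖ * ‖g‖ := by
      refine le_trans ?_ ((hs.norm_sgnRes_le (hlt z hz) t (W g)).trans (W.le_opNorm g))
      rw [mul_comm]
      gcongr
    have h3 : ‖F' z t‖ ≤ ‖p‖ * (‖W‖ * ‖g‖) + 1 * (‖p‖ * (‖W‖ * ‖sgnRes A J (z • W) t (W g)‖)) := by
      refine (norm_add_le _ _).trans (add_le_add ?_ ?_)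
      · exact (norm_inner_le_norm _ _).trans (by gcongr; exact W.le_opNorm g)
      · rw [norm_mul]
        refine mul_le_mul hz1 ((norm_inner_le_norm _ _).trans ?_) (norm_nonneg _) zero_le_one
        gcongr
        rw [map_neg, norm_neg]
        exact W.le_opNorm _
    refine h3.trans ?_
    rw [← le_div_iff₀ hW'] at h1 h2
    set s := ‖sgnRes A J 0 t (A x)‖
    have h4 : ‖g‖ + ‖sgnRes A J (z • W) t (W g)‖ ≤ s / (1 - ‖W‖) / (1 - ‖W‖) := by
      have e : ‖g‖ + ‖W‖ * ‖g‖ / (1 - ‖W‖) = ‖g‖ / (1 - ‖W‖) := by field_simp; ring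
      calc _ ≤ ‖g‖ + ‖W‖ * ‖g‖ / (1 - ‖W‖) := by gcongr
        _ = ‖g‖ / (1 - ‖W‖) := e
        _ ≤ _ := by gcongr
    calc _ = ‖W‖ * ‖p‖ * (‖g‖ + ‖sgnRes A J (z • W) t (W g)‖) := by ring
      _ ≤ ‖W‖ * ‖p‖ * (s / (1 - ‖W‖) / (1 - ‖W‖)) := by gcongr
      _ = ‖W‖ / (1 - ‖W‖) / (1 - ‖W‖) * (‖p‖ * s) := by ring
      _ ≤ _ := by
        gcongr
        nlinarith [sq_nonneg (‖p‖ - s)]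
  · exact hs.integrable_square_bound _ y x
  · refine Eventually.of_forall fun t z hz => ?_
    have h1 := hs.hasDerivAt_sgnRes (hlt z hz) t
    have h2 : HasDerivAt (fun z : ℂ => sgnRes A J (z • W) t (A x))
        (-(sgnRes A J (z • W) t (W (sgnRes A J (z • W) t (A x))))) z := by
      have := h1.clm_apply (hasDerivAt_const z (A x))
      simpa using this
    have h3 : HasDerivAt (fun z : ℂ => ⟪sgnRes A J 0 (-t) (A y), W (sgnRes A J (z • W) t (A x))⟫)
        ⟪sgnRes A J 0 (-t) (A y), W (-(sgnRes A J (z • W) t (W (sgnRes A J (z • W) t (A x)))))⟫ z :=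
      ((innerSL ℂ (sgnRes A J 0 (-t) (A y))).comp W).hasFDerivAt.comp_hasDerivAt z h2
    simp only [smul_apply, inner_smul_right]
    refine ((hasDerivAt_id' z).mul h3).congr_deriv ?_
    simp only [F', one_mul]

end SqrtSetup

lemma IsSgn.differentiableAt {A J W : H →L[ℂ] H} {S : ℂ → H →L[ℂ] H} (hs : SqrtSetup A J)
    (hW : ‖W‖ < 1) (hS : ∀ z ∈ Metric.ball (0 : ℂ) 1, IsSgn A J (z • W) (S z)) {z₀ : ℂ}
    (hz₀ : z₀ ∈ Metric.ball (0 : ℂ) 1) : DifferentiableAt ℂ S z₀ := by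
  obtain ⟨r, hr, hsub⟩ := Metric.isOpen_ball.mem_nhds_iff.1 (Metric.isOpen_ball.mem_nhds hz₀) |>
    fun _ => Metric.isOpen_iff.1 Metric.isOpen_ball z₀ hz₀
  have hlt : ∀ z ∈ Metric.ball (0 : ℂ) 1, ‖z • W‖ < 1 := fun z hz =>
    (SqrtSetup.norm_smul_clm_le hz).trans_lt hW
  refine differentiableAt_of_weak hr (M := 1 / (1 - ‖W‖)) (fun z hz => ?_) fun x y => ?_
  · refine ((hS z (hsub hz)).norm_le hs (hlt z (hsub hz))).trans ?_
    have := SqrtSetup.norm_smul_clm_le (W := W) (hsub hz)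
    have hW' : 0 < 1 - ‖W‖ := by linarith
    gcongr
  · refine DifferentiableOn.congr (f := fun z : ℂ => ⟪y, J x⟫ - (Real.pi : ℂ)⁻¹ *
      ∫ t, ⟪sgnRes A J 0 (-t) (A y), (z • W) (sgnRes A J (z • W) t (A x))⟫) ?_ fun z hz =>
      (hS z (hsub hz)).inner_eq hs (hlt z (hsub hz)) y x
    intro z hz
    exact (((hs.differentiableAt_correction hW (hsub hz) y x).const_mul _).const_sub
      _).differentiableWithinAt

end SquareFunction

section BinomialRoot

lemma descPochhammer_smeval_eq_prod (r : ℝ) (n : ℕ) :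
    (descPochhammer ℤ n).smeval r = ∏ i ∈ Finset.range n, (r - i) := by
  rw [← Polynomial.aeval_eq_smeval, Polynomial.aeval_def, ← Polynomial.eval_map,
    descPochhammer_map, descPochhammer_eval_eq_prod_range]

lemma binomHalf_eq_choose (n : ℕ) : binomHalf n = Ring.choose (-1 / 2 : ℝ) n := by
  have h := Ring.descPochhammer_eq_factorial_smul_choose (-1 / 2 : ℝ) n
  rw [descPochhammer_smeval_eq_prod, nsmul_eq_mul] at h
  rw [binomHalf, div_eq_iff (by positivity), h, mul_comm]

lemma abs_binomHalf_le (n : ℕ) : |binomHalf n| ≤ 1 := by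
  rw [binomHalf, abs_div, Finset.abs_prod, Nat.abs_cast, div_le_one (by positivity),
    ← Finset.prod_range_add_one_eq_factorial, Nat.cast_prod]
  refine Finset.prod_le_prod (fun _ _ => abs_nonneg _) fun i _ => ?_
  push_cast
  rw [abs_le]
  constructor <;> linarith [(Nat.cast_nonneg i : (0 : ℝ) ≤ i)]

lemma sum_antidiagonal_binomHalf (n : ℕ) :
    ∑ p ∈ Finset.HasAntidiagonal.antidiagonal n, binomHalf p.1 * binomHalf p.2 = (-1) ^ n := by
  simp only [binomHalf_eq_choose]
  have h := Ring.add_choose_eq n (Commute.all (-1 / 2 : ℝ) (-1 / 2))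
  rw [← h]
  norm_num
  have h2 := Ring.descPochhammer_eq_factorial_smul_choose (-1 : ℝ) n
  rw [descPochhammer_smeval_eq_prod, nsmul_eq_mul] at h2
  have h3 : ∏ j ∈ Finset.range n, (-1 - (j : ℝ)) = (-1) ^ n * n.factorial := by
    rw [← Finset.prod_range_add_one_eq_factorial, Nat.cast_prod, ← Finset.card_range n,
      ← Finset.prod_const, Finset.card_range, ← Finset.prod_mul_distrib]
    refine Finset.prod_congr rfl fun i _ => by push_cast; ring
  rw [h3, mul_comm] at h2
  exact (mul_left_cancel₀ (by positivity) h2).symm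

variable {E : Type*} [NormedRing E] [NormedAlgebra ℝ E]

/-- The binomial series for `(1 - a)^{-1/2}`. -/
def invSqrtSeries (a : E) : E := ∑' n : ℕ, binomHalf n • (-a) ^ n

lemma norm_binomHalf_smul_le {a : E} {θ : ℝ} (ha : ‖a‖ ≤ θ) (n : ℕ) :
    ‖binomHalf n • (-a) ^ n‖ ≤ (‖(1 : E)‖ + 1) * θ ^ n := by
  have h0 := norm_nonneg (1 : E)
  have hθ : 0 ≤ θ := (norm_nonneg a).trans ha
  have h2 : ‖(-a) ^ n‖ ≤ (‖(1 : E)‖ + 1) * θ ^ n := by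
    rcases Nat.eq_zero_or_pos n with rfl | hn
    · simp
    · calc _ ≤ ‖a‖ ^ n := by simpa using norm_pow_le' (-a) hn
        _ ≤ 1 * θ ^ n := by rw [one_mul]; gcongr
        _ ≤ _ := by gcongr; linarith
  rw [norm_smul]
  calc _ ≤ 1 * ((‖(1 : E)‖ + 1) * θ ^ n) :=
        mul_le_mul (abs_binomHalf_le n) h2 (norm_nonneg _) zero_le_one
    _ = _ := one_mul _

lemma summable_norm_binomHalf {a : E} (ha : ‖a‖ < 1) :
    Summable fun n : ℕ => ‖binomHalf n • (-a) ^ n‖ :=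
  Summable.of_nonneg_of_le (fun _ => norm_nonneg _) (norm_binomHalf_smul_le le_rfl)
    ((summable_geometric_of_lt_one (norm_nonneg _) ha).mul_left _)

variable [CompleteSpace E]

lemma hasSum_invSqrtSeries {a : E} (ha : ‖a‖ < 1) :
    HasSum (fun n : ℕ => binomHalf n • (-a) ^ n) (invSqrtSeries a) :=
  (summable_norm_binomHalf ha).of_norm.hasSum

lemma invSqrtSeries_mul_self {a : E} (ha : ‖a‖ < 1) :
    invSqrtSeries a * invSqrtSeries a * (1 - a) = 1 := by
  have h := tsum_mul_tsum_eq_tsum_sum_antidiagonal_of_summable_norm (summable_norm_binomHalf ha)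
    (summable_norm_binomHalf ha)
  rw [invSqrtSeries, h]
  refine Eq.trans ?_ (geom_series_mul_neg a ha)
  congr 1
  refine tsum_congr fun n => ?_
  have e : ∀ p ∈ Finset.HasAntidiagonal.antidiagonal n, binomHalf p.1 • (-a) ^ p.1 * binomHalf p.2 • (-a) ^ p.2 =
      (binomHalf p.1 * binomHalf p.2) • (-a) ^ n := fun p hp => by
    rw [smul_mul_smul_comm, ← pow_add, Finset.HasAntidiagonal.mem_antidiagonal.1 hp]
  rw [Finset.sum_congr rfl e, ← Finset.sum_smul, sum_antidiagonal_binomHalf, neg_pow a,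
    ← Algebra.smul_mul_assoc]
  rcases neg_one_pow_eq_or ℝ n with h | h <;> rcases Nat.even_or_odd n with h' | h' <;>
    simp [h'.neg_one_pow]

lemma invSqrtSeries_semiconj {a b c : E} (ha : ‖a‖ < 1) (hb : ‖b‖ < 1)
    (h : a * c = c * b) : invSqrtSeries a * c = c * invSqrtSeries b := by
  refine ((hasSum_invSqrtSeries ha).mul_right c).unique ?_
  have := (hasSum_invSqrtSeries hb).mul_left c
  convert this using 2 with n
  have h' : SemiconjBy c (-b) (-a) := by simp [SemiconjBy, h]
  rw [smul_mul_assoc, mul_smul_comm, (h'.pow_right n).eq]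

lemma invSqrtSeries_star [StarRing E] [ContinuousStar E] [StarModule ℝ E] {a : E}
    (ha : ‖a‖ < 1) (ha' : ‖star a‖ < 1) : star (invSqrtSeries a) = invSqrtSeries (star a) := by
  refine (hasSum_invSqrtSeries ha).star.unique ?_
  convert hasSum_invSqrtSeries ha' using 2 with n
  simp

end BinomialRoot

section Angular
variable {H : Type*} [NormedAddCommGroup H] [InnerProductSpace ℂ H]

section Cayley
variable [CompleteSpace H]

/-- The Cayley transform `(1 - K)(1 + K)⁻¹ = 2(1 + K)⁻¹ - 1`. -/
def cayley (K : H →L[ℂ] H) : H →L[ℂ] H := (2 : ℂ) • Ring.inverse (1 + K) - 1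

lemma isUnit_one_add_of_accretive {K : H →L[ℂ] H} (hK : ∀ x, 0 ≤ (⟪x, K x⟫).re) :
    IsUnit (1 + K) := by
  refine ContinuousLinearMap.isUnit_of_forall_le_norm_inner_map _ (c := 1) one_pos fun x => ?_
  rw [norm_inner_symm]
  refine le_trans ?_ (Complex.re_le_norm _)
  have h1 : (⟪x, x⟫).re = ‖x‖ ^ 2 := inner_self_eq_norm_sq (𝕜 := ℂ) x
  have h2 := hK x
  simp only [add_apply, one_apply_eq_self, inner_add_right, Complex.add_re, h1]
  push_cast
  linarith

lemma norm_cayley_le {K : H →L[ℂ] H} {c M : ℝ} (hc : 0 ≤ c)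
    (hK : ∀ x, c * ‖x‖ ^ 2 ≤ (⟪x, K x⟫).re) (hM : ‖K‖ ≤ M) :
    ‖cayley K‖ ≤ Real.sqrt (1 - 4 * c / (1 + M) ^ 2) := by
  have hM0 : 0 ≤ M := (norm_nonneg _).trans hM
  have hu := isUnit_one_add_of_accretive fun x => le_trans (by positivity) (hK x)
  refine ContinuousLinearMap.opNorm_le_bound _ (Real.sqrt_nonneg _) fun y => ?_
  set x := Ring.inverse (1 + K) y with hx
  have hy : y = x + K x := by
    have := congrArg (fun f : H →L[ℂ] H => f y) (Ring.mul_inverse_cancel _ hu)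
    simpa [mul_apply_eq_comp] using this.symm
  have hXy : cayley K y = x - K x := by
    rw [cayley, sub_apply, smul_apply, ← hx, one_apply_eq_self]
    rw [hy, two_smul]; abel
  have h1 : ‖x - K x‖ ^ 2 = ‖x + K x‖ ^ 2 - 4 * (⟪x, K x⟫).re := by
    rw [@norm_sub_sq ℂ, @norm_add_sq ℂ]; simp only [RCLike.re_to_complex]; ring
  have h2 : ‖x + K x‖ ≤ (1 + M) * ‖x‖ := by
    refine (norm_add_le _ _).trans ?_
    have := K.le_of_opNorm_le hM x
    linarith
  have h3 : ‖cayley K y‖ ^ 2 ≤ (1 - 4 * c / (1 + M) ^ 2) * ‖y‖ ^ 2 := by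
    rw [hXy, h1, ← hy]
    have h4 : ‖y‖ ^ 2 / (1 + M) ^ 2 ≤ ‖x‖ ^ 2 := by
      rw [div_le_iff₀ (by positivity), ← mul_pow, mul_comm, hy]
      gcongr
    have h5 : 4 * c / (1 + M) ^ 2 * ‖y‖ ^ 2 = 4 * (c * (‖y‖ ^ 2 / (1 + M) ^ 2)) := by ring
    have h6 := mul_le_mul_of_nonneg_left h4 hc
    have := hK x
    nlinarith
  by_cases hy0 : y = 0
  · simp [hy0]
  have hpos : 0 < ‖y‖ ^ 2 := by positivity
  have h7 : 0 ≤ 1 - 4 * c / (1 + M) ^ 2 := by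
    by_contra hneg
    push Not at hneg
    nlinarith [sq_nonneg ‖cayley K y‖]
  refine le_of_sq_le_sq ?_ (by positivity)
  rw [mul_pow, Real.sq_sqrt h7]
  exact h3

lemma sqrt_lt_one_of_pos {c M : ℝ} (hc : 0 < c) (hM : 0 ≤ M) :
    Real.sqrt (1 - 4 * c / (1 + M) ^ 2) < 1 := by
  rw [Real.sqrt_lt' one_pos]
  have : 0 < 4 * c / (1 + M) ^ 2 := by positivity
  linarith

lemma eq_cayley {K X : H →L[ℂ] H} (hK : ∀ x, 0 ≤ (⟪x, K x⟫).re) (h : K * (1 + X) = 1 - X) :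
    X = cayley K := by
  have hu := isUnit_one_add_of_accretive hK
  have h1 : (1 + K) * (1 + X) = (2 : ℂ) • 1 := by
    rw [add_mul, h, two_smul, one_mul]; abel
  have h2 : 1 + X = (2 : ℂ) • Ring.inverse (1 + K) := by
    have := congrArg (fun f => Ring.inverse (1 + K) * f) h1
    simpa [← mul_assoc, Ring.inverse_mul_cancel _ hu] using this
  rw [cayley, ← h2]; abel

lemma cayley_semiconj {K L A : H →L[ℂ] H} (hK : ∀ x, 0 ≤ (⟪x, K x⟫).re)
    (hL : ∀ x, 0 ≤ (⟪x, L x⟫).re) (h : K * A = A * L) : cayley K * A = A * cayley L := by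
  have hu := isUnit_one_add_of_accretive hK
  have hv := isUnit_one_add_of_accretive hL
  have h1 : (1 + K) * A = A * (1 + L) := by rw [add_mul, h, mul_add, one_mul, mul_one]
  have h2 : Ring.inverse (1 + K) * A = A * Ring.inverse (1 + L) := by
    have := congrArg (fun f => Ring.inverse (1 + K) * f * Ring.inverse (1 + L)) h1
    simp only [← mul_assoc, Ring.inverse_mul_cancel _ hu, one_mul] at this
    simp only [mul_assoc, Ring.mul_inverse_cancel _ hv, mul_one] at this
    exact this.symm
  rw [cayley, cayley, sub_mul, mul_sub, smul_mul_assoc, h2, mul_smul_comm, one_mul, mul_one]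

end Cayley

/-- The Douglas–Kroll–Heß transformation `(1 + X)(1 - X²)^{-1/2}`. -/
def dkh (X : H →L[ℂ] H) : H →L[ℂ] H := (1 + X) * invSqrtSeries (X * X)

variable [CompleteSpace H]

lemma dkh_neg_mul {X : H →L[ℂ] H} (hX : ‖X * X‖ < 1) : dkh (-X) * dkh X = 1 := by
  have h1 : invSqrtSeries (X * X) * (1 + X) = (1 + X) * invSqrtSeries (X * X) :=
    invSqrtSeries_semiconj hX hX (by noncomm_ring)
  have h2 : invSqrtSeries (X * X) * (1 - X) = (1 - X) * invSqrtSeries (X * X) :=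
    invSqrtSeries_semiconj hX hX (by noncomm_ring)
  have h3 := invSqrtSeries_mul_self hX
  rw [dkh, dkh, neg_mul_neg, ← sub_eq_add_neg, ← h1, ← h2]
  calc _ = invSqrtSeries (X * X) * ((1 - X) * invSqrtSeries (X * X)) * (1 + X) := by
        simp only [mul_assoc]
    _ = invSqrtSeries (X * X) * invSqrtSeries (X * X) * ((1 - X) * (1 + X)) := by
        rw [← h2]; simp only [mul_assoc]
    _ = 1 := by
        rw [show (1 - X) * (1 + X) = 1 - X * X by noncomm_ring, h3]

lemma dkh_mul_neg {X : H →L[ℂ] H} (hX : ‖X * X‖ < 1) : dkh X * dkh (-X) = 1 := by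
  have := dkh_neg_mul (X := -X) (by rwa [neg_mul_neg])
  rwa [neg_neg] at this

lemma dkh_semiconj {X Y A : H →L[ℂ] H} (hX : ‖X * X‖ < 1) (hY : ‖Y * Y‖ < 1)
    (h : X * A = A * Y) : dkh X * A = A * dkh Y := by
  have h1 : X * X * A = A * (Y * Y) := by rw [mul_assoc, h, ← mul_assoc, h, mul_assoc]
  rw [dkh, mul_assoc, invSqrtSeries_semiconj hX hY h1, ← mul_assoc, add_mul, h, dkh, ← mul_assoc]
  rw [mul_add, one_mul, mul_one]

lemma star_dkh {X Y : H →L[ℂ] H} (hX : ‖X * X‖ < 1) (h : star X = -Y) :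
    star (dkh X) = dkh (-Y) := by
  have h1 : star (X * X) = Y * Y := by rw [star_mul, h, neg_mul_neg]
  have hY : ‖Y * Y‖ < 1 := by rwa [← h1, norm_star]
  rw [dkh, dkh, star_mul, invSqrtSeries_star hX (by rwa [h1]), h1, neg_mul_neg, star_add, h,
    star_one]
  exact invSqrtSeries_semiconj hY hY (by noncomm_ring)

lemma differentiableOn_dkh {X : ℂ → H →L[ℂ] H} {s : Set ℂ} (hs : IsOpen s) {θ : ℝ} (hθ : θ < 1)
    (hX : DifferentiableOn ℂ X s) (hb : ∀ z ∈ s, ‖X z * X z‖ ≤ θ) :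
    DifferentiableOn ℂ (fun z => dkh (X z)) s := by
  rcases s.eq_empty_or_nonempty with rfl | ⟨z₀, hz₀⟩
  · exact differentiableOn_empty
  have hθ0 : 0 ≤ θ := (norm_nonneg _).trans (hb z₀ hz₀)
  refine (hX.const_add 1).mul (differentiableOn_tsum_of_summable_norm
    ((summable_geometric_of_lt_one hθ0 hθ).mul_left (‖(1 : H →L[ℂ] H)‖ + 1)) (fun n => ?_) hs
    fun n z hz => norm_binomHalf_smul_le (hb z hz) n)
  exact ((hX.mul hX).neg.pow n).const_smul _

end Angular

section Angular
variable {H : Type*} [NormedAddCommGroup H] [InnerProductSpace ℂ H] [CompleteSpace H]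

variable {A J w S : H →L[ℂ] H}

lemma IsSgn.accretive_mul (h : IsSgn A J w S) (hs : SqrtSetup A J) {q : ℝ} (hw : ‖w‖ ≤ q)
    (hq : q < 1) (x : H) : (1 - q) / (1 + q) ^ 2 * ‖x‖ ^ 2 ≤ (⟪x, (J * S) x⟫).re := by
  have h0 := norm_nonneg w
  have h1 := h.accretive hs (hw.trans_lt hq) x
  rw [hs.symmJ] at h1
  refine le_trans ?_ h1
  have : 0 ≤ 1 - ‖w‖ := by linarith
  gcongr

lemma IsSgn.norm_J_mul_le (h : IsSgn A J w S) (hs : SqrtSetup A J) {q : ℝ} (hw : ‖w‖ ≤ q)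
    (hq : q < 1) : ‖J * S‖ ≤ 1 / (1 - q) := by
  have hq' : 0 < 1 - q := by linarith
  refine ContinuousLinearMap.opNorm_le_bound _ (by positivity) fun x => ?_
  rw [mul_apply_eq_comp, hs.norm_J]
  refine S.le_of_opNorm_le ((h.norm_le hs (hw.trans_lt hq)).trans ?_) x
  gcongr

lemma exists_norm_cayley_le {q : ℝ} (hq0 : 0 ≤ q) (hq : q < 1) :
    ∃ θ < 1, ∀ {A J w S : H →L[ℂ] H}, IsSgn A J w S → SqrtSetup A J → ‖w‖ ≤ q →
      ‖cayley (J * S) * cayley (J * S)‖ ≤ θ := by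
  have hq' : 0 < 1 - q := by linarith
  set θ := Real.sqrt (1 - 4 * ((1 - q) / (1 + q) ^ 2) / (1 + 1 / (1 - q)) ^ 2)
  have hθ1 : θ < 1 := sqrt_lt_one_of_pos (by positivity) (by positivity)
  refine ⟨θ, hθ1, fun {A J w S} h hs hw => ?_⟩
  have h1 := norm_cayley_le (by positivity) (fun x => h.accretive_mul hs hw hq x)
    (h.norm_J_mul_le hs hw hq)
  have hθ0 : 0 ≤ θ := Real.sqrt_nonneg _
  calc _ ≤ θ * θ := (norm_mul_le _ _).trans (mul_le_mul h1 h1 (norm_nonneg _) hθ0)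
    _ ≤ θ := mul_le_of_le_one_right hθ0 hθ1.le

variable {W Wh : H →L[ℂ] H} {σ X : ℂ → H →L[ℂ] H}

lemma SqrtSetup.isSelfAdjoint_left (hs : SqrtSetup A J) : star A = A := by
  rw [ContinuousLinearMap.star_eq_adjoint]
  exact (ContinuousLinearMap.eq_adjoint_iff _ _).2 hs.symmA |>.symm

lemma SqrtSetup.isSelfAdjoint_right (hs : SqrtSetup A J) : star J = J := by
  rw [ContinuousLinearMap.star_eq_adjoint]
  exact (ContinuousLinearMap.eq_adjoint_iff _ _).2 hs.symmJ |>.symm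

lemma star_cayley {K : H →L[ℂ] H} (hK : ∀ x, 0 ≤ (⟪x, K x⟫).re) :
    star (cayley K) = cayley (star K) := by
  obtain ⟨u, hu⟩ := isUnit_one_add_of_accretive hK
  have h : 1 + star K = ↑(star u) := by rw [Units.coe_star, hu, star_add, star_one]
  rw [cayley, cayley, h, ← hu, Ring.inverse_unit, Ring.inverse_unit, star_sub, star_smul, star_one,
    ← Units.coe_star, star_inv]
  simp

lemma differentiableOn_cayley {K : ℂ → H →L[ℂ] H} {s : Set ℂ}
    (hK : ∀ z ∈ s, ∀ x, 0 ≤ (⟪x, K z x⟫).re) (hd : DifferentiableOn ℂ K s) :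
    DifferentiableOn ℂ (fun z => cayley (K z)) s := by
  suffices h : DifferentiableOn ℂ (fun z => Ring.inverse (1 + K z)) s from
    (h.const_smul (2 : ℂ)).sub_const (1 : H →L[ℂ] H)
  intro z hz
  exact (differentiableAt_inverse (𝕜 := ℂ) (isUnit_one_add_of_accretive
    (hK z hz))).comp_differentiableWithinAt z ((hd z hz).const_add 1)

lemma triple_mul_cancel {M : Type*} [Monoid M] {a b c a' b' c' : M} (ha : a * a' = 1)
    (hb : b * b' = 1) (hc : c * c' = 1) : a * b * c * (c' * b' * a') = 1 := by
  calc _ = a * (b * (c * c') * b') * a' := by simp only [mul_assoc]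
    _ = 1 := by rw [hc, mul_one, hb, mul_one, ha]

/-- The sandwiched block-diagonalized operators `|H₀|^{-1/2} Ĥ_diag(γ) |H₀|^{-1/2}` form a bounded
holomorphic family of invertible operators. -/
theorem exists_holomorphic_family (hs : SqrtSetup A J) (hWs : star W = W)
    {q : ℝ} (hq : q < 1) (hW : ‖W‖ ≤ q) (hWh : ‖Wh‖ ≤ q) (hi : ∀ x, W (A x) = A (Wh x))
    (hσ : ∀ z ∈ Metric.ball (0 : ℂ) 1, IsSgn A J (z • W) (σ z))
    (hX : ∀ z ∈ Metric.ball (0 : ℂ) 1, σ z * (1 + X z) = J * (1 - X z))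
    (hXJ : ∀ z ∈ Metric.ball (0 : ℂ) 1, J * X z = - X z * J) :
    ∃ D : ℂ → H →L[ℂ] H, DifferentiableOn ℂ D (Metric.ball 0 1) ∧
      ∀ z ∈ Metric.ball (0 : ℂ) 1, star (D (conj z)) = D z ∧ ‖X z * X z‖ < 1 ∧
        ∃ D' M : H →L[ℂ] H, D z * D' = 1 ∧ D' * D z = 1 ∧
          (J + z • W) * M = 1 ∧ M * (J + z • W) = 1 ∧
          A * D' * A = dkh (-X z) * (A * M * A) * dkh (X z) := by
  have hq0 : 0 ≤ q := (norm_nonneg W).trans hW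
  have hq' : 0 < 1 - q := by linarith
  have hle : ∀ {z : ℂ}, z ∈ Metric.ball (0 : ℂ) 1 → ∀ {B : H →L[ℂ] H}, ‖B‖ ≤ q → ‖z • B‖ ≤ q :=
    fun {z} hz {B} hB => (SqrtSetup.norm_smul_clm_le hz).trans hB
  have hJJ : J * J = 1 := by ext x; simp [mul_apply_eq_comp, hs.invol]
  have hcj : ∀ {z : ℂ}, z ∈ Metric.ball (0 : ℂ) 1 → conj z ∈ Metric.ball (0 : ℂ) 1 := fun {z} hz => by
    rw [mem_ball_zero_iff] at hz ⊢
    rwa [RCLike.norm_conj]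
  have hex : ∀ z : ℂ, ∃ S, z ∈ Metric.ball (0 : ℂ) 1 → IsSgn A J (z • Wh) S := fun z => by
    by_cases hz : z ∈ Metric.ball (0 : ℂ) 1
    · obtain ⟨S, hS, -⟩ := hs.exists_isSgn ((hle hz hWh).trans_lt hq)
      exact ⟨S, fun _ => hS⟩
    · exact ⟨0, fun h => absurd h hz⟩
  choose σh hσh using hex
  obtain ⟨θ, hθ1, hθ⟩ := exists_norm_cayley_le (H := H) hq0 hq
  have hacc : ∀ {w S : H →L[ℂ] H}, IsSgn A J w S → ‖w‖ ≤ q → ∀ x, 0 ≤ (⟪x, (J * S) x⟫).re :=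
    fun h hw x => le_trans (by positivity) (h.accretive_mul hs hw hq x)
  have hXc : ∀ z ∈ Metric.ball (0 : ℂ) 1, X z = cayley (J * σ z) := fun z hz => by
    refine eq_cayley (hacc (hσ z hz) (hle hz hW)) ?_
    rw [mul_assoc, hX z hz, ← mul_assoc, hJJ, one_mul]
  set Xh : ℂ → H →L[ℂ] H := fun z => cayley (J * σh z) with hXh
  have hXX : ∀ z ∈ Metric.ball (0 : ℂ) 1, ‖X z * X z‖ < 1 := fun z hz => by
    rw [hXc z hz]
    exact (hθ (hσ z hz) hs (hle hz hW)).trans_lt hθ1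
  have hXhθ : ∀ z ∈ Metric.ball (0 : ℂ) 1, ‖Xh z * Xh z‖ ≤ θ := fun z hz =>
    hθ (hσh z hz) hs (hle hz hWh)
  have hXXh : ∀ z ∈ Metric.ball (0 : ℂ) 1, ‖Xh z * Xh z‖ < 1 := fun z hz =>
    (hXhθ z hz).trans_lt hθ1
  have hXA : ∀ z ∈ Metric.ball (0 : ℂ) 1, X z * A = A * Xh z := fun z hz => by
    rw [hXc z hz]
    refine cayley_semiconj (hacc (hσ z hz) (hle hz hW)) (hacc (hσh z hz) (hle hz hWh)) ?_
    ext x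
    have := (hσ z hz).intertw (hσh z hz) hs ((hle hz hW).trans_lt hq) ((hle hz hWh).trans_lt hq)
      (fun x => by simp [hi]) x
    simp [mul_apply_eq_comp, this, hs.comm]
  have hstarσ : ∀ z ∈ Metric.ball (0 : ℂ) 1, star (σ z) = σ (conj z) := fun z hz => by
    rw [ContinuousLinearMap.star_eq_adjoint]
    refine ((ContinuousLinearMap.eq_adjoint_iff _ _).2 fun y x => ?_).symm
    refine (hσ z hz).inner_symm (hσ _ (hcj hz)) hs ((hle hz hW).trans_lt hq)
      ((hle (hcj hz) hW).trans_lt hq) (fun x y => ?_) x y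
    have hW' : ∀ x y, ⟪W y, x⟫ = ⟪y, W x⟫ := fun x y => by
      conv_lhs => rw [← hWs]
      rw [ContinuousLinearMap.star_eq_adjoint, ContinuousLinearMap.adjoint_inner_left]
    simp [hW', mul_comm]
  have hstarX : ∀ z ∈ Metric.ball (0 : ℂ) 1, star (X z) = - X (conj z) := fun z hz => by
    rw [hXc z hz, star_cayley (hacc (hσ z hz) (hle hz hW)), star_mul, hs.isSelfAdjoint_right,
      hstarσ z hz]
    refine (eq_cayley (fun x => ?_) ?_).symm
    · have := hacc (hσ _ (hcj hz)) (hle (hcj hz) hW) (J x)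
      simpa [mul_apply_eq_comp, hs.symmJ, hs.invol] using this
    · have h2 : J * (1 - X (conj z)) = (1 + X (conj z)) * J := by
        rw [mul_sub, hXJ _ (hcj hz)]; noncomm_ring
      rw [← sub_eq_add_neg, mul_assoc, h2, ← mul_assoc, hX _ (hcj hz), h2, mul_assoc, hJJ]
      noncomm_ring
  have hsA := hs.isSelfAdjoint_left
  have hdA : ∀ z ∈ Metric.ball (0 : ℂ) 1, dkh (X z) * A = A * dkh (Xh z) := fun z hz =>
    dkh_semiconj (hXX z hz) (hXXh z hz) (hXA z hz)
  have hdA' : ∀ z ∈ Metric.ball (0 : ℂ) 1, dkh (-X z) * A = A * dkh (-Xh z) := fun z hz =>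
    dkh_semiconj (by rw [neg_mul_neg]; exact hXX z hz) (by rw [neg_mul_neg]; exact hXXh z hz)
      (by rw [neg_mul, hXA z hz, mul_neg])
  have hσd : DifferentiableOn ℂ σh (Metric.ball 0 1) := fun z hz =>
    (IsSgn.differentiableAt hs (hWh.trans_lt hq) hσh hz).differentiableWithinAt
  have hXd : DifferentiableOn ℂ Xh (Metric.ball 0 1) :=
    differentiableOn_cayley (fun z hz => hacc (hσh z hz) (hle hz hWh)) (hσd.const_mul J)
  have hUd : DifferentiableOn ℂ (fun z => dkh (Xh z)) (Metric.ball 0 1) :=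
    differentiableOn_dkh Metric.isOpen_ball hθ1 hXd hXhθ
  refine ⟨fun z => star (dkh (Xh (conj z))) * (J + z • W) * dkh (Xh z), ?_, fun z hz =>
    ⟨?_, hXX z hz, ?_⟩⟩
  · refine (DifferentiableOn.mul (fun z hz => ?_) ?_).mul hUd
    · have := ((hUd _ (hcj hz)).differentiableAt (Metric.isOpen_ball.mem_nhds (hcj hz))).star_conj
      simp only [Complex.conj_conj] at this
      exact this.differentiableWithinAt
    · exact (differentiable_id.smul_const W).differentiableOn.const_add J
  · simp only [Complex.conj_conj, star_mul, star_star, star_add, star_smul, hWs,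
      hs.isSelfAdjoint_right, RCLike.star_def]
    rw [mul_assoc]
  · obtain ⟨u, hu⟩ : IsUnit (J + z • W) := by
      have := hs.isUnit_J_add_sub 0 ((hle hz hW).trans_lt hq)
      simpa using this
    refine ⟨dkh (-Xh z) * ↑u⁻¹ * star (dkh (-Xh (conj z))), ↑u⁻¹, ?_, ?_, ?_, ?_, ?_⟩
    · refine triple_mul_cancel ?_ (by rw [← hu]; exact u.mul_inv) (dkh_mul_neg (hXXh z hz))
      rw [← star_mul, dkh_neg_mul (hXXh _ (hcj hz)), star_one]
    · refine triple_mul_cancel (dkh_neg_mul (hXXh z hz)) (by rw [← hu]; exact u.inv_mul) ?_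
      rw [← star_mul, dkh_mul_neg (hXXh _ (hcj hz)), star_one]
    · rw [← hu]; exact u.mul_inv
    · rw [← hu]; exact u.inv_mul
    · have h1 : star (dkh (-X (conj z))) = dkh (X z) := by
        have := star_dkh (X := -X (conj z)) (Y := -X z)
          (by rw [neg_mul_neg]; exact hXX _ (hcj hz))
          (by rw [star_neg, hstarX _ (hcj hz), Complex.conj_conj])
        rwa [neg_neg] at this
      have h2 : star (dkh (-Xh (conj z))) * A = A * dkh (X z) := by
        have := congrArg star (hdA' _ (hcj hz))
        rw [star_mul, star_mul, hsA, h1] at this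
        exact this.symm
      calc _ = (A * dkh (-Xh z)) * ↑u⁻¹ * (star (dkh (-Xh (conj z))) * A) := by
            simp only [mul_assoc]
        _ = _ := by rw [h2, ← hdA' z hz]; simp only [mul_assoc]

end Angular

section InverseOperator
variable {H : Type*} [NormedAddCommGroup H] [InnerProductSpace ℂ H] [CompleteSpace H]

variable {k : H →L[ℂ] H}

lemma mem_pinv_graph (hk : ∀ x, k x = 0 → x = 0) {u v : H} :
    (u, v) ∈ (pinv k).graph ↔ k v = u := by
  rw [pinv, Submodule.toLinearPMap_graph_eq]
  · simp [eq_comm]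
  · rintro ⟨a, b⟩ h (rfl : a = 0)
    have : 0 = k b := by simpa using h
    exact hk b this.symm

lemma mem_pinv_domain (hk : ∀ x, k x = 0 → x = 0) {u : H} :
    u ∈ (pinv k).domain ↔ ∃ v, k v = u := by
  simp only [LinearPMap.mem_domain_iff, mem_pinv_graph hk]

lemma pinv_apply_eq (hk : ∀ x, k x = 0 → x = 0) (u : (pinv k).domain) : k (pinv k u) = u :=
  (mem_pinv_graph hk).1 ((pinv k).mem_graph u)

lemma pinv_apply (hk : ∀ x, k x = 0 → x = 0) (v : H) (h : k v ∈ (pinv k).domain) :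
    pinv k ⟨k v, h⟩ = v := by
  have := pinv_apply_eq hk ⟨k v, h⟩
  rw [← sub_eq_zero, ← map_sub] at this
  exact sub_eq_zero.1 (hk _ this)

lemma pApply_pinv (hk : ∀ x, k x = 0 → x = 0) (v : H) : pApply (pinv k) (k v) = v := by
  have h : k v ∈ (pinv k).domain := (mem_pinv_domain hk).2 ⟨v, rfl⟩
  rw [pApply, dif_pos h, pinv_apply hk]

lemma eq_pinv_of_graph (hk : ∀ x, k x = 0 → x = 0) {T : H →ₗ.[ℂ] H}
    (h : ∀ u v, (u, v) ∈ T.graph ↔ k v = u) : T = pinv k := by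
  refine LinearPMap.eq_of_eq_graph ?_
  ext ⟨u, v⟩
  rw [h, mem_pinv_graph hk]

lemma pinv_isClosed (hk : ∀ x, k x = 0 → x = 0) : (pinv k).IsClosed := by
  have : ((pinv k).graph : Set (H × H)) = {p | k p.2 = p.1} := by
    ext ⟨u, v⟩
    exact mem_pinv_graph hk
  rw [LinearPMap.IsClosed, this]
  exact isClosed_eq (k.continuous.comp continuous_snd) continuous_fst

lemma dense_range_of_star_inj (hk' : ∀ x, star k x = 0 → x = 0) : DenseRange k := by
  have h : (LinearMap.range (k : H →ₗ[ℂ] H)).topologicalClosure = ⊤ := by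
    rw [Submodule.topologicalClosure_eq_top_iff, Submodule.eq_bot_iff]
    intro y hy
    refine hk' y (ext_inner_right ℂ fun x => ?_)
    rw [ContinuousLinearMap.star_eq_adjoint, ContinuousLinearMap.adjoint_inner_left,
      inner_zero_left, ← inner_conj_symm, hy (k x) ⟨x, rfl⟩, map_zero]
  have h2 := congrArg (fun K : Submodule ℂ H => (K : Set H)) h
  simp only [Submodule.topologicalClosure_coe, Submodule.top_coe] at h2
  exact dense_iff_closure_eq.2 h2

lemma pinv_dense (hk : ∀ x, k x = 0 → x = 0) (hk' : ∀ x, star k x = 0 → x = 0) :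
    Dense ((pinv k).domain : Set H) := by
  have h : ((pinv k).domain : Set H) = Set.range k := by
    ext u
    simp [mem_pinv_domain hk]
  rw [h]
  exact dense_range_of_star_inj hk'

lemma pinv_adjoint (hk : ∀ x, k x = 0 → x = 0) (hk' : ∀ x, star k x = 0 → x = 0) :
    (pinv k).adjoint = pinv (star k) := by
  refine eq_pinv_of_graph hk' fun y x => ?_
  rw [LinearPMap.adjoint_graph_eq_graph_adjoint (pinv_dense hk hk'), Submodule.mem_adjoint_iff]
  simp only [mem_pinv_graph hk]
  constructor
  · intro h
    refine ext_inner_right ℂ fun u => ?_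
    have := h (k u) u rfl
    rw [ContinuousLinearMap.star_eq_adjoint, ContinuousLinearMap.adjoint_inner_left]
    rw [sub_eq_zero] at this
    rw [← inner_conj_symm x, ← this, inner_conj_symm]
  · rintro rfl a b rfl
    rw [ContinuousLinearMap.star_eq_adjoint, ContinuousLinearMap.adjoint_inner_right, sub_self]

/-- A resolvent of `k⁻¹` in terms of an inverse of `1 - z k`. -/
lemma isResolventAt_pinv (hk : ∀ x, k x = 0 → x = 0) {z : ℂ} {M : H →L[ℂ] H}
    (h1 : (1 - z • k) * M = 1) (h2 : M * (1 - z • k) = 1) :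
    IsResolventAt (pinv k) z (k * M) := by
  have hc : k * M = M * k := by
    calc k * M = M * (1 - z • k) * k * M := by rw [h2, one_mul]
      _ = M * k * ((1 - z • k) * M) := by noncomm_ring
      _ = M * k := by rw [h1, mul_one]
  have e1 : ∀ y, M y - z • k (M y) = y := fun y => by
    simpa using congrArg (fun f : H →L[ℂ] H => f y) h1
  have e2 : ∀ y, M (y - z • k y) = y := fun y => by
    simpa [-map_sub] using congrArg (fun f : H →L[ℂ] H => f y) h2
  constructor
  · intro u
    have h := pinv_apply_eq hk u
    set x := pinv k u
    rw [hc, mul_apply_eq_comp, ← h, map_sub, map_smul]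
    exact e2 (k x)
  · intro y
    refine ⟨(mem_pinv_domain hk).2 ⟨M y, rfl⟩, ?_⟩
    have := pinv_apply hk (M y) ((mem_pinv_domain hk).2 ⟨M y, rfl⟩)
    simp only [mul_apply_eq_comp]
    rw [this]
    exact e1 y

end InverseOperator

section FormOperator
variable {H : Type*} [NormedAddCommGroup H] [InnerProductSpace ℂ H] [CompleteSpace H]

lemma clm_congr {f g : H →L[ℂ] H} (h : f = g) (x : H) : f x = g x := by rw [h]

lemma triple_inj {A s s' : H →L[ℂ] H} (hA : ∀ x, A x = 0 → x = 0) (h : s * s' = 1) (x : H)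
    (hx : (A * s' * A) x = 0) : x = 0 := by
  have h1 : s' (A x) = 0 := hA _ hx
  have h2 := clm_congr h (A x)
  rw [mul_apply_eq_comp, h1, map_zero] at h2
  exact hA _ h2.symm

lemma star_triple {A s' : H →L[ℂ] H} (hA : star A = A) :
    star (A * s' * A) = A * star s' * A := by
  rw [star_mul, star_mul, hA, mul_assoc]

lemma star_triple_inj {A s s' : H →L[ℂ] H} (hA : ∀ x, A x = 0 → x = 0) (hAs : star A = A)
    (h : s' * s = 1) (x : H) (hx : star (A * s' * A) x = 0) : x = 0 := by
  rw [star_triple hAs] at hx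
  exact triple_inj hA (s := star s) (by rw [← star_mul, h, star_one]) x hx

lemma star_inner_left (k : H →L[ℂ] H) (x y : H) : ⟪star k x, y⟫ = ⟪x, k y⟫ := by
  rw [ContinuousLinearMap.star_eq_adjoint, ContinuousLinearMap.adjoint_inner_left]

lemma star_inner_right (k : H →L[ℂ] H) (x y : H) : ⟪x, star k y⟫ = ⟪k x, y⟫ := by
  rw [ContinuousLinearMap.star_eq_adjoint, ContinuousLinearMap.adjoint_inner_right]

/-- The operator associated with the form `h[A u, A w] = (s u, w)` on the range of `A`
is `(A s⁻¹ A)⁻¹`. -/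
lemma isAssocForm_iff {A s s' : H →L[ℂ] H} (hA : ∀ x, A x = 0 → x = 0) (hAs : star A = A)
    (h1 : s * s' = 1) (h2 : s' * s = 1) {h : H → H → ℂ}
    (hh : ∀ u w, h (A u) (A w) = ⟪w, s u⟫) {T : H →ₗ.[ℂ] H} :
    IsAssocForm (pinv A).domain h T ↔ T = pinv (A * s' * A) := by
  have hk := triple_inj hA h1
  have hk' := star_triple_inj hA hAs h2
  have e1 : ∀ x, s (s' x) = x := clm_congr h1
  have e2 : ∀ x, s' (s x) = x := clm_congr h2
  have hsA : ∀ x y, ⟪A x, y⟫ = ⟪x, A y⟫ := fun x y => by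
    conv_lhs => rw [← hAs]
    exact star_inner_left A x y
  constructor
  · rintro ⟨hc, hd, hdom, hdom', hf, hf'⟩
    have hT : ∀ u : T.domain, (A * s' * A) (T u) = u := fun u => by
      obtain ⟨u0, hu0⟩ := (mem_pinv_domain hA).1 (hdom u.2)
      have : A (T u) = s u0 := ext_inner_left ℂ fun w => by
        rw [← hsA, hf u (A w) ((mem_pinv_domain hA).2 ⟨w, rfl⟩), ← hu0, hh]
      rw [mul_apply_eq_comp, mul_apply_eq_comp, this, e2, hu0]
    have hTs : ∀ w : T.adjoint.domain, star (A * s' * A) (T.adjoint w) = w := fun w => by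
      obtain ⟨w0, hw0⟩ := (mem_pinv_domain hA).1 (hdom' w.2)
      have : A (T.adjoint w) = star s w0 := ext_inner_right ℂ fun u => by
        rw [hsA, hf' (A u) ((mem_pinv_domain hA).2 ⟨u, rfl⟩) w, ← hw0, hh, star_inner_left]
      have h3 := clm_congr (congrArg star h1) w0
      rw [star_mul, star_one, mul_apply_eq_comp, one_apply_eq_self] at h3
      rw [star_triple hAs, mul_apply_eq_comp, mul_apply_eq_comp, this, h3, hw0]
    have hTg : ∀ {u v}, (u, v) ∈ T.graph → (A * s' * A) v = u := fun {u v} huv => by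
      obtain ⟨x, hx⟩ := (LinearPMap.mem_graph_iff' T).1 huv
      obtain ⟨rfl, rfl⟩ := Prod.mk.inj hx
      exact hT x
    set k := A * s' * A with hkdef
    let M : Submodule ℂ H := T.graph.comap ((k : H →ₗ[ℂ] H).prod LinearMap.id)
    have hM : ∀ v, v ∈ M ↔ (k v, v) ∈ T.graph := fun v => Iff.rfl
    have hMc : IsClosed (M : Set H) :=
      hc.preimage (k.continuous.prodMk continuous_id)
    have : CompleteSpace M := hMc.completeSpace_coe
    have hMt : M = ⊤ := by
      rw [← Submodule.orthogonal_eq_bot_iff, Submodule.eq_bot_iff]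
      intro y hy
      have hy' : (y, (0 : H)) ∈ T.adjoint.graph := by
        rw [LinearPMap.adjoint_graph_eq_graph_adjoint hd, Submodule.mem_adjoint_iff]
        intro a b hab
        have : b ∈ M := by
          rw [hM]
          have : k b = a := hTg hab
          rwa [this]
        rw [hy b this, inner_zero_right, sub_zero]
      obtain ⟨w, hw⟩ := (LinearPMap.mem_graph_iff' _).1 hy'
      obtain ⟨h4, h5⟩ := Prod.mk.inj hw
      rw [← h4, ← hTs w, h5, map_zero]
    refine eq_pinv_of_graph hk fun u v => ⟨hTg, ?_⟩
    · rintro rfl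
      exact (hM v).1 (hMt ▸ Submodule.mem_top)
  · rintro rfl
    refine ⟨pinv_isClosed hk, pinv_dense hk hk', fun u hu => ?_, ?_, fun u w hw => ?_, ?_⟩
    · obtain ⟨v, rfl⟩ := (mem_pinv_domain hk).1 hu
      exact (mem_pinv_domain hA).2 ⟨_, rfl⟩
    · rw [pinv_adjoint hk hk']
      intro u hu
      obtain ⟨v, rfl⟩ := (mem_pinv_domain hk').1 hu
      rw [star_triple hAs]
      exact (mem_pinv_domain hA).2 ⟨_, rfl⟩
    · obtain ⟨w, rfl⟩ := (mem_pinv_domain hA).1 hw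
      rw [← pinv_apply_eq hk u, mul_apply_eq_comp, mul_apply_eq_comp, hh, e1, hsA]
    · intro u hu w
      obtain ⟨u, rfl⟩ := (mem_pinv_domain hA).1 hu
      have hw : star (A * s' * A) ((pinv (A * s' * A)).adjoint w) = w := by
        rw [← mem_pinv_graph hk', ← pinv_adjoint hk hk']
        exact LinearPMap.mem_graph _ w
      rw [← hw, star_triple hAs, mul_apply_eq_comp, mul_apply_eq_comp, hh, star_inner_left, e2,
        hsA]

lemma conjPMap_pinv {W W' k : H →L[ℂ] H} (hk : ∀ x, k x = 0 → x = 0)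
    (h1 : W * W' = 1) (h2 : W' * W = 1) : conjPMap W W' (pinv k) = pinv (W' * k * W) := by
  have e1 : ∀ x, W (W' x) = x := clm_congr h1
  have e2 : ∀ x, W' (W x) = x := clm_congr h2
  refine eq_pinv_of_graph (fun x hx => ?_) fun u v => ?_
  · have h3 : k (W x) = 0 := by
      have := congrArg W hx
      simpa only [mul_apply_eq_comp, e1, map_zero] using this
    rw [← e2 x, hk _ h3, map_zero]
  · simp only [mul_apply_eq_comp]
    constructor
    · intro h
      obtain ⟨x, hx⟩ := (LinearPMap.mem_graph_iff' _).1 h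
      have hu : (x : H) = u := congrArg Prod.fst hx
      have hv : W' (pinv k ⟨W x, x.2⟩) = v := congrArg Prod.snd hx
      have := pinv_apply_eq hk ⟨W x, x.2⟩
      rw [← hv, e1, this, e2, hu]
    · rintro rfl
      have hd : k (W v) ∈ (pinv k).domain := (mem_pinv_domain hk).2 ⟨_, rfl⟩
      have hd' : W (W' (k (W v))) ∈ (pinv k).domain := by rwa [e1]
      refine (LinearPMap.mem_graph_iff' _).2 ⟨⟨W' (k (W v)), hd'⟩, Prod.ext rfl ?_⟩
      change W' (pinv k ⟨W (W' (k (W v))), hd'⟩) = v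
      have h3 : (⟨W (W' (k (W v))), hd'⟩ : (pinv k).domain) = ⟨k (W v), hd⟩ :=
        Subtype.ext (e1 _)
      rw [h3, pinv_apply hk, e2]

lemma isCore_pinv {A s s' : H →L[ℂ] H} (hA : ∀ x, A x = 0 → x = 0) (hAs : star A = A)
    (h1 : s * s' = 1) (h2 : s' * s = 1) :
    IsCore (pinv A) (pinv (A * s' * A)).domain := by
  have hk := triple_inj hA h1
  have hd : (pinv (A * s' * A)).domain ≤ (pinv A).domain := fun u hu => by
    obtain ⟨v, rfl⟩ := (mem_pinv_domain hk).1 hu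
    exact (mem_pinv_domain hA).2 ⟨_, rfl⟩
  refine ⟨hd, ?_⟩
  set D := (pinv (A * s' * A)).domain
  have hle : (pinv A).domRestrict D ≤ pinv A := LinearPMap.domRestrict_le
  have hcl : ((pinv A).domRestrict D).IsClosable :=
    (pinv_isClosed hA).isClosable.leIsClosable hle
  refine eq_pinv_of_graph hA fun u v => ?_
  rw [← hcl.graph_closure_eq_closure_graph]
  constructor
  · intro h
    have h3 : ((pinv A).domRestrict D).graph.topologicalClosure ≤ (pinv A).graph :=
      Submodule.topologicalClosure_minimal _ (LinearPMap.le_graph_of_le hle) (pinv_isClosed hA)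
    exact (mem_pinv_graph hA).1 (h3 h)
  · rintro rfl
    have hsr : DenseRange s' := Function.Surjective.denseRange fun x => ⟨s x, clm_congr h2 x⟩
    have hAr : DenseRange A := by
      refine dense_range_of_star_inj (k := A) fun x hx => hA x ?_
      rwa [hAs] at hx
    have hdr : DenseRange fun x => s' (A x) := hsr.comp hAr s'.continuous
    refine hdr.induction_on (p := fun v => (A v, v) ∈
      ((pinv A).domRestrict D).graph.topologicalClosure) v ?_ fun x => ?_
    · exact (Submodule.isClosed_topologicalClosure _).preimage
        (A.continuous.prodMk continuous_id)
    · refine Submodule.le_topologicalClosure _ ?_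
      have hx : A (s' (A x)) ∈ D := (mem_pinv_domain hk).2 ⟨x, rfl⟩
      refine (LinearPMap.mem_graph_iff' _).2 ⟨⟨A (s' (A x)), ⟨hx, hd hx⟩⟩, Prod.ext rfl ?_⟩
      exact pinv_apply hA _ (hd hx)

/-- The resolvent of a self-adjoint operator `k⁻¹` at `i`. -/
lemma exists_inverse_one_sub {k : H →L[ℂ] H} (hk : star k = k) :
    ∃ M : H →L[ℂ] H, (1 - I • k) * M = 1 ∧ M * (1 - I • k) = 1 ∧ ‖M‖ ≤ 1 := by
  have hre : ∀ x, (⟪x, (-(I • k)) x⟫).re = 0 := fun x => by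
    have h1 : (⟪x, k x⟫).im = 0 := by
      have h2 := inner_conj_symm (𝕜 := ℂ) x (k x)
      rw [show ⟪k x, x⟫ = ⟪x, k x⟫ by
        conv_lhs => rw [← hk]
        exact star_inner_left k x x] at h2
      have := congrArg Complex.im h2
      rw [conj_im] at this
      linarith
    rw [neg_apply, smul_apply, inner_neg_right, inner_smul_right, neg_re, mul_re, h1]
    simp
  have hu := isUnit_one_add_of_accretive (K := -(I • k)) fun x => (hre x).ge
  rw [← sub_eq_add_neg] at hu
  refine ⟨Ring.inverse (1 - I • k), Ring.mul_inverse_cancel _ hu, Ring.inverse_mul_cancel _ hu,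
    ContinuousLinearMap.opNorm_le_bound _ zero_le_one fun y => ?_⟩
  set x := Ring.inverse (1 - I • k) y with hx
  have hy : y = x + (-(I • k)) x := by
    have := clm_congr (Ring.mul_inverse_cancel _ hu) y
    rw [mul_apply_eq_comp, one_apply_eq_self, ← hx, sub_eq_add_neg, add_apply,
      one_apply_eq_self] at this
    exact this.symm
  have h3 : ‖y‖ ^ 2 = ‖x‖ ^ 2 + ‖(-(I • k)) x‖ ^ 2 := by
    rw [hy, @norm_add_sq ℂ, RCLike.re_to_complex, hre]; ring
  rw [one_mul]
  refine le_of_sq_le_sq ?_ (norm_nonneg _)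
  nlinarith [sq_nonneg ‖(-(I • k)) x‖]

lemma norm_resolvent_sub_le {k l : H →L[ℂ] H} (hk : ∀ x, k x = 0 → x = 0)
    (hl : ∀ x, l x = 0 → x = 0) (hks : star k = k) (hls : star l = l) :
    ∃ M N : H →L[ℂ] H, IsResolventAt (pinv k) I M ∧ IsResolventAt (pinv l) I N ∧
      ‖M - N‖ ≤ ‖k - l‖ := by
  obtain ⟨M, hM1, hM2, hM3⟩ := exists_inverse_one_sub hks
  obtain ⟨N, hN1, hN2, hN3⟩ := exists_inverse_one_sub hls
  refine ⟨k * M, l * N, isResolventAt_pinv hk hM1 hM2, isResolventAt_pinv hl hN1 hN2, ?_⟩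
  have e : k * M - l * N = M * (k - l) * N := by
    have hc : k * M = M * k := by
      calc k * M = M * (1 - I • k) * k * M := by rw [hM2, one_mul]
        _ = M * k * ((1 - I • k) * M) := by noncomm_ring
        _ = M * k := by rw [hM1, mul_one]
    calc k * M - l * N = M * k * ((1 - I • l) * N) - M * (1 - I • k) * l * N := by
          rw [hN1, hM2, mul_one, one_mul, hc]
      _ = M * (k - l) * N := by noncomm_ring
  rw [e]
  calc ‖M * (k - l) * N‖ ≤ ‖M‖ * ‖k - l‖ * ‖N‖ :=
        (norm_mul_le _ _).trans (by gcongr; exact norm_mul_le _ _)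
    _ ≤ 1 * ‖k - l‖ * 1 := by gcongr
    _ = ‖k - l‖ := by ring

lemma commute_of_decomposedBy {k Qp Qm : H →L[ℂ] H} (hk : ∀ x, k x = 0 → x = 0)
    (h : DecomposedBy (pinv k) Qp Qm) :
    (∀ x, k (Qp x) = Qp (k x)) ∧ ∀ x, k (Qm x) = Qm (k x) := by
  have key : ∀ {Q : H →L[ℂ] H}, (∀ u : (pinv k).domain, ∃ hp : Q (u : H) ∈ (pinv k).domain,
      pinv k ⟨Q (u : H), hp⟩ = Q (pinv k u)) → ∀ x, k (Q x) = Q (k x) := fun {Q} hQ x => by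
    have hd : k x ∈ (pinv k).domain := (mem_pinv_domain hk).2 ⟨x, rfl⟩
    obtain ⟨h1, h2⟩ := hQ ⟨k x, hd⟩
    have h3 := pinv_apply_eq hk ⟨Q (k x), h1⟩
    rw [pinv_apply hk] at h2
    rw [← h2]; exact h3
  exact ⟨key h.2.2.2.1, key h.2.2.2.2⟩

lemma exists_halfRes_of_partResolvent {k Q : H →L[ℂ] H} (hk : ∀ x, k x = 0 → x = 0)
    (hc : ∀ x, k (Q x) = Q (k x)) (hQ : ∀ x, Q (Q x) = Q x) (s : ℂ) (hs : s * s = 1)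
    (h : ∀ z : ℂ, 0 ≤ z.re → ∃ M, IsPartResolventAt (pinv k) Q (s * z) M) :
    ∃ r, HalfRes (s • k) Q r := by
  choose! M hM using h
  refine ⟨fun z => s • M z, ⟨fun z hz x => ?_, fun z hz x => ?_, fun z hz x => ?_,
    fun z hz x => ?_⟩⟩
  · obtain ⟨h1, h2, h3, h4⟩ := hM z hz
    have hd : k (Q x) ∈ (pinv k).domain := (mem_pinv_domain hk).2 ⟨_, rfl⟩
    have h5 := h4 ⟨k (Q x), hd⟩ (by rw [← hc, hQ])
    rw [pinv_apply hk] at h5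
    simp only [smul_apply]
    refine congrArg (s • ·) (Eq.trans ?_ h5)
    rw [← h1 (x - z • s • k x)]
    congr 1
    rw [map_sub, map_smul, map_smul, ← hc, smul_smul, mul_comm z]
  · obtain ⟨h1, h2, h3, h4⟩ := hM z hz
    obtain ⟨h5, h6⟩ := h3 x
    have h7 := pinv_apply_eq hk ⟨M z x, h5⟩
    simp only at h7
    rw [sub_eq_iff_eq_add] at h6
    rw [h6, map_add, map_smul] at h7
    simp only [smul_apply, map_smul]
    have h8 : s • k (Q x) = s • (M z x - (s * z) • k (M z x)) := by
      rw [← eq_sub_iff_add_eq.2 h7]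
    rw [h8, smul_sub, smul_smul, smul_smul, smul_smul, ← mul_assoc s s z, hs, one_mul,
      mul_assoc z, hs, mul_one]
  · obtain ⟨h1, h2, h3, h4⟩ := hM z hz
    simp only [smul_apply, h1]
  · obtain ⟨h1, h2, h3, h4⟩ := hM z hz
    simp only [smul_apply, map_smul, h2]

end FormOperator

section DiagFamily
variable {H : Type*} [NormedAddCommGroup H] [InnerProductSpace ℂ H] [CompleteSpace H]

/-- The abstract properties of the potential `W` and of its conjugate `Wh` under `A`. -/
structure PotData (A J W Wh : H →L[ℂ] H) (q a b κ : ℝ) : Prop extends SqrtSetup A J where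
  hq1 : q < 1
  ha : 0 ≤ a
  hb : 0 ≤ b
  hκ : 0 ≤ κ
  star_W : star W = W
  norm_W : ‖W‖ ≤ q
  norm_Wh : ‖Wh‖ ≤ q
  intertw : ∀ x, W (A x) = A (Wh x)
  loc : ∀ ρ ε : ℝ, 0 < ρ → 0 < ε → ∃ (E V : H →L[ℂ] H) (g : H → ℝ),
    (∀ x, star Wh x = star Wh (E x) + A (A (V x))) ∧ ‖V‖ ≤ a + b / ρ ∧ (∀ x, 0 ≤ g x) ∧
    (∀ (t : ℂ) x, g (t • x) = ‖t‖ * g x) ∧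
    (∀ (K : H →L[ℂ] H) (n : ℕ) (e : Fin n → H), Orthonormal ℂ e →
      ∑ i, g (K (e i)) ^ 2 ≤ κ * (ρ / ε) ^ 3 * ‖K‖ ^ 2) ∧
    ∀ u, ‖E (A (A u))‖ ≤ 2 * ε * ‖u‖ + 2 * g (A (A u))

variable {A J W Wh : H →L[ℂ] H} {q a b κ : ℝ}

lemma PotData.exists_potSetup (h : PotData A J W Wh q a b κ) {z : ℂ}
    (hz : z ∈ Metric.ball (0 : ℂ) 1) {M : H →L[ℂ] H} (h1 : (J + z • W) * M = 1)
    (h2 : M * (J + z • W) = 1) :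
    ∃ G, PotSetup A J (z • W) (z • star Wh) (A * M * A) G q a b κ := by
  have hAs := h.toSqrtSetup.isSelfAdjoint_left
  have hz1 : ‖z‖ ≤ 1 := (mem_ball_zero_iff.1 hz).le
  have hu : IsUnit (J + z • Wh) := by
    have := h.toSqrtSetup.isUnit_J_add_sub 0 (w := z • Wh)
      (((SqrtSetup.norm_smul_clm_le hz).trans h.norm_Wh).trans_lt h.hq1)
    simpa using this
  have hG := clm_congr (Ring.mul_inverse_cancel _ hu)
  have hM1 := clm_congr h1
  have hM2 := clm_congr h2
  have hA : ∀ x, star A x = A x := clm_congr hAs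
  simp only [mul_apply_eq_comp, add_apply, smul_apply, one_apply_eq_self] at hG hM1 hM2
  refine ⟨Ring.inverse (J + z • Wh), { toSqrtSetup := h.toSqrtSetup
                                       hq0 := (norm_nonneg W).trans h.norm_W
                                       hq1 := h.hq1
                                       ha := h.ha
                                       hb := h.hb
                                       hκ := h.hκ
                                       norm_w := (SqrtSetup.norm_smul_clm_le hz).trans h.norm_W
                                       norm_wt := (SqrtSetup.norm_smul_clm_le hz).trans
                                         (by rw [norm_star]; exact h.norm_Wh)
                                       solve := fun x => ⟨M (A x), rfl, hM1 (A x)⟩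
                                       intertw := fun x => ?_
                                       fact := fun x => ?_
                                       loc := fun ρ ε hρ hε => ?_ }⟩
  · simp only [smul_apply, map_smul]
    congr 1
    refine ext_inner_left ℂ fun y => ?_
    rw [star_inner_right, ← h.symmA, ← h.symmA, ← h.intertw, ← star_inner_right, h.star_W]
  · have h3 : J (A (Ring.inverse (J + z • Wh) x)) + z • W (A (Ring.inverse (J + z • Wh) x)) =
        A x := by
      rw [h.comm, h.intertw, ← map_smul, ← map_add, hG]
    have h4 := hM2 (A (Ring.inverse (J + z • Wh) x))
    rw [h3] at h4
    rw [mul_apply_eq_comp, mul_apply_eq_comp, h4]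
  · obtain ⟨E, V, g, hV1, hV2, h3⟩ := h.loc ρ ε hρ hε
    refine ⟨E, z • V, g, fun x => ?_, (SqrtSetup.norm_smul_clm_le hz).trans hV2, h3⟩
    simp only [smul_apply, map_smul]
    rw [hV1 x, smul_add]

/-- The relations between the projections `P±` and the angular operators `X±`. -/
structure AngularPair (Pp Pm Xp Xm Qp Qm : H →L[ℂ] H) : Prop where
  right_p : ∀ u, Xp (Pp u) = Xp u
  left_p : ∀ u, Pm (Xp u) = Xp u
  right_m : ∀ u, Xm (Pm u) = Xm u
  left_m : ∀ u, Pp (Xm u) = Xm u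
  range_p : Set.range ⇑Qp = {z | ∃ u, Pp u = u ∧ z = u + Xp u}
  range_m : Set.range ⇑Qm = {z | ∃ w, Pm w = w ∧ z = w + Xm w}

section Angular
variable {Pp Pm Xp Xm Qp Qm : H →L[ℂ] H}

lemma SqrtSetup.norm_proj_le (hs : SqrtSetup A (Pp - Pm)) (hP : ∀ x, Pp x + Pm x = x) (x : H) :
    ‖Pp x‖ ≤ ‖x‖ ∧ ‖Pm x‖ ≤ ‖x‖ := by
  have hJ := hs.norm_J x
  have e1 : (2 : ℂ) • Pp x = x + (Pp - Pm) x := by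
    rw [sub_apply]; nth_rewrite 2 [← hP x]; module
  have e2 : (2 : ℂ) • Pm x = x - (Pp - Pm) x := by
    rw [sub_apply]; nth_rewrite 2 [← hP x]; module
  have f1 := congrArg norm e1
  have f2 := congrArg norm e2
  rw [norm_smul] at f1 f2
  have g1 := norm_add_le x ((Pp - Pm) x)
  have g2 := norm_sub_le x ((Pp - Pm) x)
  have h2 : ‖(2 : ℂ)‖ = 2 := by simp
  rw [h2] at f1 f2
  constructor <;> linarith

namespace AngularPair

lemma proj_zero (hP : ∀ x, Pp x + Pm x = x) (hPp : ∀ x, Pp (Pp x) = Pp x) :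
    (∀ x, Pm (Pp x) = 0) ∧ (∀ x, Pm (Pm x) = Pm x) ∧ ∀ x, Pp (Pm x) = 0 := by
  have h1 : ∀ x, Pm x = x - Pp x := fun x => by rw [eq_sub_iff_add_eq, add_comm, hP]
  refine ⟨fun x => ?_, fun x => ?_, fun x => ?_⟩
  · rw [h1, hPp, sub_self]
  · rw [h1 (Pm x), h1 x, map_sub, hPp, sub_self, sub_zero]
  · rw [h1 x, map_sub, hPp, sub_self]

lemma cross_zero (h : AngularPair Pp Pm Xp Xm Qp Qm) (hP : ∀ x, Pp x + Pm x = x)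
    (hPp : ∀ x, Pp (Pp x) = Pp x) :
    (∀ x, Xp (Pm x) = 0) ∧ (∀ x, Xm (Pp x) = 0) ∧ (∀ x, Pp (Xp x) = 0) ∧
      (∀ x, Pm (Xm x) = 0) := by
  obtain ⟨h1, h2, h3⟩ := proj_zero hP hPp
  refine ⟨fun x => ?_, fun x => ?_, fun x => ?_, fun x => ?_⟩
  · rw [← h.right_p, h3, map_zero]
  · rw [← h.right_m, h1, map_zero]
  · rw [← h.left_p, h3]
  · rw [← h.left_m, h1]

lemma sgn_mul (h : AngularPair Pp Pm Xp Xm Qp Qm) (hP : ∀ x, Pp x + Pm x = x)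
    (hPp : ∀ x, Pp (Pp x) = Pp x) (hQ1 : ∀ x, Qp (Qp x) = Qp x) (hQ2 : ∀ x, Qm (Qm x) = Qm x)
    (hQ : ∀ x, Qp x + Qm x = x) :
    (Qp - Qm) * (1 + (Xp + Xm)) = (Pp - Pm) * (1 - (Xp + Xm)) ∧
      (Pp - Pm) * (Xp + Xm) = -(Xp + Xm) * (Pp - Pm) := by
  obtain ⟨z1, z2, z3⟩ := proj_zero hP hPp
  obtain ⟨c1, c2, c3, c4⟩ := h.cross_zero hP hPp
  obtain ⟨q1, -, q3⟩ := proj_zero hQ hQ1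
  constructor
  · ext u
    obtain ⟨y1, hy1⟩ : Pp u + Xp u ∈ Set.range ⇑Qp := by
      rw [h.range_p]; exact ⟨Pp u, hPp u, by rw [h.right_p]⟩
    obtain ⟨y2, hy2⟩ : Pm u + Xm u ∈ Set.range ⇑Qm := by
      rw [h.range_m]; exact ⟨Pm u, z2 u, by rw [h.right_m]⟩
    have e : u + (Xp u + Xm u) = Qp y1 + Qm y2 := by
      rw [hy1, hy2]; nth_rewrite 1 [← hP u]; abel
    simp only [mul_apply_eq_comp, add_apply, sub_apply, one_apply_eq_self]
    rw [e]
    simp only [map_add, map_sub, hQ1, hQ2, q1, q3, c3, c4, h.left_p, h.left_m]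
    rw [hy1, hy2]
    abel
  · ext u
    simp only [mul_apply_eq_comp, add_apply, sub_apply, neg_apply, map_sub, map_add, c1, c2, c3,
      c4, h.left_p, h.left_m, h.right_p, h.right_m]
    abel

/-- The block form of the Douglas–Kroll–Heß transformation. -/
lemma eq_dkh (h : AngularPair Pp Pm Xp Xm Qp Qm) (hP : ∀ x, Pp x + Pm x = x)
    (hPp : ∀ x, Pp (Pp x) = Pp x) (hs : SqrtSetup A (Pp - Pm))
    (hX : ‖(Xp + Xm) * (Xp + Xm)‖ < 1) :
    (1 + Xp) * (invSqrtSeries (Xm * Xp) * Pp) + (1 + Xm) * (invSqrtSeries (Xp * Xm) * Pm) =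
      dkh (Xp + Xm) := by
  obtain ⟨z1, z2, z3⟩ := proj_zero hP hPp
  obtain ⟨c1, c2, c3, c4⟩ := h.cross_zero hP hPp
  have a1 : ∀ x, Xm (Xm x) = 0 := fun x => by rw [← h.left_m x, c2]
  have a2 : ∀ x, Xp (Xp x) = 0 := fun x => by rw [← h.left_p x, c1]
  have e1 : Xm * Xp = Pp * ((Xp + Xm) * (Xp + Xm)) := by
    ext x
    simp only [mul_apply_eq_comp, add_apply, map_add, a1, a2, c3, h.left_m, zero_add, add_zero]
  have e2 : Xp * Xm = Pm * ((Xp + Xm) * (Xp + Xm)) := by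
    ext x
    simp only [mul_apply_eq_comp, add_apply, map_add, a1, a2, c4, h.left_p, zero_add, add_zero]
  have f1 : Xm * Xp * Pp = Pp * ((Xp + Xm) * (Xp + Xm)) := by
    rw [← e1]; ext x; simp only [mul_apply_eq_comp, h.right_p]
  have f2 : Xp * Xm * Pm = Pm * ((Xp + Xm) * (Xp + Xm)) := by
    rw [← e2]; ext x; simp only [mul_apply_eq_comp, h.right_m]
  have n1 : ‖Pp‖ ≤ 1 := ContinuousLinearMap.opNorm_le_bound _ zero_le_one fun x => by
    rw [one_mul]; exact (hs.norm_proj_le hP x).1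
  have n2 : ‖Pm‖ ≤ 1 := ContinuousLinearMap.opNorm_le_bound _ zero_le_one fun x => by
    rw [one_mul]; exact (hs.norm_proj_le hP x).2
  have m1 : ‖Xm * Xp‖ < 1 := by
    rw [e1]
    refine (norm_mul_le _ _).trans_lt (lt_of_le_of_lt ?_ hX)
    exact mul_le_of_le_one_left (norm_nonneg _) n1
  have m2 : ‖Xp * Xm‖ < 1 := by
    rw [e2]
    refine (norm_mul_le _ _).trans_lt (lt_of_le_of_lt ?_ hX)
    exact mul_le_of_le_one_left (norm_nonneg _) n2
  rw [invSqrtSeries_semiconj m1 hX f1, invSqrtSeries_semiconj m2 hX f2, dkh, ← mul_assoc,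
    ← mul_assoc, ← add_mul]
  congr 1
  ext x
  simp only [mul_apply_eq_comp, add_apply, one_apply_eq_self, h.right_p, h.right_m]
  rw [show Pp x + Xp x + (Pm x + Xm x) = (Pp x + Pm x) + (Xp x + Xm x) by abel, hP]

lemma norm_le_of_range (h : AngularPair Pp Pm Xp Xm Qp Qm) (hP : ∀ x, Pp x + Pm x = x)
    (hPp : ∀ x, Pp (Pp x) = Pp x) {c : ℝ} (hp : ‖Xp‖ ≤ c) (hm : ‖Xm‖ ≤ c) (v : H) :
    (Qm v = v → ‖v‖ ≤ (1 + c) * ‖v - (Pp - Pm) v‖) ∧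
      (Qp v = v → ‖v‖ ≤ (1 + c) * ‖v + (Pp - Pm) v‖) := by
  obtain ⟨z1, z2, z3⟩ := proj_zero hP hPp
  obtain ⟨c1, c2, c3, c4⟩ := h.cross_zero hP hPp
  have aux : ∀ {X : H →L[ℂ] H} {w : H}, ‖X‖ ≤ c → ‖w + X w‖ ≤ (1 + c) * ‖(2 : ℂ) • w‖ :=
    fun {X w} hX => by
      have hc : 0 ≤ c := (norm_nonneg _).trans hX
      rw [norm_smul, Complex.norm_ofNat]
      have h1 := norm_add_le w (X w)
      have h2 := X.le_of_opNorm_le hX w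
      nlinarith [norm_nonneg w, mul_nonneg hc (norm_nonneg w)]
  constructor
  · intro hv
    obtain ⟨w, hw, rfl⟩ : v ∈ {z | ∃ w, Pm w = w ∧ z = w + Xm w} := h.range_m ▸ ⟨v, hv⟩
    have e : w + Xm w - (Pp - Pm) (w + Xm w) = (2 : ℂ) • w := by
      have h0 : Pp w = 0 := by rw [← hw, z3]
      rw [sub_apply, map_add, map_add, h0, hw, h.left_m, c4]; module
    rw [e]
    exact aux hm
  · intro hv
    obtain ⟨w, hw, rfl⟩ : v ∈ {z | ∃ w, Pp w = w ∧ z = w + Xp w} := h.range_p ▸ ⟨v, hv⟩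
    have e : w + Xp w + (Pp - Pm) (w + Xp w) = (2 : ℂ) • w := by
      have h0 : Pm w = 0 := by rw [← hw, z1]
      rw [sub_apply, map_add, map_add, h0, hw, h.left_p, c3]; module
    rw [e]
    exact aux hp

end AngularPair
end Angular

theorem PotData.exists_diag {Pp Pm : H →L[ℂ] H} (h : PotData A (Pp - Pm) W Wh q a b κ)
    (hP : ∀ x, Pp x + Pm x = x) (hPp : ∀ x, Pp (Pp x) = Pp x)
    {f : ℂ → H → H → ℂ} (hf : ∀ z u w, f z (A u) (A w) = ⟪w, (Pp - Pm + z • W) u⟫)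
    {T : ℂ → H →ₗ.[ℂ] H}
    (hT : ∀ z ∈ Metric.ball (0 : ℂ) 1, IsAssocForm (pinv A).domain (f z) (T z))
    {Qp Qm Xp Xm Uop U' S : ℂ → H →L[ℂ] H}
    (hQ : ∀ z ∈ Metric.ball (0 : ℂ) 1, DecomposedBy (T z) (Qp z) (Qm z) ∧
      partSpec (T z) (Qp z) = spec (T z) ∩ {z : ℂ | 0 < z.re} ∧
      partSpec (T z) (Qm z) = spec (T z) ∩ {z : ℂ | z.re < 0})
    (hX : ∀ z ∈ Metric.ball (0 : ℂ) 1, AngularPair Pp Pm (Xp z) (Xm z) (Qp z) (Qm z))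
    (hUop : ∀ z, Uop z = (1 + Xp z) * (invSqrtSeries (Xm z * Xp z) * Pp) +
      (1 + Xm z) * (invSqrtSeries (Xp z * Xm z) * Pm))
    (hU' : ∀ z ∈ Metric.ball (0 : ℂ) 1, Uop z * U' z = 1 ∧ U' z * Uop z = 1)
    (hS : ∀ z ∈ Metric.ball (0 : ℂ) 1,
      Dense {x : H | A x ∈ (conjPMap (Uop z) (U' z) (T z)).domain} ∧
      ∀ x : H, ∀ hx : A x ∈ (conjPMap (Uop z) (U' z) (T z)).domain,
        S z x = A ((conjPMap (Uop z) (U' z) (T z)) ⟨A x, hx⟩)) :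
    ∃ D : ℂ → H →L[ℂ] H, DifferentiableOn ℂ D (Metric.ball 0 1) ∧
      ∀ z ∈ Metric.ball (0 : ℂ) 1, star (D (conj z)) = D z ∧ S z = D z ∧
        ∃ D' : H →L[ℂ] H, D z * D' = 1 ∧ D' * D z = 1 ∧
          conjPMap (Uop z) (U' z) (T z) = pinv (A * D' * A) := by
  have hA := h.inj
  have hAs := h.toSqrtSetup.isSelfAdjoint_left
  have hAd : DenseRange A := dense_range_of_star_inj (k := A) fun x hx => hA x (by rwa [hAs] at hx)
  have hTk : ∀ z ∈ Metric.ball (0 : ℂ) 1, ∀ M : H →L[ℂ] H, (Pp - Pm + z • W) * M = 1 →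
      M * (Pp - Pm + z • W) = 1 → T z = pinv (A * M * A) := fun z hz M h1 h2 =>
    (isAssocForm_iff hA hAs h1 h2 (hf z)).1 (hT z hz)
  have hQQ : ∀ z ∈ Metric.ball (0 : ℂ) 1, (∀ x, Qp z (Qp z x) = Qp z x) ∧
      (∀ x, Qm z (Qm z x) = Qm z x) ∧ ∀ x, Qp z x + Qm z x = x := fun z hz =>
    ⟨clm_congr (hQ z hz).1.2.1, clm_congr (hQ z hz).1.2.2.1, clm_congr (hQ z hz).1.1⟩
  have hσ : ∀ z ∈ Metric.ball (0 : ℂ) 1, IsSgn A (Pp - Pm) (z • W) (Qp z - Qm z) := by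
    intro z hz
    obtain ⟨q1, q2, q3⟩ := hQQ z hz
    have hu : IsUnit (Pp - Pm + z • W) := by
      have := h.toSqrtSetup.isUnit_J_add_sub 0 (w := z • W)
        (((SqrtSetup.norm_smul_clm_le hz).trans h.norm_W).trans_lt h.hq1)
      simpa using this
    obtain ⟨M, h1, h2⟩ : ∃ M : H →L[ℂ] H, (Pp - Pm + z • W) * M = 1 ∧
        M * (Pp - Pm + z • W) = 1 :=
      ⟨_, Ring.mul_inverse_cancel _ hu, Ring.inverse_mul_cancel _ hu⟩
    have hTz := hTk z hz M h1 h2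
    obtain ⟨G, hG⟩ := h.exists_potSetup hz h1 h2
    have hk := hG.inj_k
    have hQz := hQ z hz
    rw [hTz] at hQz
    obtain ⟨hdec, hsp, hsm⟩ := hQz
    obtain ⟨hcp, hcm⟩ := commute_of_decomposedBy hk hdec
    obtain ⟨rm, hrm⟩ := exists_halfRes_of_partResolvent hk hcm q2 1 (one_mul 1) fun u hu => by
      have : u ∉ partSpec (pinv (A * M * A)) (Qm z) := by
        rw [hsm]; exact fun hh => not_lt.2 hu hh.2
      rw [one_mul]
      exact not_not.1 this
    obtain ⟨rp, hrp⟩ := exists_halfRes_of_partResolvent hk hcp q1 (-1) (by norm_num) fun u hu => by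
      have : -u ∉ partSpec (pinv (A * M * A)) (Qp z) := by
        rw [hsp]
        rintro ⟨-, hh⟩
        simp only [Set.mem_ofPred_eq, neg_re] at hh
        linarith
      rw [neg_one_mul]
      exact not_not.1 this
    rw [one_smul] at hrm
    rw [neg_one_smul] at hrp
    have hkd : DenseRange (A * M * A) := by
      have hMd : DenseRange M :=
        Function.Surjective.denseRange fun x => ⟨(Pp - Pm + z • W) x, clm_congr h2 x⟩
      exact hAd.comp (hMd.comp hAd M.continuous) A.continuous
    have hgr := (hX z hz).norm_le_of_range hP hPp (le_max_left ‖Xp z‖ ‖Xm z‖)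
      (le_max_right ‖Xp z‖ ‖Xm z‖)
    exact hG.isSgn_sub hkd hrm hrp q3 hcm
      (add_nonneg zero_le_one ((norm_nonneg _).trans (le_max_left ‖Xp z‖ ‖Xm z‖)))
      (fun v => (hgr v).1) (fun v => (hgr v).2)
  have hXs := fun z hz => (hX z hz).sgn_mul hP hPp (hQQ z hz).1 (hQQ z hz).2.1 (hQQ z hz).2.2
  obtain ⟨D, hD, hD2⟩ := exists_holomorphic_family (X := fun z => Xp z + Xm z)
    h.toSqrtSetup h.star_W h.hq1 h.norm_W h.norm_Wh h.intertw hσ (fun z hz => (hXs z hz).1)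
    fun z hz => (hXs z hz).2
  refine ⟨D, hD, fun z hz => ?_⟩
  obtain ⟨d1, d2, D', M, d3, d4, d5, d6, d7⟩ := hD2 z hz
  have hU1 : Uop z = dkh (Xp z + Xm z) := by
    rw [hUop, (hX z hz).eq_dkh hP hPp h.toSqrtSetup d2]
  have hU2 : U' z = dkh (-(Xp z + Xm z)) := by
    have h3 := (hU' z hz).2
    rw [hU1] at h3
    calc U' z = U' z * (dkh (Xp z + Xm z) * dkh (-(Xp z + Xm z))) := by
          rw [dkh_mul_neg d2, mul_one]
      _ = dkh (-(Xp z + Xm z)) := by rw [← mul_assoc, h3, one_mul]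
  have hconj : conjPMap (Uop z) (U' z) (T z) = pinv (A * D' * A) := by
    rw [hTk z hz M d5 d6, conjPMap_pinv (triple_inj hA d5) (hU' z hz).1 (hU' z hz).2, hU1, hU2, d7]
  refine ⟨d1, ?_, D', d3, d4, hconj⟩
  obtain ⟨hSd, hSe⟩ := hS z hz
  rw [hconj] at hSd hSe
  have hk := triple_inj hA d3
  refine ContinuousLinearMap.ext fun x => ?_
  refine hSd.induction (P := fun x => S z x = D z x) (fun x hx => ?_)
    (isClosed_eq (S z).continuous (D z).continuous) x
  rw [hSe x hx]
  have h4 := pinv_apply_eq hk ⟨A x, hx⟩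
  have h5 : D' (A (pinv (A * D' * A) ⟨A x, hx⟩)) = x := by
    rw [← sub_eq_zero]
    refine hA _ ?_
    rw [map_sub, sub_eq_zero]
    exact h4
  have h6 := clm_congr d3 (A (pinv (A * D' * A) ⟨A x, hx⟩))
  rw [mul_apply_eq_comp, h5, one_apply_eq_self] at h6
  exact h6.symm

end DiagFamily

section AbsoluteValue
variable {H : Type*} [NormedAddCommGroup H] [InnerProductSpace ℂ H] [CompleteSpace H]

variable {H0 : H →ₗ.[ℂ] H} {R U Pp Pm : H →L[ℂ] H}

lemma IsResolventAt.inj_zero (hR : IsResolventAt H0 0 R) (x : H) (hx : R x = 0) : x = 0 := by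
  obtain ⟨h, e⟩ := hR.2 x
  rw [zero_smul, sub_zero] at e
  rw [← e, show (⟨R x, h⟩ : H0.domain) = 0 from Subtype.ext hx, LinearPMap.map_zero]

lemma IsResolventAt.isSelfAdjoint (hH : H0.adjoint = H0) (hR : IsResolventAt H0 0 R) :
    IsSelfAdjoint R := by
  have hd : Dense (H0.domain : Set H) := IsSelfAdjoint.dense_domain hH
  have key := H0.adjoint_isFormalAdjoint hd
  rw [hH] at key
  rw [ContinuousLinearMap.isSelfAdjoint_iff_isSymmetric]
  intro x y
  obtain ⟨hx, ex⟩ := hR.2 x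
  obtain ⟨hy, ey⟩ := hR.2 y
  rw [zero_smul, sub_zero] at ex ey
  have := key ⟨R x, hx⟩ ⟨R y, hy⟩
  rw [ex, ey] at this
  exact this.symm

/-- The modulus of `R` is `R (P₊ - P₋)`. -/
lemma absCLM_eq (hs : IsSelfAdjoint R) (hP : IsPosNegPair R Pp Pm) :
    absCLM R = R * (Pp - Pm) ∧ 0 ≤ R * (Pp - Pm) ∧ (Pp - Pm) * R = R * (Pp - Pm) ∧
      (Pp - Pm) * (Pp - Pm) = 1 := by
  obtain ⟨h1, h2, h3, h4, h5, h6, h7, h8⟩ := hP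
  have hm : Pm = 1 - Pp := by rw [← h1]; abel
  have hpm : Pp * Pm = 0 := by rw [hm, mul_sub, mul_one, h4.eq, sub_self]
  have hmp : Pm * Pp = 0 := by rw [hm, sub_mul, one_mul, h4.eq, sub_self]
  have h6' : Pm * R = R * Pm := by rw [hm, sub_mul, mul_sub, h6, one_mul, mul_one]
  have hc : (Pp - Pm) * R = R * (Pp - Pm) := by rw [sub_mul, mul_sub, h6, h6']
  have hsq : (Pp - Pm) * (Pp - Pm) = 1 := by
    rw [sub_mul, mul_sub, mul_sub, h4.eq, h5.eq, hpm, hmp, ← h1]; abel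
  have hsa : IsSelfAdjoint (R * (Pp - Pm)) := by
    rw [IsSelfAdjoint, star_mul, (h2.sub h3).star_eq, hs.star_eq, hc]
  have hpos : 0 ≤ R * (Pp - Pm) := by
    rw [ContinuousLinearMap.nonneg_iff_isPositive, ContinuousLinearMap.isPositive_def]
    refine ⟨(ContinuousLinearMap.isSelfAdjoint_iff_isSymmetric.1 hsa), fun x => ?_⟩
    have e : R * (Pp - Pm) = Pp * (R * Pp) - Pm * (R * Pm) := by
      rw [← mul_assoc, ← mul_assoc, h6, h6', mul_assoc, mul_assoc, h4.eq, h5.eq, mul_sub]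
    have f1 : ⟪Pp (R (Pp x)), x⟫ = ⟪R (Pp x), Pp x⟫ := by
      rw [← star_inner_left, h2.star_eq]
    have f2 : ⟪Pm (R (Pm x)), x⟫ = ⟪R (Pm x), Pm x⟫ := by
      rw [← star_inner_left, h3.star_eq]
    have g1 := h7 x
    have g2 := h8 x
    rw [← inner_conj_symm, Complex.conj_re] at g1 g2
    rw [ContinuousLinearMap.reApplyInnerSelf_apply, e]
    simp only [sub_apply, mul_apply_eq_comp, inner_sub_left, f1, f2, map_sub]
    exact sub_nonneg.2 (g2.trans g1)
  refine ⟨CFC.sqrt_unique ?_ hpos, hpos, hc, hsq⟩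
  rw [mul_assoc, ← mul_assoc (Pp - Pm), hc, mul_assoc, hsq, mul_one]

lemma sqrtSetup_of_free (hH : H0.adjoint = H0) (hR : IsResolventAt H0 0 R)
    (hP : IsPosNegPair R Pp Pm) :
    SqrtSetup (invSqrtAbs R) (Pp - Pm) ∧
      ∀ x, invSqrtAbs R (invSqrtAbs R x) = R ((Pp - Pm) x) := by
  have hs := hR.isSelfAdjoint hH
  obtain ⟨e1, e2, e3, e4⟩ := absCLM_eq hs hP
  have hsq : invSqrtAbs R * invSqrtAbs R = R * (Pp - Pm) := by
    rw [invSqrtAbs, CFC.sqrt_mul_sqrt_self _ (e1 ▸ e2), e1]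
  have hJ := hP.2.1.sub hP.2.2.1
  have hA : IsSelfAdjoint (invSqrtAbs R) := (CFC.sqrt_nonneg _).isSelfAdjoint
  have hcomm : Commute (invSqrtAbs R) (Pp - Pm) := by
    have : Commute (absCLM R) (Pp - Pm) := by
      rw [e1, Commute, SemiconjBy, ← mul_assoc, e3]
    rw [invSqrtAbs, CFC.sqrt_eq_cfc]
    exact this.cfc_nnreal _
  refine ⟨⟨?_, ?_, fun x => ?_, fun x => ?_, fun x hx => ?_⟩, fun x => ?_⟩
  · exact ContinuousLinearMap.isSelfAdjoint_iff_isSymmetric.1 hA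
  · exact ContinuousLinearMap.isSelfAdjoint_iff_isSymmetric.1 hJ
  · exact clm_congr e4 x
  · exact clm_congr hcomm.eq.symm x
  · have h1 : R ((Pp - Pm) x) = 0 := by
      rw [← mul_apply_eq_comp, ← hsq, mul_apply_eq_comp, hx, map_zero]
    have h2 := hR.inj_zero _ h1
    calc x = ((Pp - Pm) * (Pp - Pm)) x := by rw [e4, one_apply_eq_self]
      _ = 0 := by rw [mul_apply_eq_comp, h2, map_zero]
  · exact clm_congr hsq x

lemma sign_unique (hR : IsResolventAt H0 0 R) (hs : IsSelfAdjoint R)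
    (hP : IsPosNegPair R Pp Pm) (hU : IsSignOf U R) : U = Pp - Pm := by
  ext x
  have e := hU.2.2.1
  rw [(absCLM_eq hs hP).1] at e
  rw [← sub_eq_zero]
  apply hR.inj_zero
  rw [map_sub, sub_eq_zero]
  exact clm_congr e x

/-- A bounded symmetric operator is dominated by any operator it is intertwined with. -/
lemma norm_le_of_intertwine {A C K : H →L[ℂ] H} (hA : DenseRange A)
    (hC : ∀ x y, ⟪C x, y⟫ = ⟪x, C y⟫) (h : ∀ x, C (A x) = A (K x)) : ‖C‖ ≤ ‖K‖ := by
  have key : ∀ z, ‖C (A z)‖ ≤ ‖K‖ * ‖A z‖ := by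
    intro z
    by_contra! hlt
    obtain ⟨x, hx⟩ : ∃ x, x = A z := ⟨_, rfl⟩
    rw [← hx] at hlt
    have hx0 : 0 < ‖x‖ := by
      rw [norm_pos_iff]; rintro h0
      rw [h0, map_zero, norm_zero, mul_zero] at hlt
      exact lt_irrefl _ hlt
    have hsq : ∀ v, ‖C v‖ ^ 2 ≤ ‖C (C v)‖ * ‖v‖ := fun v => by
      have e : ((‖C v‖ ^ 2 : ℝ) : ℂ) = ⟪C (C v), v⟫ := by
        rw [hC, inner_self_eq_norm_sq_to_K]; norm_cast
      have h1 := norm_inner_le_norm (𝕜 := ℂ) (C (C v)) v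
      rwa [← e, Complex.norm_real, Real.norm_eq_abs, abs_of_nonneg (by positivity)] at h1
    set t := ‖C x‖ / ‖x‖ with ht
    have htK : ‖K‖ < t := by rw [ht, lt_div_iff₀ hx0]; exact hlt
    have ht0 : 0 < t := (norm_nonneg _).trans_lt htK
    have hgrow : ∀ n : ℕ, 0 < ‖(C ^ n) x‖ ∧ t * ‖(C ^ n) x‖ ≤ ‖(C ^ (n + 1)) x‖ := by
      intro n
      induction n with
      | zero =>
        refine ⟨by simpa using hx0, le_of_eq ?_⟩
        rw [pow_zero, one_apply_eq_self, zero_add, pow_one, ht, div_mul_cancel₀ _ hx0.ne']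
      | succ n ih =>
        obtain ⟨i1, i2⟩ := ih
        have h2 := hsq ((C ^ n) x)
        rw [← mul_apply_eq_comp, ← pow_succ', ← mul_apply_eq_comp, ← pow_succ'] at h2
        have i3 : 0 < ‖(C ^ (n + 1)) x‖ := lt_of_lt_of_le (by positivity) i2
        refine ⟨i3, le_of_mul_le_mul_right ?_ i1⟩
        calc t * ‖(C ^ (n + 1)) x‖ * ‖(C ^ n) x‖
            = (t * ‖(C ^ n) x‖) * ‖(C ^ (n + 1)) x‖ := by ring
          _ ≤ ‖(C ^ (n + 1)) x‖ * ‖(C ^ (n + 1)) x‖ := by gcongr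
          _ = ‖(C ^ (n + 1)) x‖ ^ 2 := by ring
          _ ≤ _ := h2
    have hlow : ∀ n : ℕ, t ^ n * ‖x‖ ≤ ‖(C ^ n) x‖ := by
      intro n
      induction n with
      | zero => simp
      | succ n ih =>
        calc t ^ (n + 1) * ‖x‖ = t * (t ^ n * ‖x‖) := by ring
          _ ≤ t * ‖(C ^ n) x‖ := by gcongr
          _ ≤ _ := (hgrow n).2
    have hup : ∀ n : ℕ, ‖(C ^ n) x‖ ≤ ‖A‖ * ‖z‖ * ‖K‖ ^ n := by
      intro n
      have e : (C ^ n) x = A ((K ^ n) z) := by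
        induction n with
        | zero => exact hx
        | succ n ih => rw [pow_succ', pow_succ', mul_apply_eq_comp, mul_apply_eq_comp, ih, h]
      rw [e]
      calc ‖A ((K ^ n) z)‖ ≤ ‖A‖ * (‖K ^ n‖ * ‖z‖) :=
            (A.le_opNorm _).trans (by gcongr; exact (K ^ n).le_opNorm z)
        _ ≤ ‖A‖ * (‖K‖ ^ n * ‖z‖) := by
            gcongr
            rcases Nat.eq_zero_or_pos n with rfl | hn
            · rw [pow_zero, pow_zero]; exact ContinuousLinearMap.norm_id_le
            · exact norm_pow_le' K hn
        _ = _ := by ring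
    have hlim : Tendsto (fun n : ℕ => ‖A‖ * ‖z‖ * (‖K‖ / t) ^ n) atTop (𝓝 0) := by
      have := tendsto_pow_atTop_nhds_zero_of_lt_one (r := ‖K‖ / t) (by positivity)
        ((div_lt_one ht0).2 htK)
      simpa using this.const_mul (‖A‖ * ‖z‖)
    have : ‖x‖ ≤ 0 := by
      refine ge_of_tendsto' hlim fun n => ?_
      have h3 := (hlow n).trans (hup n)
      rw [div_pow, ← mul_div_assoc, le_div_iff₀ (by positivity)]
      linarith
    exact absurd hx0 (not_lt.2 this)
  refine ContinuousLinearMap.opNorm_le_bound _ (norm_nonneg _) fun x => ?_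
  refine hA.induction (P := fun x => ‖C x‖ ≤ ‖K‖ * ‖x‖) (fun x hx => ?_)
    (isClosed_le (by fun_prop) (by fun_prop)) x
  obtain ⟨z, rfl⟩ := hx
  exact key z

end AbsoluteValue

section FreeEnergy

/-- A matrix acting on spinors, as a bounded operator. -/
def spinMat (M : Matrix (Fin 4) (Fin 4) ℂ) : C4 →L[ℂ] C4 :=
  Matrix.toEuclideanCLM (n := Fin 4) (𝕜 := ℂ) M

lemma mapp_eq (M : Matrix (Fin 4) (Fin 4) ℂ) (ξ : C4) : mapp M ξ = spinMat M ξ := rfl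

lemma spinMat_mul (M N : Matrix (Fin 4) (Fin 4) ℂ) (ξ : C4) :
    spinMat M (spinMat N ξ) = spinMat (M * N) ξ := by
  rw [spinMat, spinMat, spinMat, map_mul, mul_apply_eq_comp]

lemma inner_spinMat {M : Matrix (Fin 4) (Fin 4) ℂ} (hM : M.IsHermitian) (ξ η : C4) :
    ⟪spinMat M ξ, η⟫ = ⟪ξ, spinMat M η⟫ := by
  have h : star (spinMat M) = spinMat M := by
    rw [spinMat, ← map_star, Matrix.star_eq_conjTranspose, hM.eq]
  rw [← star_inner_left, h]

lemma spinMat_one (ξ : C4) : spinMat 1 ξ = ξ := by rw [spinMat, map_one, one_apply_eq_self]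

lemma spinMat_neg (M : Matrix (Fin 4) (Fin 4) ℂ) (ξ : C4) : spinMat (-M) ξ = -spinMat M ξ := by
  rw [spinMat, spinMat, map_neg, neg_apply]

lemma diracβ_herm : diracβ.IsHermitian := by
  ext i j; fin_cases i <;> fin_cases j <;> simp [diracβ]

lemma diracβ_sq : diracβ * diracβ = 1 := by
  ext i j; fin_cases i <;> fin_cases j <;> simp [diracβ, Matrix.mul_apply, Fin.sum_univ_four]

lemma diracα_herm (j : Fin 3) : (diracα j).IsHermitian := by
  ext k l; fin_cases j <;> fin_cases k <;> fin_cases l <;> simp [diracα]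

lemma diracα_sq (j : Fin 3) : diracα j * diracα j = 1 := by
  ext k l
  fin_cases j <;> fin_cases k <;> fin_cases l <;>
    simp [diracα, Matrix.mul_apply, Fin.sum_univ_four]

lemma diracαβ (j : Fin 3) : diracα j * diracβ = -(diracβ * diracα j) := by
  ext k l
  fin_cases j <;> fin_cases k <;> fin_cases l <;>
    simp [diracα, diracβ, Matrix.mul_apply, Fin.sum_univ_four]

lemma diracα_anticomm {i j : Fin 3} (h : i ≠ j) : diracα i * diracα j = -(diracα j * diracα i) := by
  ext k l
  fin_cases i <;> fin_cases j <;> first | exact absurd rfl h |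
    (fin_cases k <;> fin_cases l <;> simp [diracα, Matrix.mul_apply, Fin.sum_univ_four])

/-- The partial derivative in the `j`-th coordinate direction. -/
def pd (j : Fin 3) (f : V3 → C4) (x : V3) : C4 :=
  fderiv ℝ f x (EuclideanSpace.single j (1 : ℝ))

/-- The squared length of the gradient. -/
def gradSq (f : V3 → C4) (x : V3) : ℝ := ∑ j, ‖pd j f x‖ ^ 2

lemma norm_diracAct_sq (f : V3 → C4) (x : V3) :
    ‖diracAct f x‖ ^ 2 = ‖f x‖ ^ 2 + gradSq f x +
      (∑ j, 2 * (⟪f x, spinMat diracβ (-(Complex.I) • spinMat (diracα j) (pd j f x))⟫).re +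
      (2 * (⟪pd 0 f x, spinMat (diracα 0 * diracα 1) (pd 1 f x)⟫).re +
       2 * (⟪pd 0 f x, spinMat (diracα 0 * diracα 2) (pd 2 f x)⟫).re +
       2 * (⟪pd 1 f x, spinMat (diracα 1 * diracα 2) (pd 2 f x)⟫).re)) := by
  have hsq : ∀ {M : Matrix (Fin 4) (Fin 4) ℂ}, M.IsHermitian → M * M = 1 → ∀ ξ,
      ‖spinMat M ξ‖ ^ 2 = ‖ξ‖ ^ 2 := fun {M} h1 h2 ξ => by
    rw [← inner_self_eq_norm_sq (𝕜 := ℂ), ← inner_self_eq_norm_sq (𝕜 := ℂ), inner_spinMat h1,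
      spinMat_mul, h2, spinMat_one]
  have e : diracAct f x = spinMat diracβ (f x) + ((-(Complex.I)) • spinMat (diracα 0) (pd 0 f x) +
      (-(Complex.I)) • spinMat (diracα 1) (pd 1 f x) +
      (-(Complex.I)) • spinMat (diracα 2) (pd 2 f x)) := by
    simp only [diracAct, mapp_eq, Fin.sum_univ_three, pd]
    module
  have hI : ∀ ξ η : C4, ⟪(-(Complex.I)) • ξ, (-(Complex.I)) • η⟫ = ⟪ξ, η⟫ := fun ξ η => by
    rw [inner_smul_left, inner_smul_right, ← mul_assoc]; simp
  have hN : ‖(-(Complex.I))‖ = 1 := by simp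
  rw [e, norm_add_sq (𝕜 := ℂ), norm_add_sq (𝕜 := ℂ), norm_add_sq (𝕜 := ℂ), gradSq,
    Fin.sum_univ_three, Fin.sum_univ_three]
  simp only [map_add, inner_add_left, inner_add_right, hI, norm_smul, hN, one_mul,
    hsq diracβ_herm diracβ_sq, hsq (diracα_herm _) (diracα_sq _), inner_spinMat diracβ_herm,
    inner_spinMat (diracα_herm _), spinMat_mul, RCLike.re_eq_complex_re]
  ring

variable {f : V3 → C4}

lemma IsTestFn.differentiable (hf : IsTestFn f) : Differentiable ℝ f :=
  hf.1.differentiable (by simp)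

lemma IsTestFn.deriv (hf : IsTestFn f) (j : Fin 3) : IsTestFn (pd j f) := by
  constructor
  · exact (hf.1.fderiv_right (m := (⊤ : ℕ∞)) (by simp)).clm_apply contDiff_const
  · exact hf.2.fderiv_apply (𝕜 := ℝ) _

lemma integral_fderiv_eq_zero {E : Type*} [NormedAddCommGroup E] [NormedSpace ℝ E]
    {g : V3 → E} (hg : ContDiff ℝ 1 g) (hc : HasCompactSupport g)
    (v : V3) : ∫ x, fderiv ℝ g x v = 0 := by
  have h1 : Integrable (fun x => fderiv ℝ g x v) :=
    ((hg.continuous_fderiv (by simp)).clm_apply continuous_const).integrable_of_hasCompactSupport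
      (hc.fderiv_apply (𝕜 := ℝ) v)
  have := integral_smul_fderiv_eq_neg_fderiv_smul_of_integrable (𝕜 := ℝ) (μ := volume)
    (f := fun _ : V3 => (1 : ℝ)) (g := g) (v := v) (by simp) (by simpa using h1)
    (by simpa using hg.continuous.integrable_of_hasCompactSupport hc)
    (by fun_prop) (fun x _ => hg.differentiable (by simp) x)
  simpa using this

variable {h : V3 → C4}

lemma IsTestFn.inner (hf : IsTestFn f) (hh : IsTestFn h) (M : C4 →L[ℂ] C4) :
    ContDiff ℝ 1 (fun x => ⟪f x, M (h x)⟫) ∧ HasCompactSupport (fun x => ⟪f x, M (h x)⟫) := by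
  constructor
  · exact (hf.1.of_le (by simp)).inner ℂ (((M.restrictScalars ℝ).contDiff).comp
      (hh.1.of_le (by simp)))
  · exact hf.2.mono fun x hx h0 => hx (by simp only [h0, inner_zero_left])

lemma IsTestFn.integrable_inner (hf : IsTestFn f) (hh : IsTestFn h) (M : C4 →L[ℂ] C4) :
    Integrable (fun x => ⟪f x, M (h x)⟫) :=
  (hf.inner hh M).1.continuous.integrable_of_hasCompactSupport (hf.inner hh M).2

lemma IsTestFn.integral_inner_pd (hf : IsTestFn f) (hh : IsTestFn h) (M : C4 →L[ℂ] C4)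
    (j : Fin 3) :
    ∫ x, ⟪pd j f x, M (h x)⟫ = -∫ x, ⟪f x, M (pd j h x)⟫ := by
  have h0 := integral_fderiv_eq_zero (hf.inner hh M).1 (hf.inner hh M).2
    (EuclideanSpace.single j (1 : ℝ))
  have e : ∀ x, fderiv ℝ (fun x => ⟪f x, M (h x)⟫) x (EuclideanSpace.single j (1 : ℝ)) =
      ⟪f x, M (pd j h x)⟫ + ⟪pd j f x, M (h x)⟫ := fun x => by
    have d2 : HasFDerivAt (fun x => M (h x)) ((M.restrictScalars ℝ).comp (fderiv ℝ h x)) x :=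
      (M.restrictScalars ℝ).hasFDerivAt.comp x (hh.differentiable x).hasFDerivAt
    rw [fderiv_inner_apply ℂ (hf.differentiable x) d2.differentiableAt, d2.fderiv]
    rfl
  simp_rw [e] at h0
  rw [integral_add (hf.integrable_inner (hh.deriv j) M) ((hf.deriv j).integrable_inner hh M)] at h0
  rw [eq_neg_iff_add_eq_zero, add_comm]
  exact h0

lemma pd_comm (hf : IsTestFn f) (i j : Fin 3) (x : V3) : pd i (pd j f) x = pd j (pd i f) x := by
  have hd : ContDiff ℝ 2 f := contDiff_infty.1 hf.1 2
  have hs := (hd.contDiffAt (x := x)).isSymmSndFDerivAt (by simp)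
  have hdd : Differentiable ℝ (fderiv ℝ f) :=
    (hf.1.fderiv_right (m := (⊤ : ℕ∞)) (by simp)).differentiable (by simp)
  have e : ∀ v w : V3, fderiv ℝ (fun y => fderiv ℝ f y v) x w = fderiv ℝ (fderiv ℝ f) x w v :=
    fun v w => by
      rw [fderiv_clm_apply (hdd x) (differentiableAt_const v)]
      simp
  have e1 : pd i (pd j f) x = _ := e (EuclideanSpace.single j 1) (EuclideanSpace.single i 1)
  have e2 : pd j (pd i f) x = _ := e (EuclideanSpace.single i 1) (EuclideanSpace.single j 1)
  rw [e1, e2]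
  exact hs _ _

lemma IsTestFn.integral_re_herm (hf : IsTestFn f) {M : C4 →L[ℂ] C4}
    (hM : ∀ ξ η, ⟪M ξ, η⟫ = ⟪ξ, M η⟫) (j : Fin 3) :
    ∫ x, 2 * (⟪f x, M (pd j f x)⟫).re = 0 := by
  have h1 := hf.integral_inner_pd hf M j
  have h2 : ∫ x, ⟪pd j f x, M (f x)⟫ = conj (∫ x, ⟪f x, M (pd j f x)⟫) := by
    rw [← integral_conj]
    refine integral_congr_ae (Eventually.of_forall fun x => ?_)
    simp only
    rw [inner_conj_symm, hM]
  rw [h2] at h1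
  have h3 := congrArg Complex.re h1
  rw [Complex.conj_re, Complex.neg_re] at h3
  rw [integral_const_mul]
  have h4 := integral_re (𝕜 := ℂ) (hf.integrable_inner (hf.deriv j) M)
  simp only [RCLike.re_eq_complex_re] at h4
  rw [h4]; linarith

lemma IsTestFn.integral_re_antiherm (hf : IsTestFn f) {M : C4 →L[ℂ] C4}
    (hM : ∀ ξ η, ⟪M ξ, η⟫ = -⟪ξ, M η⟫) (i j : Fin 3) :
    ∫ x, 2 * (⟪pd i f x, M (pd j f x)⟫).re = 0 := by
  have h1 := hf.integral_inner_pd (hf.deriv j) M i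
  have h2 := hf.integral_inner_pd (hf.deriv i) M j
  simp_rw [pd_comm hf j i] at h2
  rw [← h2] at h1
  have h3 : ∫ x, ⟪pd j f x, M (pd i f x)⟫ =
      -conj (∫ x, ⟪pd i f x, M (pd j f x)⟫) := by
    rw [← integral_conj, ← integral_neg]
    refine integral_congr_ae (Eventually.of_forall fun x => ?_)
    simp only
    rw [inner_conj_symm, hM, neg_neg]
  rw [h3] at h1
  have h3 := congrArg Complex.re h1
  rw [Complex.neg_re, Complex.conj_re] at h3
  rw [integral_const_mul]
  have h4 := integral_re (𝕜 := ℂ) ((hf.deriv i).integrable_inner (hf.deriv j) M)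
  simp only [RCLike.re_eq_complex_re] at h4
  rw [h4]; linarith

lemma IsTestFn.integrable_norm_sq (hf : IsTestFn f) : Integrable (fun x => ‖f x‖ ^ 2) := by
  have := (hf.integrable_inner hf 1).re
  refine this.congr (Eventually.of_forall fun x => ?_)
  simp only [one_apply_eq_self]
  exact inner_self_eq_norm_sq (𝕜 := ℂ) _

lemma IsTestFn.integrable_gradSq (hf : IsTestFn f) : Integrable (gradSq f) :=
  integrable_finsetSum _ fun j _ => (hf.deriv j).integrable_norm_sq

/-- The energy identity `‖H₀ f‖² = ‖f‖² + ‖∇f‖²`. -/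
lemma IsTestFn.integral_diracAct_sq (hf : IsTestFn f) :
    ∫ x, ‖diracAct f x‖ ^ 2 = (∫ x, ‖f x‖ ^ 2) + ∫ x, gradSq f x := by
  have hC : ∀ (j : Fin 3) (ξ : C4), spinMat diracβ (-(Complex.I) • spinMat (diracα j) ξ) =
      (-(Complex.I) • spinMat (diracβ * diracα j)) ξ := fun j ξ => by
    rw [map_smul, spinMat_mul, smul_apply]
  have hH : ∀ (j : Fin 3) (ξ η : C4), ⟪(-(Complex.I) • spinMat (diracβ * diracα j)) ξ, η⟫ =
      ⟪ξ, (-(Complex.I) • spinMat (diracβ * diracα j)) η⟫ := fun j ξ η => by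
    rw [smul_apply, smul_apply, inner_smul_left, inner_smul_right, ← spinMat_mul,
      inner_spinMat diracβ_herm, inner_spinMat (diracα_herm j), spinMat_mul, diracαβ, spinMat_neg,
      inner_neg_right]
    simp
  have hN : ∀ {i j : Fin 3}, i ≠ j → ∀ ξ η : C4, ⟪spinMat (diracα i * diracα j) ξ, η⟫ =
      -⟪ξ, spinMat (diracα i * diracα j) η⟫ := fun {i j} hij ξ η => by
    rw [← spinMat_mul, inner_spinMat (diracα_herm i), inner_spinMat (diracα_herm j), spinMat_mul,
      diracα_anticomm hij.symm, spinMat_neg, inner_neg_right]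
  have i1 : ∀ (M : C4 →L[ℂ] C4) {g h : V3 → C4}, IsTestFn g → IsTestFn h →
      Integrable (fun x => 2 * (⟪g x, M (h x)⟫).re) := fun M g h hg hh =>
    (hg.integrable_inner hh M).re.const_mul 2
  simp_rw [norm_diracAct_sq, hC]
  have d := hf.deriv
  rw [integral_add, integral_add hf.integrable_norm_sq hf.integrable_gradSq, integral_add,
    integral_add, integral_add, integral_finsetSum]
  · simp only [hf.integral_re_herm (hH _), hf.integral_re_antiherm (hN (by decide : (0 : Fin 3) ≠ 1)),
      hf.integral_re_antiherm (hN (by decide : (0 : Fin 3) ≠ 2)),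
      hf.integral_re_antiherm (hN (by decide : (1 : Fin 3) ≠ 2)), Finset.sum_const_zero, add_zero]
  · exact fun j _ => i1 _ hf (d j)
  · exact i1 _ (d 0) (d 1)
  · exact i1 _ (d 0) (d 2)
  · exact (i1 _ (d 0) (d 1)).add (i1 _ (d 0) (d 2))
  · exact i1 _ (d 1) (d 2)
  · exact integrable_finsetSum _ fun j _ => i1 _ hf (d j)
  · exact ((i1 _ (d 0) (d 1)).add (i1 _ (d 0) (d 2))).add (i1 _ (d 1) (d 2))
  · exact hf.integrable_norm_sq.add hf.integrable_gradSq
  · exact (integrable_finsetSum _ fun j _ => i1 _ hf (d j)).add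
      (((i1 _ (d 0) (d 1)).add (i1 _ (d 0) (d 2))).add (i1 _ (d 1) (d 2)))

end FreeEnergy

section Hardy

variable {f : V3 → C4}

lemma norm_sq_eq_re_inner (ξ : C4) : ‖ξ‖ ^ 2 = (⟪ξ, ξ⟫).re := (inner_self_eq_norm_sq (𝕜 := ℂ) ξ).symm

lemma IsTestFn.hasFDerivAt_norm_sq (hf : IsTestFn f) (x : V3) :
    ∃ p' : V3 →L[ℝ] ℝ, HasFDerivAt (fun y => ‖f y‖ ^ 2) p' x ∧
      ∀ j, p' (EuclideanSpace.single j 1) = 2 * (⟪f x, pd j f x⟫).re := by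
  have h1 := (hf.differentiable x).hasFDerivAt
  have h2 := h1.inner ℂ h1
  have h3 := Complex.reCLM.hasFDerivAt.comp x h2
  refine ⟨_, h3.congr_of_eventuallyEq (Eventually.of_forall fun y => norm_sq_eq_re_inner _), ?_⟩
  intro j
  have : (⟪fderiv ℝ f x (EuclideanSpace.single j 1), f x⟫).re =
      (⟪f x, fderiv ℝ f x (EuclideanSpace.single j 1)⟫).re := by
    rw [← inner_conj_symm, Complex.conj_re]
  simp [pd, this]
  ring

lemma norm_sq_add_pos {s : ℝ} (hs : 0 < s) (x : V3) : 0 < ‖x‖ ^ 2 + s := by positivity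

/-- The regularised Hardy inequality. -/
lemma IsTestFn.hardy (hf : IsTestFn f) {s : ℝ} (hs : 0 < s) :
    ∫ x, ‖f x‖ ^ 2 / (‖x‖ ^ 2 + s) ≤ 4 * ∫ x, gradSq f x := by
  set g : Fin 3 → V3 → ℝ := fun j x => x j * (‖x‖ ^ 2 + s)⁻¹ * ‖f x‖ ^ 2 with hg
  have hp : ContDiff ℝ 1 (fun x => ‖f x‖ ^ 2) := by
    have h1 : ContDiff ℝ 1 f := hf.1.of_le (by simp)
    simp_rw [norm_sq_eq_re_inner]
    exact Complex.reCLM.contDiff.comp (h1.inner ℂ h1)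
  have hφ : ContDiff ℝ 1 (fun x : V3 => (‖x‖ ^ 2 + s)⁻¹) :=
    ((contDiff_norm_sq ℝ).add contDiff_const).inv fun x => (norm_sq_add_pos hs x).ne'
  have hpc : HasCompactSupport (fun x => ‖f x‖ ^ 2) :=
    hf.2.mono fun x hx h0 => hx (by simp [h0])
  have hgd : ∀ j, ContDiff ℝ 1 (g j) := fun j =>
    (((EuclideanSpace.proj (𝕜 := ℝ) j).contDiff).mul hφ).mul hp
  have hgc : ∀ j, HasCompactSupport (g j) := fun j => hpc.mul_left
  have hz : ∀ j, ∫ x, fderiv ℝ (g j) x (EuclideanSpace.single j 1) = 0 := fun j =>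
    integral_fderiv_eq_zero (hgd j) (hgc j) _
  have hzi : ∀ j, Integrable fun x => fderiv ℝ (g j) x (EuclideanSpace.single j 1) := fun j =>
    (((hgd j).continuous_fderiv (by simp)).clm_apply
      continuous_const).integrable_of_hasCompactSupport ((hgc j).fderiv_apply (𝕜 := ℝ) _)
  have hsum : ∫ x, ∑ j, fderiv ℝ (g j) x (EuclideanSpace.single j 1) = 0 := by
    rw [integral_finsetSum _ fun j _ => hzi j]
    exact Finset.sum_eq_zero fun j _ => hz j
  have hφi : Integrable (fun x => ‖f x‖ ^ 2 / (‖x‖ ^ 2 + s)) := by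
    simp_rw [div_eq_mul_inv]
    exact (hp.continuous.mul hφ.continuous).integrable_of_hasCompactSupport hpc.mul_right
  have hpt : ∀ x, 2⁻¹ * (‖f x‖ ^ 2 / (‖x‖ ^ 2 + s)) - 2 * gradSq f x ≤
      ∑ j, fderiv ℝ (g j) x (EuclideanSpace.single j 1) := by
    intro x
    have hr := norm_sq_add_pos hs x
    obtain ⟨p', hp', hpj⟩ := hf.hasFDerivAt_norm_sq x
    have hφ' : HasFDerivAt (fun x : V3 => (‖x‖ ^ 2 + s)⁻¹)
        (-((‖x‖ ^ 2 + s) ^ 2)⁻¹ • (2 • innerSL ℝ x)) x := by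
      have h1 := (((hasStrictFDerivAt_norm_sq x).hasFDerivAt).add_const s)
      exact (hasDerivAt_inv hr.ne').comp_hasFDerivAt x h1
    have hd : ∀ j, fderiv ℝ (g j) x (EuclideanSpace.single j 1) =
        (‖x‖ ^ 2 + s)⁻¹ * ‖f x‖ ^ 2 - 2 * (x j) ^ 2 * ((‖x‖ ^ 2 + s) ^ 2)⁻¹ * ‖f x‖ ^ 2 +
          x j * (‖x‖ ^ 2 + s)⁻¹ * (2 * (⟪f x, pd j f x⟫).re) := fun j => by
      have h1 : HasFDerivAt (g j) _ x :=
        (((EuclideanSpace.proj (𝕜 := ℝ) j).hasFDerivAt (x := x)).mul hφ').mul hp'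
      rw [h1.fderiv]
      simp only [add_apply, smul_apply, hpj, innerSL_apply_apply, EuclideanSpace.inner_single_right,
        PiLp.proj_apply, PiLp.single_apply, smul_eq_mul, Pi.mul_apply, nsmul_eq_mul]
      simp
      ring
    simp only [hd]
    set φ := (‖x‖ ^ 2 + s)⁻¹ with hφd
    have hx2 : ∑ j, (x j) ^ 2 = ‖x‖ ^ 2 := (EuclideanSpace.real_norm_sq_eq x).symm
    have hlow : ∀ j, -(2⁻¹ * (x j) ^ 2 * φ ^ 2 * ‖f x‖ ^ 2 + 2 * ‖pd j f x‖ ^ 2) ≤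
        x j * φ * (2 * (⟪f x, pd j f x⟫).re) := fun j => by
      have h1 : |(⟪f x, pd j f x⟫).re| ≤ ‖f x‖ * ‖pd j f x‖ :=
        (Complex.abs_re_le_norm _).trans (norm_inner_le_norm _ _)
      have h2 : |x j * φ * (2 * (⟪f x, pd j f x⟫).re)| ≤
          2 * (|x j * φ| * ‖f x‖) * ‖pd j f x‖ := by
        rw [abs_mul, abs_mul 2, abs_two]
        nlinarith [abs_nonneg (x j * φ)]
      have h3 := neg_abs_le (x j * φ * (2 * (⟪f x, pd j f x⟫).re))
      have h4 : (|x j * φ| * ‖f x‖) ^ 2 = (x j) ^ 2 * φ ^ 2 * ‖f x‖ ^ 2 := by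
        rw [mul_pow, sq_abs, mul_pow]
      nlinarith [sq_nonneg (|x j * φ| * ‖f x‖ - 2 * ‖pd j f x‖)]
    have hφ0 : 0 < φ := inv_pos.2 hr
    have hφ1 : ‖x‖ ^ 2 * φ ^ 2 ≤ φ := by
      have : (‖x‖ ^ 2 + s) * φ = 1 := mul_inv_cancel₀ hr.ne'
      nlinarith [mul_pos hs (mul_pos hφ0 hφ0)]
    calc 2⁻¹ * (‖f x‖ ^ 2 / (‖x‖ ^ 2 + s)) - 2 * gradSq f x
        ≤ 3 * (φ * ‖f x‖ ^ 2) - 2 * (‖x‖ ^ 2 * φ ^ 2) * ‖f x‖ ^ 2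
          - (2⁻¹ * (‖x‖ ^ 2 * φ ^ 2) * ‖f x‖ ^ 2 + 2 * gradSq f x) := by
          rw [div_eq_mul_inv, ← hφd]
          nlinarith [mul_le_mul_of_nonneg_right hφ1 (sq_nonneg ‖f x‖)]
      _ = ∑ j, (φ * ‖f x‖ ^ 2 - 2 * (x j) ^ 2 * ((‖x‖ ^ 2 + s) ^ 2)⁻¹ * ‖f x‖ ^ 2 +
          -(2⁻¹ * (x j) ^ 2 * φ ^ 2 * ‖f x‖ ^ 2 + 2 * ‖pd j f x‖ ^ 2)) := by
          rw [← inv_pow, ← hφd, ← hx2, gradSq, Fin.sum_univ_three, Fin.sum_univ_three,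
            Fin.sum_univ_three]
          ring
      _ ≤ _ := Finset.sum_le_sum fun j _ => add_le_add le_rfl (hlow j)
  have hfin : ∫ x, (2⁻¹ * (‖f x‖ ^ 2 / (‖x‖ ^ 2 + s)) - 2 * gradSq f x) ≤ 0 := by
    rw [← hsum]
    exact integral_mono ((hφi.const_mul _).sub (hf.integrable_gradSq.const_mul _))
      (integrable_finsetSum _ fun j _ => hzi j) hpt
  rw [integral_sub (hφi.const_mul _) (hf.integrable_gradSq.const_mul _), integral_const_mul,
    integral_const_mul] at hfin
  linarith

/-- The regularised weight `a + b (|x|² + s)^{-1/2}`. -/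
def regWeight (a b s : ℝ) (x : V3) : ℝ := a + b / Real.sqrt (‖x‖ ^ 2 + s)

lemma continuous_regWeight (a b : ℝ) {s : ℝ} (hs : 0 < s) : Continuous (regWeight a b s) := by
  have : ∀ x : V3, Real.sqrt (‖x‖ ^ 2 + s) ≠ 0 := fun x =>
    (Real.sqrt_pos.2 (norm_sq_add_pos hs x)).ne'
  unfold regWeight
  fun_prop (disch := exact this _)

lemma regWeight_sq_le {a b s : ℝ} (ha : 0 ≤ a) (hb : 0 ≤ b) (hs : 0 < s) (x : V3) :
    regWeight a b s x ^ 2 ≤ (a + 2 * b) * (a + b / 2 * (1 / (‖x‖ ^ 2 + s))) := by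
  have h := norm_sq_add_pos hs x
  have e : 1 / (‖x‖ ^ 2 + s) = (1 / Real.sqrt (‖x‖ ^ 2 + s)) ^ 2 := by
    rw [div_pow, Real.sq_sqrt h.le, one_pow]
  rw [regWeight, e, div_eq_mul_one_div b]
  nlinarith [mul_nonneg (mul_nonneg ha hb) (sq_nonneg (1 / Real.sqrt (‖x‖ ^ 2 + s) - 2))]

lemma IsTestFn.weight_bound (hf : IsTestFn f) {a b s : ℝ} (ha : 0 ≤ a) (hb : 0 ≤ b) (hs : 0 < s) :
    ∫ x, regWeight a b s x ^ 2 * ‖f x‖ ^ 2 ≤ (a + 2 * b) ^ 2 * ∫ x, ‖diracAct f x‖ ^ 2 := by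
  have hc : Continuous fun x => ‖f x‖ ^ 2 := hf.1.continuous.norm.pow 2
  have hpc : HasCompactSupport (fun x => ‖f x‖ ^ 2) :=
    hf.2.mono fun x hx h0 => hx (by simp [h0])
  have hφ : Continuous (fun x : V3 => (‖x‖ ^ 2 + s)⁻¹) :=
    (by fun_prop : Continuous fun x : V3 => ‖x‖ ^ 2 + s).inv₀ fun x => (norm_sq_add_pos hs x).ne'
  have i1 : Integrable fun x => regWeight a b s x ^ 2 * ‖f x‖ ^ 2 :=
    (((continuous_regWeight a b hs).pow 2).mul hc).integrable_of_hasCompactSupport hpc.mul_left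
  have i2 : Integrable fun x => ‖f x‖ ^ 2 / (‖x‖ ^ 2 + s) := by
    simp_rw [div_eq_mul_inv]
    exact (hc.mul hφ).integrable_of_hasCompactSupport hpc.mul_right
  have i3 := hf.integrable_norm_sq
  calc ∫ x, regWeight a b s x ^ 2 * ‖f x‖ ^ 2
      ≤ ∫ x, ((a + 2 * b) * a * ‖f x‖ ^ 2 +
          (a + 2 * b) * (b / 2) * (‖f x‖ ^ 2 / (‖x‖ ^ 2 + s))) := by
        refine integral_mono i1 ((i3.const_mul _).add (i2.const_mul _)) fun x => ?_
        have := mul_le_mul_of_nonneg_right (regWeight_sq_le ha hb hs x) (sq_nonneg ‖f x‖)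
        refine this.trans (le_of_eq ?_)
        ring
    _ = (a + 2 * b) * (a * ∫ x, ‖f x‖ ^ 2) +
          (a + 2 * b) * (b / 2 * ∫ x, ‖f x‖ ^ 2 / (‖x‖ ^ 2 + s)) := by
        rw [integral_add (i3.const_mul _) (i2.const_mul _), integral_const_mul,
          integral_const_mul, mul_assoc, mul_assoc]
    _ ≤ (a + 2 * b) ^ 2 * ∫ x, ‖diracAct f x‖ ^ 2 := by
        rw [hf.integral_diracAct_sq]
        have h1 := hf.hardy hs
        have h2 : 0 ≤ ∫ x, ‖f x‖ ^ 2 := integral_nonneg fun x => by positivity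
        have h3 : 0 ≤ ∫ x, gradSq f x := integral_nonneg fun x =>
          Finset.sum_nonneg fun j _ => by positivity
        have h4 := mul_le_mul_of_nonneg_left h1 (by positivity : 0 ≤ (a + 2 * b) * (b / 2))
        nlinarith [mul_nonneg (by positivity : 0 ≤ (a + 2 * b) * a) h3,
          mul_nonneg (by positivity : 0 ≤ (a + 2 * b) * (2 * b)) h2]

end Hardy

section Multipliers

lemma lintegral_enorm_sq {f : V3 → C4} : ∫⁻ x, ‖f x‖ₑ ^ 2 = eLpNorm f 2 volume ^ 2 := by
  rw [eLpNorm_eq_lintegral_rpow_enorm_toReal (by simp) (by simp)]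
  simp only [ENNReal.toReal_ofNat, ENNReal.rpow_ofNat, one_div]
  rw [← ENNReal.rpow_natCast, ← ENNReal.rpow_mul]
  simp

lemma lintegral_enorm_sq_Lp (u : DSp) : ∫⁻ x, ‖u x‖ₑ ^ 2 = ENNReal.ofReal (‖u‖ ^ 2) := by
  rw [lintegral_enorm_sq, ← Lp.enorm_def, ← ofReal_norm, ENNReal.ofReal_pow (norm_nonneg _)]

lemma norm_sq_Lp (u : DSp) : ‖u‖ ^ 2 = ∫ x, ‖u x‖ ^ 2 := by
  have h : ((‖u‖ ^ 2 : ℝ) : ℂ) = ((∫ x, ‖u x‖ ^ 2 : ℝ) : ℂ) := by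
    have h1 := inner_self_eq_norm_sq_to_K (𝕜 := ℂ) u
    rw [L2.inner_def] at h1
    rw [← integral_complex_ofReal]
    push_cast
    refine h1.symm.trans (integral_congr_ae (Eventually.of_forall fun x => ?_))
    exact inner_self_eq_norm_sq_to_K (𝕜 := ℂ) (u x)
  exact_mod_cast h

lemma lintegral_enorm_sq_congr {f g : V3 → C4} (h : f =ᵐ[volume] g) :
    ∫⁻ x, ‖f x‖ₑ ^ 2 = ∫⁻ x, ‖g x‖ₑ ^ 2 :=
  lintegral_congr_ae (h.mono fun x hx => by simp only [hx])

/-- A pointwise multiplier composed with a bounded operator, under an `L²` bound. -/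
lemma exists_mulComp {m : V3 → C4 →L[ℂ] C4} (hm : AEStronglyMeasurable m volume)
    (K : DSp →L[ℂ] DSp) {c : ℝ} (hc : 0 ≤ c)
    (h : ∀ y, ∫⁻ x, ‖m x (K y x)‖ₑ ^ 2 ≤ ENNReal.ofReal ((c * ‖y‖) ^ 2)) :
    ∃ G : DSp →L[ℂ] DSp, ‖G‖ ≤ c ∧ ∀ y, G y =ᵐ[volume] fun x => m x (K y x) := by
  have hL : ∀ y, MemLp (fun x => m x (K y x)) 2 volume := fun y => by
    refine ⟨isBoundedBilinearMap_apply.continuous.comp_aestronglyMeasurable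
      (hm.prodMk (Lp.aestronglyMeasurable _)), ?_⟩
    have h1 := (h y).trans_lt ENNReal.ofReal_lt_top
    rw [lintegral_enorm_sq] at h1
    by_contra h2
    rw [not_lt, top_le_iff] at h2
    rw [h2] at h1
    simp at h1
  let G0 : DSp →ₗ[ℂ] DSp :=
    { toFun := fun y => (hL y).toLp _
      map_add' := fun y z => by
        rw [← MemLp.toLp_add]
        refine MemLp.toLp_congr _ _ ?_
        rw [map_add]
        filter_upwards [Lp.coeFn_add (K y) (K z)] with x hx
        rw [hx, Pi.add_apply, map_add, Pi.add_apply]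
      map_smul' := fun t y => by
        rw [RingHom.id_apply, ← MemLp.toLp_const_smul]
        refine MemLp.toLp_congr _ _ ?_
        rw [map_smul]
        filter_upwards [Lp.coeFn_smul t (K y)] with x hx
        rw [hx, Pi.smul_apply, map_smul, Pi.smul_apply] }
  have hn : ∀ y, ‖G0 y‖ ≤ c * ‖y‖ := fun y => by
    have h1 := h y
    rw [← lintegral_enorm_sq_congr (hL y).coeFn_toLp, lintegral_enorm_sq_Lp,
      ENNReal.ofReal_le_ofReal_iff (by positivity)] at h1
    exact le_of_sq_le_sq h1 (by positivity)
  refine ⟨G0.mkContinuous c hn, LinearMap.mkContinuous_norm_le _ hc _, fun y => ?_⟩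
  exact (hL y).coeFn_toLp

/-- Multiplication by a bounded operator-valued function. -/
lemma exists_mul {m : V3 → C4 →L[ℂ] C4} (hm : AEStronglyMeasurable m volume) {c : ℝ} (hc : 0 ≤ c)
    (h : ∀ᵐ x, ‖m x‖ ≤ c) :
    ∃ G : DSp →L[ℂ] DSp, ‖G‖ ≤ c ∧ ∀ y, G y =ᵐ[volume] fun x => m x (y x) := by
  refine exists_mulComp hm 1 hc fun y => ?_
  rw [mul_pow, ENNReal.ofReal_mul (by positivity), one_apply_eq_self, ← lintegral_enorm_sq_Lp,
    ← lintegral_const_mul' _ _ ENNReal.ofReal_ne_top]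
  refine lintegral_mono_ae (h.mono fun x hx => ?_)
  rw [ENNReal.ofReal_pow hc, ← mul_pow]
  gcongr
  rw [← ofReal_norm, ← ofReal_norm, ← ENNReal.ofReal_mul hc]
  exact ENNReal.ofReal_le_ofReal ((m x).le_of_opNorm_le hx _)

/-- Scalar functions as multipliers. -/
def scalarMult (g : V3 → ℝ) (x : V3) : C4 →L[ℂ] C4 := (g x : ℂ) • 1

lemma aestronglyMeasurable_scalarMult {g : V3 → ℝ} (hg : Measurable g) :
    AEStronglyMeasurable (scalarMult g) volume :=
  ((Complex.measurable_ofReal.comp hg).aestronglyMeasurable (μ := volume)).smul_const _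

lemma scalarMult_apply (g : V3 → ℝ) (x : V3) (ξ : C4) : scalarMult g x ξ = (g x : ℂ) • ξ := by
  rw [scalarMult, smul_apply, one_apply_eq_self]

lemma norm_scalarMult_le (g : V3 → ℝ) (x : V3) : ‖scalarMult g x‖ ≤ |g x| :=
  ContinuousLinearMap.opNorm_le_bound _ (abs_nonneg _) fun ξ => by
    rw [scalarMult_apply, norm_smul, Complex.norm_real, Real.norm_eq_abs]

/-- The inner product of `L²` functions known up to null sets. -/
lemma inner_eq_integral {u v : DSp} {f g : V3 → C4} (hu : u =ᵐ[volume] f) (hv : v =ᵐ[volume] g) :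
    ⟪u, v⟫ = ∫ x, ⟪f x, g x⟫ := by
  rw [L2.inner_def]
  refine integral_congr_ae ?_
  filter_upwards [hu, hv] with x hx hx'
  rw [hx, hx']

end Multipliers

section FreeDirac

lemma mem_testSub {u : DSp} (hu : u ∈ testSub) : ∃ f : V3 → C4, IsTestFn f ∧ ⇑u =ᵐ[volume] f := by
  induction hu using Submodule.span_induction with
  | mem x h => exact h
  | zero => exact ⟨0, ⟨contDiff_const, HasCompactSupport.zero⟩, Lp.coeFn_zero _ _ _⟩
  | add x y _ _ hx hy =>
    obtain ⟨f, hf, hxf⟩ := hx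
    obtain ⟨g, hg, hyg⟩ := hy
    exact ⟨f + g, ⟨hf.1.add hg.1, hf.2.add hg.2⟩, (Lp.coeFn_add x y).trans (hxf.add hyg)⟩
  | smul c x _ hx =>
    obtain ⟨f, hf, hxf⟩ := hx
    exact ⟨fun x => c • f x, ⟨hf.1.const_smul c, hf.2.mono fun y hy h0 => hy (by simp [h0])⟩,
      (Lp.coeFn_smul c x).trans (hxf.mono fun y hy => by simp [hy])⟩

lemma graph_closure_le {X : Type*} [NormedAddCommGroup X] [NormedSpace ℂ X] (f : X →ₗ.[ℂ] X) :
    f.closure.graph ≤ f.graph.topologicalClosure := by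
  by_cases h : f.IsClosable
  · rw [h.graph_closure_eq_closure_graph]
  · rw [LinearPMap.closure_def' h]
    exact Submodule.le_topologicalClosure _

/-- Closed relations between `u` and `H₀ u` need only be checked on test functions. -/
lemma IsFreeDirac.induction {H0 : DSp →ₗ.[ℂ] DSp} (h0 : IsFreeDirac H0) {P : DSp → DSp → Prop}
    (hcl : IsClosed {p : DSp × DSp | P p.1 p.2})
    (h : ∀ f, IsTestFn f → ∀ u v : DSp, u =ᵐ[volume] f → v =ᵐ[volume] (fun x => diracAct f x) →
      P u v) (u : H0.domain) : P u (H0 u) := by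
  have hg : ((u : DSp), H0 u) ∈ (H0.domRestrict testSub).closure.graph := by
    rw [h0.2.1.2]
    exact H0.mem_graph u
  have hg' : ((u : DSp), H0 u) ∈ closure ((H0.domRestrict testSub).graph : Set (DSp × DSp)) :=
    graph_closure_le _ hg
  refine closure_minimal (fun p hp => ?_) hcl hg'
  obtain ⟨y, hy1, hy2⟩ := (LinearPMap.mem_graph_iff _).1 hp
  obtain ⟨f, hf, hyf⟩ := mem_testSub (u := (y : DSp)) y.2.1
  obtain ⟨hu, hv⟩ := h0.2.2 y f hf hyf
  refine h f hf _ _ (hy1 ▸ hyf) ?_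
  have e : H0 ⟨y, hu⟩ = p.2 := by
    rw [← hy2]
    exact (LinearPMap.domRestrict_apply (x := y) (y := ⟨y, hu⟩) rfl).symm
  rw [← e]
  exact hv

variable {H0 : DSp →ₗ.[ℂ] DSp} {R : DSp →L[ℂ] DSp}

lemma IsFreeDirac.induction_res (h0 : IsFreeDirac H0) (hR : IsResolventAt H0 0 R)
    {P : DSp → DSp → Prop} (hcl : IsClosed {p : DSp × DSp | P p.1 p.2})
    (h : ∀ f, IsTestFn f → ∀ u v : DSp, u =ᵐ[volume] f → v =ᵐ[volume] (fun x => diracAct f x) →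
      P u v) (y : DSp) : P (R y) y := by
  obtain ⟨hy, e⟩ := hR.2 y
  rw [zero_smul, sub_zero] at e
  have := h0.induction hcl h ⟨R y, hy⟩
  rwa [e] at this

lemma norm_sq_of_ae {u : DSp} {f : V3 → C4} (h : u =ᵐ[volume] f) : ‖u‖ ^ 2 = ∫ x, ‖f x‖ ^ 2 := by
  rw [norm_sq_Lp]
  exact integral_congr_ae (h.mono fun x hx => by simp only [hx])

lemma regWeight_nonneg {a b : ℝ} (ha : 0 ≤ a) (hb : 0 ≤ b) (s : ℝ) (x : V3) :
    0 ≤ regWeight a b s x := add_nonneg ha (div_nonneg hb (Real.sqrt_nonneg _))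

lemma regWeight_le {a b s : ℝ} (hb : 0 ≤ b) (hs : 0 < s) (x : V3) :
    regWeight a b s x ≤ a + b / √s := by
  have : 0 < √s := Real.sqrt_pos.2 hs
  rw [regWeight]
  gcongr
  nlinarith [sq_nonneg ‖x‖]

lemma IsFreeDirac.exists_regWeight (h0 : IsFreeDirac H0) (hR : IsResolventAt H0 0 R)
    {a b s : ℝ} (ha : 0 ≤ a) (hb : 0 ≤ b) (hs : 0 < s) :
    ∃ M : DSp →L[ℂ] DSp, (∀ u, M u =ᵐ[volume] fun x => scalarMult (regWeight a b s) x (u x)) ∧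
      ∀ y, ‖M (R y)‖ ≤ (a + 2 * b) * ‖y‖ := by
  obtain ⟨M, -, hM⟩ := exists_mul
    (aestronglyMeasurable_scalarMult (continuous_regWeight a b hs).measurable)
    (c := a + b / √s) (by positivity) (Eventually.of_forall fun x =>
      (norm_scalarMult_le _ x).trans (by
        rw [abs_of_nonneg (regWeight_nonneg ha hb s x)]
        exact regWeight_le hb hs x))
  refine ⟨M, hM, fun y => ?_⟩
  refine h0.induction_res hR (P := fun u v => ‖M u‖ ≤ (a + 2 * b) * ‖v‖)
    (isClosed_le (by fun_prop) (by fun_prop)) (fun f hf u v hu hv => ?_) y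
  refine le_of_sq_le_sq ?_ (by positivity)
  rw [mul_pow, norm_sq_of_ae hv, norm_sq_of_ae (f := fun x => (regWeight a b s x : ℂ) • f x)
    (by filter_upwards [hM u, hu] with x h1 h2; rw [h1, h2, scalarMult_apply])]
  refine le_trans (le_of_eq (integral_congr_ae (Eventually.of_forall fun x => ?_)))
    (hf.weight_bound ha hb hs)
  simp only [norm_smul, mul_pow, Complex.norm_real, Real.norm_eq_abs, sq_abs]

lemma lintegral_scalarMult_le_of_tendsto {g : ℕ → V3 → ℝ} {g' : V3 → ℝ}
    (hg : ∀ n, Measurable (g n)) (hl : ∀ᵐ x, Tendsto (fun n => g n x) atTop (𝓝 (g' x)))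
    {u : DSp} {C : ℝ≥0∞} (h : ∀ n, ∫⁻ x, ‖scalarMult (g n) x (u x)‖ₑ ^ 2 ≤ C) :
    ∫⁻ x, ‖scalarMult g' x (u x)‖ₑ ^ 2 ≤ C := by
  calc ∫⁻ x, ‖scalarMult g' x (u x)‖ₑ ^ 2
      = ∫⁻ x, liminf (fun n => ‖scalarMult (g n) x (u x)‖ₑ ^ 2) atTop := by
        refine lintegral_congr_ae (hl.mono fun x hx => ?_)
        refine (Tendsto.liminf_eq ?_).symm
        simp only [scalarMult_apply]
        refine ENNReal.Tendsto.pow (Tendsto.enorm ?_)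
        exact ((Complex.continuous_ofReal.tendsto _).comp hx).smul_const _
    _ ≤ liminf (fun n => ∫⁻ x, ‖scalarMult (g n) x (u x)‖ₑ ^ 2) atTop :=
        lintegral_liminf_le' fun n => ((isBoundedBilinearMap_apply.continuous.comp_aestronglyMeasurable
          ((aestronglyMeasurable_scalarMult (hg n)).prodMk
            (Lp.aestronglyMeasurable u))).enorm.pow_const 2)
    _ ≤ C := by
        refine (liminf_le_liminf (Eventually.of_forall h)).trans_eq ?_
        simp

/-- The singular weight `a + b / |x|`. -/
def weight (a b : ℝ) (x : V3) : ℝ := a + b / ‖x‖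

lemma weight_nonneg {a b : ℝ} (ha : 0 ≤ a) (hb : 0 ≤ b) (x : V3) : 0 ≤ weight a b x :=
  add_nonneg ha (div_nonneg hb (norm_nonneg _))

lemma measurable_weight (a b : ℝ) : Measurable (weight a b) :=
  (measurable_const.div measurable_norm).const_add a

lemma tendsto_regWeight (a b : ℝ) : ∀ᵐ x : V3, Tendsto (fun n : ℕ => regWeight a b (1 / (n + 1)) x)
    atTop (𝓝 (weight a b x)) := by
  filter_upwards [compl_mem_ae_iff.2 (measure_singleton (0 : V3))] with x hx
  have h1 : Tendsto (fun n : ℕ => √(‖x‖ ^ 2 + 1 / ((n : ℝ) + 1))) atTop (𝓝 √(‖x‖ ^ 2 + 0)) :=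
    (Real.continuous_sqrt.tendsto _).comp (tendsto_one_div_add_atTop_nhds_zero_nat.const_add _)
  rw [add_zero, Real.sqrt_sq (norm_nonneg x)] at h1
  exact (tendsto_const_nhds.div h1 (norm_ne_zero_iff.2 hx)).const_add a

variable {A J : DSp →L[ℂ] DSp}

lemma IsFreeDirac.lintegral_weight_le (h0 : IsFreeDirac H0) (hR : IsResolventAt H0 0 R)
    (hs : SqrtSetup A J) (hA : ∀ x, A (A x) = R (J x)) {a b : ℝ} (ha : 0 ≤ a) (hb : 0 ≤ b)
    (y : DSp) :
    ∫⁻ x, ‖scalarMult (weight a b) x (A (A y) x)‖ₑ ^ 2 ≤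
        ENNReal.ofReal (((a + 2 * b) * ‖y‖) ^ 2) ∧
    ∫⁻ x, ‖scalarMult (fun x => √(weight a b x)) x (A y x)‖ₑ ^ 2 ≤
        ENNReal.ofReal ((√(a + 2 * b) * ‖y‖) ^ 2) := by
  have hJ : ∀ x, ‖J x‖ = ‖x‖ := fun x => by
    rw [← sq_eq_sq₀ (norm_nonneg _) (norm_nonneg _), ← inner_self_eq_norm_sq (𝕜 := ℂ),
      ← inner_self_eq_norm_sq (𝕜 := ℂ), hs.symmJ, hs.invol]
  have hn : ∀ n : ℕ, (0 : ℝ) < 1 / (n + 1) := fun n => by positivity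
  choose M hM hMR using fun n : ℕ => h0.exists_regWeight hR ha hb (hn n)
  have hMA : ∀ n x, ‖M n (A (A x))‖ ≤ (a + 2 * b) * ‖x‖ := fun n x => by
    rw [hA]
    exact (hMR n _).trans_eq (by rw [hJ])
  have hw := fun n : ℕ => (continuous_regWeight a b (hn n)).measurable
  constructor
  · refine lintegral_scalarMult_le_of_tendsto hw (tendsto_regWeight a b) fun n => ?_
    rw [← lintegral_enorm_sq_congr (hM n _), lintegral_enorm_sq_Lp]
    exact ENNReal.ofReal_le_ofReal (pow_le_pow_left₀ (norm_nonneg _) (hMA n y) 2)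
  · refine lintegral_scalarMult_le_of_tendsto (fun n => (hw n).sqrt)
      ((tendsto_regWeight a b).mono fun x hx => (Real.continuous_sqrt.tendsto _).comp hx)
      fun n => ?_
    have hsym : ∀ u v, ⟪M n u, v⟫ = ⟪u, M n v⟫ := fun u v => by
      rw [inner_eq_integral (hM n u) EventuallyEq.rfl, inner_eq_integral EventuallyEq.rfl (hM n v)]
      simp only [scalarMult_apply, inner_smul_left, inner_smul_right, Complex.conj_ofReal]
    have hC : ‖A * (M n * A)‖ ≤ a + 2 * b := by
      have hd : DenseRange A := dense_range_of_star_inj fun x hx => by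
        rw [ContinuousLinearMap.star_eq_adjoint] at hx
        refine hs.inj x ?_
        rw [← inner_self_eq_zero (𝕜 := ℂ), hs.symmA, ← ContinuousLinearMap.adjoint_inner_left, hx,
          inner_zero_left]
      refine (norm_le_of_intertwine (K := M n * (A * A)) hd (fun x y => ?_) fun x => ?_).trans ?_
      · simp only [mul_apply_eq_comp]
        rw [hs.symmA, hsym, hs.symmA]
      · simp only [mul_apply_eq_comp]
      · exact ContinuousLinearMap.opNorm_le_bound _ (by positivity) fun x => hMA n x
    have e : ∫⁻ x, ‖scalarMult (fun x => √(regWeight a b (1 / (n + 1)) x)) x (A y x)‖ₑ ^ 2 =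
        ENNReal.ofReal (∫ x, regWeight a b (1 / (n + 1)) x * ‖A y x‖ ^ 2) := by
      rw [ofReal_integral_eq_lintegral_ofReal]
      · refine lintegral_congr fun x => ?_
        rw [scalarMult_apply, ← ofReal_norm, ← ENNReal.ofReal_pow (norm_nonneg _), norm_smul,
          mul_pow, Complex.norm_real, Real.norm_eq_abs, sq_abs,
          Real.sq_sqrt (regWeight_nonneg ha hb _ x)]
      · refine (L2.integrable_inner (𝕜 := ℂ) (A y) (M n (A y))).re.congr ?_
        filter_upwards [hM n (A y)] with x hx
        rw [hx, scalarMult_apply, inner_smul_right, RCLike.re_eq_complex_re,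
          Complex.re_ofReal_mul, ← norm_sq_eq_re_inner]
      · exact Eventually.of_forall fun x =>
          mul_nonneg (regWeight_nonneg ha hb _ x) (sq_nonneg _)
    have e2 : ((∫ x, regWeight a b (1 / (n + 1)) x * ‖A y x‖ ^ 2 : ℝ) : ℂ) =
        ⟪y, (A * (M n * A)) y⟫ := by
      simp only [mul_apply_eq_comp]
      rw [← hs.symmA, inner_eq_integral EventuallyEq.rfl (hM n _), ← integral_complex_ofReal]
      refine integral_congr_ae (Eventually.of_forall fun x => ?_)
      simp only [scalarMult_apply, inner_smul_right, inner_self_eq_norm_sq_to_K]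
      push_cast
      rfl
    rw [e]
    refine ENNReal.ofReal_le_ofReal ?_
    rw [mul_pow, Real.sq_sqrt (by positivity)]
    have h1 := norm_inner_le_norm (𝕜 := ℂ) y ((A * (M n * A)) y)
    rw [← e2, Complex.norm_real] at h1
    refine (le_abs_self _).trans (h1.trans ?_)
    have h2 := (A * (M n * A)).le_of_opNorm_le hC y
    exact (mul_le_mul_of_nonneg_left h2 (norm_nonneg y)).trans_eq (by ring)

end FreeDirac

section Potential

variable {V : V3 → Matrix (Fin 4) (Fin 4) ℂ} {a b : ℝ}

lemma aestronglyMeasurable_spinMat (hV : ∀ i j : Fin 4, Measurable fun x : V3 => V x i j) :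
    AEStronglyMeasurable (fun x => spinMat (V x)) volume := by
  let l : (Fin 4 → Fin 4 → ℂ) →ₗ[ℂ] (C4 →L[ℂ] C4) :=
    { toFun := fun M => spinMat (Matrix.of M)
      map_add' := fun M N => map_add (Matrix.toEuclideanCLM (n := Fin 4) (𝕜 := ℂ)) _ _
      map_smul' := fun t M => map_smul (Matrix.toEuclideanCLM (n := Fin 4) (𝕜 := ℂ)) t _ }
  exact l.continuous_of_finiteDimensional.comp_aestronglyMeasurable
    (measurable_pi_lambda _ fun i => measurable_pi_lambda _ (hV i)).aestronglyMeasurable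

lemma scalarMult_apply_real (g : V3 → ℝ) (x : V3) (ξ : C4) : scalarMult g x ξ = g x • ξ := by
  rw [scalarMult_apply, Complex.coe_smul]

lemma spinMat_real_smul (M : Matrix (Fin 4) (Fin 4) ℂ) (t : ℝ) (ξ : C4) :
    spinMat M (t • ξ) = t • spinMat M ξ := by
  rw [← Complex.coe_smul, map_smul, Complex.coe_smul]

lemma inner_weight_smul {w : ℝ} (hw : 0 ≤ w) (M : Matrix (Fin 4) (Fin 4) ℂ) (ξ η : C4) :
    ⟪√w • ξ, w⁻¹ • spinMat M (√w • η)⟫ = ⟪ξ, w⁻¹ • w • spinMat M η⟫ := by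
  rw [spinMat_real_smul, inner_smul_left_eq_smul, ← inner_smul_right_eq_smul, smul_comm,
    smul_smul √w, Real.mul_self_sqrt hw]

/-- Multiplication by a Hermitian matrix potential with a bounded real cut-off or weight. -/
lemma exists_mul_spinMat (hV : ∀ i j : Fin 4, Measurable fun x : V3 => V x i j)
    (hh : ∀ᵐ x : V3 ∂volume, (V x).IsHermitian) {φ : V3 → ℝ} (hφ : Measurable φ) {c : ℝ}
    (hc : 0 ≤ c) (hb : ∀ᵐ x : V3 ∂volume, ∀ ξ : C4, ‖φ x • mapp (V x) ξ‖ ≤ c * ‖ξ‖) :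
    ∃ N : DSp →L[ℂ] DSp, ‖N‖ ≤ c ∧
      (∀ u, N u =ᵐ[volume] fun x => φ x • spinMat (V x) (u x)) ∧
      ∀ u v, ⟪N u, v⟫ = ⟪u, N v⟫ := by
  obtain ⟨N, h1, h2⟩ := exists_mul (m := fun x => φ x • spinMat (V x)) (c := c)
    (hφ.aestronglyMeasurable.smul (aestronglyMeasurable_spinMat hV)) hc
    (hb.mono fun x hx => ContinuousLinearMap.opNorm_le_bound _ hc hx)
  refine ⟨N, h1, h2, fun u v => ?_⟩
  rw [inner_eq_integral (h2 u) EventuallyEq.rfl, inner_eq_integral EventuallyEq.rfl (h2 v)]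
  refine integral_congr_ae (hh.mono fun x hx => ?_)
  simp only [smul_apply]
  rw [inner_smul_left_eq_smul, inner_smul_right_eq_smul, inner_spinMat hx]

set_option maxHeartbeats 1000000 in
/-- The bounded form operator of a matrix potential, and its conjugate by `|H₀|^{1/2}`. -/
theorem IsFreeDirac.exists_potential {H0 : DSp →ₗ.[ℂ] DSp} {R A J : DSp →L[ℂ] DSp}
    (h0 : IsFreeDirac H0) (hR : IsResolventAt H0 0 R)
    (hs : SqrtSetup A J) (hA : ∀ x, A (A x) = R (J x)) (ha : 0 ≤ a) (hb : 0 ≤ b)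
    (hV : ∀ i j : Fin 4, Measurable fun x : V3 => V x i j)
    (hh : ∀ᵐ x : V3 ∂volume, (V x).IsHermitian)
    (hbd : ∀ᵐ x : V3 ∂volume, ∀ ξ : C4, ‖mapp (V x) ξ‖ ≤ (a + b / ‖x‖) * ‖ξ‖) :
    ∃ W Wh : DSp →L[ℂ] DSp, star W = W ∧ ‖W‖ ≤ a + 2 * b ∧ ‖Wh‖ ≤ a + 2 * b ∧
      (∀ x, W (A x) = A (Wh x)) ∧ (∀ x y, ⟪y, W x⟫ = matPotForm V (A x) (A y)) ∧
      ∀ u, Wh u =ᵐ[volume] fun x => spinMat (V x) (A (A u) x) := by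
  have hq : 0 ≤ a + 2 * b := by positivity
  obtain ⟨G, hG1, hG2⟩ := exists_mulComp
    (aestronglyMeasurable_scalarMult (measurable_weight a b).sqrt) A (Real.sqrt_nonneg _)
    fun y => (h0.lintegral_weight_le hR hs hA ha hb y).2
  obtain ⟨L, hL1, hL2⟩ := exists_mulComp
    (aestronglyMeasurable_scalarMult (measurable_weight a b)) (A * A) hq
    fun y => (h0.lintegral_weight_le hR hs hA ha hb y).1
  have hle : ∀ x, (weight a b x)⁻¹ * weight a b x ≤ 1 := fun x => by
    rw [mul_comm]
    exact mul_inv_le_one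
  obtain ⟨N, hN1, hN2, hN3⟩ := exists_mul_spinMat hV hh (measurable_weight a b).inv zero_le_one
    (hbd.mono fun x hx ξ => by
      rw [norm_smul, Real.norm_eq_abs, Pi.inv_apply,
        abs_of_nonneg (inv_nonneg.2 (weight_nonneg ha hb x))]
      calc _ ≤ (weight a b x)⁻¹ * (weight a b x * ‖ξ‖) := by
            gcongr
            · exact inv_nonneg.2 (weight_nonneg ha hb x)
            · exact hx ξ
        _ = ((weight a b x)⁻¹ * weight a b x) * ‖ξ‖ := by ring
        _ ≤ _ := by gcongr; exact hle x)
  have hcancel : ∀ᵐ x : V3, ∀ ξ : C4,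
      (weight a b x)⁻¹ • weight a b x • spinMat (V x) ξ = spinMat (V x) ξ :=
    hbd.mono fun x hx ξ => by
      by_cases h : weight a b x = 0
      · have h1 := hx ξ
        rw [show a + b / ‖x‖ = 0 from h, zero_mul, norm_le_zero_iff] at h1
        rw [← mapp_eq, h1, smul_zero, smul_zero]
      · rw [inv_smul_smul₀ h]
  have hWh : ∀ u, (N * L) u =ᵐ[volume] fun x => spinMat (V x) (A (A u) x) := fun u => by
    filter_upwards [hN2 (L u), hL2 u, hcancel] with x h1 h2 h3
    rw [mul_apply_eq_comp, h1, h2, scalarMult_apply_real, Pi.inv_apply, spinMat_real_smul, h3,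
      mul_apply_eq_comp]
  have hW : ∀ x y, ⟪y, (star G * (N * G)) x⟫ = matPotForm V (A x) (A y) := fun x y => by
    rw [mul_apply_eq_comp, ContinuousLinearMap.star_eq_adjoint,
      ContinuousLinearMap.adjoint_inner_right, mul_apply_eq_comp,
      inner_eq_integral (hG2 y) (hN2 (G x)), matPotForm]
    refine integral_congr_ae ?_
    filter_upwards [hG2 x, hcancel] with p h1 h2
    rw [h1, scalarMult_apply_real, scalarMult_apply_real, Pi.inv_apply,
      inner_weight_smul (weight_nonneg ha hb p), h2, mapp_eq]
  refine ⟨star G * (N * G), N * L, ?_, ?_, ?_, fun x => ?_, hW, hWh⟩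
  · have : star N = N := ContinuousLinearMap.isSelfAdjoint_iff_isSymmetric.2 hN3
    rw [star_mul, star_mul, star_star, this, mul_assoc]
  · have h1 : ‖star G‖ ≤ √(a + 2 * b) := (norm_star G).le.trans hG1
    calc ‖star G * (N * G)‖ ≤ ‖star G‖ * (‖N‖ * ‖G‖) :=
          (norm_mul_le _ _).trans (mul_le_mul_of_nonneg_left (norm_mul_le _ _) (norm_nonneg _))
      _ ≤ √(a + 2 * b) * (1 * √(a + 2 * b)) := by gcongr
      _ = a + 2 * b := by rw [one_mul, Real.mul_self_sqrt hq]
  · calc ‖N * L‖ ≤ ‖N‖ * ‖L‖ := norm_mul_le _ _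
      _ ≤ 1 * (a + 2 * b) := by gcongr
      _ = _ := one_mul _
  · refine ext_inner_left ℂ fun y => ?_
    rw [hW, ← hs.symmA, inner_eq_integral EventuallyEq.rfl (hWh x)]
    rfl

end Potential

section BallAverage

/-- The volume of the ball of radius `ε`. -/
def ballVol (ε : ℝ) : ℝ := volume.real (Metric.ball (0 : V3) ε)

lemma ballVol_pos {ε : ℝ} (hε : 0 < ε) : 0 < ballVol ε :=
  ENNReal.toReal_pos (Metric.measure_ball_pos _ _ hε).ne' measure_ball_lt_top.ne

lemma ballVol_div {ρ ε : ℝ} (hρ : 0 < ρ) (hε : 0 < ε) : ballVol ρ / ballVol ε = (ρ / ε) ^ 3 := by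
  have h : ∀ {r : ℝ}, 0 < r → ballVol r = r ^ 3 * ballVol 1 := fun {r} hr => by
    rw [ballVol, ballVol, measureReal_def, Measure.addHaar_ball_of_pos _ _ hr,
      finrank_euclideanSpace_fin, ENNReal.toReal_mul, ENNReal.toReal_ofReal (by positivity),
      measureReal_def]
  have h1 := ballVol_pos one_pos
  rw [h hρ, h hε]
  field_simp

/-- The average of `f` over the ball of radius `ε` around `x`. -/
def ballAvg (ε : ℝ) (f : V3 → C4) (x : V3) : C4 :=
  (ballVol ε)⁻¹ • ∫ y in Metric.ball x ε, f y

/-- The vectors representing the components of the ball average. -/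
def ballVec (ε : ℝ) (x : V3) (j : Fin 4) : DSp :=
  indicatorConstLp 2 (Metric.isOpen_ball (x := x) (ε := ε)).measurableSet measure_ball_lt_top.ne
    ((ballVol ε)⁻¹ • EuclideanSpace.single j (1 : ℂ))

lemma inner_ballVec (ε : ℝ) (x : V3) (j : Fin 4) (u : DSp) :
    ⟪ballVec ε x j, u⟫ = ballAvg ε u x j := by
  rw [ballVec, L2.inner_indicatorConstLp_eq_inner_setIntegral, inner_smul_left_eq_smul,
    EuclideanSpace.inner_single_left, map_one, one_mul, ballAvg, PiLp.smul_apply]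

lemma norm_sq_ballVec {ε : ℝ} (hε : 0 < ε) (x : V3) (j : Fin 4) :
    ‖ballVec ε x j‖ ^ 2 = (ballVol ε)⁻¹ := by
  have h := ballVol_pos hε
  have h2 : volume.real (Metric.ball x ε) = ballVol ε := Measure.addHaar_real_ball_center _ _ _
  rw [ballVec, norm_indicatorConstLp (by simp) (by simp), h2, norm_smul, PiLp.norm_single,
    norm_one, mul_one, Real.norm_eq_abs, abs_of_pos (inv_pos.2 h), ENNReal.toReal_ofNat,
    ← Real.sqrt_eq_rpow, mul_pow, Real.sq_sqrt h.le]
  field_simp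

lemma norm_sq_ballAvg (ε : ℝ) (u : DSp) (x : V3) :
    ‖ballAvg ε u x‖ ^ 2 = ∑ j, ‖⟪ballVec ε x j, u⟫‖ ^ 2 := by
  rw [EuclideanSpace.norm_sq_eq]
  simp only [inner_ballVec]

lemma sum_norm_sq_ballAvg_le {ε : ℝ} (hε : 0 < ε) (K : DSp →L[ℂ] DSp) {n : ℕ} {e : Fin n → DSp}
    (he : Orthonormal ℂ e) (x : V3) :
    ∑ i, ‖ballAvg ε (K (e i)) x‖ ^ 2 ≤ 4 * (ballVol ε)⁻¹ * ‖K‖ ^ 2 := by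
  simp only [norm_sq_ballAvg]
  rw [Finset.sum_comm]
  have h : ∀ j : Fin 4, ∑ i, ‖⟪ballVec ε x j, K (e i)⟫‖ ^ 2 ≤ (ballVol ε)⁻¹ * ‖K‖ ^ 2 := fun j => by
    have h1 := he.sum_inner_products_le (x := star K (ballVec ε x j)) (s := Finset.univ)
    have h2 := (star K).le_opNorm (ballVec ε x j)
    calc ∑ i, ‖⟪ballVec ε x j, K (e i)⟫‖ ^ 2
        = ∑ i, ‖⟪e i, star K (ballVec ε x j)⟫‖ ^ 2 := Finset.sum_congr rfl fun i _ => by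
          rw [norm_inner_symm, ContinuousLinearMap.star_eq_adjoint,
            ContinuousLinearMap.adjoint_inner_right]
      _ ≤ ‖star K (ballVec ε x j)‖ ^ 2 := h1
      _ ≤ (‖star K‖ * ‖ballVec ε x j‖) ^ 2 := pow_le_pow_left₀ (norm_nonneg _) h2 2
      _ = (ballVol ε)⁻¹ * ‖K‖ ^ 2 := by
        rw [mul_pow, norm_sq_ballVec hε, show ‖star K‖ = ‖K‖ from norm_star K, mul_comm]
  refine (Finset.sum_le_sum fun j _ => h j).trans_eq ?_
  rw [Finset.sum_const, Finset.card_univ, Fintype.card_fin, nsmul_eq_mul]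
  push_cast
  ring

lemma norm_sq_ballAvg_le {ε : ℝ} (hε : 0 < ε) (u : DSp) (x : V3) :
    ‖ballAvg ε u x‖ ^ 2 ≤ 4 * (ballVol ε)⁻¹ * ‖u‖ ^ 2 := by
  rw [norm_sq_ballAvg]
  refine (Finset.sum_le_sum (g := fun _ => (ballVol ε)⁻¹ * ‖u‖ ^ 2) fun j _ => ?_).trans_eq ?_
  · refine (pow_le_pow_left₀ (norm_nonneg _) (norm_inner_le_norm (𝕜 := ℂ) _ _) 2).trans_eq ?_
    rw [mul_pow, norm_sq_ballVec hε]
  · rw [Finset.sum_const, Finset.card_univ, Fintype.card_fin, nsmul_eq_mul]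
    push_cast
    ring

lemma stronglyMeasurable_ballAvg (ε : ℝ) (u : DSp) : StronglyMeasurable (ballAvg ε u) := by
  have h : StronglyMeasurable fun p : V3 × V3 =>
      {p : V3 × V3 | dist p.2 p.1 < ε}.indicator (fun p => u p.2) p :=
    ((Lp.stronglyMeasurable u).comp_measurable measurable_snd).indicator
      (isOpen_lt (by fun_prop) (by fun_prop)).measurableSet
  refine StronglyMeasurable.const_smul (f := fun x => ∫ y in Metric.ball x ε, u y) ?_ (ballVol ε)⁻¹
  have h2 := h.integral_prod_right' (ν := (volume : Measure V3))
  refine (funext fun x => ?_ : (fun x => ∫ y in Metric.ball x ε, u y) = _) ▸ h2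
  rw [← integral_indicator Metric.isOpen_ball.measurableSet]
  rfl

/-- The averaging operator, cut off to a ball, is Hilbert-Schmidt. -/
lemma exists_ballAvg {ρ ε : ℝ} (hρ : 0 < ρ) (hε : 0 < ε) :
    ∃ G : DSp →L[ℂ] DSp, (∀ u, G u =ᵐ[volume] (Metric.ball 0 ρ).indicator (ballAvg ε u)) ∧
      ∀ (K : DSp →L[ℂ] DSp) (n : ℕ) (e : Fin n → DSp), Orthonormal ℂ e →
        ∑ i, ‖G (K (e i))‖ ^ 2 ≤ 4 * (ρ / ε) ^ 3 * ‖K‖ ^ 2 := by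
  have hm : MeasurableSet (Metric.ball (0 : V3) ρ) := Metric.isOpen_ball.measurableSet
  have hv := ballVol_pos hε
  have hle : ∀ (u : DSp) x, ‖ballAvg ε u x‖ ≤ √(4 * (ballVol ε)⁻¹ * ‖u‖ ^ 2) := fun u x =>
    Real.le_sqrt_of_sq_le (norm_sq_ballAvg_le hε u x)
  have hL : ∀ u : DSp, MemLp ((Metric.ball (0 : V3) ρ).indicator (ballAvg ε u)) 2 volume := fun u => by
    rw [memLp_indicator_iff_restrict hm]
    have : IsFiniteMeasure ((volume : Measure V3).restrict (Metric.ball 0 ρ)) :=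
      ⟨by rw [Measure.restrict_apply_univ]; exact measure_ball_lt_top⟩
    exact MemLp.of_bound (stronglyMeasurable_ballAvg ε u).aestronglyMeasurable _
      (Eventually.of_forall (hle u))
  have hadd : ∀ u v : DSp, ballAvg ε ⇑(u + v) = ballAvg ε u + ballAvg ε v := fun u v => by
    ext x j
    rw [Pi.add_apply, PiLp.add_apply, ← inner_ballVec, ← inner_ballVec, ← inner_ballVec,
      inner_add_right]
  have hsmul : ∀ (t : ℂ) (u : DSp), ballAvg ε ⇑(t • u) = t • ballAvg ε u := fun t u => by
    ext x j
    rw [Pi.smul_apply, PiLp.smul_apply, ← inner_ballVec, ← inner_ballVec, inner_smul_right,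
      smul_eq_mul]
  have hint : ∀ u : DSp, IntegrableOn (fun x => ‖ballAvg ε u x‖ ^ 2) (Metric.ball 0 ρ) := fun u =>
    Measure.integrableOn_of_bounded measure_ball_lt_top.ne
      ((stronglyMeasurable_ballAvg ε u).norm.pow 2).aestronglyMeasurable
      (Eventually.of_forall fun x => by
        rw [Real.norm_eq_abs, abs_of_nonneg (sq_nonneg _)]
        exact norm_sq_ballAvg_le hε u x)
  have hsq : ∀ u, ‖(hL u).toLp _‖ ^ 2 = ∫ x in Metric.ball 0 ρ, ‖ballAvg ε u x‖ ^ 2 := fun u => by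
    rw [norm_sq_of_ae (hL u).coeFn_toLp, ← integral_indicator hm]
    refine integral_congr_ae (Eventually.of_forall fun x => ?_)
    by_cases hx : x ∈ Metric.ball (0 : V3) ρ
    · simp only [Set.indicator_of_mem hx]
    · simp [Set.indicator_of_notMem hx]
  let G0 : DSp →ₗ[ℂ] DSp :=
    { toFun := fun u => (hL u).toLp _
      map_add' := fun u v => by
        rw [← MemLp.toLp_add]
        refine MemLp.toLp_congr _ _ (Eventually.of_forall fun x => ?_)
        rw [hadd, Set.indicator_add']
      map_smul' := fun t u => by
        rw [RingHom.id_apply, ← MemLp.toLp_const_smul]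
        refine MemLp.toLp_congr _ _ (Eventually.of_forall fun x => ?_)
        rw [hsmul, Pi.smul_apply, ← Set.indicator_const_smul_apply]
        rfl }
  have hρv : ∀ c : ℝ, ∫ _ in Metric.ball (0 : V3) ρ, c = ballVol ρ * c := fun c => by
    rw [setIntegral_const, smul_eq_mul, ballVol]
  have hb : ∀ u, ‖G0 u‖ ≤ √(ballVol ρ * (4 * (ballVol ε)⁻¹)) * ‖u‖ := fun u => by
    refine le_of_sq_le_sq ?_ (by positivity)
    rw [mul_pow, Real.sq_sqrt (by have := ballVol_pos hρ; positivity), mul_assoc, ← hρv]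
    refine (hsq u).trans_le ?_
    exact setIntegral_mono (hint u) (integrableOn_const measure_ball_lt_top.ne)
      fun x => norm_sq_ballAvg_le hε u x
  refine ⟨G0.mkContinuous _ hb, fun u => (hL u).coeFn_toLp, fun K n e he => ?_⟩
  calc ∑ i, ‖G0.mkContinuous _ hb (K (e i))‖ ^ 2
      = ∑ i, ∫ x in Metric.ball 0 ρ, ‖ballAvg ε (K (e i)) x‖ ^ 2 :=
        Finset.sum_congr rfl fun i _ => hsq _
    _ = ∫ x in Metric.ball 0 ρ, ∑ i, ‖ballAvg ε (K (e i)) x‖ ^ 2 :=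
        (integral_finsetSum _ fun i _ => hint _).symm
    _ ≤ ∫ _ in Metric.ball (0 : V3) ρ, 4 * (ballVol ε)⁻¹ * ‖K‖ ^ 2 :=
        setIntegral_mono (integrable_finsetSum _ fun i _ => hint _)
          (integrableOn_const measure_ball_lt_top.ne) fun x => sum_norm_sq_ballAvg_le hε K he x
    _ = 4 * (ρ / ε) ^ 3 * ‖K‖ ^ 2 := by
        rw [hρv, ← ballVol_div hρ hε]
        ring

end BallAverage

section Poincare

lemma sq_lintegral_le {α : Type*} [MeasurableSpace α] (μ : Measure α) {g : α → ℝ≥0∞}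
    (hg : AEMeasurable g μ) : (∫⁻ x, g x ∂μ) ^ 2 ≤ μ Set.univ * ∫⁻ x, g x ^ 2 ∂μ := by
  have h := ENNReal.lintegral_mul_le_Lp_mul_Lq μ
    (Real.HolderConjugate.two_two) (aemeasurable_const (b := (1 : ℝ≥0∞))) hg
  simp only [Pi.mul_apply, one_mul, lintegral_const, ENNReal.rpow_two, one_pow] at h
  have hsq : ∀ t : ℝ≥0∞, (t ^ (1 / 2 : ℝ)) ^ 2 = t := fun t => by
    rw [← ENNReal.rpow_two, ← ENNReal.rpow_mul]
    norm_num
  refine (pow_le_pow_left₀ zero_le h 2).trans_eq ?_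
  rw [mul_pow, hsq, hsq]

variable {f : V3 → C4}

lemma IsTestFn.norm_fderiv_sq_le (f : V3 → C4) (x z : V3) :
    ‖fderiv ℝ f x z‖ ^ 2 ≤ ‖z‖ ^ 2 * gradSq f x := by
  have e : fderiv ℝ f x z = ∑ j, z j • pd j f x := by
    conv_lhs => rw [← (EuclideanSpace.basisFun (Fin 3) ℝ).sum_repr z, map_sum]
    refine Finset.sum_congr rfl fun j _ => ?_
    rw [map_smul, EuclideanSpace.basisFun_repr, EuclideanSpace.basisFun_apply]
    rfl
  have h : ‖fderiv ℝ f x z‖ ≤ ∑ j, ‖z j‖ * ‖pd j f x‖ := by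
    rw [e]
    exact (norm_sum_le _ _).trans (Finset.sum_le_sum fun j _ => (norm_smul _ _).le)
  refine (pow_le_pow_left₀ (norm_nonneg _) h 2).trans ?_
  rw [EuclideanSpace.norm_sq_eq, gradSq]
  exact Finset.sum_mul_sq_le_sq_mul_sq _ _ _

lemma IsTestFn.lintegral_translate_le (hf : IsTestFn f) (z : V3) :
    ∫⁻ x, ‖f (x + z) - f x‖ₑ ^ 2 ≤ ENNReal.ofReal (‖z‖ ^ 2 * ∫ x, gradSq f x) := by
  have hc : Continuous fun x => fderiv ℝ f x z :=
    (hf.1.continuous_fderiv (by simp)).clm_apply continuous_const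
  have hc2 : Continuous fun p : V3 × ℝ => fderiv ℝ f (p.1 + p.2 • z) z :=
    hc.comp (by fun_prop)
  have h1 : ∀ x, ‖f (x + z) - f x‖ₑ ^ 2 ≤
      ∫⁻ t in Set.Ioc (0 : ℝ) 1, ‖fderiv ℝ f (x + t • z) z‖ₑ ^ 2 := fun x => by
    have hct : Continuous fun t : ℝ => fderiv ℝ f (x + t • z) z := hc.comp (by fun_prop)
    have e : f (x + z) - f x = ∫ t in Set.Ioc (0 : ℝ) 1, fderiv ℝ f (x + t • z) z := by
      rw [← intervalIntegral.integral_of_le zero_le_one,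
        intervalIntegral.integral_eq_sub_of_hasDerivAt (f := fun t : ℝ => f (x + t • z))
          (fun t _ => ?_) (hct.intervalIntegrable _ _)]
      · simp
      · have h2 : HasDerivAt (fun t : ℝ => x + t • z) z t := by
          simpa using ((hasDerivAt_id t).smul_const z).const_add x
        exact (hf.differentiable _).hasFDerivAt.comp_hasDerivAt t h2
    rw [e]
    refine (pow_le_pow_left₀ zero_le (enorm_integral_le_lintegral_enorm _) 2).trans ?_
    refine (sq_lintegral_le _ hct.enorm.measurable.aemeasurable).trans_eq ?_
    rw [Measure.restrict_apply_univ, Real.volume_Ioc, sub_zero, ENNReal.ofReal_one, one_mul]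
  calc ∫⁻ x, ‖f (x + z) - f x‖ₑ ^ 2
      ≤ ∫⁻ x, ∫⁻ t in Set.Ioc (0 : ℝ) 1, ‖fderiv ℝ f (x + t • z) z‖ₑ ^ 2 := lintegral_mono h1
    _ = ∫⁻ t in Set.Ioc (0 : ℝ) 1, ∫⁻ x, ‖fderiv ℝ f (x + t • z) z‖ₑ ^ 2 :=
        lintegral_lintegral_swap (hc2.enorm.measurable.pow_const 2).aemeasurable
    _ = ∫⁻ _ in Set.Ioc (0 : ℝ) 1, ∫⁻ x, ‖fderiv ℝ f x z‖ₑ ^ 2 := lintegral_congr fun t =>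
        lintegral_add_right_eq_self (fun x => ‖fderiv ℝ f x z‖ₑ ^ 2) (t • z)
    _ = ∫⁻ x, ‖fderiv ℝ f x z‖ₑ ^ 2 := by
        rw [lintegral_const, Measure.restrict_apply_univ, Real.volume_Ioc, sub_zero,
          ENNReal.ofReal_one, mul_one]
    _ ≤ ∫⁻ x, ENNReal.ofReal (‖z‖ ^ 2 * gradSq f x) := lintegral_mono fun x => by
        rw [← ofReal_norm, ← ENNReal.ofReal_pow (norm_nonneg _)]
        exact ENNReal.ofReal_le_ofReal (IsTestFn.norm_fderiv_sq_le f x z)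
    _ = ENNReal.ofReal (‖z‖ ^ 2 * ∫ x, gradSq f x) := by
        rw [← integral_const_mul, ofReal_integral_eq_lintegral_ofReal
          (hf.integrable_gradSq.const_mul _)]
        exact Eventually.of_forall fun x => mul_nonneg (sq_nonneg _)
          (Finset.sum_nonneg fun j _ => sq_nonneg _)

lemma ballAvg_eq (ε : ℝ) (f : V3 → C4) (x : V3) :
    ballAvg ε f x = (ballVol ε)⁻¹ • ∫ z in Metric.ball 0 ε, f (x + z) := by
  rw [ballAvg, ← integral_indicator Metric.isOpen_ball.measurableSet,
    ← integral_indicator Metric.isOpen_ball.measurableSet, ← integral_add_left_eq_self _ x]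
  congr 2
  funext z
  by_cases hz : z ∈ Metric.ball (0 : V3) ε
  · rw [Set.indicator_of_mem hz, Set.indicator_of_mem (by simpa using hz)]
  · rw [Set.indicator_of_notMem hz, Set.indicator_of_notMem (by simpa using hz)]

/-- A Poincaré inequality for ball averages. -/
lemma IsTestFn.lintegral_sub_ballAvg_le (hf : IsTestFn f) {ε : ℝ} (hε : 0 < ε) :
    ∫⁻ x, ‖f x - ballAvg ε f x‖ₑ ^ 2 ≤ ENNReal.ofReal (ε ^ 2 * ∫ x, gradSq f x) := by
  have hfc := hf.1.continuous
  have hv := ballVol_pos hε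
  set c := ENNReal.ofReal (ballVol ε)⁻¹ with hcdef
  have hcv : c * volume (Metric.ball (0 : V3) ε) = 1 := by
    rw [← ENNReal.ofReal_toReal (measure_ball_lt_top (μ := (volume : Measure V3)) (x := 0) (r := ε)).ne,
      hcdef, ← ENNReal.ofReal_mul (by positivity), ← ENNReal.ofReal_one]
    congr 1
    exact inv_mul_cancel₀ hv.ne'
  have hct : Measurable fun p : V3 × V3 => ‖f (p.1 + p.2) - f p.1‖ₑ ^ 2 :=
    ((hfc.comp (by fun_prop)).sub (hfc.comp (by fun_prop))).enorm.measurable.pow_const 2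
  have h1 : ∀ x, ‖f x - ballAvg ε f x‖ₑ ^ 2 ≤
      c * ∫⁻ z in Metric.ball 0 ε, ‖f (x + z) - f x‖ₑ ^ 2 := fun x => by
    have hcx : Continuous fun z => f (x + z) - f x :=
      (hfc.comp (by fun_prop)).sub continuous_const
    have hi : IntegrableOn (fun z => f (x + z)) (Metric.ball 0 ε) :=
      ((hfc.comp (continuous_const.add continuous_id)).locallyIntegrable.integrableOn_isCompact
        (isCompact_closedBall 0 ε)).mono_set Metric.ball_subset_closedBall
    have e : ballAvg ε f x - f x =
        (ballVol ε)⁻¹ • ∫ z in Metric.ball 0 ε, (f (x + z) - f x) := by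
      rw [integral_sub hi (integrableOn_const measure_ball_lt_top.ne), setIntegral_const, smul_sub,
        ballAvg_eq, smul_smul, show volume.real (Metric.ball (0 : V3) ε) = ballVol ε from rfl,
        inv_mul_cancel₀ hv.ne', one_smul]
    rw [← enorm_neg, neg_sub, e, enorm_smul, mul_pow]
    have hcn : ‖(ballVol ε)⁻¹‖ₑ = c := Real.enorm_of_nonneg (by positivity)
    rw [hcn]
    calc _ ≤ c ^ 2 * (volume (Metric.ball (0 : V3) ε) *
          ∫⁻ z in Metric.ball 0 ε, ‖f (x + z) - f x‖ₑ ^ 2) := by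
          gcongr
          refine (pow_le_pow_left₀ zero_le (enorm_integral_le_lintegral_enorm _) 2).trans ?_
          refine (sq_lintegral_le _ hcx.enorm.measurable.aemeasurable).trans_eq ?_
          rw [Measure.restrict_apply_univ]
      _ = c * (c * volume (Metric.ball (0 : V3) ε)) *
          ∫⁻ z in Metric.ball 0 ε, ‖f (x + z) - f x‖ₑ ^ 2 := by ring
      _ = _ := by rw [hcv, mul_one]
  have hI : 0 ≤ ∫ x, gradSq f x := integral_nonneg fun x => Finset.sum_nonneg fun j _ => sq_nonneg _
  calc ∫⁻ x, ‖f x - ballAvg ε f x‖ₑ ^ 2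
      ≤ ∫⁻ x, c * ∫⁻ z in Metric.ball 0 ε, ‖f (x + z) - f x‖ₑ ^ 2 := lintegral_mono h1
    _ = c * ∫⁻ x, ∫⁻ z in Metric.ball 0 ε, ‖f (x + z) - f x‖ₑ ^ 2 :=
        lintegral_const_mul' _ _ ENNReal.ofReal_ne_top
    _ = c * ∫⁻ z in Metric.ball 0 ε, ∫⁻ x, ‖f (x + z) - f x‖ₑ ^ 2 := by
        rw [lintegral_lintegral_swap hct.aemeasurable]
    _ ≤ c * ∫⁻ _ in Metric.ball (0 : V3) ε, ENNReal.ofReal (ε ^ 2 * ∫ x, gradSq f x) := by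
        gcongr 1
        refine setLIntegral_mono measurable_const fun z hz => ?_
        refine (hf.lintegral_translate_le z).trans (ENNReal.ofReal_le_ofReal ?_)
        have : ‖z‖ ≤ ε := (mem_ball_zero_iff.1 hz).le
        gcongr
    _ = ENNReal.ofReal (ε ^ 2 * ∫ x, gradSq f x) := by
        rw [lintegral_const, Measure.restrict_apply_univ, mul_left_comm, hcv, mul_one]

end Poincare

section Assembly

variable {V : V3 → Matrix (Fin 4) (Fin 4) ℂ} {a b : ℝ}

lemma ballAvg_congr {ε : ℝ} {u f : V3 → C4} (h : u =ᵐ[volume] f) : ballAvg ε u = ballAvg ε f := by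
  funext x
  rw [ballAvg, ballAvg, integral_congr_ae (ae_restrict_of_ae h)]

lemma gradSq_nonneg (f : V3 → C4) (x : V3) : 0 ≤ gradSq f x :=
  Finset.sum_nonneg fun _ _ => sq_nonneg _

lemma IsFreeDirac.norm_cutoff_sub_le {H0 : DSp →ₗ.[ℂ] DSp} {R E G : DSp →L[ℂ] DSp}
    (h0 : IsFreeDirac H0) (hR : IsResolventAt H0 0 R) {s : Set V3} {ε : ℝ} (hε : 0 < ε)
    (hE : ∀ u : DSp, E u =ᵐ[volume] s.indicator u)
    (hG : ∀ u : DSp, G u =ᵐ[volume] s.indicator (ballAvg ε u)) (y : DSp) :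
    ‖E (R y) - G (R y)‖ ≤ ε * ‖y‖ := by
  refine h0.induction_res hR (P := fun u v => ‖E u - G u‖ ≤ ε * ‖v‖) ?_ ?_ y
  · exact isClosed_le (by fun_prop) (by fun_prop)
  · intro f hf u v hu hv
    refine le_of_sq_le_sq ?_ (by positivity)
    rw [mul_pow, norm_sq_of_ae hv, hf.integral_diracAct_sq,
      ← ENNReal.ofReal_le_ofReal_iff (mul_nonneg (sq_nonneg _) (add_nonneg
        (integral_nonneg fun x => sq_nonneg _) (integral_nonneg (gradSq_nonneg f)))),
      ← lintegral_enorm_sq_Lp]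
    calc ∫⁻ x, ‖(E u - G u : DSp) x‖ₑ ^ 2 ≤ ∫⁻ x, ‖f x - ballAvg ε f x‖ₑ ^ 2 := by
          refine lintegral_mono_ae ?_
          filter_upwards [Lp.coeFn_sub (E u) (G u), hE u, hG u, hu] with x h1 h2 h3 h4
          rw [h1, Pi.sub_apply, h2, h3, ballAvg_congr hu]
          by_cases hx : x ∈ s
          · rw [Set.indicator_of_mem hx, Set.indicator_of_mem hx, h4]
          · rw [Set.indicator_of_notMem hx, Set.indicator_of_notMem hx, sub_self]
            simp
      _ ≤ _ := hf.lintegral_sub_ballAvg_le hε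
      _ ≤ _ := by
          refine ENNReal.ofReal_le_ofReal (mul_le_mul_of_nonneg_left ?_ (sq_nonneg _))
          have h1 : 0 ≤ ∫ x, ‖f x‖ ^ 2 := integral_nonneg fun x => sq_nonneg _
          linarith

lemma exists_mul_indicator {s : Set V3} (hs : MeasurableSet s) :
    ∃ E : DSp →L[ℂ] DSp, ∀ u, E u =ᵐ[volume] s.indicator u := by
  obtain ⟨E, -, hE⟩ := exists_mul
    (aestronglyMeasurable_scalarMult (measurable_one.indicator hs)) zero_le_one
    (Eventually.of_forall fun x => (norm_scalarMult_le (s.indicator 1) x).trans (by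
      by_cases hx : x ∈ s <;> simp [hx]))
  refine ⟨E, fun u => (hE u).trans (Eventually.of_forall fun x => ?_)⟩
  dsimp only
  rw [scalarMult_apply_real]
  by_cases hx : x ∈ s <;> simp [hx]

set_option maxHeartbeats 1000000 in
/-- The free Dirac operator with a Coulomb-bounded potential satisfies the abstract hypotheses. -/
theorem IsFreeDirac.exists_potData {H0 : DSp →ₗ.[ℂ] DSp} {R A J : DSp →L[ℂ] DSp}
    (h0 : IsFreeDirac H0) (hR : IsResolventAt H0 0 R)
    (hs : SqrtSetup A J) (hA : ∀ x, A (A x) = R (J x)) (ha : 0 ≤ a) (hb : 0 ≤ b)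
    (hq : a + 2 * b < 1)
    (hV : ∀ i j : Fin 4, Measurable fun x : V3 => V x i j)
    (hh : ∀ᵐ x : V3 ∂volume, (V x).IsHermitian)
    (hbd : ∀ᵐ x : V3 ∂volume, ∀ ξ : C4, ‖mapp (V x) ξ‖ ≤ (a + b / ‖x‖) * ‖ξ‖) :
    ∃ W Wh : DSp →L[ℂ] DSp, PotData A J W Wh (a + 2 * b) a b 4 ∧
      ∀ x y, ⟪y, W x⟫ = matPotForm V (A x) (A y) := by
  obtain ⟨W, Wh, hW, hW1, hWh1, hi, hform, hWh⟩ := h0.exists_potential hR hs hA ha hb hV hh hbd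
  have hJ : ∀ x, ‖J x‖ = ‖x‖ := fun x => by
    have h1 : ⟪J x, J x⟫ = ⟪x, x⟫ := by rw [hs.symmJ, hs.invol]
    rw [@norm_eq_sqrt_re_inner ℂ, h1, ← @norm_eq_sqrt_re_inner ℂ]
  refine ⟨W, Wh, { hs with
    hq1 := hq
    ha := ha
    hb := hb
    hκ := by norm_num
    star_W := hW
    norm_W := hW1
    norm_Wh := hWh1
    intertw := hi
    loc := fun ρ ε hρ hε => ?_ }, hform⟩
  obtain ⟨E, hE⟩ := exists_mul_indicator (Metric.isOpen_ball (x := (0 : V3)) (ε := ρ)).measurableSet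
  obtain ⟨G, hG, hGS⟩ := exists_ballAvg hρ hε
  have hc : 0 ≤ a + b / ρ := by positivity
  obtain ⟨N, hN1, hN2, hN3⟩ := exists_mul_spinMat hV hh
    (measurable_one.indicator (Metric.isOpen_ball (x := (0 : V3)) (ε := ρ)).measurableSet.compl
      : Measurable ((Metric.ball (0 : V3) ρ)ᶜ.indicator (1 : V3 → ℝ))) hc
    (hbd.mono fun x hx ξ => by
      by_cases h : x ∈ Metric.ball (0 : V3) ρ
      · rw [Set.indicator_of_notMem (by simpa using h), zero_smul, norm_zero]
        positivity
      · rw [Set.indicator_of_mem (by simpa using h), Pi.one_apply, one_smul]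
        have h2 : ρ ≤ ‖x‖ := by simpa using h
        refine (hx ξ).trans ?_
        gcongr)
  refine ⟨E, N, fun u => ‖G u‖, fun x => ?_, hN1, fun x => norm_nonneg _, fun t x => ?_, hGS,
    fun u => ?_⟩
  · refine ext_inner_left ℂ fun y => ?_
    have h1 : ⟪y, star Wh (x - E x)⟫ = ⟪y, A (A (N x))⟫ := by
      rw [ContinuousLinearMap.star_eq_adjoint, ContinuousLinearMap.adjoint_inner_right,
        ← hs.symmA, ← hs.symmA, inner_eq_integral (hWh y) (Lp.coeFn_sub x (E x)),
        inner_eq_integral EventuallyEq.rfl (hN2 x)]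
      refine integral_congr_ae ?_
      filter_upwards [hE x, hh] with p h2 h3
      rw [inner_spinMat h3, Pi.sub_apply, h2]
      by_cases h : p ∈ Metric.ball (0 : V3) ρ
      · rw [Set.indicator_of_mem h, Set.indicator_of_notMem (by simpa using h), sub_self, zero_smul,
          map_zero]
      · rw [Set.indicator_of_notMem h, Set.indicator_of_mem (by simpa using h), sub_zero,
          Pi.one_apply, one_smul]
    rw [inner_add_right, ← h1, map_sub, inner_sub_right, add_sub_cancel]
  · change ‖G (t • x)‖ = ‖t‖ * ‖G x‖
    rw [map_smul, norm_smul]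
  · change ‖E (A (A u))‖ ≤ 2 * ε * ‖u‖ + 2 * ‖G (A (A u))‖
    have h1 := h0.norm_cutoff_sub_le hR hε hE hG (J u)
    rw [← hA, hJ] at h1
    have h2 := norm_le_insert' (E (A (A u))) (G (A (A u)))
    have h3 := norm_nonneg (G (A (A u)))
    have h4 : 0 ≤ ε * ‖u‖ := by positivity
    linarith

end Assembly

section Taylor

variable {F : Type*} [NormedAddCommGroup F] [NormedSpace ℂ F]

/-- The Taylor polynomial of `f` at the origin. -/
def taylorSum (f : ℂ → F) (N : ℕ) (z : ℂ) : F :=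
  ∑ n ∈ Finset.range (N + 1), (z ^ n / (n.factorial : ℂ)) • iteratedDeriv n f 0

lemma tendstoUniformlyOn_taylorSum [CompleteSpace F] {f : ℂ → F} {r s : ℝ}
    (hf : DifferentiableOn ℂ f (Metric.ball 0 s)) (hr : 0 ≤ r) (hrs : r < s) :
    TendstoUniformlyOn (taylorSum f) f atTop (Metric.closedBall 0 r) := by
  obtain ⟨t, hrt, hts⟩ := exists_between hrs
  have ht : 0 < t := hr.trans_lt hrt
  have hsub : Metric.closedBall (0 : ℂ) t ⊆ Metric.ball 0 s := Metric.closedBall_subset_ball hts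
  have hd : DiffContOnCl ℂ f (Metric.ball 0 t) := by
    refine DifferentiableOn.diffContOnCl ?_
    rw [closure_ball _ ht.ne']
    exact hf.mono hsub
  obtain ⟨C, hC⟩ := (isCompact_sphere (0 : ℂ) t).exists_bound_of_continuousOn
    (hf.continuousOn.mono (Metric.sphere_subset_closedBall.trans hsub))
  have hC0 : 0 ≤ C := (norm_nonneg _).trans (hC t (by simp [abs_of_pos ht]))
  have hb : ∀ n : ℕ, ∀ z ∈ Metric.closedBall (0 : ℂ) r,
      ‖(z ^ n / (n.factorial : ℂ)) • iteratedDeriv n f 0‖ ≤ C * (r / t) ^ n := fun n z hz => by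
    have h1 := Complex.norm_iteratedDeriv_le_of_forall_mem_sphere_norm_le n ht hd hC
    have h2 : ‖z‖ ≤ r := by simpa using hz
    have h3 : (0 : ℝ) < n.factorial := by positivity
    rw [norm_smul, norm_div, norm_pow, Complex.norm_natCast]
    calc ‖z‖ ^ n / n.factorial * ‖iteratedDeriv n f 0‖
        ≤ r ^ n / n.factorial * (n.factorial * C / t ^ n) := by gcongr
      _ = C * (r / t) ^ n := by rw [div_pow]; field_simp
  have hu : Summable fun n : ℕ => C * (r / t) ^ n :=
    (summable_geometric_of_lt_one (by positivity) ((div_lt_one ht).2 hrt)).mul_left _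
  have h1 := tendstoUniformlyOn_tsum_nat hu hb
  have h2 : TendstoUniformlyOn (fun N z => ∑ n ∈ Finset.range N,
      (z ^ n / (n.factorial : ℂ)) • iteratedDeriv n f 0) f atTop (Metric.closedBall 0 r) := by
    refine h1.congr_right fun z hz => ?_
    have hz' : z ∈ Metric.ball (0 : ℂ) s := Metric.closedBall_subset_ball hrs hz
    rw [← Complex.taylorSeries_eq_on_ball hf hz']
    refine tsum_congr fun n => ?_
    rw [sub_zero, smul_smul, div_eq_inv_mul]
  exact fun v hv => (tendsto_add_atTop_nat 1).eventually (h2 v hv)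

lemma taylorSum_congr {f g : ℂ → F} (h : f =ᶠ[𝓝 0] g) (N : ℕ) (z : ℂ) :
    taylorSum f N z = taylorSum g N z :=
  Finset.sum_congr rfl fun n _ => by rw [h.iteratedDeriv_eq n]

lemma map_taylorSum {G : Type*} [NormedAddCommGroup G] [NormedSpace ℂ G]
    [CompleteSpace F] (L : F →L[ℂ] G) {f : ℂ → F} (hf : AnalyticAt ℂ f 0) (N : ℕ) (z : ℂ) :
    taylorSum (fun z => L (f z)) N z = L (taylorSum f N z) := by
  rw [taylorSum, taylorSum, map_sum]
  refine Finset.sum_congr rfl fun n _ => ?_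
  have h := L.iteratedFDeriv_comp_left (n := n) (i := n) hf.contDiffAt le_rfl
  rw [map_smul, iteratedDeriv, iteratedDeriv, show (fun z => L (f z)) = L ∘ f from rfl, h]
  rfl

lemma iteratedDeriv_star_conj [StarAddMonoid F] [NormedStarGroup F] [StarModule ℂ F] (f : ℂ → F)
    (n : ℕ) (z : ℂ) :
    iteratedDeriv n (fun z => star (f (conj z))) z = star (iteratedDeriv n f (conj z)) := by
  induction n generalizing z with
  | zero => simp
  | succ n ih =>
    rw [iteratedDeriv_succ, iteratedDeriv_succ, funext ih]
    by_cases h : DifferentiableAt ℂ (iteratedDeriv n f) (conj z)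
    · have := h.hasDerivAt.star_conj
      rw [conj_conj] at this
      exact this.deriv
    · rw [deriv_zero_of_not_differentiableAt h, star_zero, deriv_zero_of_not_differentiableAt]
      intro h'
      exact h (differentiableAt_star_conj_iff.1 h')

lemma star_taylorSum [StarAddMonoid F] [NormedStarGroup F] [StarModule ℂ F] {f : ℂ → F}
    (h : ∀ᶠ z in 𝓝 (0 : ℂ), star (f (conj z)) = f z) (N : ℕ) (t : ℝ) :
    star (taylorSum f N (t : ℂ)) = taylorSum f N (t : ℂ) := by
  rw [taylorSum, star_sum]
  refine Finset.sum_congr rfl fun n _ => ?_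
  have h1 : iteratedDeriv n (fun z => star (f (conj z))) 0 = iteratedDeriv n f 0 :=
    Filter.EventuallyEq.iteratedDeriv_eq n h
  rw [iteratedDeriv_star_conj, map_zero] at h1
  rw [star_smul, h1]
  simp

end Taylor

section InversePerturbation

variable {E : Type*} [NormedRing E] [CompleteSpace E]

/-- Uniform stability of inverses on compact sets. -/
lemma exists_inverse_of_norm_sub_le {α : Type*} [TopologicalSpace α] {K : Set α}
    (hK : IsCompact K) {D : α → E} (hD : ContinuousOn D K)
    (hu : ∀ x ∈ K, ∃ D', D x * D' = 1 ∧ D' * D x = 1) {ε : ℝ} (hε : 0 < ε) :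
    ∃ δ, 0 < δ ∧ ∀ x ∈ K, ∀ D' s : E, D x * D' = 1 → D' * D x = 1 → ‖D x - s‖ ≤ δ →
      ∃ s', s * s' = 1 ∧ s' * s = 1 ∧ ‖D' - s'‖ ≤ ε := by
  have hinv : ∀ x ∈ K, IsUnit (D x) := fun x hx => by
    obtain ⟨D', h1, h2⟩ := hu x hx
    exact ⟨⟨D x, D', h1, h2⟩, rfl⟩
  have hc : ContinuousOn (fun x => Ring.inverse (D x)) K := fun x hx => by
    obtain ⟨u, hu⟩ := hinv x hx
    have := NormedRing.inverse_continuousAt u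
    rw [hu] at this
    exact this.comp_continuousWithinAt (hD x hx)
  obtain ⟨M, hM⟩ := hK.exists_bound_of_continuousOn hc
  set m := max M 1 with hm
  have hm0 : 0 < m := zero_lt_one.trans_le (le_max_right _ _)
  refine ⟨min (1 / (2 * m)) (ε / (2 * m ^ 2)), by positivity, fun x hx D' s h1 h2 hs => ?_⟩
  have hD' : Ring.inverse (D x) = D' := by
    have := Ring.inverse_unit (⟨D x, D', h1, h2⟩ : Eˣ)
    exact this
  have hMD : ‖D'‖ ≤ m := hD' ▸ (hM x hx).trans (le_max_left _ _)
  have hs1 : ‖D x - s‖ ≤ 1 / (2 * m) := hs.trans (min_le_left _ _)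
  have hs2 : ‖D x - s‖ ≤ ε / (2 * m ^ 2) := hs.trans (min_le_right _ _)
  have ht : ‖D' * (D x - s)‖ < 1 := calc
    _ ≤ ‖D'‖ * ‖D x - s‖ := norm_mul_le _ _
    _ ≤ m * (1 / (2 * m)) := by gcongr
    _ < 1 := by field_simp; norm_num
  have hu1 : IsUnit (1 - D' * (D x - s)) := isUnit_one_sub_of_norm_lt_one ht
  have e : s = D x * (1 - D' * (D x - s)) := by
    rw [mul_sub, mul_one, ← mul_assoc, h1, one_mul, sub_sub_cancel]
  have hsu : IsUnit s := by
    rw [e]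
    exact (hinv x hx).mul hu1
  obtain ⟨u, rfl⟩ := hsu
  have e2 : D' - ↑u⁻¹ = D' * (↑u - D x) * ↑u⁻¹ := by
    rw [mul_sub, sub_mul, h2, mul_assoc, u.mul_inv, mul_one, one_mul]
  have hn : ‖D' - ↑u⁻¹‖ ≤ ‖D'‖ * ‖D x - u‖ * ‖(↑u⁻¹ : E)‖ := by
    rw [e2, norm_sub_rev (D x)]
    exact (norm_mul_le _ _).trans (mul_le_mul_of_nonneg_right (norm_mul_le _ _) (norm_nonneg _))
  have hv : ‖(↑u⁻¹ : E)‖ ≤ 2 * m := by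
    have h3 : ‖(↑u⁻¹ : E)‖ ≤ ‖D'‖ + ‖D' - ↑u⁻¹‖ := by
      rw [norm_sub_rev]
      exact norm_le_insert' _ _
    have h4 : ‖D'‖ * ‖D x - u‖ * ‖(↑u⁻¹ : E)‖ ≤ m * (1 / (2 * m)) * ‖(↑u⁻¹ : E)‖ := by gcongr
    have h5 : m * (1 / (2 * m)) = 1 / 2 := by field_simp
    rw [h5] at h4
    linarith
  refine ⟨↑u⁻¹, u.mul_inv, u.inv_mul, hn.trans ?_⟩
  calc ‖D'‖ * ‖D x - u‖ * ‖(↑u⁻¹ : E)‖ ≤ m * (ε / (2 * m ^ 2)) * (2 * m) := by gcongr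
    _ = ε := by field_simp

end InversePerturbation

section Approximants
variable {H : Type*} [NormedAddCommGroup H] [InnerProductSpace ℂ H] [CompleteSpace H]

/-- The operators associated with the Taylor forms converge in the norm-resolvent sense. -/
theorem exists_approximants {A : H →L[ℂ] H} (hA : ∀ x, A x = 0 → x = 0) (hAs : star A = A)
    {D S : ℂ → H →L[ℂ] H} (hD : DifferentiableOn ℂ D (Metric.ball 0 1))
    (hDs : ∀ z ∈ Metric.ball (0 : ℂ) 1, star (D (conj z)) = D z)
    (hDi : ∀ z ∈ Metric.ball (0 : ℂ) 1, ∃ D' : H →L[ℂ] H, D z * D' = 1 ∧ D' * D z = 1)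
    (hS : ∀ z ∈ Metric.ball (0 : ℂ) 1, S z = D z) {K : Set ℝ} (hK : IsCompact K)
    (hK1 : K ⊆ Set.Ioo (-1 : ℝ) 1) {ε : ℝ} (hε : 0 < ε) :
    ∃ N₀ : ℕ, ∀ N, N₀ ≤ N → ∀ γ ∈ K, ∀ D' : H →L[ℂ] H, D γ * D' = 1 → D' * D γ = 1 →
      ∀ h : H → H → ℂ, (∀ u w, h u w = ∑ n ∈ Finset.range (N + 1),
        (((γ : ℂ) ^ n / (n.factorial : ℂ)) *
          iteratedDeriv n (fun z : ℂ => ⟪pApply (pinv A) w, S z (pApply (pinv A) u)⟫) 0)) →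
      (∃! TN : H →ₗ.[ℂ] H, IsAssocForm (pinv A).domain h TN ∧ TN.adjoint = TN) ∧
      ∀ TN : H →ₗ.[ℂ] H, IsAssocForm (pinv A).domain h TN →
        IsCore (pinv A) TN.domain ∧
        ∃ Rd RN : H →L[ℂ] H, IsResolventAt (pinv (A * D' * A)) I Rd ∧ IsResolventAt TN I RN ∧
          ‖Rd - RN‖ ≤ ε := by
  have hball : ∀ γ ∈ K, (γ : ℂ) ∈ Metric.ball (0 : ℂ) 1 := fun γ hγ => by
    rw [mem_ball_zero_iff, Complex.norm_real, Real.norm_eq_abs]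
    exact abs_lt.2 (hK1 hγ)
  have hDc : ContinuousOn (fun γ : ℝ => D γ) K :=
    hD.continuousOn.comp Complex.continuous_ofReal.continuousOn hball
  have hε' : 0 < ε / (‖A‖ * ‖A‖ + 1) := by positivity
  obtain ⟨δ, hδ, hinv⟩ := exists_inverse_of_norm_sub_le hK hDc (fun γ hγ => hDi γ (hball γ hγ)) hε'
  obtain ⟨r, hr0, hr1, hr⟩ : ∃ r : ℝ, 0 ≤ r ∧ r < 1 ∧ ∀ γ ∈ K, |γ| ≤ r := by
    obtain rfl | hne := K.eq_empty_or_nonempty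
    · exact ⟨0, le_rfl, one_pos, by simp⟩
    · obtain ⟨γ₀, h0, hm⟩ := hK.exists_isMaxOn hne (continuous_abs.continuousOn)
      exact ⟨|γ₀|, abs_nonneg _, abs_lt.2 (hK1 h0), fun γ hγ => hm hγ⟩
  have h0 : Metric.ball (0 : ℂ) 1 ∈ 𝓝 (0 : ℂ) := Metric.ball_mem_nhds _ one_pos
  have hana : AnalyticAt ℂ D 0 := hD.analyticAt h0
  have hu := Metric.tendstoUniformlyOn_iff.1 (tendstoUniformlyOn_taylorSum hD hr0 hr1) δ hδ
  obtain ⟨N₀, hN₀⟩ := eventually_atTop.1 hu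
  refine ⟨N₀, fun N hN γ hγ D' h1 h2 h hh => ?_⟩
  have hclose : ‖D γ - taylorSum D N γ‖ ≤ δ := by
    rw [← dist_eq_norm]
    exact (hN₀ N hN γ (by simpa using hr γ hγ)).le
  obtain ⟨s', hs1, hs2, hs3⟩ := hinv γ hγ D' _ h1 h2 hclose
  have hTs : star (taylorSum D N (γ : ℂ)) = taylorSum D N (γ : ℂ) :=
    star_taylorSum (Filter.eventually_of_mem h0 hDs) N γ
  have hs's : star s' = s' := by
    calc star s' = star s' * (taylorSum D N γ * s') := by rw [hs1, mul_one]
      _ = star (taylorSum D N (γ : ℂ) * s') * s' := by rw [star_mul, hTs, mul_assoc]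
      _ = s' := by rw [hs1, star_one, one_mul]
  have hD's : star D' = D' := by
    have h3 : star (D γ) = D γ := by
      have := hDs γ (hball γ hγ)
      rwa [Complex.conj_ofReal] at this
    calc star D' = star D' * (D γ * D') := by rw [h1, mul_one]
      _ = star (D γ * D') * D' := by rw [star_mul, h3, mul_assoc]
      _ = D' := by rw [h1, star_one, one_mul]
  have hform : ∀ u w, h (A u) (A w) = ⟪w, taylorSum D N γ u⟫ := fun u w => by
    rw [hh, pApply_pinv hA, pApply_pinv hA]
    have h3 : (fun z => ⟪w, S z u⟫) =ᶠ[𝓝 (0 : ℂ)] fun z => ⟪w, D z u⟫ :=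
      Filter.eventually_of_mem h0 fun z hz => by simp only [hS z hz]
    exact (taylorSum_congr h3 N γ).trans
      (map_taylorSum ((innerSL ℂ w).comp (ContinuousLinearMap.apply ℂ H u)) hana N γ)
  have hiff := fun T => isAssocForm_iff (T := T) hA hAs hs1 hs2 hform
  have hk := triple_inj hA h1
  have hl := triple_inj hA hs1
  have hls : star (A * s' * A) = A * s' * A := by rw [star_triple hAs, hs's]
  have hks : star (A * D' * A) = A * D' * A := by rw [star_triple hAs, hD's]
  refine ⟨⟨pinv (A * s' * A), ⟨(hiff _).2 rfl, ?_⟩, fun T hT => (hiff T).1 hT.1⟩, fun T hT => ?_⟩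
  · rw [pinv_adjoint hl (star_triple_inj hA hAs hs2), hls]
  · obtain rfl := (hiff T).1 hT
    refine ⟨isCore_pinv hA hAs hs1 hs2, ?_⟩
    obtain ⟨M, N', hM, hN', hle⟩ := norm_resolvent_sub_le hk hl hks hls
    refine ⟨M, N', hM, hN', hle.trans ?_⟩
    have e : A * D' * A - A * s' * A = A * (D' - s') * A := by noncomm_ring
    rw [e]
    calc ‖A * (D' - s') * A‖ ≤ ‖A‖ * ‖D' - s'‖ * ‖A‖ :=
          (norm_mul_le _ _).trans (mul_le_mul_of_nonneg_right (norm_mul_le _ _) (norm_nonneg _))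
      _ ≤ ‖A‖ * (ε / (‖A‖ * ‖A‖ + 1)) * ‖A‖ := by gcongr
      _ = ε * ((‖A‖ * ‖A‖) / (‖A‖ * ‖A‖ + 1)) := by ring
      _ ≤ ε * 1 := by
          gcongr
          rw [div_le_one (by positivity)]
          linarith
      _ = ε := mul_one _

end Approximants

section Forms
variable {H : Type*} [NormedAddCommGroup H] [InnerProductSpace ℂ H] [CompleteSpace H]

lemma SqrtSetup.h0form_apply {R J : H →L[ℂ] H} (hs : SqrtSetup (invSqrtAbs R) J) (u w : H) :
    h0form R J (invSqrtAbs R u) (invSqrtAbs R w) = ⟪w, J u⟫ := by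
  rw [h0form, sqrtAbsPMap, pApply_pinv hs.inj, pApply_pinv hs.inj, hs.symmJ]

/-- For an abstract potential the approximants exist and converge in the norm-resolvent sense. -/
theorem PotData.exists_diag_approximants {R Pp Pm W Wh : H →L[ℂ] H} {q a b κ : ℝ}
    (h : PotData (invSqrtAbs R) (Pp - Pm) W Wh q a b κ)
    (hP : Pp + Pm = 1) (hPp : IsIdempotentElem Pp) {v : H → H → ℂ}
    (hv : ∀ x y, ⟪y, W x⟫ = v (invSqrtAbs R x) (invSqrtAbs R y))
    {T : ℂ → H →ₗ.[ℂ] H}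
    (hT : ∀ z ∈ Metric.ball (0 : ℂ) 1, IsAssocForm (sqrtAbsPMap R).domain
      (fun u w => h0form R (Pp - Pm) u w + z * v u w) (T z))
    {Qp Qm Xp Xm Uop U' S : ℂ → H →L[ℂ] H}
    (hQ : ∀ z ∈ Metric.ball (0 : ℂ) 1, DecomposedBy (T z) (Qp z) (Qm z) ∧
      partSpec (T z) (Qp z) = spec (T z) ∩ {z : ℂ | 0 < z.re} ∧
      partSpec (T z) (Qm z) = spec (T z) ∩ {z : ℂ | z.re < 0})
    (hX : ∀ z ∈ Metric.ball (0 : ℂ) 1,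
      (∀ u : H, Xp z (Pp u) = Xp z u) ∧ (∀ u : H, Pm (Xp z u) = Xp z u) ∧
      (∀ u : H, Xm z (Pm u) = Xm z u) ∧ (∀ u : H, Pp (Xm z u) = Xm z u) ∧
      Set.range ⇑(Qp z) = {x : H | ∃ u : H, Pp u = u ∧ x = u + Xp z u} ∧
      Set.range ⇑(Qm z) = {x : H | ∃ w : H, Pm w = w ∧ x = w + Xm z w})
    (hUop : ∀ z, Uop z = (1 + Xp z) ∘L (invSqrtSeries (Xm z ∘L Xp z) ∘L Pp) +
      (1 + Xm z) ∘L (invSqrtSeries (Xp z ∘L Xm z) ∘L Pm))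
    (hU' : ∀ z ∈ Metric.ball (0 : ℂ) 1, Uop z ∘L U' z = 1 ∧ U' z ∘L Uop z = 1)
    (hS : ∀ z ∈ Metric.ball (0 : ℂ) 1,
      Dense {x : H | invSqrtAbs R x ∈ (conjPMap (Uop z) (U' z) (T z)).domain} ∧
      ∀ x : H, ∀ hx : invSqrtAbs R x ∈ (conjPMap (Uop z) (U' z) (T z)).domain,
        S z x = invSqrtAbs R ((conjPMap (Uop z) (U' z) (T z)) ⟨invSqrtAbs R x, hx⟩))
    {K : Set ℝ} (hK : IsCompact K) (hK1 : K ⊆ Set.Ioo (-1 : ℝ) 1) {ε : ℝ} (hε : 0 < ε) :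
    ∃ N₀ : ℕ, ∀ N : ℕ, N₀ ≤ N → ∀ γ : ℝ, γ ∈ K →
      (∃! TN : H →ₗ.[ℂ] H,
        IsAssocForm (sqrtAbsPMap R).domain
          (fun u w => ∑ n ∈ Finset.range (N + 1), (((γ : ℂ) ^ n / (n.factorial : ℂ)) *
            iteratedDeriv n (fun z : ℂ =>
              ⟪pApply (sqrtAbsPMap R) w, S z (pApply (sqrtAbsPMap R) u)⟫) 0)) TN ∧
        TN.adjoint = TN) ∧
      ∀ TN : H →ₗ.[ℂ] H,
        IsAssocForm (sqrtAbsPMap R).domain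
          (fun u w => ∑ n ∈ Finset.range (N + 1), (((γ : ℂ) ^ n / (n.factorial : ℂ)) *
            iteratedDeriv n (fun z : ℂ =>
              ⟪pApply (sqrtAbsPMap R) w, S z (pApply (sqrtAbsPMap R) u)⟫) 0)) TN →
        TN.adjoint = TN →
        IsCore (sqrtAbsPMap R) TN.domain ∧
        ∃ Rd RN : H →L[ℂ] H,
          IsResolventAt (conjPMap (Uop (γ : ℂ)) (U' (γ : ℂ)) (T (γ : ℂ))) Complex.I Rd ∧
          IsResolventAt TN Complex.I RN ∧
          ‖Rd - RN‖ ≤ ε := by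
  have hs := h.toSqrtSetup
  have hf : ∀ (z : ℂ) (u w : H), h0form R (Pp - Pm) (invSqrtAbs R u) (invSqrtAbs R w) +
      z * v (invSqrtAbs R u) (invSqrtAbs R w) = ⟪w, (Pp - Pm + z • W) u⟫ :=
    fun z u w => by
      rw [hs.h0form_apply, ← hv, add_apply, smul_apply, inner_add_right, inner_smul_right]
  obtain ⟨D, hD, hDz⟩ := h.exists_diag (Xp := Xp) (Xm := Xm) (Uop := Uop) (U' := U') (S := S)
    (clm_congr hP) (clm_congr hPp)
    (f := fun z u w => h0form R (Pp - Pm) u w + z * v u w)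
    hf hT hQ (fun z hz => ⟨(hX z hz).1, (hX z hz).2.1, (hX z hz).2.2.1, (hX z hz).2.2.2.1,
      (hX z hz).2.2.2.2.1, (hX z hz).2.2.2.2.2⟩) hUop hU' hS
  obtain ⟨N₀, hN₀⟩ := exists_approximants hs.inj hs.isSelfAdjoint_left hD
    (fun z hz => (hDz z hz).1)
    (fun z hz => (hDz z hz).2.2.imp fun D' h => ⟨h.1, h.2.1⟩) (fun z hz => (hDz z hz).2.1)
    hK hK1 hε
  refine ⟨N₀, fun N hN γ hγ => ?_⟩
  obtain ⟨D', h1, h2, h3⟩ := (hDz γ (by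
    rw [mem_ball_zero_iff, Complex.norm_real, Real.norm_eq_abs]
    exact abs_lt.2 (hK1 hγ))).2.2
  have := hN₀ N hN γ hγ D' h1 h2 _ fun u w => rfl
  rw [h3]
  exact ⟨this.1, fun TN hTN _ => this.2 TN hTN⟩

end Forms

lemma omegaSeries_eq_invSqrtSeries (A : DSp →L[ℂ] DSp) : omegaSeries A = invSqrtSeries A := by
  rw [omegaSeries, invSqrtSeries]
  exact tsum_congr fun n => map_real_smul (AddMonoidHom.id _) continuous_id (binomHalf n) _

end Proofs

/-!
STATEMENT 19 (convergence of the Douglas–Kroll–Heß method for the Dirac operator):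
Let `H₀` be the free Dirac operator on `ℝ³`, `P±` its spectral projections, and `V` a
measurable Hermitian matrix-valued potential with `‖V(x)‖ ≤ a + b/|x|` a.e., `a, b ≥ 0`,
`a + (b/2)(π/2 + 2/π) < 1/2` and `a + 2b < 1` (so `‖V H₀⁻¹‖ < 1` by Hardy's inequality).
For `γ ∈ 𝔻` let `H(γ)` be associated with `h₀ + γv`, `Q±(γ)` its spectral projections
for `ℂ±`, `X±(γ)` the angular operators, `Ω±(γ) = (1 - X∓(γ)X±(γ))^{-1/2}`,
`U(γ) = [[Ω₊(γ), X₋(γ)Ω₋(γ)],[X₊(γ)Ω₊(γ), Ω₋(γ)]]` and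
`Ĥ_diag(γ) = U(γ)⁻¹ H(γ) U(γ)`, with `T(γ)` the bounded closure of
`|H₀|^{-1/2} Ĥ_diag(γ) |H₀|^{-1/2}`.  Then the DKH approximants `Ĥ_diag^N(γ)` — the
unique self-adjoint operators associated with the `N`-th order Taylor forms — exist for all
sufficiently large `N`, their domains are cores of `|H₀|^{1/2}`, and they converge to
`Ĥ_diag(γ)` in the norm-resolvent topology as `N → ∞`, uniformly on compact subsets of
`(-1, 1)`.  (For the Coulomb potential this covers `γ(π/4 + 1/π) < 1/2`, i.e. `Z ≤ 62`.)
-/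

theorem statement_19
    (H0 : DSp →ₗ.[ℂ] DSp) (hH0 : IsFreeDirac H0)
    (R : DSp →L[ℂ] DSp) (hR : IsResolventAt H0 0 R)
    (U : DSp →L[ℂ] DSp) (hU : IsSignOf U R)
    (Pp Pm : DSp →L[ℂ] DSp) (hP : IsPosNegPair R Pp Pm)
    (V : V3 → Matrix (Fin 4) (Fin 4) ℂ)
    (hVmeas : ∀ i j : Fin 4, Measurable fun x : V3 => V x i j)
    (hVherm : ∀ᵐ x : V3 ∂volume, (V x).IsHermitian)
    (a b : ℝ) (ha : 0 ≤ a) (hb : 0 ≤ b)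
    (hVbd : ∀ᵐ x : V3 ∂volume, ∀ ξ : C4, ‖mapp (V x) ξ‖ ≤ (a + b / ‖x‖) * ‖ξ‖)
    (hsmall : a + (b / 2) * (Real.pi / 2 + 2 / Real.pi) < 1 / 2)
    (hsmall' : a + 2 * b < 1)
    -- the family `H(γ)` of operators associated with `h₀ + γ v`, `γ ∈ 𝔻`
    (T : ℂ → (DSp →ₗ.[ℂ] DSp))
    (hT : ∀ γ ∈ Metric.ball (0 : ℂ) 1, IsAssocForm (sqrtAbsPMap R).domain
      (fun u w => h0form R U u w + γ * matPotForm V u w) (T γ))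
    -- its spectral projections `Q±(γ)` corresponding to `ℂ±`
    (Qp Qm : ℂ → (DSp →L[ℂ] DSp))
    (hQ : ∀ γ ∈ Metric.ball (0 : ℂ) 1, DecomposedBy (T γ) (Qp γ) (Qm γ) ∧
      partSpec (T γ) (Qp γ) = spec (T γ) ∩ {z : ℂ | 0 < z.re} ∧
      partSpec (T γ) (Qm γ) = spec (T γ) ∩ {z : ℂ | z.re < 0})
    -- the angular operators `X±(γ)` of `Q±(γ)H` with respect to `P±H`
    (Xp Xm : ℂ → (DSp →L[ℂ] DSp))
    (hX : ∀ γ ∈ Metric.ball (0 : ℂ) 1,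
      (∀ u : DSp, Xp γ (Pp u) = Xp γ u) ∧ (∀ u : DSp, Pm (Xp γ u) = Xp γ u) ∧
      (∀ u : DSp, Xm γ (Pm u) = Xm γ u) ∧ (∀ u : DSp, Pp (Xm γ u) = Xm γ u) ∧
      Set.range ⇑(Qp γ) = {z : DSp | ∃ u : DSp, Pp u = u ∧ z = u + Xp γ u} ∧
      Set.range ⇑(Qm γ) = {z : DSp | ∃ w : DSp, Pm w = w ∧ z = w + Xm γ w})
    -- the unitary transformation `U(γ)` built from `Ω±(γ)`
    (Uop : ℂ → (DSp →L[ℂ] DSp))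
    (hUop : ∀ γ : ℂ, Uop γ =
      (1 + Xp γ) ∘L (omegaSeries (Xm γ ∘L Xp γ) ∘L Pp) +
      (1 + Xm γ) ∘L (omegaSeries (Xp γ ∘L Xm γ) ∘L Pm))
    (U' : ℂ → (DSp →L[ℂ] DSp))
    (hU' : ∀ γ ∈ Metric.ball (0 : ℂ) 1, Uop γ ∘L U' γ = 1 ∧ U' γ ∘L Uop γ = 1)
    -- `S(γ) = T(γ)`, the bounded closure of `|H₀|^{-1/2} Ĥ_diag(γ) |H₀|^{-1/2}`
    (S : ℂ → (DSp →L[ℂ] DSp))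
    (hS : ∀ γ ∈ Metric.ball (0 : ℂ) 1,
      Dense {x : DSp | invSqrtAbs R x ∈ (conjPMap (Uop γ) (U' γ) (T γ)).domain} ∧
      ∀ x : DSp, ∀ hx : invSqrtAbs R x ∈ (conjPMap (Uop γ) (U' γ) (T γ)).domain,
        S γ x = invSqrtAbs R ((conjPMap (Uop γ) (U' γ) (T γ)) ⟨invSqrtAbs R x, hx⟩)) :
    -- existence and uniqueness of the DKH approximants for large `N`, core property, and
    -- norm-resolvent convergence, uniformly on compact subsets of `(-1, 1)`
    ∀ K : Set ℝ, IsCompact K → K ⊆ Set.Ioo (-1 : ℝ) 1 → ∀ ε : ℝ, 0 < ε →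
      ∃ N₀ : ℕ, ∀ N : ℕ, N₀ ≤ N → ∀ γ : ℝ, γ ∈ K →
        (∃! TN : DSp →ₗ.[ℂ] DSp,
          IsAssocForm (sqrtAbsPMap R).domain
            (fun u w => ∑ n ∈ Finset.range (N + 1), (((γ : ℂ) ^ n / (n.factorial : ℂ)) *
              iteratedDeriv n (fun z : ℂ =>
                ⟪pApply (sqrtAbsPMap R) w, S z (pApply (sqrtAbsPMap R) u)⟫) 0)) TN ∧
          TN.adjoint = TN) ∧
        ∀ TN : DSp →ₗ.[ℂ] DSp,
          IsAssocForm (sqrtAbsPMap R).domain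
            (fun u w => ∑ n ∈ Finset.range (N + 1), (((γ : ℂ) ^ n / (n.factorial : ℂ)) *
              iteratedDeriv n (fun z : ℂ =>
                ⟪pApply (sqrtAbsPMap R) w, S z (pApply (sqrtAbsPMap R) u)⟫) 0)) TN →
          TN.adjoint = TN →
          IsCore (sqrtAbsPMap R) TN.domain ∧
          ∃ Rd RN : DSp →L[ℂ] DSp,
            IsResolventAt (conjPMap (Uop (γ : ℂ)) (U' (γ : ℂ)) (T (γ : ℂ))) Complex.I Rd ∧
            IsResolventAt TN Complex.I RN ∧
            ‖Rd - RN‖ ≤ ε := by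
  obtain ⟨hs, hAA⟩ := sqrtSetup_of_free hH0.1 hR hP
  obtain rfl := sign_unique hR (hR.isSelfAdjoint hH0.1) hP hU
  obtain ⟨W, Wh, hW, hform⟩ :=
    hH0.exists_potData hR hs hAA ha hb hsmall' hVmeas hVherm hVbd
  simp_rw [omegaSeries_eq_invSqrtSeries] at hUop
  exact fun K hK hK1 ε hε =>
    hW.exists_diag_approximants hP.1 hP.2.2.2.1 hform hT hQ hX hUop hU' hS hK hK1 hε

end Statement19

end Paper
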